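/- Let d ≥ 4 and q > q_d := 2 + 4/(d−3), and set α = α(q) = d(1/2 − 1/q) − 1/2. Then there is a constant C = C(q,d) such that for every L > 0 and every Schwartz function f on ℝ^d, (1/(2L)) ∫_{−L}^{L} ‖e^{it√(−Δ)} f‖_{L^q(ℝ^d)}^q dt ≤ C^q ‖(I − L²Δ)^{α/2} f‖_{L^q(ℝ^d)}^q. -/

import Mathlib

open MeasureTheory Metric Set
open scoped FourierTransform ENNReal NNReal

noncomputable section

abbrev Ed (d : ℕ) := EuclideanSpace ℝ (Fin d)

/-- The wave propagator `e^{it√(-Δ)}`: Fourier multiplier with multiplier `ξ ↦ e^{it|ξ|}`. -/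
def waveOp (d : ℕ) (t : ℝ) (f : Ed d → ℂ) : Ed d → ℂ :=
  𝓕⁻ (fun ξ => Complex.exp (Complex.I * (t : ℂ) * (‖ξ‖ : ℂ)) * 𝓕 f ξ)

/-- The Bessel potential operator `(I - L²Δ)^{α/2}`:
Fourier multiplier with multiplier `ξ ↦ (1 + L²|ξ|²)^{α/2}`. -/
def besselOp (d : ℕ) (L α : ℝ) (f : Ed d → ℂ) : Ed d → ℂ :=
  𝓕⁻ (fun ξ => (((1 + L ^ 2 * ‖ξ‖ ^ 2) ^ (α / 2) : ℝ) : ℂ) * 𝓕 f ξ)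

section Part1
open scoped Pointwise
set_option linter.all false

/-- surface measure on the unit sphere, as a measure on the whole space -/
def sig (d : ℕ) : Measure (Ed d) :=
  ((volume : Measure (Ed d)).toSphere).map Subtype.val

instance sig_finite (d : ℕ) : IsFiniteMeasure (sig d) := by
  unfold sig; infer_instance

lemma sig_ae_norm (d : ℕ) : ∀ᵐ ω ∂(sig d), ‖ω‖ = 1 := by
  unfold sig
  rw [ae_map_iff (by fun_prop) (measurableSet_eq_fun (by fun_prop) (by fun_prop))]
  exact Filter.Eventually.of_forall fun ω => by simpa using ω.2

lemma sig_rot {d : ℕ} (R : Ed d ≃ₗᵢ[ℝ] Ed d) : (sig d).map R = sig d := by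
  ext A hA
  rw [Measure.map_apply (by fun_prop) hA]
  unfold sig
  have hR : MeasurableSet (R ⁻¹' A) := R.continuous.measurable hA
  rw [Measure.map_apply (by fun_prop) hA, Measure.map_apply (by fun_prop) hR,
    Measure.toSphere_apply' _ (measurable_subtype_coe hA),
    Measure.toSphere_apply' _ (measurable_subtype_coe hR)]
  congr 1
  rw [← R.measurePreserving.measure_preimage_emb R.toHomeomorph.measurableEmbedding
    (Ioo (0 : ℝ) 1 • ((Subtype.val : sphere (0 : Ed d) 1 → Ed d) '' (Subtype.val ⁻¹' A)))]
  congr 1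
  ext x
  constructor
  · rintro ⟨r, hr, _, ⟨ω, hω, rfl⟩, rfl⟩
    exact ⟨r, hr, R ω, ⟨⟨R ω, by simp⟩, hω, rfl⟩, by simp⟩
  · rintro ⟨r, hr, _, ⟨ω, hω, rfl⟩, h⟩
    refine ⟨r, hr, R.symm ω, ⟨⟨R.symm ω, by simp⟩, by simpa using hω, rfl⟩, ?_⟩
    apply R.injective
    simpa using h

lemma sig_integral_rot {d : ℕ} {F : Type*} [NormedAddCommGroup F] [NormedSpace ℝ F]
    (R : Ed d ≃ₗᵢ[ℝ] Ed d) (f : Ed d → F) :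
    ∫ ω, f (R ω) ∂(sig d) = ∫ ω, f ω ∂(sig d) := by
  conv_rhs => rw [← sig_rot R]
  exact (R.toHomeomorph.measurableEmbedding.integral_map f).symm

lemma exists_rot {d : ℕ} {v w : Ed d} (h : ‖v‖ = ‖w‖) : ∃ R : Ed d ≃ₗᵢ[ℝ] Ed d, R v = w :=
  ⟨_, Submodule.reflection_sub h⟩

/-- polar coordinates for Bochner integrals -/
lemma polar_integral {d : ℕ} (hd : 1 ≤ d) {F : Type*} [NormedAddCommGroup F] [NormedSpace ℝ F]
    (f : Ed d → F) (hf : Integrable f) :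
    ∫ x, f x = ∫ r in Ioi (0 : ℝ), r ^ (d - 1) • ∫ ω, f (r • ω) ∂(sig d) := by
  haveI : Nontrivial (Ed d) := by
    haveI : Nonempty (Fin d) := ⟨⟨0, hd⟩⟩
    infer_instance
  have hdim : Module.finrank ℝ (Ed d) = d := by simp
  set μ : Measure (Ed d) := volume
  have mp := μ.measurePreserving_homeomorphUnitSphereProd
  have emb := (homeomorphUnitSphereProd (Ed d)).measurableEmbedding
  have e1 : ∫ x, f x = ∫ x : ({0}ᶜ : Set (Ed d)), f x ∂(μ.comap (↑)) := by
    rw [integral_subtype_comap (measurableSet_singleton _).compl f, restrict_compl_singleton]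
  set g : sphere (0 : Ed d) 1 × Ioi (0 : ℝ) → F := fun p => f (p.2.1 • p.1.1) with hg
  have hcomp : ∀ x : ({0}ᶜ : Set (Ed d)), f x = g (homeomorphUnitSphereProd (Ed d) x) := by
    intro x
    have := congrArg Subtype.val ((homeomorphUnitSphereProd (Ed d)).symm_apply_apply x)
    have hx : (x : Ed d) ≠ 0 := x.2
    have h0 : ‖(x : Ed d)‖ ≠ 0 := by simpa using hx
    simp [hg, smul_smul, h0]
  have hgi : Integrable g (μ.toSphere.prod (Measure.volumeIoiPow (Module.finrank ℝ (Ed d) - 1))) := by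
    rw [← mp.integrable_comp_emb emb]
    have : (g ∘ homeomorphUnitSphereProd (Ed d)) = f ∘ Subtype.val := by
      ext x; exact (hcomp x).symm
    rw [this]
    rw [← (MeasurableEmbedding.subtype_coe
      (measurableSet_singleton (0 : Ed d)).compl).integrableOn_range_iff_comap]
    exact hf.integrableOn
  rw [e1]
  simp_rw [hcomp]
  rw [mp.integral_comp emb, integral_prod_symm _ hgi]
  rw [Measure.volumeIoiPow, hdim]
  rw [integral_withDensity_eq_integral_toReal_smul (by fun_prop) (by simp)]
  rw [integral_subtype_comap measurableSet_Ioi (fun r : ℝ => (ENNReal.ofReal (r ^ (d-1))).toReal •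
     ∫ x : sphere (0 : Ed d) 1, f (r • x.1) ∂μ.toSphere)]
  refine setIntegral_congr_fun measurableSet_Ioi fun r hr => ?_
  have hr' : (0 : ℝ) < r := hr
  show (ENNReal.ofReal (r ^ (d-1))).toReal • ∫ x : sphere (0 : Ed d) 1, f (r • x.1) ∂μ.toSphere = _
  rw [ENNReal.toReal_ofReal (by positivity)]
  congr 1
  unfold sig
  rw [((MeasurableEmbedding.subtype_coe (isClosed_sphere.measurableSet))).integral_map]

end Part1

section Part2
set_option linter.all false

/-- the Fourier transform of surface measure as a function of the radius -/
def Jf (d : ℕ) [NeZero d] (s : ℝ) : ℝ := ∫ ω, Real.cos (s * ω 0) ∂(sig d)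
def J1 (d : ℕ) [NeZero d] (s : ℝ) : ℝ := ∫ ω, -(ω 0 * Real.sin (s * ω 0)) ∂(sig d)
def J2 (d : ℕ) [NeZero d] (s : ℝ) : ℝ := ∫ ω, -(ω 0 * ω 0 * Real.cos (s * ω 0)) ∂(sig d)

lemma sig_coord_le {d : ℕ} {ω : Ed d} (h : ‖ω‖ = 1) (i : Fin d) : |ω i| ≤ 1 := by
  have := PiLp.norm_apply_le ω i
  rw [h] at this; simpa using this

lemma sig_integrable_of_bdd {d : ℕ} {F : Type*} [NormedAddCommGroup F] {f : Ed d → F} (hf : Continuous f)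
    (C : ℝ) (hC : ∀ ω, ‖ω‖ = 1 → ‖f ω‖ ≤ C) : Integrable f (sig d) := by
  refine Integrable.of_bound hf.aestronglyMeasurable C ?_
  filter_upwards [sig_ae_norm d] with ω h using hC ω h

lemma sig_deriv {d : ℕ} (f f' : ℝ → ℝ) (hf : ∀ x, HasDerivAt f (f' x) x) (hfc : Continuous f')
    (hb : ∀ x, |f x| ≤ 1) (hb' : ∀ x, |f' x| ≤ 1) (p a b : Ed d → ℝ) (hp : Continuous p)
    (ha : Continuous a) (hbc : Continuous b)
    (hp1 : ∀ ω, ‖ω‖ = 1 → |p ω| ≤ 1) (hb1 : ∀ ω, ‖ω‖ = 1 → |b ω| ≤ 1) (τ : ℝ) :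
    HasDerivAt (fun τ => ∫ ω, p ω * f (a ω + τ * b ω) ∂(sig d))
      (∫ ω, p ω * b ω * f' (a ω + τ * b ω) ∂(sig d)) τ := by
  have hfc0 : Continuous f := continuous_iff_continuousAt.2 fun x => (hf x).continuousAt
  refine (hasDerivAt_integral_of_dominated_loc_of_deriv_le (μ := sig d) (𝕜 := ℝ) (x₀ := τ)
    (F := fun τ ω => p ω * f (a ω + τ * b ω)) (F' := fun τ ω => p ω * b ω * f' (a ω + τ * b ω))
    (s := univ) (bound := fun _ => 1)
    Filter.univ_mem ?_ ?_ ?_ ?_ ?_ ?_).2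
  · exact Filter.Eventually.of_forall fun x => (by fun_prop : Continuous _).aestronglyMeasurable
  · refine sig_integrable_of_bdd (by fun_prop) 1 fun ω h => ?_
    rw [Real.norm_eq_abs, abs_mul]
    exact mul_le_one₀ (hp1 ω h) (abs_nonneg _) (hb _)
  · exact (by fun_prop : Continuous _).aestronglyMeasurable
  · filter_upwards [sig_ae_norm d] with ω h x _
    rw [Real.norm_eq_abs, abs_mul, abs_mul]
    exact mul_le_one₀ (mul_le_one₀ (hp1 ω h) (abs_nonneg _) (hb1 ω h)) (abs_nonneg _) (hb' _)
  · exact integrable_const _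
  · refine Filter.Eventually.of_forall fun ω x _ => ?_
    have h1 : HasDerivAt (fun τ => a ω + τ * b ω) (b ω) x := by
      simpa using ((hasDerivAt_id x).mul_const (b ω)).const_add (a ω)
    have := ((hf (a ω + x * b ω)).comp x h1).const_mul (p ω)
    exact this.congr_deriv (by ring)

variable {d : ℕ} [NeZero d]

lemma Jf_deriv (s : ℝ) : HasDerivAt (Jf d) (J1 d s) s := by
  have := sig_deriv (d := d) Real.cos (fun x => -Real.sin x) Real.hasDerivAt_cos (by fun_prop)
    Real.abs_cos_le_one (fun x => by rw [abs_neg]; exact Real.abs_sin_le_one x) (fun _ => 1) (fun _ => 0)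
    (fun ω => ω 0) (by fun_prop) (by fun_prop) (by fun_prop) (by simp)
    (fun ω h => sig_coord_le h 0) s
  unfold J1
  have e : Jf d = fun s => ∫ ω, Real.cos (s * ω 0) ∂(sig d) := rfl
  rw [e]
  simpa using this

lemma J1_deriv (s : ℝ) : HasDerivAt (J1 d) (J2 d s) s := by
  have := sig_deriv (d := d) Real.sin Real.cos Real.hasDerivAt_sin (by fun_prop)
    Real.abs_sin_le_one Real.abs_cos_le_one (fun ω => - ω 0) (fun _ => 0)
    (fun ω => ω 0) (by fun_prop) (by fun_prop) (by fun_prop)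
    (fun ω h => by rw [abs_neg]; exact sig_coord_le h 0)
    (fun ω h => sig_coord_le h 0) s
  unfold J1 J2
  simpa using this

lemma sig_inner_cos (z : Ed d) : ∫ ω, Real.cos (inner ℝ z ω) ∂(sig d) = Jf d ‖z‖ := by
  obtain ⟨R, hR⟩ := exists_rot (v := z) (w := EuclideanSpace.single (0 : Fin d) ‖z‖) (by simp)
  rw [Jf, ← sig_integral_rot R (fun ω => Real.cos (‖z‖ * ω 0))]
  congr 1; ext ω
  congr 1
  rw [← R.inner_map_map z ω, hR]
  simp [EuclideanSpace.inner_single_left]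

lemma sig_inner_sin (z : Ed d) : ∫ ω, Real.sin (inner ℝ z ω) ∂(sig d) = 0 := by
  have := sig_integral_rot (LinearIsometryEquiv.neg ℝ) (fun ω : Ed d => Real.sin (inner ℝ z ω))
  simp only [LinearIsometryEquiv.coe_neg, inner_neg_right, Real.sin_neg, integral_neg] at this
  linarith

lemma sig_inner_exp (z : Ed d) :
    ∫ ω, Complex.exp (Complex.I * ((inner ℝ z ω : ℝ) : ℂ)) ∂(sig d) = (Jf d ‖z‖ : ℂ) := by
  have h1 : ∀ ω : Ed d, Complex.exp (Complex.I * ((inner ℝ z ω : ℝ) : ℂ)) =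
      ((Real.cos (inner ℝ z ω) : ℝ) : ℂ) + ((Real.sin (inner ℝ z ω) : ℝ) : ℂ) * Complex.I := by
    intro ω
    rw [mul_comm, Complex.exp_mul_I]; simp
  simp_rw [h1]
  have i1 : Integrable (fun ω : Ed d => Real.cos (inner ℝ z ω)) (sig d) :=
    sig_integrable_of_bdd (by fun_prop) 1 fun ω _ => Real.abs_cos_le_one _
  have i2 : Integrable (fun ω : Ed d => Real.sin (inner ℝ z ω)) (sig d) :=
    sig_integrable_of_bdd (by fun_prop) 1 fun ω _ => Real.abs_sin_le_one _
  rw [integral_add i1.ofReal (i2.ofReal.mul_const _), integral_mul_const, integral_complex_ofReal,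
    integral_complex_ofReal, sig_inner_cos, sig_inner_sin]
  simp

lemma sig_coord_ident (s : ℝ) (hs : 0 < s) (i : Fin d) (hi : i ≠ 0) :
    s * ∫ ω, -(ω i * ω i * Real.cos (s * ω 0)) ∂(sig d) = J1 d s := by
  -- first derivative
  have d1 : ∀ τ, HasDerivAt (fun τ => ∫ ω, Real.cos (s * ω 0 + τ * ω i) ∂(sig d))
      (∫ ω, ω i * -Real.sin (s * ω 0 + τ * ω i) ∂(sig d)) τ := by
    intro τ
    have := sig_deriv (d := d) Real.cos (fun x => -Real.sin x) Real.hasDerivAt_cos (by fun_prop)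
      Real.abs_cos_le_one (fun x => by rw [abs_neg]; exact Real.abs_sin_le_one x) (fun _ => 1)
      (fun ω => s * ω 0)
      (fun ω => ω i) (by fun_prop) (by fun_prop) (by fun_prop) (by simp)
      (fun ω h => sig_coord_le h i) τ
    simpa using this
  have d2 : HasDerivAt (fun τ => ∫ ω, ω i * -Real.sin (s * ω 0 + τ * ω i) ∂(sig d))
      (∫ ω, -(ω i * ω i * Real.cos (s * ω 0)) ∂(sig d)) 0 := by
    have := sig_deriv (d := d) (fun x => -Real.sin x) (fun x => -Real.cos x)
      (fun x => (Real.hasDerivAt_sin x).neg) (by fun_prop)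
      (fun x => by rw [abs_neg]; exact Real.abs_sin_le_one x)
      (fun x => by rw [abs_neg]; exact Real.abs_cos_le_one x) (fun ω => ω i)
      (fun ω => s * ω 0)
      (fun ω => ω i) (by fun_prop) (by fun_prop) (by fun_prop) (fun ω h => sig_coord_le h i)
      (fun ω h => sig_coord_le h i) 0
    simpa using this
  -- the radial expression
  have hpos : ∀ τ : ℝ, 0 < s ^ 2 + τ ^ 2 := fun τ => by positivity
  have e0 : ∀ τ, ∫ ω, Real.cos (s * ω 0 + τ * ω i) ∂(sig d) = Jf d (Real.sqrt (s ^ 2 + τ ^ 2)) := by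
    intro τ
    have := sig_inner_cos (d := d) (EuclideanSpace.single 0 s + EuclideanSpace.single i τ)
    have hn : ‖(EuclideanSpace.single 0 s + EuclideanSpace.single i τ : Ed d)‖
        = Real.sqrt (s ^ 2 + τ ^ 2) := by
      have h2 : ‖(EuclideanSpace.single 0 s + EuclideanSpace.single i τ : Ed d)‖ ^ 2
          = s ^ 2 + τ ^ 2 := by
        rw [@norm_add_sq_real]
        simp [EuclideanSpace.inner_single_left, Ne.symm hi, hi]
      rw [← h2, Real.sqrt_sq (norm_nonneg _)]
    rw [hn] at this
    rw [← this]
    congr 1; ext ω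
    simp [inner_add_left, EuclideanSpace.inner_single_left]
  have e1 : ∀ τ, ∫ ω, ω i * -Real.sin (s * ω 0 + τ * ω i) ∂(sig d)
      = τ * (J1 d (Real.sqrt (s ^ 2 + τ ^ 2)) / Real.sqrt (s ^ 2 + τ ^ 2)) := by
    intro τ
    refine (d1 τ).unique ?_
    simp_rw [e0]
    have hq : HasDerivAt (fun τ : ℝ => Real.sqrt (s ^ 2 + τ ^ 2))
        (2 * τ / (2 * Real.sqrt (s ^ 2 + τ ^ 2))) τ := by
      have : HasDerivAt (fun τ : ℝ => s ^ 2 + τ ^ 2) (2 * τ) τ := by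
        simpa using (hasDerivAt_pow 2 τ).const_add (s ^ 2)
      exact this.sqrt (hpos τ).ne'
    have := (Jf_deriv (d := d) (Real.sqrt (s ^ 2 + τ ^ 2))).comp τ hq
    exact this.congr_deriv (by ring)
  have d3 : HasDerivAt (fun τ : ℝ => τ * (J1 d (Real.sqrt (s ^ 2 + τ ^ 2)) / Real.sqrt (s ^ 2 + τ ^ 2)))
      (J1 d s / s) 0 := by
    have hc : ContinuousAt (fun τ : ℝ => J1 d (Real.sqrt (s ^ 2 + τ ^ 2)) / Real.sqrt (s ^ 2 + τ ^ 2)) 0 := by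
      have hJ : Continuous (J1 d) := continuous_iff_continuousAt.2 fun x => (J1_deriv x).continuousAt
      refine ContinuousAt.div (by fun_prop) (by fun_prop) (Real.sqrt_pos.2 (hpos 0)).ne'
    rw [hasDerivAt_iff_tendsto_slope]
    have := hc.tendsto.mono_left (nhdsWithin_le_nhds (s := {0}ᶜ))
    simp only [ne_eq, OfNat.ofNat_ne_zero, not_false_eq_true, zero_pow, add_zero,
      Real.sqrt_sq hs.le] at this
    refine this.congr' ?_
    filter_upwards [self_mem_nhdsWithin] with τ hτ
    have : τ ≠ 0 := hτ
    simp [slope, this]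
  have := d2.unique (by simp_rw [e1]; exact d3)
  rw [this]
  field_simp

lemma J_ode (s : ℝ) (hs : 0 < s) : s * (J2 d s + Jf d s) = -((d : ℝ) - 1) * J1 d s := by
  have i0 : ∀ i : Fin d, Integrable (fun ω : Ed d => -(ω i * ω i * Real.cos (s * ω 0))) (sig d) := by
    intro i
    refine sig_integrable_of_bdd (by fun_prop) 1 fun ω h => ?_
    rw [Real.norm_eq_abs, abs_neg, abs_mul, abs_mul]
    exact mul_le_one₀ (mul_le_one₀ (sig_coord_le h i) (abs_nonneg _) (sig_coord_le h i))
      (abs_nonneg _) (Real.abs_cos_le_one _)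
  have hsum : ∑ i : Fin d, ∫ ω, -(ω i * ω i * Real.cos (s * ω 0)) ∂(sig d) = - Jf d s := by
    rw [← integral_finset_sum _ (fun i _ => i0 i), Jf, ← integral_neg]
    refine integral_congr_ae ?_
    filter_upwards [sig_ae_norm d] with ω h
    rw [Finset.sum_neg_distrib, ← Finset.sum_mul]
    have : ∑ i, ω i * ω i = 1 := by
      have := EuclideanSpace.real_norm_sq_eq ω
      rw [h] at this
      simp only [sq] at this
      linarith
    rw [this, one_mul]
  have h2 : s * ∑ i ∈ Finset.univ.erase (0 : Fin d), ∫ ω, -(ω i * ω i * Real.cos (s * ω 0)) ∂(sig d)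
      = ((d : ℝ) - 1) * J1 d s := by
    rw [Finset.mul_sum, Finset.sum_congr rfl (fun i hi => sig_coord_ident s hs i (Finset.ne_of_mem_erase hi))]
    rw [Finset.sum_const, Finset.card_erase_of_mem (Finset.mem_univ _)]
    have : 1 ≤ d := NeZero.one_le
    simp [Nat.cast_sub this]
  rw [← Finset.add_sum_erase _ _ (Finset.mem_univ (0 : Fin d))] at hsum
  have : J2 d s = ∫ ω, -(ω 0 * ω 0 * Real.cos (s * ω 0)) ∂(sig d) := rfl
  rw [← this] at hsum
  have h3 : ∑ i ∈ Finset.univ.erase (0 : Fin d), ∫ ω, -(ω i * ω i * Real.cos (s * ω 0)) ∂(sig d)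
     = - Jf d s - J2 d s := by linarith
  rw [h3] at h2
  linarith

lemma Jf_bdd (s : ℝ) : |Jf d s| ≤ (sig d).real univ := by
  have := norm_integral_le_of_norm_le_const (μ := sig d) (f := fun ω => Real.cos (s * ω 0)) (C := 1)
    (Filter.Eventually.of_forall fun ω => Real.abs_cos_le_one _)
  simpa [Jf] using this

lemma J1_bdd (s : ℝ) : |J1 d s| ≤ (sig d).real univ := by
  have := norm_integral_le_of_norm_le_const (μ := sig d) (f := fun ω => -(ω 0 * Real.sin (s * ω 0))) (C := 1)
    (by filter_upwards [sig_ae_norm d] with ω h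
        rw [Real.norm_eq_abs, abs_neg, abs_mul]
        exact mul_le_one₀ (sig_coord_le h 0) (abs_nonneg _) (Real.abs_sin_le_one _))
  simpa [J1] using this

end Part2

section Part3
set_option linter.all false

variable {d : ℕ} [NeZero d]

/-- the decay exponent `(d-1)/2` -/
def kap (d : ℕ) : ℝ := ((d : ℝ) - 1) / 2

def Wz (d : ℕ) [NeZero d] (s : ℝ) : ℝ := s ^ kap d * Jf d s
def Wd (d : ℕ) [NeZero d] (s : ℝ) : ℝ := kap d * s ^ (kap d - 1) * Jf d s + s ^ kap d * J1 d s
def cW (d : ℕ) : ℝ := kap d * (kap d - 1)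

lemma Wz_deriv (s : ℝ) (hs : 0 < s) : HasDerivAt (Wz d) (Wd d s) s := by
  have h1 := Real.hasDerivAt_rpow_const (x := s) (p := kap d) (Or.inl hs.ne')
  exact h1.mul (Jf_deriv (d := d) s)

lemma Wd_deriv (s : ℝ) (hs : 0 < s) : HasDerivAt (Wd d) ((cW d / s ^ 2 - 1) * Wz d s) s := by
  have h1 := Real.hasDerivAt_rpow_const (x := s) (p := kap d) (Or.inl hs.ne')
  have h2 := Real.hasDerivAt_rpow_const (x := s) (p := kap d - 1) (Or.inl hs.ne')
  have := ((h2.const_mul (kap d)).mul (Jf_deriv (d := d) s)).add (h1.mul (J1_deriv (d := d) s))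
  refine this.congr_deriv ?_
  have ode := J_ode (d := d) s hs
  have hk : (d : ℝ) - 1 = 2 * kap d := by unfold kap; ring
  rw [hk] at ode
  have e1 : s ^ (kap d - 1) = s ^ kap d / s := Real.rpow_sub_one hs.ne' _
  have e2 : s ^ (kap d - 1 - 1) = s ^ kap d / s / s := by rw [Real.rpow_sub_one hs.ne', e1]
  have hJ2 : J2 d s = - Jf d s - 2 * kap d * J1 d s / s := by
    field_simp
    linarith
  rw [e1, e2, hJ2, Wz, cW]
  field_simp
  ring

lemma W_bdd (hd : 3 ≤ d) : ∃ C : ℝ, 0 < C ∧ ∀ s : ℝ, 0 < s → |Wz d s| ≤ C ∧ |Wd d s| ≤ C := by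
  have hk : 1 ≤ kap d := by
    have : (3 : ℝ) ≤ d := by exact_mod_cast hd
    unfold kap; linarith
  have hc : 0 ≤ cW d := by unfold cW; apply mul_nonneg <;> linarith
  set A := (sig d).real univ with hA
  have hA0 : 0 ≤ A := measureReal_nonneg
  set E : ℝ → ℝ := fun s => Wz d s ^ 2 + Wd d s ^ 2 with hE
  have hmono : AntitoneOn (fun s => E s * Real.exp (cW d / s)) (Ici 1) := by
    have hder : ∀ s, 0 < s → HasDerivAt (fun s => E s * Real.exp (cW d / s))
        ((2 * Wz d s * Wd d s + 2 * Wd d s * ((cW d / s ^ 2 - 1) * Wz d s)) * Real.exp (cW d / s)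
          + E s * (Real.exp (cW d / s) * (-cW d / s ^ 2))) s := by
      intro s hs
      have h1 := ((Wz_deriv (d := d) s hs).pow 2).add ((Wd_deriv (d := d) s hs).pow 2)
      have h2 : HasDerivAt (fun s : ℝ => cW d / s) (-cW d / s ^ 2) s := by
        have := (hasDerivAt_inv hs.ne').const_mul (cW d)
        simp only [div_eq_mul_inv]
        exact this.congr_deriv (by ring)
      have := h1.mul h2.exp
      refine this.congr_deriv ?_
      simp [hE]
    refine antitoneOn_of_deriv_nonpos (convex_Ici 1) ?_ ?_ ?_
    · intro s hs
      exact (hder s (by have : (1:ℝ) ≤ s := hs; linarith)).continuousAt.continuousWithinAt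
    · intro s hs
      rw [interior_Ici] at hs
      exact (hder s (by have : (1:ℝ) < s := hs; linarith)).differentiableAt.differentiableWithinAt
    · intro s hs
      rw [interior_Ici] at hs
      have hs0 : 0 < s := by have : (1:ℝ) < s := hs; linarith
      rw [(hder s hs0).deriv]
      have : (2 * Wz d s * Wd d s + 2 * Wd d s * ((cW d / s ^ 2 - 1) * Wz d s)) * Real.exp (cW d / s)
          + E s * (Real.exp (cW d / s) * (-cW d / s ^ 2))
          = - (Real.exp (cW d / s) * (cW d / s ^ 2) * (Wz d s - Wd d s) ^ 2) := by
        simp only [hE]; ring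
      rw [this]
      have : 0 ≤ Real.exp (cW d / s) * (cW d / s ^ 2) * (Wz d s - Wd d s) ^ 2 := by positivity
      linarith
  set M := E 1 * Real.exp (cW d) with hM
  have hM0 : 0 ≤ M := by positivity
  refine ⟨Real.sqrt M + kap d * A + A + 1, by positivity, fun s hs => ?_⟩
  rcases le_or_gt 1 s with h1 | h1
  · have hb := hmono (mem_Ici.2 le_rfl) (mem_Ici.2 h1) h1
    have hexp : 1 ≤ Real.exp (cW d / s) := Real.one_le_exp (by positivity)
    have hE0 : 0 ≤ E s := by positivity
    have hEM : E s ≤ M := by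
      have : E s * Real.exp (cW d / s) ≤ M := by simpa using hb
      nlinarith
    have hw : |Wz d s| ≤ Real.sqrt M := Real.abs_le_sqrt (by
      have := sq_nonneg (Wd d s); simp only [hE] at hEM; linarith)
    have hw' : |Wd d s| ≤ Real.sqrt M := Real.abs_le_sqrt (by
      have := sq_nonneg (Wz d s); simp only [hE] at hEM; linarith)
    have : 0 ≤ kap d * A := by positivity
    constructor <;> linarith
  · have p1 : s ^ kap d ≤ 1 := Real.rpow_le_one hs.le h1.le (by linarith)
    have p2 : s ^ (kap d - 1) ≤ 1 := Real.rpow_le_one hs.le h1.le (by linarith)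
    have q1 : 0 ≤ s ^ kap d := Real.rpow_nonneg hs.le _
    have q2 : 0 ≤ s ^ (kap d - 1) := Real.rpow_nonneg hs.le _
    have hJ := Jf_bdd (d := d) s
    have hJ1 := J1_bdd (d := d) s
    rw [← hA] at hJ hJ1
    have := Real.sqrt_nonneg M
    have b1 : s ^ kap d * |Jf d s| ≤ 1 * A := mul_le_mul p1 hJ (abs_nonneg _) (by norm_num)
    have b2 : s ^ kap d * |J1 d s| ≤ 1 * A := mul_le_mul p1 hJ1 (abs_nonneg _) (by norm_num)
    have b3 : s ^ (kap d - 1) * |Jf d s| ≤ 1 * A := mul_le_mul p2 hJ (abs_nonneg _) (by norm_num)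
    have b4 : kap d * (s ^ (kap d - 1) * |Jf d s|) ≤ kap d * (1 * A) :=
      mul_le_mul_of_nonneg_left b3 (by linarith)
    have k0 : 0 ≤ kap d * A := by positivity
    constructor
    · rw [Wz, abs_mul, abs_of_nonneg q1]; linarith
    · rw [Wd]
      refine (abs_add_le _ _).trans ?_
      rw [abs_mul, abs_mul, abs_mul, abs_of_nonneg q1, abs_of_nonneg q2, abs_of_nonneg (by linarith : 0 ≤ kap d), mul_assoc]
      linarith

/-- decay of `J` -/
lemma Jf_decay (hd : 3 ≤ d) : ∃ C : ℝ, 0 < C ∧ ∀ s : ℝ, 0 < s → |Jf d s| ≤ C * s ^ (-kap d) := by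
  obtain ⟨C, hC, h⟩ := W_bdd (d := d) hd
  refine ⟨C, hC, fun s hs => ?_⟩
  have := (h s hs).1
  rw [Wz, abs_mul, abs_of_nonneg (Real.rpow_nonneg hs.le _)] at this
  rw [Real.rpow_neg hs.le, ← div_eq_mul_inv, le_div_iff₀ (Real.rpow_pos_of_pos hs _)]
  linarith

lemma radial_integral (φ : ℝ → ℂ) (hφ : Integrable (fun ξ : Ed d => φ ‖ξ‖)) (z : Ed d) :
    ∫ ξ : Ed d, φ ‖ξ‖ * Complex.exp (Complex.I * ((inner ℝ z ξ : ℝ) : ℂ))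
      = ∫ r in Ioi (0 : ℝ), r ^ (d - 1) • (φ r * (Jf d (r * ‖z‖) : ℂ)) := by
  rw [polar_integral NeZero.one_le]
  · refine setIntegral_congr_fun measurableSet_Ioi fun r hr => ?_
    have hr' : (0 : ℝ) < r := hr
    congr 1
    have : (fun ω : Ed d => φ ‖r • ω‖ * Complex.exp (Complex.I * ((inner ℝ z (r • ω) : ℝ) : ℂ)))
       =ᵐ[sig d] fun ω => φ r * Complex.exp (Complex.I * ((inner ℝ (r • z) ω : ℝ) : ℂ)) := by
      filter_upwards [sig_ae_norm d] with ω h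
      rw [norm_smul, h, mul_one, Real.norm_of_nonneg hr'.le, inner_smul_right, inner_smul_left]
      simp
    rw [integral_congr_ae this, integral_const_mul, sig_inner_exp, norm_smul, Real.norm_of_nonneg hr'.le]
  · refine hφ.mul_bdd (c := 1) (Continuous.aestronglyMeasurable (by fun_prop)) ?_
    refine Filter.Eventually.of_forall fun ξ => ?_
    rw [mul_comm, Complex.norm_exp_ofReal_mul_I]

end Part3

section Part4
open scoped ContDiff
set_option linter.all false

/-- smooth amplitudes depending on a parameter, supported in `[1/8,8]` -/
structure Good (b : ℝ → ℝ → ℂ) : Prop where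
  smooth : ContDiff ℝ ∞ (fun p : ℝ × ℝ => b p.1 p.2)
  supp : ∀ δ l, l ∉ Icc (1/8 : ℝ) 8 → b δ l = 0

lemma Good.mul {b : ℝ → ℝ → ℂ} (hb : Good b) {g : ℝ → ℝ → ℂ}
    (hg : ∀ p : ℝ × ℝ, 0 < p.2 → ContDiffAt ℝ ∞ (fun p : ℝ × ℝ => g p.1 p.2) p) :
    Good (fun δ l => g δ l * b δ l) := by
  refine ⟨?_, fun δ l h => by simp [hb.supp δ l h]⟩
  rw [contDiff_iff_contDiffAt]
  intro p
  rcases lt_or_ge 0 p.2 with h | h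
  · exact (hg p h).mul hb.smooth.contDiffAt
  · have : (fun p : ℝ × ℝ => g p.1 p.2 * b p.1 p.2) =ᶠ[nhds p] fun _ => 0 := by
      have hop : IsOpen {p : ℝ × ℝ | p.2 < 1/8} := isOpen_lt continuous_snd continuous_const
      filter_upwards [hop.mem_nhds (show p.2 < 1/8 by linarith)] with x hx
      have : x.2 < 1/8 := hx
      simp [hb.supp x.1 x.2 (by intro hh; linarith [hh.1])]
    exact contDiffAt_const.congr_of_eventuallyEq this

lemma Good.add {b b' : ℝ → ℝ → ℂ} (hb : Good b) (hb' : Good b') :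
    Good (fun δ l => b δ l + b' δ l) :=
  ⟨hb.smooth.add hb'.smooth, fun δ l h => by simp [hb.supp δ l h, hb'.supp δ l h]⟩

def dl (b : ℝ → ℝ → ℂ) : ℝ → ℝ → ℂ := fun δ l => deriv (b δ) l

lemma Good.hasDerivAt {b : ℝ → ℝ → ℂ} (hb : Good b) (δ l : ℝ) : HasDerivAt (b δ) (dl b δ l) l := by
  have : ContDiff ℝ ∞ (b δ) := hb.smooth.comp (by fun_prop : ContDiff ℝ ∞ (fun l : ℝ => (δ, l)))
  exact (this.differentiable (by simp) l).hasDerivAt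

lemma Good.dl {b : ℝ → ℝ → ℂ} (hb : Good b) : Good (dl b) := by
  constructor
  · have e : (fun p : ℝ × ℝ => _root_.dl b p.1 p.2) =
        fun p => fderiv ℝ (fun p : ℝ × ℝ => b p.1 p.2) p (0, 1) := by
      ext p
      have h1 := (hb.smooth.differentiable (by simp) p).hasFDerivAt
      have h2 : HasDerivAt (fun l : ℝ => (p.1, l)) ((0 : ℝ), (1 : ℝ)) p.2 :=
        (hasDerivAt_const _ _).prodMk (hasDerivAt_id _)
      have h3 := HasFDerivAt.comp_hasDerivAt (f := fun l : ℝ => (p.1, l)) p.2 h1 h2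
      exact h3.deriv
    rw [e]
    exact (hb.smooth.fderiv_right (m := ∞) (by simp)).clm_apply contDiff_const
  · intro δ l hl
    have : b δ =ᶠ[nhds l] fun _ => 0 := by
      filter_upwards [isClosed_Icc.isOpen_compl.mem_nhds hl] with x hx using hb.supp δ x hx
    unfold _root_.dl
    rw [this.deriv_eq]; simp

lemma Good.bdd {b : ℝ → ℝ → ℂ} (hb : Good b) :
    ∃ C : ℝ, 0 ≤ C ∧ ∀ δ ∈ Icc (0:ℝ) 1, ∀ l, ‖b δ l‖ ≤ C := by
  obtain ⟨C, hC⟩ := (isCompact_Icc.prod isCompact_Icc : IsCompact (Icc (0:ℝ) 1 ×ˢ Icc (1/8 : ℝ) 8)).exists_bound_of_continuousOn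
    hb.smooth.continuous.continuousOn
  refine ⟨max C 0, le_max_right _ _, fun δ hδ l => ?_⟩
  by_cases h : l ∈ Icc (1/8 : ℝ) 8
  · exact (hC (δ, l) ⟨hδ, h⟩).trans (le_max_left _ _)
  · rw [hb.supp δ l h]; simp

lemma Good.cont {b : ℝ → ℝ → ℂ} (hb : Good b) (δ : ℝ) : Continuous (b δ) :=
  hb.smooth.continuous.comp (by fun_prop : Continuous (fun l : ℝ => (δ, l)))

variable {d : ℕ} [NeZero d]

/-- basic oscillatory integral -/
def osc (t : ℝ) (h : ℝ → ℂ) : ℂ :=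
  ∫ l in (1/16 : ℝ)..9, Complex.exp (Complex.I * t * l) * h l

lemma osc_bdd (t : ℝ) (h : ℝ → ℂ) (C : ℝ) (hC : ∀ l, 0 < l → ‖h l‖ ≤ C) : ‖osc t h‖ ≤ C * 9 := by
  have hC0 : 0 ≤ C := (norm_nonneg _).trans (hC 1 one_pos)
  refine (intervalIntegral.norm_integral_le_of_norm_le_const (C := C) fun l hl => ?_).trans ?_
  · rw [uIoc_of_le (by norm_num)] at hl
    have : Complex.I * t * l = ((t * l : ℝ) : ℂ) * Complex.I := by push_cast; ring
    rw [norm_mul, this, Complex.norm_exp_ofReal_mul_I, one_mul]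
    exact hC l (by linarith [hl.1])
  · rw [abs_of_nonneg (by norm_num)]
    nlinarith

lemma osc_ibp (t ρ : ℝ) (h h1 h2 : ℝ → ℂ) (H1 : ∀ l, 0 < l → HasDerivAt h (h1 l) l)
    (H2 : ∀ l, 0 < l → HasDerivAt h1 (h2 l) l) (hc : ContinuousOn h2 (Ioi 0))
    (z1 : h (1/16) = 0) (z2 : h 9 = 0) (z3 : h1 (1/16) = 0) (z4 : h1 9 = 0) :
    osc t (fun l => h2 l + ρ ^ 2 * h l) = (ρ ^ 2 - t ^ 2) * osc t h := by
  have hpos : ∀ l ∈ uIcc (1/16 : ℝ) 9, 0 < l := by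
    intro l hl
    rw [uIcc_of_le (by norm_num)] at hl
    linarith [hl.1]
  have sub : uIcc (1/16 : ℝ) 9 ⊆ Ioi 0 := hpos
  have c0 : ContinuousOn h (uIcc (1/16 : ℝ) 9) := fun l hl => (H1 l (hpos l hl)).continuousAt.continuousWithinAt
  have c2 : ContinuousOn h2 (uIcc (1/16 : ℝ) 9) := hc.mono sub
  have ce : Continuous (fun l : ℝ => Complex.exp (Complex.I * t * l)) := by fun_prop
  have i0 : IntervalIntegrable (fun l => Complex.exp (Complex.I * t * l) * h l) volume (1/16) 9 :=
    (ce.continuousOn.mul c0).intervalIntegrable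
  have i2 : IntervalIntegrable (fun l => Complex.exp (Complex.I * t * l) * h2 l) volume (1/16) 9 :=
    (ce.continuousOn.mul c2).intervalIntegrable
  have key : ∫ l in (1/16 : ℝ)..9, (Complex.exp (Complex.I * t * l) * h2 l
      + t ^ 2 * (Complex.exp (Complex.I * t * l) * h l)) = 0 := by
    rw [intervalIntegral.integral_eq_sub_of_hasDerivAt
      (f := fun l : ℝ => Complex.exp (Complex.I * t * l) * (h1 l - Complex.I * t * h l))]
    · simp [z1, z2, z3, z4]
      have e1 : h (16⁻¹) = 0 := by simpa using z1
      have e2 : h1 (16⁻¹) = 0 := by simpa using z3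
      simp [e1, e2]
    · intro l hl
      have he : HasDerivAt (fun l : ℝ => Complex.exp (Complex.I * t * l))
          (Complex.exp (Complex.I * t * l) * (Complex.I * t)) l := by
        have : HasDerivAt (fun l : ℝ => Complex.I * t * (l : ℂ)) (Complex.I * t) l := by
          simpa using (Complex.ofRealCLM.hasDerivAt (x := l)).const_mul (Complex.I * (t : ℂ))
        exact this.cexp
      have := he.mul ((H2 l (hpos l hl)).sub ((H1 l (hpos l hl)).const_mul (Complex.I * (t : ℂ))))
      refine this.congr_deriv ?_
      have hI : Complex.I * Complex.I = -1 := Complex.I_mul_I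
      simp only [Pi.sub_apply]
      linear_combination (-t ^ 2 * Complex.exp (Complex.I * t * l) * h l : ℂ) * hI
    · exact i2.add (i0.const_mul _)
  rw [intervalIntegral.integral_add i2 (i0.const_mul _), intervalIntegral.integral_const_mul] at key
  unfold osc
  have e : ∀ l : ℝ, Complex.exp (Complex.I * t * l) * (h2 l + ρ ^ 2 * h l)
     = Complex.exp (Complex.I * t * l) * h2 l + ρ ^ 2 * (Complex.exp (Complex.I * t * l) * h l) := by
    intro l; ring
  simp_rw [e]
  rw [intervalIntegral.integral_add i2 (i0.const_mul _), intervalIntegral.integral_const_mul]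
  linear_combination key

lemma osc_add (t : ℝ) {f g : ℝ → ℂ} (hf : ContinuousOn f (Ioi 0)) (hg : ContinuousOn g (Ioi 0)) :
    osc t (fun l => f l + g l) = osc t f + osc t g := by
  have sub : uIcc (1/16 : ℝ) 9 ⊆ Ioi 0 := by
    intro l hl
    rw [uIcc_of_le (by norm_num)] at hl
    exact lt_of_lt_of_le (by norm_num) hl.1
  have ce : Continuous (fun l : ℝ => Complex.exp (Complex.I * t * l)) := by fun_prop
  unfold osc
  have i1 : IntervalIntegrable (fun l => Complex.exp (Complex.I * t * l) * f l) volume (1/16) 9 :=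
    (ce.continuousOn.mul (hf.mono sub)).intervalIntegrable
  have i2 : IntervalIntegrable (fun l => Complex.exp (Complex.I * t * l) * g l) volume (1/16) 9 :=
    (ce.continuousOn.mul (hg.mono sub)).intervalIntegrable
  rw [← intervalIntegral.integral_add i1 i2]
  congr 1; ext l; ring

lemma osc_const_mul (t : ℝ) (c : ℂ) (f : ℝ → ℂ) : osc t (fun l => c * f l) = c * osc t f := by
  unfold osc
  rw [← intervalIntegral.integral_const_mul]
  congr 1; ext l; ring

lemma osc_congr (t : ℝ) {f g : ℝ → ℂ} (h : ∀ l, 0 < l → f l = g l) : osc t f = osc t g := by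
  unfold osc
  refine intervalIntegral.integral_congr fun l hl => ?_
  rw [uIcc_of_le (by norm_num)] at hl
  simp only [h l (lt_of_lt_of_le (by norm_num) hl.1)]

def WW (d : ℕ) [NeZero d] (ρ l : ℝ) : ℂ := ((Wz d (ρ * l) : ℝ) : ℂ)
def WD (d : ℕ) [NeZero d] (ρ l : ℝ) : ℂ := ((ρ * Wd d (ρ * l) : ℝ) : ℂ)

lemma WW_deriv {ρ : ℝ} (hρ : 0 < ρ) {l : ℝ} (hl : 0 < l) : HasDerivAt (WW d ρ) (WD d ρ l) l := by
  have h1 : HasDerivAt (fun l : ℝ => ρ * l) ρ l := by simpa using (hasDerivAt_id l).const_mul ρ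
  have := ((Wz_deriv (d := d) (ρ * l) (by positivity)).comp l h1).ofReal_comp
  exact this.congr_deriv (by unfold WD; push_cast; ring)

lemma WD_deriv {ρ : ℝ} (hρ : 0 < ρ) {l : ℝ} (hl : 0 < l) :
    HasDerivAt (WD d ρ) ((cW d / l ^ 2 - ρ ^ 2) * WW d ρ l) l := by
  have h1 : HasDerivAt (fun l : ℝ => ρ * l) ρ l := by simpa using (hasDerivAt_id l).const_mul ρ
  have := (((Wd_deriv (d := d) (ρ * l) (by positivity)).comp l h1).const_mul ρ).ofReal_comp
  refine this.congr_deriv ?_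
  unfold WW
  have e : ρ * ((cW d / (ρ * l) ^ 2 - 1) * Wz d (ρ * l) * ρ) = (cW d / l ^ 2 - ρ ^ 2) * Wz d (ρ * l) := by
    field_simp
  rw [e]; push_cast; ring

lemma WW_cont {ρ : ℝ} (hρ : 0 < ρ) : ContinuousOn (WW d ρ) (Ioi 0) :=
  fun _ hl => (WW_deriv hρ hl).continuousAt.continuousWithinAt
lemma WD_cont {ρ : ℝ} (hρ : 0 < ρ) : ContinuousOn (WD d ρ) (Ioi 0) :=
  fun _ hl => (WD_deriv hρ hl).continuousAt.continuousWithinAt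

lemma Good.mulr {b : ℝ → ℝ → ℂ} (hb : Good b) (c : ℂ) (k : ℕ) :
    Good (fun δ l => c / (l : ℂ) ^ k * b δ l) := by
  refine hb.mul (g := fun δ l => c / (l : ℂ) ^ k) fun p hp => ?_
  have hden : ContDiffAt ℝ ∞ (fun p : ℝ × ℝ => ((p.2 : ℝ) : ℂ) ^ k) p :=
    (ContDiff.pow (Complex.ofRealCLM.contDiff.comp contDiff_snd) k).contDiffAt
  have hne : ((p.2 : ℝ) : ℂ) ^ k ≠ 0 := pow_ne_zero _ (by exact_mod_cast hp.ne')
  have := (contDiffAt_const (c := c)).mul (hden.inv hne)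
  exact this.congr_of_eventuallyEq (Filter.Eventually.of_forall fun x => by simp [div_eq_mul_inv])

lemma osc_W {b : ℝ → ℝ → ℂ} (hb : Good b) {ρ : ℝ} (hρ : 0 < ρ) (t δ : ℝ) :
    ((ρ : ℂ) ^ 2 - t ^ 2) * osc t (fun l => b δ l * WW d ρ l) =
      osc t (fun l => (dl (dl b) δ l + cW d / (l : ℂ) ^ 2 * b δ l) * WW d ρ l)
        + 2 * osc t (fun l => dl b δ l * WD d ρ l) := by
  have b1 := hb.dl
  have b2 := b1.dl
  have o1 : (1/16 : ℝ) ∉ Icc (1/8 : ℝ) 8 := by norm_num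
  have o2 : (9 : ℝ) ∉ Icc (1/8 : ℝ) 8 := by norm_num
  have g2 := hb.mulr (cW d) 2
  rw [← osc_ibp t ρ (fun l => b δ l * WW d ρ l)
    (fun l => dl b δ l * WW d ρ l + b δ l * WD d ρ l)
    (fun l => dl (dl b) δ l * WW d ρ l + dl b δ l * WD d ρ l + (dl b δ l * WD d ρ l
      + b δ l * ((cW d / (l : ℂ) ^ 2 - ρ ^ 2) * WW d ρ l)))
    (fun l hl => (hb.hasDerivAt δ l).mul (WW_deriv hρ hl))
    (fun l hl => ((b1.hasDerivAt δ l).mul (WW_deriv hρ hl)).add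
      ((hb.hasDerivAt δ l).mul (WD_deriv hρ hl)))]
  · rw [← osc_const_mul, ← osc_add]
    · refine osc_congr t fun l hl => ?_
      ring
    · exact ((b2.cont δ).add (g2.cont δ)).continuousOn.mul (WW_cont hρ)
    · exact ((b1.cont δ).continuousOn.mul (WD_cont hρ)).const_smul (2 : ℂ)
  · have c1 := (b2.cont δ).continuousOn.mul (WW_cont (d := d) hρ)
    have c2 := (b1.cont δ).continuousOn.mul (WD_cont (d := d) hρ)
    have c3 := ((g2.cont δ).continuousOn.sub ((hb.cont δ).continuousOn.const_smul ((ρ : ℂ) ^ 2))).mul (WW_cont (d := d) hρ)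
    refine ((c1.add c2).add (c2.add c3)).congr fun l hl => ?_
    simp only [smul_eq_mul, Pi.add_apply, Pi.mul_apply]; simp; ring
  · simp [hb.supp δ _ o1, -one_div]
  · simp [hb.supp δ _ o2]
  · simp [hb.supp δ _ o1, b1.supp δ _ o1, -one_div]
  · simp [hb.supp δ _ o2, b1.supp δ _ o2]

lemma osc_D {b : ℝ → ℝ → ℂ} (hb : Good b) {ρ : ℝ} (hρ : 0 < ρ) (t δ : ℝ) :
    ((ρ : ℂ) ^ 2 - t ^ 2) * osc t (fun l => b δ l * WD d ρ l) =
      osc t (fun l => (dl (dl b) δ l + cW d / (l : ℂ) ^ 2 * b δ l) * WD d ρ l)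
        + osc t (fun l => (2 * cW d / (l : ℂ) ^ 2 * dl b δ l + (-2 * cW d) / (l : ℂ) ^ 3 * b δ l) * WW d ρ l)
        + (-2 * ρ ^ 2) * osc t (fun l => dl b δ l * WW d ρ l) := by
  have b1 := hb.dl
  have b2 := b1.dl
  have o1 : (1/16 : ℝ) ∉ Icc (1/8 : ℝ) 8 := by norm_num
  have o2 : (9 : ℝ) ∉ Icc (1/8 : ℝ) 8 := by norm_num
  have g2 := hb.mulr (cW d) 2
  have g3 := hb.mulr (-2 * cW d) 3
  have g4 := b1.mulr (2 * cW d) 2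
  have hinv : ∀ l : ℝ, 0 < l → HasDerivAt (fun l : ℝ => ((cW d : ℂ) / (l : ℂ) ^ 2 - ρ ^ 2))
      ((-2 * cW d) / (l : ℂ) ^ 3) l := by
    intro l hl
    have h : HasDerivAt (fun l : ℝ => cW d / l ^ 2 - ρ ^ 2) (cW d * (-(2 * l) / (l ^ 2) ^ 2)) l := by
      have h0 : HasDerivAt (fun l : ℝ => l ^ 2) (2 * l) l := by simpa using hasDerivAt_pow 2 l
      have := ((h0.inv (by positivity)).const_mul (cW d)).sub_const (ρ ^ 2)
      simpa [div_eq_mul_inv] using this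
    have := h.ofReal_comp
    have e : (fun l : ℝ => ((cW d : ℂ) / (l : ℂ) ^ 2 - ρ ^ 2)) = fun l : ℝ => ((cW d / l ^ 2 - ρ ^ 2 : ℝ) : ℂ) := by
      ext l; push_cast; rfl
    rw [e]
    refine this.congr_deriv ?_
    have hl' : (l : ℂ) ≠ 0 := by exact_mod_cast hl.ne'
    push_cast
    field_simp
  rw [← osc_ibp t ρ (fun l => b δ l * WD d ρ l)
    (fun l => dl b δ l * WD d ρ l + b δ l * ((cW d / (l : ℂ) ^ 2 - ρ ^ 2) * WW d ρ l))
    (fun l => dl (dl b) δ l * WD d ρ l + dl b δ l * ((cW d / (l : ℂ) ^ 2 - ρ ^ 2) * WW d ρ l)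
      + (dl b δ l * ((cW d / (l : ℂ) ^ 2 - ρ ^ 2) * WW d ρ l)
      + b δ l * ((-2 * cW d) / (l : ℂ) ^ 3 * WW d ρ l + (cW d / (l : ℂ) ^ 2 - ρ ^ 2) * WD d ρ l)))
    (fun l hl => (hb.hasDerivAt δ l).mul (WD_deriv hρ hl))
    (fun l hl => ((b1.hasDerivAt δ l).mul (WD_deriv hρ hl)).add
      ((hb.hasDerivAt δ l).mul ((hinv l hl).mul (WW_deriv hρ hl))))]
  · have c1 : ContinuousOn (fun l => (dl (dl b) δ l + cW d / (l : ℂ) ^ 2 * b δ l) * WD d ρ l) (Ioi 0) :=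
      ((b2.cont δ).add (g2.cont δ)).continuousOn.mul (WD_cont (d := d) hρ)
    have c2 : ContinuousOn (fun l : ℝ => (2 * cW d / (l : ℂ) ^ 2 * dl b δ l + (-2 * cW d) / (l : ℂ) ^ 3 * b δ l) * WW d ρ l) (Ioi 0) :=
      ((g4.cont δ).add (g3.cont δ)).continuousOn.mul (WW_cont (d := d) hρ)
    have c3 : ContinuousOn (fun l => -2 * (ρ : ℂ) ^ 2 * (dl b δ l * WW d ρ l)) (Ioi 0) :=
      ((b1.cont δ).continuousOn.mul (WW_cont (d := d) hρ)).const_smul (-2 * (ρ : ℂ) ^ 2)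
    rw [← osc_const_mul, ← osc_add t c1 c2]
    refine Eq.trans ?_ (osc_add t (c1.add c2) c3)
    refine osc_congr t fun l hl => ?_
    ring
  · have c1 := (b2.cont δ).continuousOn.mul (WD_cont (d := d) hρ)
    have ci : ContinuousOn (fun l : ℝ => ((cW d : ℂ) / (l : ℂ) ^ 2 - ρ ^ 2)) (Ioi 0) :=
      fun l hl => (hinv l hl).continuousAt.continuousWithinAt
    have c2 := (b1.cont δ).continuousOn.mul (ci.mul (WW_cont (d := d) hρ))
    have c3 := (g3.cont δ).continuousOn.mul (WW_cont (d := d) hρ)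
    have c4 := (hb.cont δ).continuousOn.mul (ci.mul (WD_cont (d := d) hρ))
    refine ((c1.add c2).add (c2.add (c3.add c4))).congr fun l hl => ?_
    simp only [Pi.add_apply, Pi.mul_apply]; ring
  · simp [hb.supp δ _ o1, -one_div]
  · simp [hb.supp δ _ o2]
  · simp [hb.supp δ _ o1, b1.supp δ _ o1, -one_div]
  · simp [hb.supp δ _ o2, b1.supp δ _ o2]

lemma osc_main (hd : 3 ≤ d) (n : ℕ) : ∀ b : ℝ → ℝ → ℂ, Good b → ∃ C : ℝ, 0 ≤ C ∧
    ∀ ρ : ℝ, 0 < ρ → ∀ t : ℝ, ∀ δ ∈ Icc (0 : ℝ) 1,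
      ‖((ρ : ℂ) ^ 2 - t ^ 2) ^ n * osc t (fun l => b δ l * WW d ρ l)‖ ≤ C * (1 + ρ) ^ n ∧
      ‖((ρ : ℂ) ^ 2 - t ^ 2) ^ n * osc t (fun l => b δ l * WD d ρ l)‖ ≤ C * (1 + ρ) ^ (n + 1) := by
  induction n with
  | zero =>
    intro b hb
    obtain ⟨A, hA0, hA⟩ := hb.bdd
    obtain ⟨B, hB0, hB⟩ := W_bdd (d := d) hd
    refine ⟨A * B * 9, by positivity, fun ρ hρ t δ hδ => ⟨?_, ?_⟩⟩
    · simp only [pow_zero, one_mul, mul_one]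
      refine osc_bdd t _ _ fun l hl => ?_
      rw [norm_mul]
      refine mul_le_mul (hA δ hδ l) ?_ (norm_nonneg _) hA0
      simpa [WW] using (hB (ρ * l) (by positivity)).1
    · simp only [pow_zero, one_mul, zero_add, pow_one]
      refine (osc_bdd t _ (A * (ρ * B)) fun l hl => ?_).trans ?_
      · rw [norm_mul]
        refine mul_le_mul (hA δ hδ l) ?_ (norm_nonneg _) hA0
        have := (hB (ρ * l) (by positivity)).2
        simp only [WD, Complex.norm_real, Real.norm_eq_abs, abs_mul, abs_of_pos hρ]
        exact mul_le_mul_of_nonneg_left this hρ.le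
      · have : 0 ≤ A * B * 9 := by positivity
        nlinarith
  | succ n ih =>
    intro b hb
    have b1 := hb.dl
    have b2 := b1.dl
    have g2 := b2.add (hb.mulr (cW d) 2)
    have g3 := (b1.mulr (2 * cW d) 2).add (hb.mulr (-2 * cW d) 3)
    obtain ⟨C1, h10, h1⟩ := ih _ b1
    obtain ⟨C2, h20, h2⟩ := ih _ g2
    obtain ⟨C3, h30, h3⟩ := ih _ g3
    refine ⟨2 * C1 + C2 + C3, by positivity, fun ρ hρ t δ hδ => ⟨?_, ?_⟩⟩
    · rw [pow_succ, mul_assoc, osc_W hb hρ, mul_add]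
      refine (norm_add_le _ _).trans ?_
      have e1 := (h2 ρ hρ t δ hδ).1
      have e2 := (h1 ρ hρ t δ hδ).2
      have : ‖((ρ : ℂ) ^ 2 - t ^ 2) ^ n * (2 * osc t (fun l => dl b δ l * WD d ρ l))‖
          = 2 * ‖((ρ : ℂ) ^ 2 - t ^ 2) ^ n * osc t (fun l => dl b δ l * WD d ρ l)‖ := by
        rw [mul_left_comm, norm_mul]; simp
      rw [this]
      have e3 : C2 * (1 + ρ) ^ n ≤ C2 * (1 + ρ) ^ (n + 1) :=
        mul_le_mul_of_nonneg_left (pow_le_pow_right₀ (by linarith) (by omega)) h20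
      have : 0 ≤ C3 * (1 + ρ) ^ (n + 1) := by positivity
      nlinarith
    · rw [pow_succ, mul_assoc, osc_D hb hρ, mul_add, mul_add]
      refine (norm_add₃_le).trans ?_
      have e1 := (h2 ρ hρ t δ hδ).2
      have e2 := (h3 ρ hρ t δ hδ).1
      have e4 := (h1 ρ hρ t δ hδ).1
      have : ‖((ρ : ℂ) ^ 2 - t ^ 2) ^ n * ((-2 * (ρ : ℂ) ^ 2) * osc t (fun l => dl b δ l * WW d ρ l))‖
          = 2 * ρ ^ 2 * ‖((ρ : ℂ) ^ 2 - t ^ 2) ^ n * osc t (fun l => dl b δ l * WW d ρ l)‖ := by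
        rw [mul_left_comm, norm_mul]; simp
      rw [this]
      have p1 : (1 + ρ) ^ (n + 1) ≤ (1 + ρ) ^ (n + 1 + 1) := pow_le_pow_right₀ (by linarith) (by omega)
      have p2 : (1 + ρ) ^ n ≤ (1 + ρ) ^ (n + 1 + 1) := pow_le_pow_right₀ (by linarith) (by omega)
      have f1 := mul_le_mul_of_nonneg_left p1 h20
      have f2 := mul_le_mul_of_nonneg_left p2 h30
      have f3 : 2 * ρ ^ 2 * (C1 * (1 + ρ) ^ n) ≤ 2 * C1 * (1 + ρ) ^ (n + 1 + 1) := by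
        have : ρ ^ 2 ≤ (1 + ρ) ^ 2 := by nlinarith
        have h5 : 0 ≤ 2 * C1 * (1 + ρ) ^ n := by positivity
        calc 2 * ρ ^ 2 * (C1 * (1 + ρ) ^ n) = (2 * C1 * (1 + ρ) ^ n) * ρ ^ 2 := by ring
          _ ≤ (2 * C1 * (1 + ρ) ^ n) * (1 + ρ) ^ 2 := mul_le_mul_of_nonneg_left this h5
          _ = _ := by ring
      have f4 := mul_le_mul_of_nonneg_left e4 (by positivity : 0 ≤ 2 * ρ ^ 2)
      linarith

/-- decay of the oscillatory integral away from `|t| = ρ` -/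
lemma osc_decay (hd : 3 ≤ d) (n : ℕ) (b : ℝ → ℝ → ℂ) (hb : Good b) : ∃ C : ℝ, 0 < C ∧
    ∀ ρ : ℝ, 0 < ρ → ∀ t : ℝ, ∀ δ ∈ Icc (0 : ℝ) 1,
      ‖osc t (fun l => b δ l * WW d ρ l)‖ * (1 + |ρ - (|t|)|) ^ n ≤ C := by
  obtain ⟨C0, h00, h0⟩ := osc_main (d := d) hd 0 b hb
  obtain ⟨C, h10, h1⟩ := osc_main (d := d) hd n b hb
  refine ⟨2 ^ n * C0 + 2 ^ n * (2 ^ n * C) + 1, by positivity, fun ρ hρ t δ hδ => ?_⟩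
  have e0 := (h0 ρ hρ t δ hδ).1
  have e1 := (h1 ρ hρ t δ hδ).1
  simp only [pow_zero, one_mul, mul_one] at e0
  set I := ‖osc t (fun l => b δ l * WW d ρ l)‖ with hI
  have hI0 : 0 ≤ I := norm_nonneg _
  set x := |ρ - (|t|)| with hx
  have hx0 : 0 ≤ x := abs_nonneg _
  rcases le_or_gt x 1 with h | h
  · have : (1 + x) ^ n ≤ 2 ^ n := pow_le_pow_left₀ (by linarith) (by linarith) n
    have h2 : I * (1 + x) ^ n ≤ C0 * 2 ^ n := mul_le_mul e0 this (by positivity) h00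
    have : 0 ≤ 2 ^ n * (2 ^ n * C) := by positivity
    linarith
  · have hs : 1 ≤ ρ + |t| := by
      have : x ≤ ρ + |t| := by
        rw [hx]; refine abs_le.2 ⟨?_, ?_⟩ <;> linarith [abs_nonneg t]
      linarith
    have hn : ‖((ρ : ℂ) ^ 2 - t ^ 2)‖ = x * (ρ + |t|) := by
      have : ((ρ : ℂ) ^ 2 - t ^ 2) = ((ρ ^ 2 - t ^ 2 : ℝ) : ℂ) := by push_cast; ring
      rw [this, Complex.norm_real, Real.norm_eq_abs, hx]
      have h3 : ρ ^ 2 - t ^ 2 = (ρ - |t|) * (ρ + |t|) := by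
        have := sq_abs t; nlinarith
      rw [h3, abs_mul, abs_of_nonneg (by positivity : 0 ≤ ρ + |t|)]
    rw [norm_mul, norm_pow, hn, ← hI, mul_pow] at e1
    have h4 : (1 + ρ) ^ n ≤ 2 ^ n * (ρ + |t|) ^ n := by
      rw [← mul_pow]; exact pow_le_pow_left₀ (by linarith) (by linarith [abs_nonneg t]) n
    have hpos : 0 < (ρ + |t|) ^ n := by positivity
    have h5 : x ^ n * I ≤ 2 ^ n * C := by
      have : (x ^ n * I) * (ρ + |t|) ^ n ≤ (2 ^ n * C) * (ρ + |t|) ^ n := by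
        calc (x ^ n * I) * (ρ + |t|) ^ n = x ^ n * (ρ + |t|) ^ n * I := by ring
          _ ≤ C * (1 + ρ) ^ n := e1
          _ ≤ C * (2 ^ n * (ρ + |t|) ^ n) := mul_le_mul_of_nonneg_left h4 h10
          _ = _ := by ring
      exact le_of_mul_le_mul_right this hpos
    have h6 : (1 + x) ^ n ≤ 2 ^ n * x ^ n := by
      rw [← mul_pow]; exact pow_le_pow_left₀ (by linarith) (by linarith) n
    have h7 : I * (1 + x) ^ n ≤ 2 ^ n * (x ^ n * I) := by
      calc I * (1 + x) ^ n ≤ I * (2 ^ n * x ^ n) := mul_le_mul_of_nonneg_left h6 hI0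
        _ = _ := by ring
    have h8 := mul_le_mul_of_nonneg_left h5 (by positivity : (0:ℝ) ≤ 2 ^ n)
    have : 0 ≤ 2 ^ n * C0 := by positivity
    linarith

end Part4

section Part5
open scoped ContDiff
set_option linter.all false

variable {d : ℕ} [NeZero d]

/-- the multiplier -/
def wm (b : ℝ → ℝ → ℂ) (δ t : ℝ) (r : ℝ) : ℂ := Complex.exp (Complex.I * t * r) * b δ r

lemma wm_cont {b : ℝ → ℝ → ℂ} (hb : Good b) (δ t : ℝ) : Continuous (wm b δ t) :=
  (by fun_prop : Continuous (fun r : ℝ => Complex.exp (Complex.I * t * r))).mul (hb.cont δ)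

lemma wm_norm (b : ℝ → ℝ → ℂ) (δ t r : ℝ) : ‖wm b δ t r‖ = ‖b δ r‖ := by
  have : Complex.I * t * r = ((t * r : ℝ) : ℂ) * Complex.I := by push_cast; ring
  rw [wm, norm_mul, this, Complex.norm_exp_ofReal_mul_I, one_mul]

lemma wm_supp {b : ℝ → ℝ → ℂ} (hb : Good b) (δ t : ℝ) {d : ℕ} :
    HasCompactSupport (fun ξ : Ed d => wm b δ t ‖ξ‖) := by
  refine HasCompactSupport.intro (isCompact_closedBall (0 : Ed d) 8) fun x hx => ?_
  have : 8 < ‖x‖ := by simpa using hx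
  rw [wm, hb.supp δ _ (fun h => by linarith [h.2]), mul_zero]

lemma wm_integrable {b : ℝ → ℝ → ℂ} (hb : Good b) (δ t : ℝ) {d : ℕ} :
    Integrable (fun ξ : Ed d => wm b δ t ‖ξ‖) :=
  ((wm_cont hb δ t).comp continuous_norm).integrable_of_hasCompactSupport (wm_supp hb δ t)

/-- radial profile of the kernel -/
def kr (d : ℕ) [NeZero d] (b : ℝ → ℝ → ℂ) (δ t s : ℝ) : ℂ :=
  ∫ r in Ioi (0 : ℝ), r ^ (d - 1) • (wm b δ t r * (Jf d (r * (2 * Real.pi * s)) : ℂ))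

lemma kernel_eq {b : ℝ → ℝ → ℂ} (hb : Good b) (δ t : ℝ) (x : Ed d) :
    𝓕⁻ (fun ξ : Ed d => wm b δ t ‖ξ‖) x = kr d b δ t ‖x‖ := by
  rw [Real.fourierInv_eq']
  have h := radial_integral (d := d) (wm b δ t) (wm_integrable hb δ t) ((2 * Real.pi) • x)
  rw [norm_smul, Real.norm_of_nonneg (by positivity : 0 ≤ 2 * Real.pi)] at h
  rw [kr, ← h]
  congr 1; ext ξ
  rw [smul_eq_mul, mul_comm]
  congr 2
  rw [inner_smul_left, real_inner_comm]
  simp; ring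

lemma kr_eq_osc {b : ℝ → ℝ → ℂ} (hb : Good b) (δ t : ℝ) {s : ℝ} (hs : 0 < s) :
    kr d b δ t s = (((2 * Real.pi * s) ^ (-kap d) : ℝ) : ℂ) *
      osc t (fun l => (((l ^ kap d : ℝ) : ℂ) * b δ l) * WW d (2 * Real.pi * s) l) := by
  have hrho : 0 < 2 * Real.pi * s := by positivity
  rw [← osc_const_mul, kr, osc, intervalIntegral.integral_of_le (by norm_num)]
  symm
  rw [setIntegral_eq_of_subset_of_forall_diff_eq_zero (s := Ioc (1/16 : ℝ) 9) (t := Ioi (0:ℝ)) measurableSet_Ioi]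
  · refine setIntegral_congr_fun measurableSet_Ioc fun r hr => ?_
    have hr0 : 0 < r := lt_trans (by norm_num) hr.1
    have e1 : ((2 * Real.pi * s) ^ (-kap d)) * (r ^ kap d * Wz d (2 * Real.pi * s * r))
        = r ^ (d - 1) * Jf d (r * (2 * Real.pi * s)) := by
      rw [Wz, Real.mul_rpow hrho.le hr0.le, Real.rpow_neg hrho.le, mul_comm r (2 * Real.pi * s)]
      have e2 : r ^ kap d * r ^ kap d = r ^ (d - 1) := by
        rw [← Real.rpow_add hr0, ← Real.rpow_natCast]
        congr 1
        have : 1 ≤ d := NeZero.one_le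
        rw [kap]; push_cast [this]; ring
      have h3 : (2 * Real.pi * s) ^ kap d ≠ 0 := by positivity
      rw [← e2]; field_simp
    have e1' : ((((2 * Real.pi * s) ^ (-kap d) : ℝ) : ℂ)) * ((((r ^ kap d : ℝ)) : ℂ) * ((Wz d (2 * Real.pi * s * r) : ℝ) : ℂ))
        = (r : ℂ) ^ (d - 1) * ((Jf d (r * (2 * Real.pi * s)) : ℝ) : ℂ) := by
      exact_mod_cast congrArg (fun x : ℝ => (x : ℂ)) e1
    simp only [wm, WW, Complex.real_smul]
    push_cast
    linear_combination (Complex.exp (Complex.I * t * r) * b δ r) * e1'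
  · intro x hx
    exact lt_trans (by norm_num) hx.1
  · intro x hx
    have : x ∉ Icc (1/8 : ℝ) 8 := by
      intro h; exact hx.2 ⟨by linarith [h.1], by linarith [h.2]⟩
    simp [wm, hb.supp δ _ this]

lemma kr_decay (hd : 3 ≤ d) (n : ℕ) (b : ℝ → ℝ → ℂ) (hb : Good b) : ∃ C : ℝ, 0 < C ∧
    ∀ s : ℝ, 0 < s → ∀ t : ℝ, ∀ δ ∈ Icc (0 : ℝ) 1,
      ‖kr d b δ t s‖ ≤ C * s ^ (-kap d) * ((1 + |2 * Real.pi * s - (|t|)|) ^ n)⁻¹ := by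
  have hb' : Good (fun δ l => ((l ^ kap d : ℝ) : ℂ) * b δ l) := by
    refine hb.mul (g := fun δ l => ((l ^ kap d : ℝ) : ℂ)) fun p hp => ?_
    have h1 : ContDiffAt ℝ ∞ (fun p : ℝ × ℝ => p.2 ^ kap d) p :=
      contDiffAt_snd.rpow_const_of_ne hp.ne'
    exact Complex.ofRealCLM.contDiff.contDiffAt.comp p h1
  obtain ⟨C, hC, h⟩ := osc_decay (d := d) hd n _ hb'
  refine ⟨(2 * Real.pi) ^ (-kap d) * C, by positivity, fun s hs t δ hδ => ?_⟩
  have h2 := h (2 * Real.pi * s) (by positivity) t δ hδ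
  rw [kr_eq_osc hb δ t hs, norm_mul, Complex.norm_real, Real.norm_of_nonneg (by positivity),
    Real.mul_rpow (by positivity) hs.le]
  have : 0 < (1 + |2 * Real.pi * s - (|t|)|) ^ n := by positivity
  rw [← div_eq_mul_inv, le_div_iff₀ this]
  have h3 : 0 ≤ (2 * Real.pi) ^ (-kap d) * s ^ (-kap d) := by positivity
  nlinarith [mul_le_mul_of_nonneg_left h2 h3]

end Part5

section Part6
open scoped ContDiff
set_option linter.all false

section planch
variable {d : ℕ}

lemma integral_fourier_mul {u v : Ed d → ℂ} (hu : Integrable u) (hv : Integrable v) :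
    ∫ ξ, 𝓕 u ξ * v ξ = ∫ x, u x * 𝓕 v x := by
  have := VectorFourier.integral_fourierIntegral_smul_eq_flip (μ := (volume : Measure (Ed d)))
    (ν := (volume : Measure (Ed d))) (L := innerₗ (Ed d)) (f := u) (g := v)
    Real.continuous_fourierChar continuous_inner hu hv
  rw [flip_innerₗ] at this
  exact this

lemma fourier_continuous {u : Ed d → ℂ} (hu : Integrable u) : Continuous (𝓕 u) :=
  VectorFourier.fourierIntegral_continuous Real.continuous_fourierChar
    (by exact continuous_inner) hu

lemma fourierInv_continuous {u : Ed d → ℂ} (hu : Integrable u) : Continuous (𝓕⁻ u) := by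
  have : 𝓕⁻ u = fun x => 𝓕 u (-x) := by ext x; exact Real.fourierInv_eq_fourier_neg u x
  rw [this]
  exact (fourier_continuous hu).comp continuous_neg

lemma fourier_toLp_ae {u : Ed d → ℂ} (hu : Integrable u) (hu2 : MemLp u 2) :
    ((𝓕 (hu2.toLp u) : Lp ℂ 2 (volume : Measure (Ed d))) : Ed d → ℂ) =ᵐ[volume] 𝓕 u := by
  refine ae_eq_of_integral_contDiff_smul_eq ?_ ?_ ?_
  · exact (Lp.memLp _).locallyIntegrable (by norm_num)
  · exact (fourier_continuous hu).locallyIntegrable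
  · intro g hg hgs
    have hg' : ContDiff ℝ ∞ (fun x => (g x : ℂ)) := Complex.ofRealCLM.contDiff.comp hg
    have hgs' : HasCompactSupport (fun x => (g x : ℂ)) := hgs.comp_left (g := fun x : ℝ => (x : ℂ)) (by simp)
    set φ := hgs'.toSchwartzMap hg' with hφ
    have hφe : ∀ x, φ x = (g x : ℂ) := fun x => rfl
    have h1 := congrArg (fun T => T φ) (Lp.fourier_toTemperedDistribution_eq (hu2.toLp u))
    simp only [TemperedDistribution.fourier_apply, Lp.toTemperedDistribution_apply] at h1
    have e1 : ∀ f : Ed d → ℂ, ∫ x, g x • f x = ∫ x, φ x • f x := by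
      intro f; congr 1
    rw [e1, e1, ← h1]
    have e2 : ∫ x, (𝓕 φ) x • (hu2.toLp u : Ed d → ℂ) x = ∫ x, (𝓕 φ) x • u x := by
      refine integral_congr_ae ?_
      filter_upwards [hu2.coeFn_toLp] with x hx
      rw [hx]
    rw [e2]
    have := integral_fourier_mul φ.integrable hu
    simpa [SchwartzMap.fourier_coe] using this

lemma fourier_memLp {u : Ed d → ℂ} (hu : Integrable u) (hu2 : MemLp u 2) : MemLp (𝓕 u) 2 :=
  (memLp_congr_ae (fourier_toLp_ae hu hu2)).1 (Lp.memLp _)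

lemma planch {u v : Ed d → ℂ} (hu : Integrable u) (hu2 : MemLp u 2) (hv : Integrable v) (hv2 : MemLp v 2) :
    ∫ ξ, inner ℂ (𝓕 u ξ) (𝓕 v ξ) = ∫ x, inner ℂ (u x) (v x) := by
  have h := Lp.inner_fourier_eq (hu2.toLp u) (hv2.toLp v)
  rw [L2.inner_def, L2.inner_def] at h
  calc _ = _ := integral_congr_ae ?_
    _ = _ := h
    _ = _ := integral_congr_ae ?_
  · filter_upwards [fourier_toLp_ae hu hu2, fourier_toLp_ae hv hv2] with x h1 h2
    rw [h1, h2]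
  · filter_upwards [hu2.coeFn_toLp, hv2.coeFn_toLp] with x h1 h2
    rw [h1, h2]

lemma planch_norm {u : Ed d → ℂ} (hu : Integrable u) (hu2 : MemLp u 2) :
    eLpNorm (𝓕 u) 2 volume = eLpNorm u 2 volume := by
  have h := Lp.norm_fourier_eq (hu2.toLp u)
  rw [Lp.norm_def, Lp.norm_def, ENNReal.toReal_eq_toReal_iff' (Lp.eLpNorm_ne_top _) (Lp.eLpNorm_ne_top _)] at h
  rw [← eLpNorm_congr_ae (fourier_toLp_ae hu hu2), h, eLpNorm_congr_ae hu2.coeFn_toLp]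

lemma fourierInv_mul {m u : Ed d → ℂ} (hm : Integrable m) (hu : Integrable u) (x : Ed d) :
    𝓕⁻ (fun ξ => m ξ * 𝓕 u ξ) x = ∫ y, 𝓕⁻ m (x - y) * u y := by
  rw [Real.fourierInv_eq']
  set E : Ed d → ℂ := fun ξ => Complex.exp (↑(2 * Real.pi * inner ℝ ξ x) * Complex.I) with hE
  have hm' : Integrable (fun ξ => E ξ * m ξ) := by
    refine hm.bdd_mul (c := 1) (Continuous.aestronglyMeasurable (by fun_prop)) (Filter.Eventually.of_forall fun ξ => ?_)
    rw [hE, Complex.norm_exp_ofReal_mul_I]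
  have := integral_fourier_mul hu hm'
  calc _ = ∫ ξ, 𝓕 u ξ * (E ξ * m ξ) := by
        congr 1; ext ξ; simp only [smul_eq_mul, hE]; ring
    _ = ∫ y, u y * 𝓕 (fun ξ => E ξ * m ξ) y := this
    _ = _ := by
        congr 1; ext y
        rw [mul_comm]; congr 1
        rw [Real.fourier_eq', Real.fourierInv_eq']
        congr 1; ext ξ
        simp only [smul_eq_mul, hE, ← mul_assoc, ← Complex.exp_add]
        congr 2
        rw [inner_sub_right]; push_cast; ring
end planch

end Part6

section Part7
open scoped ContDiff
set_option linter.all false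

section psi
variable {d : ℕ}

def bump0 (x : Ed d) : ℂ := ((Real.smoothTransition (1 - (100 * ‖x‖) ^ 2) : ℝ) : ℂ)

lemma bump0_supp (x : Ed d) (hx : 1 / 100 < ‖x‖) : bump0 x = 0 := by
  rw [bump0, Real.smoothTransition.zero_of_nonpos]; · simp
  nlinarith

lemma bump0_compact : HasCompactSupport (bump0 (d := d)) := by
  refine HasCompactSupport.intro (isCompact_closedBall (0 : Ed d) (1/100)) fun x hx => ?_
  exact bump0_supp x (by simpa using hx)

lemma bump0_smooth : ContDiff ℝ ∞ (bump0 (d := d)) := by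
  refine Complex.ofRealCLM.contDiff.comp (Real.smoothTransition.contDiff.comp ?_)
  have : (fun x : Ed d => 1 - (100 * ‖x‖) ^ 2) = fun x => 1 - 10000 * ‖x‖ ^ 2 := by ext x; ring
  rw [this]
  exact contDiff_const.sub (contDiff_const.mul (contDiff_norm_sq ℝ))

def psi0 (d : ℕ) : SchwartzMap (Ed d) ℂ := bump0_compact.toSchwartzMap bump0_smooth

lemma psi0_apply (x : Ed d) : psi0 d x = bump0 x := rfl

def lapS (f : SchwartzMap (Ed d) ℂ) : SchwartzMap (Ed d) ℂ := Laplacian.laplacian f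

def psi (d : ℕ) : SchwartzMap (Ed d) ℂ := (lapS^[d]) (psi0 d)

lemma lapS_supp (f : SchwartzMap (Ed d) ℂ) (hf : ∀ x, 1 / 100 < ‖x‖ → f x = 0) (x : Ed d)
    (hx : 1 / 100 < ‖x‖) : lapS f x = 0 := by
  rw [lapS, SchwartzMap.laplacian_apply]
  have hop : IsOpen {x : Ed d | 1 / 100 < ‖x‖} := isOpen_lt continuous_const continuous_norm
  have h : (f : Ed d → ℂ) =ᶠ[nhds x] fun _ => (0 : ℂ) := by
    filter_upwards [hop.mem_nhds hx] with y hy using hf y hy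
  rw [(InnerProductSpace.laplacian_congr_nhds h).eq_of_nhds]
  simp

lemma psi0_supp (x : Ed d) (hx : 1 / 100 < ‖x‖) : psi0 d x = 0 := bump0_supp x hx

lemma psi_supp (x : Ed d) (hx : 1 / 100 < ‖x‖) : psi d x = 0 := by
  have : ∀ n : ℕ, ∀ x, 1 / 100 < ‖x‖ → (lapS^[n]) (psi0 d) x = 0 := by
    intro n
    induction n with
    | zero => exact psi0_supp
    | succ n ih => rw [Function.iterate_succ_apply']; exact lapS_supp _ ih
  exact this d x hx

lemma lapS_fourier (f : SchwartzMap (Ed d) ℂ) (ξ : Ed d) :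
    𝓕 (lapS f) ξ = ((-(2 * Real.pi * ‖ξ‖) ^ 2 : ℝ) : ℂ) * 𝓕 f ξ := by
  rw [lapS, SchwartzMap.laplacian_eq_fourierMultiplierCLM, SchwartzMap.fourierMultiplierCLM_apply,
    FourierTransform.fourier_smul, FourierTransform.fourier_fourierInv_eq, SchwartzMap.smul_apply]
  have : (fun x : Ed d => ‖x‖ ^ 2).HasTemperateGrowth := by fun_prop
  rw [SchwartzMap.smulLeftCLM_apply_apply this]
  simp only [Complex.real_smul]
  push_cast; ring

lemma psi_fourier (ξ : Ed d) :
    𝓕 (psi d) ξ = ((-(2 * Real.pi * ‖ξ‖) ^ 2 : ℝ) : ℂ) ^ d * 𝓕 (psi0 d) ξ := by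
  have : ∀ n : ℕ, 𝓕 ((lapS^[n]) (psi0 d)) ξ = ((-(2 * Real.pi * ‖ξ‖) ^ 2 : ℝ) : ℂ) ^ n * 𝓕 (psi0 d) ξ := by
    intro n
    induction n with
    | zero => simp
    | succ n ih => rw [Function.iterate_succ_apply', lapS_fourier, ih, pow_succ]; ring
  exact this d

lemma psi0_fourier_radial {ξ η : Ed d} (h : ‖ξ‖ = ‖η‖) : 𝓕 (psi0 d) ξ = 𝓕 (psi0 d) η := by
  obtain ⟨R, hR⟩ := exists_rot h
  have := Real.fourier_comp_linearIsometry R (psi0 d : Ed d → ℂ) ξ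
  have e : (psi0 d : Ed d → ℂ) ∘ R = psi0 d := by
    ext x; simp [psi0_apply, bump0]
  rw [e, hR] at this
  simpa [SchwartzMap.fourier_coe] using this

lemma psi0_fourier_ne {ξ : Ed d} (h : ‖ξ‖ ≤ 8) : 𝓕 (psi0 d) ξ ≠ 0 := by
  intro h0
  have h1 : (∫ x : Ed d, Real.smoothTransition (1 - (100 * ‖x‖) ^ 2) * Real.cos (2 * Real.pi * inner ℝ x ξ)) = 0 := by
    have := congrArg Complex.re h0
    rw [SchwartzMap.fourier_coe, Real.fourier_eq'] at this
    have hre : ∫ x : Ed d, (Complex.exp (↑(-2 * Real.pi * inner ℝ x ξ) * Complex.I) • (psi0 d) x).re = 0 := by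
      rw [Complex.zero_re] at this
      rw [← this]
      have hintg : Integrable (fun x : Ed d => Complex.exp (↑(-2 * Real.pi * inner ℝ x ξ) * Complex.I) • (psi0 d) x) := by
        refine (psi0 d).integrable.bdd_mul (c := 1) (Continuous.aestronglyMeasurable (by fun_prop)) (Filter.Eventually.of_forall fun ξ => ?_)
        rw [Complex.norm_exp_ofReal_mul_I]
      exact integral_re hintg
    rw [← hre]
    congr 1; ext x
    rw [smul_eq_mul, psi0_apply, bump0, Complex.re_mul_ofReal, Complex.exp_ofReal_mul_I_re, mul_comm]
    congr 1
    rw [← Real.cos_neg]; congr 1; ring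
  have hnn : ∀ x : Ed d, 0 ≤ Real.smoothTransition (1 - (100 * ‖x‖) ^ 2) * Real.cos (2 * Real.pi * inner ℝ x ξ) := by
    intro x
    rcases le_or_gt ‖x‖ (1/100) with hx | hx
    · refine mul_nonneg (Real.smoothTransition.nonneg _) (Real.cos_nonneg_of_mem_Icc ?_)
      have h2 : |inner ℝ x ξ| ≤ 8 / 100 := (abs_real_inner_le_norm x ξ).trans (by nlinarith [norm_nonneg x, norm_nonneg ξ])
      have := abs_le.1 h2
      constructor <;> nlinarith [Real.pi_pos]
    · rw [Real.smoothTransition.zero_of_nonpos (by nlinarith), zero_mul]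
  have hc : Continuous (fun x : Ed d => Real.smoothTransition (1 - (100 * ‖x‖) ^ 2) * Real.cos (2 * Real.pi * inner ℝ x ξ)) := by
    have := Real.smoothTransition.continuous
    fun_prop
  have hs : HasCompactSupport (fun x : Ed d => Real.smoothTransition (1 - (100 * ‖x‖) ^ 2) * Real.cos (2 * Real.pi * inner ℝ x ξ)) := by
    refine HasCompactSupport.intro (isCompact_closedBall (0 : Ed d) (1/100)) fun x hx => ?_
    have : 1 / 100 < ‖x‖ := by simpa using hx
    rw [Real.smoothTransition.zero_of_nonpos (by nlinarith), zero_mul]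
  have h9 := hc.integral_pos_of_hasCompactSupport_nonneg_nonzero (μ := volume) hs hnn (x := 0) (by simp)
  exact absurd h1 h9.ne'
end psi

end Part7

section Part8
set_option linter.all false

section phi
variable {d : ℕ} [NeZero d]

def Phi (d : ℕ) (r : ℝ) (x y : Ed d) : ℂ := ((r ^ kap d : ℝ) : ℂ) * ∫ ω, psi d (x - y - r • ω) ∂(sig d)

lemma psi_bdd (d : ℕ) : ∃ C : ℝ, 0 < C ∧ ∀ x, ‖psi d x‖ ≤ C := by
  obtain ⟨C, hC, h⟩ := (psi d).decay 0 0
  exact ⟨C, hC, fun x => by simpa using h x⟩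

lemma kap_nonneg : 0 ≤ kap d := by
  have : 1 ≤ d := NeZero.one_le
  have : (1 : ℝ) ≤ d := by exact_mod_cast this
  unfold kap; linarith

lemma psi_sig_cont : Continuous (fun p : ℝ × Ed d => ∫ ω, psi d (p.2 - p.1 • ω) ∂(sig d)) := by
  obtain ⟨C, hC, h⟩ := psi_bdd d
  refine continuous_of_dominated (bound := fun _ => C) (fun p => ?_) (fun p => ?_) (integrable_const _) ?_
  · exact ((psi d).continuous.comp (by fun_prop)).aestronglyMeasurable
  · exact Filter.Eventually.of_forall fun ω => h _
  · exact Filter.Eventually.of_forall fun ω => (psi d).continuous.comp (by fun_prop)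

lemma Phi_cont : Continuous (fun p : ℝ × Ed d × Ed d => Phi d p.1 p.2.1 p.2.2) := by
  unfold Phi
  refine Continuous.mul ?_ ?_
  · exact Complex.continuous_ofReal.comp (continuous_fst.rpow_const (fun _ => Or.inr kap_nonneg))
  · exact psi_sig_cont.comp (by fun_prop : Continuous (fun p : ℝ × Ed d × Ed d => (p.1, p.2.1 - p.2.2)))

lemma Phi_cont_y (r : ℝ) (x : Ed d) : Continuous (Phi d r x) :=
  Phi_cont.comp (by fun_prop : Continuous (fun y : Ed d => (r, x, y)))

lemma Phi_bdd (d : ℕ) [NeZero d] : ∃ C : ℝ, 0 < C ∧ ∀ r x y, ‖Phi d r x y‖ ≤ C * |r ^ kap d| := by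
  obtain ⟨C, hC, h⟩ := psi_bdd d
  refine ⟨C * (sig d).real univ + 1, by positivity, fun r x y => ?_⟩
  rw [Phi, norm_mul, Complex.norm_real, Real.norm_eq_abs, mul_comm]
  refine mul_le_mul_of_nonneg_right ?_ (abs_nonneg _)
  exact (norm_integral_le_of_norm_le_const (Filter.Eventually.of_forall fun ω => h _)).trans (by linarith)

lemma Phi_supp {r : ℝ} (hr : 0 ≤ r) {x y : Ed d} (h : 1 / 100 < |‖x - y‖ - r|) : Phi d r x y = 0 := by
  rw [Phi]
  have : ∫ ω, psi d (x - y - r • ω) ∂(sig d) = 0 := by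
    refine integral_eq_zero_of_ae ?_
    filter_upwards [sig_ae_norm d] with ω hω
    refine psi_supp _ (h.trans_le ?_)
    have := abs_norm_sub_norm_le (x - y) (r • ω)
    rwa [norm_smul, hω, mul_one, Real.norm_of_nonneg hr] at this
  rw [this, mul_zero]

lemma Phi_compact {r : ℝ} (hr : 0 ≤ r) (x : Ed d) : HasCompactSupport (Phi d r x) := by
  refine HasCompactSupport.intro (isCompact_closedBall x (r + 1)) fun y hy => Phi_supp hr ?_
  have : r + 1 < ‖x - y‖ := by simpa [dist_eq_norm, norm_sub_rev] using hy
  exact lt_of_lt_of_le (by linarith) (le_abs_self _)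

lemma Phi_int {r : ℝ} (hr : 0 ≤ r) (x : Ed d) : Integrable (Phi d r x) :=
  (Phi_cont_y r x).integrable_of_hasCompactSupport (Phi_compact hr x)

lemma Phi_mem {r : ℝ} (hr : 0 ≤ r) (x : Ed d) (p : ℝ≥0∞) : MemLp (Phi d r x) p :=
  (Phi_cont_y r x).memLp_of_hasCompactSupport (Phi_compact hr x)

lemma fourier_refl (f : Ed d → ℂ) (x ξ : Ed d) :
    𝓕 (fun y => f (x - y)) ξ = Complex.exp (((-2 * Real.pi * inner ℝ x ξ : ℝ) : ℂ) * Complex.I) * 𝓕 f (-ξ) := by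
  rw [Real.fourier_eq', Real.fourier_eq', ← integral_const_mul]
  rw [← integral_sub_left_eq_self _ volume x]
  congr 1; ext y
  simp only [smul_eq_mul, sub_sub_cancel, ← mul_assoc, ← Complex.exp_add]
  congr 2
  rw [inner_sub_left, inner_neg_right]; push_cast; ring

lemma psi_fourier_radial {ξ η : Ed d} (h : ‖ξ‖ = ‖η‖) : 𝓕 (psi d) ξ = 𝓕 (psi d) η := by
  rw [psi_fourier, psi_fourier, psi0_fourier_radial h, h]

lemma Phi_fourier {r : ℝ} (hr : 0 ≤ r) (x ξ : Ed d) :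
    𝓕 (Phi d r x) ξ = ((r ^ kap d * Jf d (2 * Real.pi * r * ‖ξ‖) : ℝ) : ℂ) *
      (Complex.exp (((-2 * Real.pi * inner ℝ x ξ : ℝ) : ℂ) * Complex.I) * 𝓕 (psi d) ξ) := by
  have h1 : ∀ ω : Ed d, ∫ y : Ed d, Complex.exp (↑(-2 * Real.pi * inner ℝ y ξ) * Complex.I) * psi d (x - y - r • ω)
      = Complex.exp (Complex.I * ((inner ℝ ((2 * Real.pi * r) • ξ) ω : ℝ) : ℂ)) *
        (Complex.exp (((-2 * Real.pi * inner ℝ x ξ : ℝ) : ℂ) * Complex.I) * 𝓕 (psi d) ξ) := by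
    intro ω
    have := fourier_refl (psi d) (x - r • ω) ξ
    rw [Real.fourier_eq'] at this
    have e : (𝓕 (psi d : Ed d → ℂ)) (-ξ) = 𝓕 (psi d) ξ := by
      rw [← SchwartzMap.fourier_coe]; exact psi_fourier_radial (by simp)
    rw [e] at this
    have e2 : ∀ y, x - y - r • ω = x - r • ω - y := fun y => by abel
    simp only [smul_eq_mul] at this
    simp_rw [e2]
    rw [this, ← mul_assoc, ← Complex.exp_add]
    congr 2
    rw [inner_sub_left, inner_smul_left, inner_smul_left, real_inner_comm ξ ω]
    simp only [conj_trivial]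
    push_cast; ring
  rw [Real.fourier_eq']
  simp only [Phi, smul_eq_mul]
  have h2 : ∫ y : Ed d, Complex.exp (↑(-2 * Real.pi * inner ℝ y ξ) * Complex.I) * (((r ^ kap d : ℝ) : ℂ) * ∫ ω, psi d (x - y - r • ω) ∂(sig d))
      = ((r ^ kap d : ℝ) : ℂ) * ∫ y : Ed d, ∫ ω, Complex.exp (↑(-2 * Real.pi * inner ℝ y ξ) * Complex.I) * psi d (x - y - r • ω) ∂(sig d) := by
    rw [← integral_const_mul]
    congr 1; ext y
    rw [integral_const_mul]; ring
  rw [h2, integral_integral_swap]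
  · simp_rw [h1]
    rw [integral_mul_const, sig_inner_exp, norm_smul, Real.norm_of_nonneg (by positivity)]
    push_cast; ring
  · set F : Ed d × Ed d → ℂ := Function.uncurry fun y ω => Complex.exp (↑(-2 * Real.pi * inner ℝ y ξ) * Complex.I) * psi d (x - y - r • ω) with hF
    have hFc : Continuous F := by
      have := (psi d).continuous
      simp only [hF, Function.uncurry_def]
      fun_prop
    obtain ⟨C, hC, hψ⟩ := psi_bdd d
    have hb : Integrable (fun p : Ed d × Ed d => (indicator (closedBall x (r + 1)) (fun _ => C) p.1) * (1 : ℝ)) (volume.prod (sig d)) := by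
      refine Integrable.mul_prod (f := indicator (closedBall x (r + 1)) (fun _ => C)) (g := fun _ => (1:ℝ)) ?_ (integrable_const _)
      exact (integrable_indicator_iff measurableSet_closedBall).2 (integrableOn_const (by exact measure_closedBall_lt_top.ne))
    refine hb.mono hFc.aestronglyMeasurable ?_
    have hae : ∀ᵐ p ∂((volume : Measure (Ed d)).prod (sig d)), ‖p.2‖ = 1 :=
      Measure.quasiMeasurePreserving_snd.ae (sig_ae_norm d)
    filter_upwards [hae] with p hp
    simp only [hF, Function.uncurry_def, norm_mul, Complex.norm_exp_ofReal_mul_I, one_mul, mul_one]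
    by_cases h : p.1 ∈ closedBall x (r + 1)
    · simp only [indicator_of_mem h, Real.norm_of_nonneg hC.le]; simpa using hψ _
    · rw [psi_supp]; · simp
      have h3 : r + 1 < ‖x - p.1‖ := by simpa [dist_eq_norm, norm_sub_rev] using h
      have := norm_sub_norm_le (x - p.1) (r • p.2)
      rw [norm_smul, hp, mul_one, Real.norm_of_nonneg hr] at this
      linarith
end phi

end Part8

section Part9
set_option linter.all false

section cells
variable {d : ℕ}

def cell (x : Ed d) : Fin d → ℤ := fun i => ⌊x i⌋

lemma coord_le (x : Ed d) (i : Fin d) : |x i| ≤ ‖x‖ := by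
  simpa using PiLp.norm_apply_le x i

lemma cell_near {x y : Ed d} (h : ‖x - y‖ < 1) :
    cell x ∈ Fintype.piFinset (fun i => Finset.Icc (cell y i - 1) (cell y i + 1)) := by
  rw [Fintype.mem_piFinset]
  intro i
  have h1 : |x i - y i| < 1 := lt_of_le_of_lt (by simpa using coord_le (x - y) i) h
  rw [abs_lt] at h1
  rw [Finset.mem_Icc]
  simp only [cell]
  constructor
  · rw [Int.le_floor]; push_cast; have := Int.floor_le (y i); linarith
  · have h2 : (⌊x i⌋ : ℝ) < ⌊y i⌋ + 2 := by
      have := Int.floor_le (x i); have := Int.lt_floor_add_one (y i); linarith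
    have : ⌊x i⌋ < ⌊y i⌋ + 2 := by exact_mod_cast h2
    linarith

lemma near_card {ι : Type*} (s : Finset ι) (x : ι → Ed d) (hx : Set.InjOn (fun i => cell (x i)) s) (y : Ed d) 
    (t : Finset ι) (hts : t ⊆ s) (ht : ∀ i ∈ t, ‖x i - y‖ < 1) : t.card ≤ 3 ^ d := by
  classical
  have : t.card ≤ (Fintype.piFinset (fun i => Finset.Icc (cell y i - 1) (cell y i + 1))).card := by
    refine Finset.card_le_card_of_injOn (fun i => cell (x i)) (fun i hi => cell_near (ht i hi)) (hx.mono (by exact_mod_cast hts))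
  refine this.trans (le_of_eq ?_)
  rw [Fintype.card_piFinset]
  have : ∀ i : Fin d, (Finset.Icc (cell y i - 1) (cell y i + 1)).card = 3 := by
    intro i; rw [Int.card_Icc]; ring_nf; rfl
  simp [this]

lemma eLpNorm_two_sq (u : Ed d → ℂ) : eLpNorm u 2 volume ^ 2 = ∫⁻ x, ‖u x‖ₑ ^ 2 := by
  have := eLpNorm_nnreal_pow_eq_lintegral (f := u) (μ := (volume : Measure (Ed d))) (p := 2) (by norm_num)
  simpa using this

lemma overlap {ι : Type*} (F : Ed d → ℂ) (hF : Continuous F) (hs : ∀ x, 1 / 100 < ‖x‖ → F x = 0)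
    (s : Finset ι) (x : ι → Ed d) (hx : Set.InjOn (fun i => cell (x i)) s) (c : ι → ℂ) :
    ∫⁻ y, ‖∑ i ∈ s, c i * F (x i - y)‖ₑ ^ 2 ≤ 3 ^ d * (∑ i ∈ s, ‖c i‖ₑ ^ 2) * ∫⁻ y, ‖F y‖ₑ ^ 2 := by
  classical
  have h1 : ∀ y, ‖∑ i ∈ s, c i * F (x i - y)‖ₑ ^ 2 ≤ 3 ^ d * ∑ i ∈ s, ‖c i‖ₑ ^ 2 * ‖F (x i - y)‖ₑ ^ 2 := by
    intro y
    set t := s.filter (fun i => ‖x i - y‖ < 1) with htd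
    have e1 : ∑ i ∈ s, c i * F (x i - y) = ∑ i ∈ t, c i * F (x i - y) := by
      rw [htd, Finset.sum_filter]
      refine Finset.sum_congr rfl fun i _ => ?_
      split_ifs with h
      · rfl
      · rw [hs _ (by linarith), mul_zero]
    have e2 : ‖∑ i ∈ t, c i * F (x i - y)‖ ^ 2 ≤ 3 ^ d * ∑ i ∈ s, ‖c i‖ ^ 2 * ‖F (x i - y)‖ ^ 2 := by
      calc ‖∑ i ∈ t, c i * F (x i - y)‖ ^ 2 ≤ (∑ i ∈ t, ‖c i * F (x i - y)‖) ^ 2 := by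
            gcongr; exact norm_sum_le _ _
        _ ≤ t.card * ∑ i ∈ t, ‖c i * F (x i - y)‖ ^ 2 := sq_sum_le_card_mul_sum_sq
        _ ≤ 3 ^ d * ∑ i ∈ s, ‖c i * F (x i - y)‖ ^ 2 := by
            gcongr
            · exact_mod_cast near_card s x hx y t (Finset.filter_subset _ _) (fun i hi => (Finset.mem_filter.1 hi).2)
            · exact Finset.filter_subset _ _
        _ = _ := by simp_rw [norm_mul, mul_pow]
    rw [e1]
    have e3 := ENNReal.ofReal_le_ofReal e2
    rw [ENNReal.ofReal_pow (norm_nonneg _), ofReal_norm, ENNReal.ofReal_mul (by positivity), ENNReal.ofReal_sum_of_nonneg (fun _ _ => by positivity)] at e3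
    refine e3.trans (le_of_eq ?_)
    congr 1
    · rw [ENNReal.ofReal_pow (by norm_num)]; norm_num
    · refine Finset.sum_congr rfl fun i _ => ?_
      rw [ENNReal.ofReal_mul (by positivity), ENNReal.ofReal_pow (norm_nonneg _), ENNReal.ofReal_pow (norm_nonneg _), ofReal_norm, ofReal_norm]
  calc _ ≤ ∫⁻ y, 3 ^ d * ∑ i ∈ s, ‖c i‖ₑ ^ 2 * ‖F (x i - y)‖ₑ ^ 2 := lintegral_mono h1
    _ = 3 ^ d * ∑ i ∈ s, ‖c i‖ₑ ^ 2 * ∫⁻ y, ‖F (x i - y)‖ₑ ^ 2 := by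
      rw [lintegral_const_mul' _ _ (by norm_num), lintegral_finset_sum]
      · congr 1; refine Finset.sum_congr rfl fun i _ => ?_
        rw [lintegral_const_mul' _ _ (by simp)]
      · intro i _
        have : Measurable F := hF.measurable
        fun_prop
    _ = _ := by
      have : ∀ i, ∫⁻ y, ‖F (x i - y)‖ₑ ^ 2 = ∫⁻ y, ‖F y‖ₑ ^ 2 := fun i =>
        lintegral_sub_left_eq_self (fun z => ‖F z‖ₑ ^ 2) (x i)
      simp_rw [this, mul_assoc, Finset.sum_mul]

end cells

section F2
variable {d : ℕ} [NeZero d]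

lemma fourier_sum {ι : Type*} (s : Finset ι) (c : ι → ℂ) (u : ι → Ed d → ℂ) (hu : ∀ i ∈ s, Integrable (u i)) (ξ : Ed d) :
    𝓕 (fun y => ∑ i ∈ s, c i * u i y) ξ = ∑ i ∈ s, c i * 𝓕 (u i) ξ := by
  simp only [Real.fourier_eq', smul_eq_mul, Finset.mul_sum]
  rw [integral_finset_sum]
  · refine Finset.sum_congr rfl fun i _ => ?_
    rw [← integral_const_mul]; congr 1; ext y; ring
  · intro i hi
    refine ((hu i hi).const_mul (c i)).bdd_mul (c := 1) (Continuous.aestronglyMeasurable (by fun_prop)) (Filter.Eventually.of_forall fun ξ => ?_)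
    rw [Complex.norm_exp_ofReal_mul_I]

lemma schw_refl_int (F : SchwartzMap (Ed d) ℂ) (x : Ed d) : Integrable (fun y => F (x - y)) :=
  F.integrable.comp_sub_left x

lemma schw_refl_mem (F : SchwartzMap (Ed d) ℂ) (x : Ed d) : MemLp (fun y => F (x - y)) 2 :=
  (F.memLp 2 volume).comp_measurePreserving (Measure.measurePreserving_sub_left volume x)

lemma Phi_F2 (hd : 3 ≤ d) : ∃ C : ℝ, 0 < C ∧ ∀ r : ℝ, 0 < r → ∀ {ι : Type} (s : Finset ι) (x : ι → Ed d) 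
    (hx : Set.InjOn (fun i => cell (x i)) s) (c : ι → ℂ),
    eLpNorm (fun y => ∑ i ∈ s, c i * Phi d r (x i) y) 2 volume ^ 2 ≤ ENNReal.ofReal (C * ∑ i ∈ s, ‖c i‖ ^ 2) := by
  obtain ⟨C, hC, hJ⟩ := Jf_decay (d := d) hd
  set A : ℝ≥0∞ := ENNReal.ofReal C ^ 2 * (2 * (3 ^ d * (∫⁻ y, ‖psi d y‖ₑ ^ 2) + 3 ^ d * (∫⁻ y, ‖psi0 d y‖ₑ ^ 2))) with hA
  have hAt : A ≠ ⊤ := by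
    have h1 : ∫⁻ y, ‖psi d y‖ₑ ^ 2 ≠ ⊤ := by
      rw [← eLpNorm_two_sq]; exact ENNReal.pow_ne_top (((psi d).memLp 2 volume).eLpNorm_ne_top)
    have h2 : ∫⁻ y, ‖psi0 d y‖ₑ ^ 2 ≠ ⊤ := by
      rw [← eLpNorm_two_sq]; exact ENNReal.pow_ne_top (((psi0 d).memLp 2 volume).eLpNorm_ne_top)
    rw [hA]
    refine ENNReal.mul_ne_top (by simp) (ENNReal.mul_ne_top (by simp) (ENNReal.add_ne_top.2 ⟨ENNReal.mul_ne_top (by simp) h1, ENNReal.mul_ne_top (by simp) h2⟩))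
  refine ⟨A.toReal + 1, by positivity, fun r hr ι s x hx c => ?_⟩
  set u := fun y => ∑ i ∈ s, c i * Phi d r (x i) y with hu
  set v := fun y => ∑ i ∈ s, c i * psi d (x i - y) with hv
  set v0 := fun y => ∑ i ∈ s, c i * psi0 d (x i - y) with hv0
  have iu : Integrable u := integrable_finset_sum _ fun i _ => (Phi_int hr.le (x i)).const_mul _
  have mu : MemLp u 2 := memLp_finset_sum _ fun i _ => (Phi_mem hr.le (x i) 2).const_mul _
  have iv : Integrable v := integrable_finset_sum _ fun i _ => (schw_refl_int _ (x i)).const_mul _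
  have mv : MemLp v 2 := memLp_finset_sum _ fun i _ => (schw_refl_mem _ (x i)).const_mul _
  have iv0 : Integrable v0 := integrable_finset_sum _ fun i _ => (schw_refl_int _ (x i)).const_mul _
  have mv0 : MemLp v0 2 := memLp_finset_sum _ fun i _ => (schw_refl_mem _ (x i)).const_mul _
  have fv : ∀ ξ, 𝓕 v ξ = ∑ i ∈ s, c i * (Complex.exp (((-2 * Real.pi * inner ℝ (x i) ξ : ℝ) : ℂ) * Complex.I) * 𝓕 (psi d) ξ) := by
    intro ξ
    rw [hv, fourier_sum s c (fun i y => psi d (x i - y)) (fun i _ => schw_refl_int _ _)]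
    refine Finset.sum_congr rfl fun i _ => ?_
    rw [fourier_refl, ← SchwartzMap.fourier_coe, psi_fourier_radial (norm_neg ξ)]
  have fv0 : ∀ ξ, 𝓕 v0 ξ = ∑ i ∈ s, c i * (Complex.exp (((-2 * Real.pi * inner ℝ (x i) ξ : ℝ) : ℂ) * Complex.I) * 𝓕 (psi0 d) ξ) := by
    intro ξ
    rw [hv0, fourier_sum s c (fun i y => psi0 d (x i - y)) (fun i _ => schw_refl_int _ _)]
    refine Finset.sum_congr rfl fun i _ => ?_
    rw [fourier_refl, ← SchwartzMap.fourier_coe, psi0_fourier_radial (norm_neg ξ)]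
  have fu : ∀ ξ, 𝓕 u ξ = ((r ^ kap d * Jf d (2 * Real.pi * r * ‖ξ‖) : ℝ) : ℂ) * 𝓕 v ξ := by
    intro ξ
    rw [hu, fourier_sum s c (fun i y => Phi d r (x i) y) (fun i _ => Phi_int hr.le _), fv, Finset.mul_sum]
    refine Finset.sum_congr rfl fun i _ => ?_
    rw [Phi_fourier hr.le]; ring
  have fvv : ∀ ξ, ‖𝓕 v ξ‖ = (2 * Real.pi * ‖ξ‖) ^ (2 * d) * ‖𝓕 v0 ξ‖ := by
    intro ξ
    have : 𝓕 v ξ = ((-(2 * Real.pi * ‖ξ‖) ^ 2 : ℝ) : ℂ) ^ d * 𝓕 v0 ξ := by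
      rw [fv, fv0, Finset.mul_sum]
      refine Finset.sum_congr rfl fun i _ => ?_
      rw [psi_fourier]; ring
    rw [this, norm_mul, norm_pow, Complex.norm_real, norm_neg, Real.norm_of_nonneg (by positivity), pow_mul]
  have key : ∀ ξ, ‖𝓕 u ξ‖ ≤ C * (‖𝓕 v ξ‖ + ‖𝓕 v0 ξ‖) := by
    intro ξ
    rcases eq_or_ne ξ 0 with rfl | hξ
    · have : ‖𝓕 v 0‖ = 0 := by
        rw [fvv]; simp [NeZero.ne d]
      rw [fu, norm_mul, this]; simp; positivity
    have hp : 0 < 2 * Real.pi * ‖ξ‖ := by have := norm_pos_iff.2 hξ; positivity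
    set w := 2 * Real.pi * ‖ξ‖ with hw
    have h1 : ‖𝓕 u ξ‖ ≤ C * w ^ (-kap d) * ‖𝓕 v ξ‖ := by
      rw [fu, norm_mul, Complex.norm_real, Real.norm_eq_abs, abs_mul, abs_of_nonneg (by positivity)]
      refine mul_le_mul_of_nonneg_right ?_ (norm_nonneg _)
      have e : 2 * Real.pi * r * ‖ξ‖ = r * w := by rw [hw]; ring
      rw [e]
      calc r ^ kap d * |Jf d (r * w)| ≤ r ^ kap d * (C * (r * w) ^ (-kap d)) := by
            gcongr; exact hJ _ (by positivity)
        _ = (r ^ kap d * r ^ (-kap d)) * (C * w ^ (-kap d)) := by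
            rw [Real.mul_rpow hr.le hp.le]; ring
        _ = _ := by rw [← Real.rpow_add hr]; simp
    have hk : 0 ≤ kap d := kap_nonneg
    rcases le_total 1 w with h | h
    · have h2 : w ^ (-kap d) ≤ 1 := Real.rpow_le_one_of_one_le_of_nonpos h (by linarith)
      calc ‖𝓕 u ξ‖ ≤ C * w ^ (-kap d) * ‖𝓕 v ξ‖ := h1
        _ ≤ C * 1 * ‖𝓕 v ξ‖ := by gcongr
        _ ≤ _ := by rw [mul_one]; gcongr; linarith [norm_nonneg (𝓕 v0 ξ)]
    · have h2 : w ^ (-kap d) * w ^ (2 * d) ≤ 1 := by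
        rw [← Real.rpow_natCast w, ← Real.rpow_add hp]
        refine Real.rpow_le_one hp.le h ?_
        have : (1 : ℝ) ≤ d := by exact_mod_cast (NeZero.one_le : 1 ≤ d)
        unfold kap; push_cast; linarith
      calc ‖𝓕 u ξ‖ ≤ C * w ^ (-kap d) * ‖𝓕 v ξ‖ := h1
        _ = C * (w ^ (-kap d) * w ^ (2 * d)) * ‖𝓕 v0 ξ‖ := by rw [fvv]; ring
        _ ≤ C * 1 * ‖𝓕 v0 ξ‖ := by gcongr
        _ ≤ _ := by rw [mul_one]; gcongr; linarith [norm_nonneg (𝓕 v ξ)]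
  have key2 : ∀ ξ, ‖𝓕 u ξ‖ₑ ^ 2 ≤ ENNReal.ofReal C ^ 2 * (2 * (‖𝓕 v ξ‖ₑ ^ 2 + ‖𝓕 v0 ξ‖ₑ ^ 2)) := by
    intro ξ
    have : ‖𝓕 u ξ‖ ^ 2 ≤ C ^ 2 * (2 * (‖𝓕 v ξ‖ ^ 2 + ‖𝓕 v0 ξ‖ ^ 2)) := by
      calc ‖𝓕 u ξ‖ ^ 2 ≤ (C * (‖𝓕 v ξ‖ + ‖𝓕 v0 ξ‖)) ^ 2 := by gcongr; exact key ξ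
        _ = C ^ 2 * (‖𝓕 v ξ‖ + ‖𝓕 v0 ξ‖) ^ 2 := by ring
        _ ≤ _ := by gcongr; exact add_sq_le
    have e3 := ENNReal.ofReal_le_ofReal this
    rwa [ENNReal.ofReal_pow (norm_nonneg _), ofReal_norm, ENNReal.ofReal_mul (by positivity), ENNReal.ofReal_mul (by positivity), ENNReal.ofReal_add (by positivity) (by positivity),
      ENNReal.ofReal_pow (norm_nonneg _), ENNReal.ofReal_pow (norm_nonneg _), ENNReal.ofReal_pow hC.le, ofReal_norm, ofReal_norm, ENNReal.ofReal_ofNat] at e3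
  rw [← planch_norm iu mu, eLpNorm_two_sq]
  calc ∫⁻ ξ, ‖𝓕 u ξ‖ₑ ^ 2 ≤ ∫⁻ ξ, ENNReal.ofReal C ^ 2 * (2 * (‖𝓕 v ξ‖ₑ ^ 2 + ‖𝓕 v0 ξ‖ₑ ^ 2)) := lintegral_mono key2
    _ = ENNReal.ofReal C ^ 2 * (2 * ((∫⁻ ξ, ‖v ξ‖ₑ ^ 2) + (∫⁻ ξ, ‖v0 ξ‖ₑ ^ 2))) := by
      rw [lintegral_const_mul' _ _ (by simp), lintegral_const_mul' _ _ (by simp), lintegral_add_left]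
      · rw [← eLpNorm_two_sq, ← eLpNorm_two_sq, planch_norm iv mv, planch_norm iv0 mv0, eLpNorm_two_sq, eLpNorm_two_sq]
      · have := (fourier_continuous iv).measurable
        fun_prop
    _ ≤ ENNReal.ofReal C ^ 2 * (2 * (3 ^ d * (∑ i ∈ s, ‖c i‖ₑ ^ 2) * (∫⁻ y, ‖psi d y‖ₑ ^ 2) + 3 ^ d * (∑ i ∈ s, ‖c i‖ₑ ^ 2) * (∫⁻ y, ‖psi0 d y‖ₑ ^ 2))) := by
      gcongr
      · exact overlap _ (psi d).continuous (fun x hx => psi_supp x hx) s x hx c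
      · exact overlap _ (psi0 d).continuous (fun x hx => psi0_supp x hx) s x hx c
    _ = A * ∑ i ∈ s, ‖c i‖ₑ ^ 2 := by rw [hA]; ring
    _ ≤ _ := by
      rw [ENNReal.ofReal_mul (by positivity), ENNReal.ofReal_sum_of_nonneg (fun _ _ => by positivity)]
      gcongr with i hi
      · rw [ENNReal.ofReal_add (by positivity) (by positivity), ENNReal.ofReal_toReal hAt]; exact le_self_add
      · rw [ENNReal.ofReal_pow (norm_nonneg _), ofReal_norm]
end F2

end Part9

section Part10
set_option linter.all false

section F3
variable {d : ℕ} [NeZero d]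

lemma psi_hat_bounds (d : ℕ) [NeZero d] : ∃ C : ℝ, 0 < C ∧ ∀ ξ : Ed d, 0 < ‖ξ‖ → ‖𝓕 (psi d) ξ‖ ^ 2 ≤ C * (1 + ‖ξ‖) ^ (-2 : ℝ) ∧
    ‖𝓕 (psi d) ξ‖ ^ 2 * ‖ξ‖ ^ (-kap d) ≤ C * (1 + ‖ξ‖) ^ (-2 : ℝ) := by
  obtain ⟨A, hA, h0⟩ := (𝓕 (psi d)).decay 0 0
  obtain ⟨B, hB, h2⟩ := (𝓕 (psi d)).decay 2 0
  obtain ⟨D, hD, h3⟩ := (𝓕 (psi0 d)).decay 0 0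
  simp only [pow_zero, norm_iteratedFDeriv_zero, one_mul] at h0 h2 h3
  have hk : 0 ≤ kap d := kap_nonneg
  set P : ℝ := (2 * Real.pi) ^ (2 * d) * D with hP
  have hPp : 0 < P := by positivity
  refine ⟨(A + P) * (2 * (A + B)), by positivity, fun ξ hξ => ?_⟩
  have e2 : (1 + ‖ξ‖) ^ (-2 : ℝ) = ((1 + ‖ξ‖) ^ 2)⁻¹ := by
    rw [Real.rpow_neg (by positivity)]; norm_cast
  have b1 : ‖𝓕 (psi d) ξ‖ ≤ 2 * (A + B) * (1 + ‖ξ‖) ^ (-2 : ℝ) := by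
    rw [e2, ← div_eq_mul_inv, le_div_iff₀ (by positivity)]
    have : (1 + ‖ξ‖) ^ 2 ≤ 2 * (1 + ‖ξ‖ ^ 2) := by nlinarith [sq_nonneg (1 - ‖ξ‖)]
    calc ‖𝓕 (psi d) ξ‖ * (1 + ‖ξ‖) ^ 2 ≤ ‖𝓕 (psi d) ξ‖ * (2 * (1 + ‖ξ‖ ^ 2)) := by gcongr
      _ = 2 * (‖𝓕 (psi d) ξ‖ + ‖ξ‖ ^ 2 * ‖𝓕 (psi d) ξ‖) := by ring
      _ ≤ _ := by gcongr; exacts [h0 ξ, h2 ξ]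
  have b2 : ‖𝓕 (psi d) ξ‖ * ‖ξ‖ ^ (-kap d) ≤ A + P := by
    rcases le_total 1 ‖ξ‖ with h | h
    · have : ‖ξ‖ ^ (-kap d) ≤ 1 := Real.rpow_le_one_of_one_le_of_nonpos h (by linarith)
      calc _ ≤ ‖𝓕 (psi d) ξ‖ * 1 := by gcongr
        _ ≤ _ := by linarith [h0 ξ]
    · have h4 : ‖𝓕 (psi d) ξ‖ ≤ P * ‖ξ‖ ^ (2 * d) := by
        rw [psi_fourier, norm_mul, norm_pow, Complex.norm_real, norm_neg, Real.norm_of_nonneg (by positivity), ← pow_mul, mul_pow, hP]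
        have := h3 ξ
        calc _ ≤ (2 * Real.pi) ^ (2 * d) * ‖ξ‖ ^ (2 * d) * D := by gcongr
          _ = _ := by ring
      have h5 : ‖ξ‖ ^ (2 * d) * ‖ξ‖ ^ (-kap d) ≤ 1 := by
        rw [← Real.rpow_natCast ‖ξ‖, ← Real.rpow_add hξ]
        refine Real.rpow_le_one hξ.le h ?_
        have : (1 : ℝ) ≤ d := by exact_mod_cast (NeZero.one_le : 1 ≤ d)
        unfold kap; push_cast; linarith
      calc _ ≤ P * ‖ξ‖ ^ (2 * d) * ‖ξ‖ ^ (-kap d) := by gcongr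
        _ = P * (‖ξ‖ ^ (2 * d) * ‖ξ‖ ^ (-kap d)) := by ring
        _ ≤ P * 1 := by gcongr
        _ ≤ _ := by linarith
  constructor
  · calc ‖𝓕 (psi d) ξ‖ ^ 2 = ‖𝓕 (psi d) ξ‖ * ‖𝓕 (psi d) ξ‖ := sq _
      _ ≤ (A + P) * (2 * (A + B) * (1 + ‖ξ‖) ^ (-2 : ℝ)) := by
        gcongr; linarith [h0 ξ]
      _ = _ := by ring
  · calc ‖𝓕 (psi d) ξ‖ ^ 2 * ‖ξ‖ ^ (-kap d) = (‖𝓕 (psi d) ξ‖ * ‖ξ‖ ^ (-kap d)) * ‖𝓕 (psi d) ξ‖ := by ring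
      _ ≤ (A + P) * (2 * (A + B) * (1 + ‖ξ‖) ^ (-2 : ℝ)) := by gcongr
      _ = _ := by ring

lemma Phi_inner_eq {r r' : ℝ} (hr : 0 < r) (hr' : 0 < r') (x x' e : Ed d) (he : ‖e‖ = 1) :
    ∫ y, inner ℂ (Phi d r x y) (Phi d r' x' y) = ∫ ρ in Ioi (0 : ℝ), ρ ^ (d - 1) • 
      ((((r ^ kap d * Jf d (2 * Real.pi * r * |ρ|)) * (r' ^ kap d * Jf d (2 * Real.pi * r' * |ρ|)) * ‖𝓕 (psi d) (ρ • e)‖ ^ 2 : ℝ) : ℂ)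
       * (Jf d (ρ * ‖(2 * Real.pi) • (x - x')‖) : ℂ)) := by
  set φ : ℝ → ℂ := fun ρ => (((r ^ kap d * Jf d (2 * Real.pi * r * |ρ|)) * (r' ^ kap d * Jf d (2 * Real.pi * r' * |ρ|)) * ‖𝓕 (psi d) (ρ • e)‖ ^ 2 : ℝ) : ℂ) with hφ
  have h1 : ∀ x x' ξ : Ed d, inner ℂ (𝓕 (Phi d r x) ξ) (𝓕 (Phi d r' x') ξ) = φ ‖ξ‖ * Complex.exp (Complex.I * ((inner ℝ ((2 * Real.pi) • (x - x')) ξ : ℝ) : ℂ)) := by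
    intro x x' ξ
    have hrad : 𝓕 (psi d) (‖ξ‖ • e) = 𝓕 (psi d) ξ := psi_fourier_radial (by rw [norm_smul, he]; simp)
    have e1 : ((‖𝓕 (psi d) ξ‖ ^ 2 : ℝ) : ℂ) = (starRingEnd ℂ) (𝓕 (psi d) ξ) * 𝓕 (psi d) ξ := by
      rw [mul_comm, Complex.mul_conj, Complex.normSq_eq_norm_sq]
    have e2 : Complex.exp (Complex.I * ((inner ℝ ((2 * Real.pi) • (x - x')) ξ : ℝ) : ℂ)) = 
        Complex.exp (((2 * Real.pi * inner ℝ x ξ : ℝ) : ℂ) * Complex.I) * Complex.exp (((-2 * Real.pi * inner ℝ x' ξ : ℝ) : ℂ) * Complex.I) := by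
      rw [← Complex.exp_add]; congr 1
      rw [inner_smul_left, inner_sub_left]; simp only [conj_trivial]; push_cast; ring
    have e3 : (starRingEnd ℂ) (Complex.exp (((-2 * Real.pi * inner ℝ x ξ : ℝ) : ℂ) * Complex.I)) = Complex.exp (((2 * Real.pi * inner ℝ x ξ : ℝ) : ℂ) * Complex.I) := by
      rw [← Complex.exp_conj]; congr 1; rw [map_mul, Complex.conj_ofReal, Complex.conj_I]; push_cast; ring
    rw [Phi_fourier hr.le, Phi_fourier hr'.le, RCLike.inner_apply]
    simp only [hφ]
    rw [hrad, e2, Complex.ofReal_mul (_ * _) (‖𝓕 (psi d) ξ‖ ^ 2), e1, map_mul, map_mul, e3, Complex.conj_ofReal, abs_of_nonneg (norm_nonneg ξ)]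
    push_cast; ring
  have hintg : Integrable (fun ξ : Ed d => φ ‖ξ‖) := by
    have := MemLp.integrable_mul (μ := (volume : Measure (Ed d))) (p := 2) (q := 2) ((fourier_memLp (Phi_int hr.le 0) (Phi_mem hr.le 0 2)).star) (fourier_memLp (Phi_int hr'.le 0) (Phi_mem hr'.le 0 2))
    refine this.congr (Filter.Eventually.of_forall fun ξ => ?_)
    have := h1 0 0 ξ
    simp only [sub_self, smul_zero, inner_zero_left, Complex.ofReal_zero, mul_zero, Complex.exp_zero, mul_one] at this
    show _ = φ ‖ξ‖
    rw [← this, RCLike.inner_apply, mul_comm]; rfl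
  rw [← planch (Phi_int hr.le x) (Phi_mem hr.le x 2) (Phi_int hr'.le x') (Phi_mem hr'.le x' 2)]
  simp_rw [h1]
  rw [radial_integral φ hintg]

lemma Phi_F3 (hd : 3 ≤ d) : ∃ C : ℝ, 0 < C ∧ ∀ (r r' : ℝ), 0 < r → 0 < r' → ∀ x x' : Ed d,
    ‖∫ y, inner ℂ (Phi d r x y) (Phi d r' x' y)‖ ≤ C * (1 + dist (x, r) (x', r')) ^ (-kap d) := by
  obtain ⟨C, hC, hJ⟩ := Jf_decay (d := d) hd
  obtain ⟨B, hB, hψ⟩ := psi_hat_bounds d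
  set A := (sig d).real univ with hA
  have hA0 : 0 ≤ A := by positivity
  have hk : 0 ≤ kap d := kap_nonneg
  set I : ℝ := ∫ ρ in Ioi (0:ℝ), (1 + ‖ρ‖) ^ (-2 : ℝ) with hI
  have hintg : Integrable (fun ρ : ℝ => (1 + ‖ρ‖) ^ (-2 : ℝ)) := integrable_one_add_norm (by simp)
  have hI0 : 0 ≤ I := setIntegral_nonneg measurableSet_Ioi fun ρ _ => by positivity
  set K := C ^ 2 * B * (A + C) * I + 1 with hK
  have hKp : 0 < K := by positivity
  refine ⟨K * 3 ^ kap d, by positivity, fun r r' hr hr' x x' => ?_⟩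
  obtain ⟨e, he⟩ : ∃ e : Ed d, ‖e‖ = 1 := ⟨EuclideanSpace.single 0 1, by simp⟩
  set D := ‖x - x'‖ with hD
  have hD0 : 0 ≤ D := norm_nonneg _
  -- main bound by factor M
  have main : ∀ M : ℝ, 0 ≤ M → (∀ ρ : ℝ, 0 < ρ → |Jf d (ρ * ‖(2 * Real.pi) • (x - x')‖)| ≤ (A + C) * M * 1 ∨ 
      |Jf d (ρ * ‖(2 * Real.pi) • (x - x')‖)| ≤ (A + C) * M * ρ ^ (-kap d)) → 
      ‖∫ y, inner ℂ (Phi d r x y) (Phi d r' x' y)‖ ≤ K * M := by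
    intro M hM hJM
    rw [Phi_inner_eq hr hr' x x' e he]
    have hb : ∀ r : ℝ, 0 < r → ∀ ρ : ℝ, 0 < ρ → |r ^ kap d * Jf d (2 * Real.pi * r * |ρ|)| ≤ C * ρ ^ (-kap d) := by
      intro r hr ρ hρ
      rw [abs_of_pos hρ, abs_mul, abs_of_nonneg (by positivity)]
      have e0 : 2 * Real.pi * r * ρ = r * (2 * Real.pi * ρ) := by ring
      calc r ^ kap d * |Jf d (2 * Real.pi * r * ρ)| ≤ r ^ kap d * (C * (2 * Real.pi * r * ρ) ^ (-kap d)) := by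
            gcongr; exact hJ _ (by positivity)
        _ = (r ^ kap d * r ^ (-kap d)) * (C * (2 * Real.pi * ρ) ^ (-kap d)) := by
            rw [e0, Real.mul_rpow hr.le (by positivity)]; ring
        _ = C * (2 * Real.pi * ρ) ^ (-kap d) := by rw [← Real.rpow_add hr]; simp
        _ ≤ _ := by
          refine mul_le_mul_of_nonneg_left ?_ hC.le
          refine Real.rpow_le_rpow_of_nonpos hρ ?_ (by linarith)
          nlinarith [Real.pi_gt_three]
    have hbd : ∀ ρ ∈ Ioi (0:ℝ), ‖ρ ^ (d - 1) • 
      ((((r ^ kap d * Jf d (2 * Real.pi * r * |ρ|)) * (r' ^ kap d * Jf d (2 * Real.pi * r' * |ρ|)) * ‖𝓕 (psi d) (ρ • e)‖ ^ 2 : ℝ) : ℂ)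
       * (Jf d (ρ * ‖(2 * Real.pi) • (x - x')‖) : ℂ))‖ ≤ C ^ 2 * B * (A + C) * M * (1 + ‖ρ‖) ^ (-2 : ℝ) := by
      intro ρ hρ
      rw [mem_Ioi] at hρ
      have hn : ‖ρ • e‖ = ρ := by rw [norm_smul, he, mul_one, Real.norm_of_nonneg hρ.le]
      obtain ⟨p1, p2⟩ := hψ (ρ • e) (by rw [hn]; exact hρ)
      rw [hn] at p1 p2
      rw [norm_smul, norm_mul, Complex.norm_real, Complex.norm_real, norm_mul, norm_mul, Real.norm_eq_abs, Real.norm_eq_abs, Real.norm_eq_abs, Real.norm_eq_abs, Real.norm_eq_abs, abs_of_nonneg (by positivity : 0 ≤ ρ ^ (d-1)),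
        abs_of_nonneg (by positivity : 0 ≤ ‖𝓕 (psi d) (ρ • e)‖ ^ 2), Real.norm_of_nonneg hρ.le]
      have q1 := hb r hr ρ hρ
      have q2 := hb r' hr' ρ hρ
      have hpow : ρ ^ (d - 1) * (ρ ^ (-kap d) * ρ ^ (-kap d)) = 1 := by
        rw [← Real.rpow_natCast, ← Real.rpow_add hρ, ← Real.rpow_add hρ, Nat.cast_sub NeZero.one_le]
        unfold kap; push_cast; ring_nf; simp
      have q3 : ‖𝓕 (psi d) (ρ • e)‖ ^ 2 * |Jf d (ρ * ‖(2 * Real.pi) • (x - x')‖)| ≤ B * (A + C) * M * (1 + ρ) ^ (-2 : ℝ) := by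
        rcases hJM ρ hρ with h | h
        · calc _ ≤ B * (1 + ρ) ^ (-2 : ℝ) * ((A + C) * M * 1) := by gcongr
            _ = _ := by ring
        · calc _ ≤ ‖𝓕 (psi d) (ρ • e)‖ ^ 2 * ((A + C) * M * ρ ^ (-kap d)) := by gcongr
            _ = (‖𝓕 (psi d) (ρ • e)‖ ^ 2 * ρ ^ (-kap d)) * ((A + C) * M) := by ring
            _ ≤ (B * (1 + ρ) ^ (-2 : ℝ)) * ((A + C) * M) := by gcongr
            _ = _ := by ring
      calc _ = ρ ^ (d - 1) * (|r ^ kap d * Jf d (2 * Real.pi * r * |ρ|)| * |r' ^ kap d * Jf d (2 * Real.pi * r' * |ρ|)|) * (‖𝓕 (psi d) (ρ • e)‖ ^ 2 * |Jf d (ρ * ‖(2 * Real.pi) • (x - x')‖)|) := by ring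
        _ ≤ ρ ^ (d - 1) * ((C * ρ ^ (-kap d)) * (C * ρ ^ (-kap d))) * (B * (A + C) * M * (1 + ρ) ^ (-2 : ℝ)) := by gcongr
        _ = (ρ ^ (d - 1) * (ρ ^ (-kap d) * ρ ^ (-kap d))) * C ^ 2 * (B * (A + C) * M * (1 + ρ) ^ (-2 : ℝ)) := by ring
        _ = _ := by rw [hpow]; ring
    have := norm_integral_le_of_norm_le (μ := volume.restrict (Ioi (0:ℝ))) ((hintg.integrableOn (s := Ioi 0)).const_mul (C ^ 2 * B * (A + C) * M)) ((ae_restrict_iff' measurableSet_Ioi).2 (Filter.Eventually.of_forall hbd))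
    refine this.trans ?_
    rw [integral_const_mul, ← hI, hK]
    nlinarith
  -- disjointness
  by_cases hdis : D + 1 < |r - r'|
  · have hz : ∀ y, inner ℂ (Phi d r x y) (Phi d r' x' y) = 0 := by
      intro y
      by_contra hne
      have n1 : ¬ 1 / 100 < |‖x - y‖ - r| := fun h => hne (by rw [Phi_supp hr.le h, inner_zero_left])
      have n2 : ¬ 1 / 100 < |‖x' - y‖ - r'| := fun h => hne (by rw [Phi_supp hr'.le h, inner_zero_right])
      push Not at n1 n2
      have n3 := abs_norm_sub_norm_le (x - y) (x' - y)
      rw [sub_sub_sub_cancel_right, ← hD] at n3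
      rw [abs_le] at n1 n2 n3
      rcases lt_abs.1 hdis with h | h <;> linarith
    simp_rw [hz]; simp; positivity
  push Not at hdis
  have hdist : dist (x, r) (x', r') ≤ D + 1 := by
    rw [Prod.dist_eq, dist_eq_norm, Real.dist_eq]; exact max_le (by simp [← hD]) hdis
  have hdp : 0 ≤ dist (x, r) (x', r') := dist_nonneg
  rcases le_total D 1 with h | h
  · have := main 1 zero_le_one (fun ρ hρ => Or.inl ((Jf_bdd _).trans (by rw [← hA]; linarith)))
    refine this.trans ?_
    rw [mul_assoc]
    gcongr
    rw [Real.rpow_neg (by positivity), ← div_eq_mul_inv, ← Real.div_rpow (by positivity) (by positivity)]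
    refine Real.one_le_rpow ?_ hk
    rw [le_div_iff₀ (by positivity)]; linarith
  · have := main (D ^ (-kap d)) (by positivity) (fun ρ hρ => Or.inr ?_)
    · refine this.trans ?_
      rw [mul_assoc]
      gcongr
      have : (3:ℝ) ^ kap d = (1/3) ^ (-kap d) := by
        rw [Real.rpow_neg (by norm_num), ← Real.inv_rpow (by norm_num)]; norm_num
      rw [this, ← Real.mul_rpow (by norm_num) (by positivity)]
      refine Real.rpow_le_rpow_of_nonpos (by positivity) ?_ (by linarith)
      linarith
    · have hDp : 0 < D := by linarith
      rw [norm_smul, Real.norm_of_nonneg (by positivity), ← hD]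
      refine (hJ _ (by positivity)).trans ?_
      calc C * (ρ * (2 * Real.pi * D)) ^ (-kap d) ≤ C * (D * ρ) ^ (-kap d) := by
            refine mul_le_mul_of_nonneg_left ?_ hC.le
            refine Real.rpow_le_rpow_of_nonpos (by positivity) ?_ (by linarith)
            nlinarith [Real.pi_gt_three, mul_pos hDp hρ]
        _ = C * D ^ (-kap d) * ρ ^ (-kap d) := by rw [Real.mul_rpow hDp.le hρ.le]; ring
        _ ≤ _ := by gcongr; linarith
end F3

end Part10

section Part11
set_option linter.all false

section dens

lemma sep_count (T : Finset ℝ) (hT : ∀ r ∈ T, ∀ r' ∈ T, r ≠ r' → 1 ≤ |r - r'|) (r l : ℝ) (hl : 0 ≤ l) :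
    (((T.filter (fun r' => |r - r'| < l)).card : ℕ) : ℝ) ≤ 2 * l + 1 := by
  have h : (T.filter (fun r' => |r - r'| < l)).card ≤ (Finset.Icc (0:ℤ) ⌊2 * l⌋).card := by
    refine Finset.card_le_card_of_injOn (fun r' => ⌊r' - r + l⌋) ?_ ?_
    · intro r' hr'
      have h1 := (Finset.mem_filter.1 hr').2
      rw [abs_lt] at h1
      simp only [Finset.coe_Icc, mem_Icc]
      constructor
      · rw [Int.floor_nonneg]; linarith
      · apply Int.floor_le_floor; linarith
    · intro a ha b hb hab
      by_contra hne
      have h1 := hT a (Finset.mem_filter.1 ha).1 b (Finset.mem_filter.1 hb).1 hne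
      have h2 := Int.abs_sub_lt_one_of_floor_eq_floor hab
      simp at h2; linarith
  rw [Int.card_Icc] at h
  have h0 : 0 ≤ ⌊2 * l⌋ := Int.floor_nonneg.2 (by linarith)
  have h2 : ((⌊2 * l⌋ + 1 - 0).toNat : ℝ) = (⌊2 * l⌋ : ℝ) + 1 := by
    have : (((⌊2 * l⌋ + 1 - 0).toNat : ℤ)) = ⌊2 * l⌋ + 1 := by rw [Int.toNat_of_nonneg (by linarith)]; ring
    exact_mod_cast this
  calc _ ≤ ((⌊2 * l⌋ + 1 - 0).toNat : ℝ) := by exact_mod_cast h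
    _ = (⌊2 * l⌋ : ℝ) + 1 := h2
    _ ≤ _ := by linarith [Int.floor_le (2 * l)]

lemma shell_sum {P : Type*} [PseudoMetricSpace P] (E : Finset P) (z : P) {k R l u : ℝ} (hk : 3 / 2 ≤ k) (hl : 1 ≤ l) (hu0 : 0 ≤ u) (hu : u ≤ l ^ k)
    (hdens : ∀ ρ, 1 ≤ ρ → ρ ≤ 8 * R → ((E.filter (fun z' => dist z z' ≤ ρ)).card : ℝ) ≤ u * ρ) :
    ∑ z' ∈ E.filter (fun z' => l ≤ dist z z' ∧ dist z z' ≤ 3 * R), (1 + dist z z') ^ (-k) ≤ 2 * (1 - 2 ^ (1 - k))⁻¹ * l := by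
  classical
  have hl0 : 0 < l := by linarith
  set g : ℝ := 2 ^ (1 - k) with hg
  have hg0 : 0 < g := by positivity
  have hg1 : g < 1 := Real.rpow_lt_one_of_one_lt_of_neg (by norm_num) (by linarith)
  obtain ⟨N, hN⟩ := pow_unbounded_of_one_lt (3 * R) (by norm_num : (1:ℝ) < 2)
  set J := (Finset.range N).filter (fun j => 2 ^ j * l ≤ 3 * R) with hJ
  have h1 : ∀ z' ∈ E.filter (fun z' => l ≤ dist z z' ∧ dist z z' ≤ 3 * R), (1 + dist z z') ^ (-k) ≤ 
      ∑ j ∈ J, if dist z z' ≤ 2 ^ (j + 1) * l then (2 ^ j * l) ^ (-k) else 0 := by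
    intro z' hz'
    obtain ⟨_, h2, h3⟩ := Finset.mem_filter.1 hz'
    obtain ⟨j, hj1, hj2⟩ := exists_nat_pow_near (x := dist z z' / l) (y := 2) (by rwa [le_div_iff₀ hl0, one_mul]) (by norm_num)
    rw [le_div_iff₀ hl0] at hj1
    rw [div_lt_iff₀ hl0] at hj2
    have hjJ : j ∈ J := by
      rw [hJ, Finset.mem_filter, Finset.mem_range]
      refine ⟨?_, hj1.trans h3⟩
      by_contra hh
      push Not at hh
      have : (2:ℝ) ^ N ≤ 2 ^ j := pow_le_pow_right₀ (by norm_num) hh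
      nlinarith [pow_pos (by norm_num : (0:ℝ) < 2) j]
    refine le_trans ?_ (Finset.single_le_sum (f := fun j => if dist z z' ≤ 2 ^ (j + 1) * l then (2 ^ j * l) ^ (-k) else 0) (fun i _ => by split_ifs <;> positivity) hjJ)
    simp only [if_pos hj2.le]
    exact Real.rpow_le_rpow_of_nonpos (by positivity) (by linarith) (by linarith)
  refine (Finset.sum_le_sum h1).trans ?_
  rw [Finset.sum_comm]
  have h4 : ∀ j ∈ J, ∑ z' ∈ E.filter (fun z' => l ≤ dist z z' ∧ dist z z' ≤ 3 * R), (if dist z z' ≤ 2 ^ (j + 1) * l then (2 ^ j * l) ^ (-k) else (0:ℝ)) ≤ 2 * l * g ^ j := by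
    intro j hj
    obtain ⟨_, hj2⟩ := Finset.mem_filter.1 hj
    rw [← Finset.sum_filter, Finset.sum_const, nsmul_eq_mul]
    have hc : (((E.filter (fun z' => l ≤ dist z z' ∧ dist z z' ≤ 3 * R)).filter (fun z' => dist z z' ≤ 2 ^ (j + 1) * l)).card : ℝ) ≤ u * (2 ^ (j + 1) * l) := by
      refine le_trans ?_ (hdens (2 ^ (j + 1) * l) ?_ ?_)
      · exact_mod_cast Finset.card_le_card (Finset.filter_subset_filter _ (Finset.filter_subset _ _))
      · have : (1:ℝ) ≤ 2 ^ (j + 1) := one_le_pow₀ (by norm_num)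
        nlinarith
      · rw [pow_succ]; nlinarith [pow_pos (by norm_num : (0:ℝ) < 2) j]
    calc _ ≤ u * (2 ^ (j + 1) * l) * (2 ^ j * l) ^ (-k) := by gcongr
      _ ≤ l ^ k * (2 ^ (j + 1) * l) * (2 ^ j * l) ^ (-k) := by gcongr
      _ = (l ^ k * l ^ (-k)) * (2 * l) * (2 ^ j * ((2:ℝ) ^ j) ^ (-k)) := by
        rw [Real.mul_rpow (by positivity) hl0.le, pow_succ]; ring
      _ = 2 * l * g ^ j := by
        rw [← Real.rpow_add hl0, add_neg_cancel, Real.rpow_zero, one_mul, hg]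
        congr 1
        rw [← Real.rpow_natCast (2 ^ (1 - k)), ← Real.rpow_mul (by norm_num), ← Real.rpow_natCast 2 j, ← Real.rpow_mul (by norm_num), ← Real.rpow_add (by norm_num)]
        congr 1; ring
  refine (Finset.sum_le_sum h4).trans ?_
  rw [← Finset.mul_sum]
  have h5 : ∑ j ∈ J, g ^ j ≤ (1 - g)⁻¹ := by
    rw [← tsum_geometric_of_lt_one hg0.le hg1]
    exact (summable_geometric_of_lt_one hg0.le hg1).sum_le_tsum _ (fun _ _ => by positivity)
  calc 2 * l * ∑ j ∈ J, g ^ j ≤ 2 * l * (1 - g)⁻¹ := by gcongr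
    _ = _ := by ring

lemma density_abs {H : Type*} [NormedAddCommGroup H] [InnerProductSpace ℂ H] {P : Type*} [PseudoMetricSpace P] 
    (E : Finset P) (rad : P → ℝ) (v : P → H) {k A B R l u : ℝ} (hk : 3 / 2 ≤ k) (hA : 0 ≤ A) (hB : 0 ≤ B) (hl : 1 ≤ l) (hu0 : 0 ≤ u) (hu : u ≤ l ^ k)
    (h1 : ∀ r, ‖∑ z ∈ E.filter (fun z => rad z = r), v z‖ ^ 2 ≤ A * (E.filter (fun z => rad z = r)).card)
    (h2 : ∀ z ∈ E, ∀ z' ∈ E, ‖inner ℂ (v z) (v z')‖ ≤ B * (1 + dist z z') ^ (-k))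
    (h3 : ∀ z ∈ E, ∀ z' ∈ E, 3 * R < dist z z' → inner ℂ (v z) (v z') = 0)
    (hsep : ∀ z ∈ E, ∀ z' ∈ E, rad z ≠ rad z' → 1 ≤ |rad z - rad z'|)
    (hlip : ∀ z z', |rad z - rad z'| ≤ dist z z')
    (hdens : ∀ z ∈ E, ∀ ρ, 1 ≤ ρ → ρ ≤ 8 * R → ((E.filter (fun z' => dist z z' ≤ ρ)).card : ℝ) ≤ u * ρ) :
    ‖∑ z ∈ E, v z‖ ^ 2 ≤ (3 * A + 2 * (1 - 2 ^ (1 - k))⁻¹ * B) * l * E.card := by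
  classical
  set T := E.image rad with hT
  have hmaps : ∀ z ∈ E, rad z ∈ T := fun z hz => Finset.mem_image_of_mem _ hz
  have hTsep : ∀ r ∈ T, ∀ r' ∈ T, r ≠ r' → 1 ≤ |r - r'| := by
    intro r hr r' hr' hne
    obtain ⟨z, hz, rfl⟩ := Finset.mem_image.1 hr
    obtain ⟨z', hz', rfl⟩ := Finset.mem_image.1 hr'
    exact hsep z hz z' hz' hne
  set G : ℝ → H := fun r => ∑ z ∈ E.filter (fun z => rad z = r), v z with hG
  have hl0 : 0 < l := by linarith
  have e1 : ((‖∑ z ∈ E, v z‖ ^ 2 : ℝ) : ℂ) = ∑ z ∈ E, ∑ z' ∈ E, inner ℂ (v z) (v z') := by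
    rw [← Finset.sum_congr rfl (fun z _ => inner_sum (𝕜 := ℂ) E v (v z)), ← sum_inner, inner_self_eq_norm_sq_to_K]
    simp
  have e2 : ∑ z ∈ E, ∑ z' ∈ E, inner ℂ (v z) (v z') = 
      (∑ z ∈ E, ∑ z' ∈ E, if |rad z - rad z'| < l then inner ℂ (v z) (v z') else 0) + 
      (∑ z ∈ E, ∑ z' ∈ E, if |rad z - rad z'| < l then 0 else inner ℂ (v z) (v z')) := by
    rw [← Finset.sum_add_distrib]
    refine Finset.sum_congr rfl fun z _ => ?_
    rw [← Finset.sum_add_distrib]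
    refine Finset.sum_congr rfl fun z' _ => ?_
    split_ifs <;> simp
  have e3 : (∑ z ∈ E, ∑ z' ∈ E, if |rad z - rad z'| < l then inner ℂ (v z) (v z') else 0) = 
      ∑ r ∈ T, ∑ r' ∈ T, if |r - r'| < l then inner ℂ (G r) (G r') else 0 := by
    rw [← Finset.sum_fiberwise_of_maps_to hmaps]
    refine Finset.sum_congr rfl fun r _ => ?_
    have : ∀ z ∈ E.filter (fun z => rad z = r), (∑ z' ∈ E, if |rad z - rad z'| < l then inner ℂ (v z) (v z') else 0)
        = ∑ r' ∈ T, if |r - r'| < l then inner ℂ (v z) (G r') else 0 := by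
      intro z hz
      rw [← Finset.sum_fiberwise_of_maps_to hmaps]
      refine Finset.sum_congr rfl fun r' _ => ?_
      have hzr := (Finset.mem_filter.1 hz).2
      rw [Finset.sum_congr rfl (g := fun z' => if |r - r'| < l then inner ℂ (v z) (v z') else 0)]
      · split_ifs
        · rw [hG, inner_sum]
        · simp
      · intro z' hz'
        rw [hzr, (Finset.mem_filter.1 hz').2]
    rw [Finset.sum_congr rfl this, Finset.sum_comm]
    refine Finset.sum_congr rfl fun r' _ => ?_
    split_ifs
    · rw [hG, ← sum_inner]
    · simp
  have hcardsum : (∑ r ∈ T, ((E.filter (fun z => rad z = r)).card : ℝ)) = E.card := by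
    rw [Finset.card_eq_sum_card_fiberwise hmaps]; push_cast; rfl
  have b1 : ‖∑ r ∈ T, ∑ r' ∈ T, if |r - r'| < l then inner ℂ (G r) (G r') else 0‖ ≤ (2 * l + 1) * (A * E.card) := by
    have c1 : ∑ r ∈ T, ∑ r' ∈ T, (if |r - r'| < l then ‖G r‖ ^ 2 else 0) ≤ (2 * l + 1) * (A * E.card) := by
      calc _ ≤ ∑ r ∈ T, (2 * l + 1) * ‖G r‖ ^ 2 := by
            refine Finset.sum_le_sum fun r hr => ?_
            rw [← Finset.sum_filter, Finset.sum_const, nsmul_eq_mul]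
            gcongr
            exact sep_count T hTsep r l hl0.le
        _ = (2 * l + 1) * ∑ r ∈ T, ‖G r‖ ^ 2 := by rw [Finset.mul_sum]
        _ ≤ (2 * l + 1) * ∑ r ∈ T, A * (E.filter (fun z => rad z = r)).card := by
            gcongr with r hr; exact h1 r
        _ = _ := by rw [← Finset.mul_sum, hcardsum]
    have c2 : ∑ r ∈ T, ∑ r' ∈ T, (if |r - r'| < l then ‖G r'‖ ^ 2 else 0) ≤ (2 * l + 1) * (A * E.card) := by
      rw [Finset.sum_comm]
      simp_rw [abs_sub_comm _ _] at c1 ⊢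
      refine le_trans (le_of_eq ?_) c1
      refine Finset.sum_congr rfl fun r _ => Finset.sum_congr rfl fun r' _ => ?_
      rw [abs_sub_comm]
    calc _ ≤ ∑ r ∈ T, ∑ r' ∈ T, (1 / 2 * (if |r - r'| < l then ‖G r‖ ^ 2 else 0) + 1 / 2 * (if |r - r'| < l then ‖G r'‖ ^ 2 else 0)) := by
          refine (norm_sum_le _ _).trans (Finset.sum_le_sum fun r _ => (norm_sum_le _ _).trans (Finset.sum_le_sum fun r' _ => ?_))
          split_ifs
          · refine (norm_inner_le_norm _ _).trans ?_
            nlinarith [sq_nonneg (‖G r‖ - ‖G r'‖)]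
          · simp
      _ = 1 / 2 * (∑ r ∈ T, ∑ r' ∈ T, (if |r - r'| < l then ‖G r‖ ^ 2 else 0)) + 1 / 2 * (∑ r ∈ T, ∑ r' ∈ T, (if |r - r'| < l then ‖G r'‖ ^ 2 else 0)) := by
          simp_rw [Finset.sum_add_distrib, Finset.mul_sum]
      _ ≤ _ := by linarith
  have b2 : ‖∑ z ∈ E, ∑ z' ∈ E, if |rad z - rad z'| < l then 0 else inner ℂ (v z) (v z')‖ ≤ E.card * (B * (2 * (1 - 2 ^ (1 - k))⁻¹ * l)) := by
    refine (norm_sum_le_of_le (n := fun _ => B * (2 * (1 - 2 ^ (1 - k))⁻¹ * l)) _ fun z hz => ?_).trans (by rw [Finset.sum_const, nsmul_eq_mul])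
    calc _ ≤ ∑ z' ∈ E, if l ≤ dist z z' ∧ dist z z' ≤ 3 * R then B * (1 + dist z z') ^ (-k) else 0 := by
          refine norm_sum_le_of_le _ fun z' hz' => ?_
          split_ifs with g1 g2 g2
          · simp; positivity
          · simp
          · exact h2 z hz z' hz'
          · have : l ≤ dist z z' := (not_lt.1 g1).trans (hlip z z')
            rw [h3 z hz z' hz' (by by_contra hh; exact g2 ⟨this, not_lt.1 hh⟩)]; simp
      _ = B * ∑ z' ∈ E.filter (fun z' => l ≤ dist z z' ∧ dist z z' ≤ 3 * R), (1 + dist z z') ^ (-k) := by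
          rw [← Finset.sum_filter, Finset.mul_sum]
      _ ≤ _ := by gcongr; exact shell_sum E z hk hl hu0 hu (hdens z hz)
  have : ‖∑ z ∈ E, v z‖ ^ 2 = ‖((‖∑ z ∈ E, v z‖ ^ 2 : ℝ) : ℂ)‖ := by
    rw [Complex.norm_real, Real.norm_of_nonneg (sq_nonneg _)]
  rw [this, e1, e2]
  refine (norm_add_le _ _).trans ?_
  rw [e3]
  have hc : 0 ≤ A * (E.card : ℝ) := mul_nonneg hA (Nat.cast_nonneg _)
  nlinarith [b1, b2]

end dens

end Part11

section Part12
set_option linter.all false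

section densPhi
variable {d : ℕ} [NeZero d]

def PhiL (d : ℕ) [NeZero d] (z : Ed d × ℝ) : Lp ℂ 2 (volume : Measure (Ed d)) :=
  if h : 0 ≤ z.2 then (Phi_mem h z.1 2).toLp _ else 0

lemma PhiL_coe {z : Ed d × ℝ} (h : 0 ≤ z.2) : PhiL d z =ᵐ[volume] Phi d z.2 z.1 := by
  rw [PhiL, dif_pos h]; exact MemLp.coeFn_toLp _

lemma PhiL_sum_coe (E : Finset (Ed d × ℝ)) (hE : ∀ z ∈ E, 0 ≤ z.2) (c : Ed d × ℝ → ℂ) :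
    ((∑ z ∈ E, c z • PhiL d z : Lp ℂ 2 (volume : Measure (Ed d))) : Ed d → ℂ) =ᵐ[volume] fun y => ∑ z ∈ E, c z * Phi d z.2 z.1 y := by
  classical
  induction E using Finset.induction_on with
  | empty => simp only [Finset.sum_empty]; exact Lp.coeFn_zero _ _ _
  | insert a s ha ih =>
    rw [Finset.sum_insert ha]
    filter_upwards [Lp.coeFn_add (c a • PhiL d a) (∑ z ∈ s, c z • PhiL d z), Lp.coeFn_smul (c a) (PhiL d a),
      PhiL_coe (hE a (Finset.mem_insert_self _ _)), ih (fun z hz => hE z (Finset.mem_insert_of_mem hz))] with y h1 h2 h3 h4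
    rw [h1, Pi.add_apply, h2, Pi.smul_apply, h3, h4, Finset.sum_insert ha, smul_eq_mul]

lemma PhiL_sum_norm (E : Finset (Ed d × ℝ)) (hE : ∀ z ∈ E, 0 ≤ z.2) (c : Ed d × ℝ → ℂ) :
    eLpNorm (fun y => ∑ z ∈ E, c z * Phi d z.2 z.1 y) 2 volume = ENNReal.ofReal ‖∑ z ∈ E, c z • PhiL d z‖ := by
  rw [← eLpNorm_congr_ae (PhiL_sum_coe E hE c), Lp.norm_def, ENNReal.ofReal_toReal (Lp.eLpNorm_ne_top _)]

lemma PhiL_inner {z z' : Ed d × ℝ} (h : 0 ≤ z.2) (h' : 0 ≤ z'.2) :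
    inner ℂ (PhiL d z) (PhiL d z') = ∫ y, inner ℂ (Phi d z.2 z.1 y) (Phi d z'.2 z'.1 y) := by
  rw [L2.inner_def]
  refine integral_congr_ae ?_
  filter_upwards [PhiL_coe h, PhiL_coe h'] with y h1 h2
  rw [h1, h2]

structure Adm (E : Finset (Ed d × ℝ)) (R : ℝ) : Prop where
  pos : ∀ z ∈ E, 0 < z.2
  le : ∀ z ∈ E, z.2 ≤ R
  sep : ∀ z ∈ E, ∀ z' ∈ E, z.2 ≠ z'.2 → 1 ≤ |z.2 - z'.2|
  inj : Set.InjOn (fun z : Ed d × ℝ => (cell z.1, z.2)) E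

lemma Adm.mono {E E' : Finset (Ed d × ℝ)} {R : ℝ} (h : Adm E R) (hE : E' ⊆ E) : Adm E' R :=
  ⟨fun z hz => h.pos z (hE hz), fun z hz => h.le z (hE hz), fun z hz z' hz' => h.sep z (hE hz) z' (hE hz'),
    h.inj.mono (by exact_mod_cast hE)⟩

lemma Phi_layer (hd : 3 ≤ d) : ∃ C : ℝ, 0 < C ∧ ∀ (E : Finset (Ed d × ℝ)) (R : ℝ), Adm E R → ∀ c : Ed d × ℝ → ℂ, (∀ z, ‖c z‖ ≤ 1) →
    ∀ r, ‖∑ z ∈ E.filter (fun z => z.2 = r), c z • PhiL d z‖ ^ 2 ≤ C * (E.filter (fun z => z.2 = r)).card := by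
  obtain ⟨C, hC, h⟩ := Phi_F2 (d := d) hd
  refine ⟨C, hC, fun E R hE c hc r => ?_⟩
  rcases (E.filter (fun z => z.2 = r)).eq_empty_or_nonempty with h0 | ⟨z0, hz0⟩
  · rw [h0]; simp
  have hr : 0 < r := by
    obtain ⟨h1, h2⟩ := Finset.mem_filter.1 hz0
    rw [← h2]; exact hE.pos _ h1
  set F := E.filter (fun z => z.2 = r) with hF
  have h1 := h r hr F (fun z => z.1) (by
    intro a ha b hb hab
    obtain ⟨a1, a2⟩ := Finset.mem_filter.1 ha
    obtain ⟨b1, b2⟩ := Finset.mem_filter.1 hb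
    exact hE.inj a1 b1 (Prod.ext hab (by simp [a2, b2]))) c
  have h2 : (fun y => ∑ z ∈ F, c z * Phi d r z.1 y) = fun y => ∑ z ∈ F, c z * Phi d z.2 z.1 y := by
    ext y; refine Finset.sum_congr rfl fun z hz => ?_
    rw [(Finset.mem_filter.1 hz).2]
  rw [h2, PhiL_sum_norm F (fun z hz => (hE.pos z (Finset.mem_filter.1 hz).1).le), ← ENNReal.ofReal_pow (norm_nonneg _)] at h1
  have h3 := (ENNReal.ofReal_le_ofReal_iff (by positivity)).1 h1
  refine h3.trans ?_
  gcongr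
  calc ∑ z ∈ F, ‖c z‖ ^ 2 ≤ ∑ z ∈ F, 1 := Finset.sum_le_sum fun z _ => pow_le_one₀ (norm_nonneg _) (hc z)
    _ = _ := by simp

lemma kap_ge (hd : 4 ≤ d) : 3 / 2 ≤ kap d := by
  have : (4:ℝ) ≤ d := by exact_mod_cast hd
  unfold kap; linarith

lemma density_Phi (hd : 4 ≤ d) : ∃ C : ℝ, 0 < C ∧ ∀ (E : Finset (Ed d × ℝ)) (R : ℝ), 1 ≤ R → Adm E R → ∀ c : Ed d × ℝ → ℂ, (∀ z, ‖c z‖ ≤ 1) →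
    ∀ u : ℝ, 1 ≤ u → 
    (∀ z ∈ E, ∀ ρ, 1 ≤ ρ → ρ ≤ 8 * R → ((E.filter (fun z' => dist z z' ≤ ρ)).card : ℝ) ≤ u * ρ) →
    eLpNorm (fun y => ∑ z ∈ E, c z * Phi d z.2 z.1 y) 2 volume ≤ ENNReal.ofReal (C * (u ^ (2 * kap d)⁻¹ * (E.card : ℝ) ^ (1 / 2 : ℝ))) := by
  obtain ⟨A, hA, h1⟩ := Phi_layer (d := d) (by omega)
  obtain ⟨B, hB, h2⟩ := Phi_F3 (d := d) (by omega)
  have hk := kap_ge hd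
  set K := (3 * A + 2 * (1 - 2 ^ (1 - kap d))⁻¹ * B) with hK
  have hg1 : (2:ℝ) ^ (1 - kap d) < 1 := Real.rpow_lt_one_of_one_lt_of_neg (by norm_num) (by linarith)
  have hKp : 0 < K := by
    have : 0 < (1 - (2:ℝ) ^ (1 - kap d))⁻¹ := inv_pos.2 (by linarith)
    positivity
  refine ⟨K ^ (1/2 : ℝ), by positivity, fun E R hR hE c hc u hu hdens => ?_⟩
  have hin : ∀ z ∈ E, ∀ z' ∈ E, ‖inner ℂ (c z • PhiL d z) (c z' • PhiL d z')‖ ≤ ‖∫ y, inner ℂ (Phi d z.2 z.1 y) (Phi d z'.2 z'.1 y)‖ := by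
    intro z hz z' hz'
    rw [inner_smul_left, inner_smul_right, PhiL_inner (hE.pos z hz).le (hE.pos z' hz').le, norm_mul, norm_mul, RCLike.norm_conj]
    have a1 := hc z; have a2 := hc z'
    have := norm_nonneg (∫ y, inner ℂ (Phi d z.2 z.1 y) (Phi d z'.2 z'.1 y))
    calc _ ≤ 1 * (1 * ‖∫ y, inner ℂ (Phi d z.2 z.1 y) (Phi d z'.2 z'.1 y)‖) := by gcongr
      _ = _ := by ring
  have key := density_abs (H := Lp ℂ 2 (volume : Measure (Ed d))) E (fun z => z.2) (fun z => c z • PhiL d z) (k := kap d) (A := A) (B := B) (R := R) (l := u ^ (kap d)⁻¹) (u := u)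
    hk hA.le hB.le (Real.one_le_rpow hu (by positivity)) (by linarith) (by rw [Real.rpow_inv_rpow (by linarith) (by linarith)])
    (h1 E R hE c hc) (fun z hz z' hz' => (hin z hz z' hz').trans (h2 _ _ (hE.pos z hz) (hE.pos z' hz') _ _))
    (fun z hz z' hz' hdist => by
      have hp := hE.pos z hz; have hp' := hE.pos z' hz'
      have hl := hE.le z hz; have hl' := hE.le z' hz'
      have : ∫ y, inner ℂ (Phi d z.2 z.1 y) (Phi d z'.2 z'.1 y) = 0 := by
        refine integral_eq_zero_of_ae (Filter.Eventually.of_forall fun y => ?_)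
        show inner ℂ (Phi d z.2 z.1 y) (Phi d z'.2 z'.1 y) = 0
        by_contra hne
        have n1 : ¬ 1 / 100 < |‖z.1 - y‖ - z.2| := fun h => hne (by rw [Phi_supp hp.le h, inner_zero_left])
        have n2 : ¬ 1 / 100 < |‖z'.1 - y‖ - z'.2| := fun h => hne (by rw [Phi_supp hp'.le h, inner_zero_right])
        push Not at n1 n2
        rw [abs_le] at n1 n2
        have n3 := norm_sub_le (z.1 - y) (z'.1 - y)
        rw [sub_sub_sub_cancel_right] at n3
        rw [Prod.dist_eq, lt_max_iff, dist_eq_norm, Real.dist_eq] at hdist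
        rcases hdist with h | h
        · linarith
        · rcases lt_abs.1 h with h | h <;> linarith
      have h0 := hin z hz z' hz'
      rw [this, norm_zero] at h0
      exact norm_le_zero_iff.1 h0)
    hE.sep (fun z z' => by rw [Prod.dist_eq, Real.dist_eq]; exact le_max_right _ _) hdens
  rw [PhiL_sum_norm E (fun z hz => (hE.pos z hz).le)]
  refine ENNReal.ofReal_le_ofReal ?_
  rw [← hK] at key
  have h5 := Real.rpow_le_rpow (by positivity) key (by norm_num : (0:ℝ) ≤ 1 / 2)
  rw [← Real.sqrt_eq_rpow, Real.sqrt_sq (norm_nonneg _)] at h5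
  refine h5.trans (le_of_eq ?_)
  rw [Real.mul_rpow (by positivity) (by positivity), Real.mul_rpow (by positivity) (by positivity), ← Real.rpow_mul (by positivity), mul_assoc]
  congr 3
  field_simp

lemma pow_diff_le {a b : ℝ} (hb : 0 ≤ b) (hab : b ≤ a) (n : ℕ) : a ^ (n + 1) - b ^ (n + 1) ≤ (n + 1) * a ^ n * (a - b) := by
  induction n with
  | zero => simp
  | succ n ih =>
    have h1 : b ^ (n+1) ≤ a ^ (n+1) := pow_le_pow_left₀ hb hab _
    have h2 : a * (a ^ (n + 1) - b ^ (n + 1)) ≤ a * ((n + 1) * a ^ n * (a - b)) := by gcongr; linarith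
    have h3 : b ^ (n+1) * (a - b) ≤ a ^ (n+1) * (a - b) := mul_le_mul_of_nonneg_right h1 (by linarith)
    push_cast
    calc a ^ (n + 1 + 1) - b ^ (n + 1 + 1) = a * (a ^ (n + 1) - b ^ (n + 1)) + b ^ (n+1) * (a - b) := by ring
      _ ≤ a * ((n + 1) * a ^ n * (a - b)) + a ^ (n+1) * (a - b) := by linarith
      _ = _ := by ring

lemma annulus_vol (d : ℕ) [NeZero d] : ∃ C : ℝ, 0 < C ∧ ∀ (x : Ed d) (r w : ℝ), 0 < r → 0 < w → 
    volume {y : Ed d | |‖x - y‖ - r| ≤ w} ≤ ENNReal.ofReal (C * (r + w) ^ (d - 1) * w) := by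
  obtain ⟨n, hn⟩ : ∃ n, d = n + 1 := ⟨d - 1, (Nat.succ_pred (NeZero.ne d)).symm⟩
  set v := (volume (ball (0 : Ed d) 1)) with hv
  have hvt : v ≠ ⊤ := measure_ball_lt_top.ne
  refine ⟨2 * d * v.toReal + 1, by positivity, fun x r w hr hw => ?_⟩
  have hfr : Module.finrank ℝ (Ed d) = d := by simp
  have hd1 : d - 1 = n := by omega
  have hball := Measure.addHaar_closedBall (volume : Measure (Ed d)) x (r := r + w) (by positivity)
  rw [hfr] at hball
  have hsub : {y : Ed d | |‖x - y‖ - r| ≤ w} ⊆ closedBall x (r + w) := by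
    intro y hy
    rw [mem_setOf_eq, abs_le] at hy
    rw [mem_closedBall, dist_comm, dist_eq_norm]; linarith
  have hfin : ∀ a : ℝ, 0 ≤ a → (a ≤ d * (r + w) ^ n * (2 * w)) → ENNReal.ofReal a * v ≤ ENNReal.ofReal ((2 * d * v.toReal + 1) * (r + w) ^ (d - 1) * w) := by
    intro a ha0 ha
    rw [hd1, ← ENNReal.ofReal_toReal hvt, ← ENNReal.ofReal_mul ha0]
    refine ENNReal.ofReal_le_ofReal ?_
    calc a * v.toReal ≤ (d * (r + w) ^ n * (2 * w)) * v.toReal := by gcongr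
      _ = (2 * d * v.toReal) * (r + w) ^ n * w := by ring
      _ ≤ _ := by rw [ENNReal.toReal_ofReal (by positivity)]; gcongr; linarith
  rcases le_or_gt r w with h | h
  · refine (measure_mono hsub).trans ?_
    rw [hball]
    refine hfin _ (by positivity) ?_
    have : (1:ℝ) ≤ d := by exact_mod_cast (NeZero.one_le : 1 ≤ d)
    have e : (r + w) ^ d = (r + w) ^ n * (r + w) := by rw [hn, pow_succ]
    rw [e]
    calc (r + w) ^ n * (r + w) ≤ 1 * (r + w) ^ n * (2 * w) := by rw [one_mul]; gcongr; linarith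
      _ ≤ _ := by gcongr
  · have hdisj : Disjoint {y : Ed d | |‖x - y‖ - r| ≤ w} (ball x (r - w)) := by
      rw [Set.disjoint_left]
      intro y hy hy2
      rw [mem_setOf_eq, abs_le] at hy
      rw [mem_ball, dist_comm, dist_eq_norm] at hy2; linarith
    have hball2 := Measure.addHaar_ball (volume : Measure (Ed d)) x (r := r - w) (by linarith)
    rw [hfr] at hball2
    have h1 : volume {y : Ed d | |‖x - y‖ - r| ≤ w} + volume (ball x (r - w)) ≤ volume (closedBall x (r + w)) := by
      rw [← measure_union hdisj measurableSet_ball]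
      refine measure_mono (union_subset hsub ?_)
      exact ball_subset_closedBall.trans (closedBall_subset_closedBall (by linarith))
    rw [hball, hball2] at h1
    have h2 : volume {y : Ed d | |‖x - y‖ - r| ≤ w} ≤ ENNReal.ofReal ((r + w) ^ d - (r - w) ^ d) * v := by
      rw [ENNReal.ofReal_sub _ (pow_nonneg (by linarith) _), ENNReal.sub_mul (fun _ _ => hvt)]
      exact ENNReal.le_sub_of_add_le_right (ENNReal.mul_ne_top (by simp) hvt) h1
    refine h2.trans (hfin _ ?_ ?_)
    · exact sub_nonneg.2 (pow_le_pow_left₀ (by linarith) (by linarith) _)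
    · have := pow_diff_le (a := r + w) (b := r - w) (by linarith) (by linarith) n
      rw [← hn] at this
      refine this.trans (le_of_eq ?_)
      rw [hn]; push_cast; ring
end densPhi

end Part12

section Part13
set_option linter.all false

section weak
variable {d : ℕ} [NeZero d]

def Vf (d : ℕ) (g : Ed d → ℂ) (r : ℝ) (x : Ed d) : ℂ := ∫ y, g y * Phi d r x y

lemma Vf_int {g : Ed d → ℂ} (hg : Integrable g) (r : ℝ) (x : Ed d) : Integrable (fun y => g y * Phi d r x y) := by
  obtain ⟨C, hC, h⟩ := Phi_bdd d
  exact hg.mul_bdd (c := C * |r ^ kap d|) (Phi_cont_y r x).aestronglyMeasurable (Filter.Eventually.of_forall fun y => h r x y)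

lemma dense_supp (d : ℕ) [NeZero d] : ∃ C : ℝ, 0 < C ∧ ∀ (E F : Finset (Ed d × ℝ)) (R : ℝ), 1 ≤ R → Adm E R → F ⊆ E → ∀ ν : ℕ,
    (∀ z ∈ F, ∃ ρ : ℝ, 1 ≤ ρ ∧ ρ ≤ 8 * R ∧ 2 ^ ν * ρ ≤ ((E.filter (fun z' => dist z z' ≤ ρ)).card : ℝ)) →
    ∃ S : Set (Ed d), MeasurableSet S ∧ volume S ≤ ENNReal.ofReal (C * (R ^ (d - 1) * (2 ^ ν)⁻¹ * E.card)) ∧ 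
      ∀ y ∉ S, ∀ z ∈ F, Phi d z.2 z.1 y = 0 := by
  classical
  obtain ⟨C, hC, hann⟩ := annulus_vol d
  refine ⟨C * 89 ^ (d - 1) * 11, by positivity, fun E F R hR hE hFE ν hF => ?_⟩
  choose! ρ h1 h8 hρ using hF
  obtain ⟨U, hUF, hdis, hcov⟩ := Vitali.exists_disjoint_subfamily_covering_enlargement_closedBall
    (F : Set (Ed d × ℝ)) id ρ (8 * R) (fun z hz => h8 z hz) 5 (by norm_num)
  set W := F.filter (fun z => z ∈ U) with hW
  have hWU : ∀ z, z ∈ W ↔ z ∈ U := fun z => by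
    rw [hW, Finset.mem_filter]; exact ⟨fun h => h.2, fun h => ⟨hUF h, h⟩⟩
  have hWF : ∀ z ∈ W, z ∈ F := fun z hz => (Finset.mem_filter.1 hz).1
  have hsum : ∑ z ∈ W, ρ z ≤ (2 ^ ν)⁻¹ * E.card := by
    rw [← div_eq_inv_mul, le_div_iff₀ (by positivity), Finset.sum_mul]
    calc ∑ z ∈ W, ρ z * 2 ^ ν ≤ ∑ z ∈ W, ((E.filter (fun z' => dist z z' ≤ ρ z)).card : ℝ) := by
          refine Finset.sum_le_sum fun z hz => ?_
          rw [mul_comm]; exact hρ z (hWF z hz)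
      _ = ((W.biUnion (fun z => E.filter (fun z' => dist z z' ≤ ρ z))).card : ℝ) := by
          rw [Finset.card_biUnion]; · push_cast; rfl
          intro a ha b hb hab
          show Disjoint _ _
          rw [Finset.disjoint_left]
          intro p hp hp2
          have := hdis ((hWU a).1 ha) ((hWU b).1 hb) hab
          refine Set.disjoint_left.1 (show Disjoint (closedBall (id a) (ρ a)) (closedBall (id b) (ρ b)) from this) (?_ : p ∈ _) ?_
          · rw [mem_closedBall, dist_comm]; exact (Finset.mem_filter.1 hp).2
          · rw [mem_closedBall, dist_comm]; exact (Finset.mem_filter.1 hp2).2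
      _ ≤ _ := by
          have : W.biUnion (fun z => E.filter (fun z' => dist z z' ≤ ρ z)) ⊆ E :=
            Finset.biUnion_subset.2 fun z _ => Finset.filter_subset _ _
          exact_mod_cast Finset.card_le_card this
  refine ⟨⋃ z ∈ W, {y : Ed d | |‖z.1 - y‖ - z.2| ≤ 11 * ρ z}, ?_, ?_, ?_⟩
  · refine Finset.measurableSet_biUnion _ fun z _ => ?_
    exact (isClosed_le (by fun_prop) (by fun_prop)).measurableSet
  · refine (measure_biUnion_finset_le _ _).trans ?_
    calc _ ≤ ∑ z ∈ W, ENNReal.ofReal (C * (89 * R) ^ (d - 1) * (11 * ρ z)) := by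
          refine Finset.sum_le_sum fun z hz => ?_
          have hz' := hWF z hz
          have a1 := hE.pos z (hFE hz'); have a2 := hE.le z (hFE hz')
          have a3 := h1 z hz'; have a4 := h8 z hz'
          refine (hann z.1 z.2 (11 * ρ z) a1 (by linarith)).trans (ENNReal.ofReal_le_ofReal ?_)
          gcongr
          linarith
      _ = ENNReal.ofReal (∑ z ∈ W, C * (89 * R) ^ (d - 1) * (11 * ρ z)) := by
          rw [ENNReal.ofReal_sum_of_nonneg]
          intro z hz
          have a3 := h1 z (hWF z hz)
          positivity
      _ ≤ _ := by
          refine ENNReal.ofReal_le_ofReal ?_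
          have : ∑ z ∈ W, C * (89 * R) ^ (d - 1) * (11 * ρ z) = (C * 89 ^ (d - 1) * 11) * (R ^ (d - 1) * ∑ z ∈ W, ρ z) := by
            rw [Finset.mul_sum, Finset.mul_sum]
            refine Finset.sum_congr rfl fun z _ => ?_
            rw [mul_pow]; ring
          rw [this, mul_assoc (R ^ (d-1))]
          gcongr
  · intro y hy z hz
    by_contra hne
    apply hy
    obtain ⟨b, hb, hsub⟩ := hcov z hz
    have hbF : b ∈ F := hUF hb
    have hzb : z ∈ closedBall (id b) (5 * ρ b) := hsub (mem_closedBall_self (by linarith [h1 z hz]))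
    rw [mem_closedBall, id, Prod.dist_eq, max_le_iff, dist_eq_norm, Real.dist_eq] at hzb
    have n1 : ¬ 1 / 100 < |‖z.1 - y‖ - z.2| := fun h => hne (Phi_supp (hE.pos z (hFE hz)).le h)
    push Not at n1
    simp only [mem_iUnion, exists_prop]
    refine ⟨b, (hWU b).2 hb, ?_⟩
    have n3 := abs_norm_sub_norm_le (z.1 - y) (b.1 - y)
    rw [sub_sub_sub_cancel_right] at n3
    have hb1 := h1 b hbF
    obtain ⟨c1, c2⟩ := hzb
    have n4 := n3.trans c1
    rw [abs_le] at n1 n4 c2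
    rw [mem_setOf_eq, abs_le]
    constructor <;> linarith

lemma holder_set {g s : Ed d → ℂ} (hg : AEStronglyMeasurable g) (hs : AEStronglyMeasurable s) {q : ℝ} (hq : 2 ≤ q) {S : Set (Ed d)} (hS : MeasurableSet S)
    (hsupp : ∀ y ∉ S, s y = 0) : 
    ∫⁻ y, ‖g y‖ₑ * ‖s y‖ₑ ≤ eLpNorm g (ENNReal.ofReal q) volume * volume S ^ (1 / 2 - 1 / q) * eLpNorm s 2 volume := by
  have e1 : ∫⁻ y, ‖g y‖ₑ * ‖s y‖ₑ = ∫⁻ y in S, ‖g y‖ₑ * ‖s y‖ₑ := by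
    rw [← lintegral_indicator hS]
    congr 1; ext y
    by_cases hy : y ∈ S
    · rw [indicator_of_mem hy]
    · rw [indicator_of_notMem hy, hsupp y hy]; simp
  have e2 : ∫⁻ y in S, ‖g y‖ₑ * ‖s y‖ₑ = eLpNorm (g • s) 1 (volume.restrict S) := by
    rw [eLpNorm_one_eq_lintegral_enorm]; simp [enorm_mul]
  rw [e1, e2]
  calc _ ≤ eLpNorm g 2 (volume.restrict S) * eLpNorm s 2 (volume.restrict S) :=
        eLpNorm_smul_le_mul_eLpNorm hs.restrict hg.restrict
    _ ≤ (eLpNorm g (ENNReal.ofReal q) (volume.restrict S) * (volume.restrict S) univ ^ (1 / (2 : ℝ≥0∞).toReal - 1 / (ENNReal.ofReal q).toReal)) * eLpNorm s 2 volume := by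
        gcongr
        · refine eLpNorm_le_eLpNorm_mul_rpow_measure_univ ?_ hg.restrict
          rw [← ENNReal.ofReal_ofNat]; exact ENNReal.ofReal_le_ofReal hq
        · exact Measure.restrict_le_self
    _ ≤ _ := by
        rw [ENNReal.toReal_ofReal (by linarith), Measure.restrict_apply_univ]
        simp only [ENNReal.toReal_ofNat]
        gcongr
        exact Measure.restrict_le_self

lemma weak_finite (hd : 4 ≤ d) {q : ℝ} (hq2 : 2 < q) (hq : 1 / q < 1 / 2 - (2 * kap d)⁻¹) : ∃ C : ℝ, 0 < C ∧ ∀ g : Ed d → ℂ, Integrable g → 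
    ∀ (E : Finset (Ed d × ℝ)) (R : ℝ), 1 ≤ R → Adm E R → ∀ lam : ℝ, 0 ≤ lam → (∀ z ∈ E, lam ≤ ‖Vf d g z.2 z.1‖) →
    ENNReal.ofReal (lam * (E.card : ℝ) ^ (1 / q)) ≤ ENNReal.ofReal (C * (R ^ (d - 1)) ^ (1 / 2 - 1 / q)) * eLpNorm g (ENNReal.ofReal q) volume := by
  classical
  obtain ⟨C1, hC1, hsupp⟩ := dense_supp d
  obtain ⟨C2, hC2, hdens⟩ := density_Phi (d := d) hd
  have hk := kap_ge hd
  set a : ℝ := 1 / 2 - 1 / q with ha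
  have ha0 : 0 < a := by
    have : 0 < (2 * kap d)⁻¹ := by positivity
    linarith
  set γ : ℝ := 2 ^ ((2 * kap d)⁻¹ - a) with hγ
  have hγ0 : 0 < γ := by positivity
  have hγ1 : γ < 1 := Real.rpow_lt_one_of_one_lt_of_neg (by norm_num) (by linarith)
  set K : ℝ := C1 ^ a * C2 * 2 ^ (2 * kap d)⁻¹ with hK
  have hKp : 0 < K := by positivity
  have hg1 : 0 < (1 - γ)⁻¹ := inv_pos.2 (by linarith)
  refine ⟨K * (1 - γ)⁻¹, by positivity, fun g hg E R hR hE lam hlam hE2 => ?_⟩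
  rcases E.eq_empty_or_nonempty with rfl | hne
  · have : (0:ℝ) ^ (1 / q) = 0 := Real.zero_rpow (by positivity)
    simp [this, show q ≠ 0 by linarith]
  have hn : 0 < (E.card : ℝ) := by exact_mod_cast hne.card_pos
  set n : ℝ := (E.card : ℝ) with hnd
  let P : Ed d × ℝ → ℕ → Prop := fun z ν => ∃ ρ : ℝ, 1 ≤ ρ ∧ ρ ≤ 8 * R ∧ 2 ^ ν * ρ ≤ ((E.filter (fun z' => dist z z' ≤ ρ)).card : ℝ)
  have hP0 : ∀ z ∈ E, P z 0 := by
    intro z hz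
    refine ⟨1, le_rfl, by linarith, ?_⟩
    have : 0 < (E.filter (fun z' => dist z z' ≤ 1)).card := Finset.card_pos.2 ⟨z, by simp [hz]⟩
    simp only [pow_zero, mul_one]
    exact_mod_cast this
  have hPb : ∀ z ν, P z ν → ν ≤ E.card := by
    rintro z ν ⟨ρ, h1, h2, h3⟩
    have h4 : ((E.filter (fun z' => dist z z' ≤ ρ)).card : ℝ) ≤ E.card := by exact_mod_cast Finset.card_le_card (Finset.filter_subset _ _)
    have h5 : (2:ℝ) ^ ν ≤ E.card := by nlinarith [pow_pos (by norm_num : (0:ℝ) < 2) ν]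
    have h6 : 2 ^ ν ≤ E.card := by exact_mod_cast h5
    exact (Nat.lt_two_pow_self.le).trans h6
  let nu : Ed d × ℝ → ℕ := fun z => Nat.findGreatest (P z) E.card
  have hnuP : ∀ z ∈ E, P z (nu z) := fun z hz => Nat.findGreatest_spec (P := P z) (Nat.zero_le _) (hP0 z hz)
  have hnuN : ∀ z, ¬ P z (nu z + 1) := fun z hz => Nat.findGreatest_is_greatest (P := P z) (n := E.card) (Nat.lt_succ_self _) (hPb z _ hz) hz
  have hmaps : ∀ z ∈ E, nu z ∈ Finset.range (E.card + 1) := fun z _ => Finset.mem_range.2 (Nat.lt_succ_of_le (Nat.findGreatest_le _))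
  -- signs
  have hc : ∀ z : Ed d × ℝ, ∃ c : ℂ, ‖c‖ ≤ 1 ∧ c * Vf d g z.2 z.1 = (‖Vf d g z.2 z.1‖ : ℂ) := by
    intro z
    by_cases h : Vf d g z.2 z.1 = 0
    · exact ⟨0, by simp, by simp [h]⟩
    · refine ⟨(‖Vf d g z.2 z.1‖ : ℂ) / Vf d g z.2 z.1, ?_, ?_⟩
      · rw [norm_div]; simp [h]
      · field_simp
  choose c hc1 hc2 using hc
  let S : ℕ → Ed d → ℂ := fun ν y => ∑ z ∈ E.filter (fun z => nu z = ν), c z * Phi d z.2 z.1 y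
  have hScont : ∀ ν, Continuous (S ν) := fun ν => continuous_finset_sum _ fun z _ => continuous_const.mul (Phi_cont_y _ _)
  have step1 : ENNReal.ofReal (lam * n) ≤ ∑ ν ∈ Finset.range (E.card + 1), ∫⁻ y, ‖g y‖ₑ * ‖S ν y‖ₑ := by
    have e1 : ((∑ z ∈ E, ‖Vf d g z.2 z.1‖ : ℝ) : ℂ) = ∫ y, g y * ∑ ν ∈ Finset.range (E.card + 1), S ν y := by
      have : ∀ y, g y * ∑ ν ∈ Finset.range (E.card + 1), S ν y = ∑ z ∈ E, c z * (g y * Phi d z.2 z.1 y) := by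
        intro y
        rw [Finset.sum_fiberwise_of_maps_to hmaps, Finset.mul_sum]
        refine Finset.sum_congr rfl fun z _ => by ring
      simp_rw [this]
      rw [integral_finset_sum _ (fun z _ => (Vf_int hg _ _).const_mul _)]
      push_cast
      refine Finset.sum_congr rfl fun z _ => ?_
      rw [integral_const_mul, ← hc2 z]; rfl
    have e2 : lam * n ≤ ∑ z ∈ E, ‖Vf d g z.2 z.1‖ := by
      calc lam * n = ∑ z ∈ E, lam := by rw [Finset.sum_const, nsmul_eq_mul]; ring
        _ ≤ _ := Finset.sum_le_sum hE2
    calc ENNReal.ofReal (lam * n) ≤ ENNReal.ofReal (∑ z ∈ E, ‖Vf d g z.2 z.1‖) := ENNReal.ofReal_le_ofReal e2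
      _ = ‖((∑ z ∈ E, ‖Vf d g z.2 z.1‖ : ℝ) : ℂ)‖ₑ := by
        rw [← ofReal_norm, Complex.norm_real, Real.norm_of_nonneg (Finset.sum_nonneg fun _ _ => norm_nonneg _)]
      _ ≤ ∫⁻ y, ‖g y * ∑ ν ∈ Finset.range (E.card + 1), S ν y‖ₑ := by rw [e1]; exact enorm_integral_le_lintegral_enorm _
      _ ≤ ∫⁻ y, ∑ ν ∈ Finset.range (E.card + 1), ‖g y‖ₑ * ‖S ν y‖ₑ := by
        refine lintegral_mono fun y => ?_
        rw [enorm_mul, ← Finset.mul_sum]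
        gcongr
        exact enorm_sum_le _ _
      _ = _ := by
        rw [lintegral_finset_sum']
        intro ν _
        exact hg.aestronglyMeasurable.enorm.mul (hScont ν).aestronglyMeasurable.enorm
  set G := eLpNorm g (ENNReal.ofReal q) volume with hG
  have step2 : ∀ ν ∈ Finset.range (E.card + 1), ∫⁻ y, ‖g y‖ₑ * ‖S ν y‖ₑ ≤ G * ENNReal.ofReal (K * (R ^ (d - 1)) ^ a * n ^ (1 - 1 / q) * γ ^ ν) := by
    intro ν _
    set F := E.filter (fun z => nu z = ν) with hF
    have hFE : F ⊆ E := Finset.filter_subset _ _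
    obtain ⟨T, hTm, hTv, hT0⟩ := hsupp E F R hR hE hFE ν (fun z hz => by
      obtain ⟨z1, z2⟩ := Finset.mem_filter.1 hz
      rw [← z2]; exact hnuP z z1)
    have h1 := holder_set (q := q) hg.aestronglyMeasurable (hScont ν).aestronglyMeasurable hq2.le hTm (fun y hy => by
      refine Finset.sum_eq_zero fun z hz => ?_
      rw [hT0 y hy z hz, mul_zero])
    refine h1.trans ?_
    have h2 := hdens F R hR (hE.mono hFE) c hc1 (2 ^ (ν + 1)) (one_le_pow₀ (by norm_num)) (by
      intro z hz ρ r1 r2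
      obtain ⟨z1, z2⟩ := Finset.mem_filter.1 hz
      have := hnuN z
      rw [z2] at this
      by_contra hcon
      push Not at hcon
      refine this ⟨ρ, r1, r2, hcon.le.trans ?_⟩
      exact_mod_cast Finset.card_le_card (Finset.filter_subset_filter _ hFE))
    have hFn : (F.card : ℝ) ≤ n := by rw [hnd]; exact_mod_cast Finset.card_le_card hFE
    have h3 : eLpNorm (S ν) 2 volume ≤ ENNReal.ofReal (C2 * ((2 ^ (ν + 1)) ^ (2 * kap d)⁻¹ * n ^ (1 / 2 : ℝ))) := by
      refine h2.trans (ENNReal.ofReal_le_ofReal ?_)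
      gcongr
    rw [mul_assoc, ← ha]
    gcongr
    calc volume T ^ a * eLpNorm (S ν) 2 volume ≤ ENNReal.ofReal (C1 * (R ^ (d - 1) * (2 ^ ν)⁻¹ * n)) ^ a * ENNReal.ofReal (C2 * ((2 ^ (ν + 1)) ^ (2 * kap d)⁻¹ * n ^ (1 / 2 : ℝ))) := by
          gcongr
      _ = ENNReal.ofReal ((C1 * (R ^ (d - 1) * (2 ^ ν)⁻¹ * n)) ^ a * (C2 * ((2 ^ (ν + 1)) ^ (2 * kap d)⁻¹ * n ^ (1 / 2 : ℝ)))) := by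
          rw [ENNReal.ofReal_rpow_of_nonneg (by positivity) ha0.le, ← ENNReal.ofReal_mul (by positivity)]
      _ = _ := by
          congr 1
          rw [Real.mul_rpow (by positivity) (by positivity), Real.mul_rpow (by positivity) (by positivity), Real.mul_rpow (by positivity) (by positivity)]
          have q1 : n ^ (1 - 1 / q) = n ^ a * n ^ (1 / 2 : ℝ) := by
            rw [← Real.rpow_add hn]; congr 1; rw [ha]; ring
          have q2 : ((2:ℝ) ^ (ν + 1)) ^ (2 * kap d)⁻¹ * (((2:ℝ) ^ ν)⁻¹) ^ a = 2 ^ (2 * kap d)⁻¹ * γ ^ ν := by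
            have two : (0:ℝ) < 2 := by norm_num
            have w1 : ((2:ℝ) ^ (ν + 1)) ^ (2 * kap d)⁻¹ = 2 ^ (((ν:ℝ) + 1) * (2 * kap d)⁻¹) := by
              rw [Real.rpow_mul two.le]; congr 1
              rw [← Real.rpow_natCast 2 (ν+1)]; push_cast; rfl
            have w2 : (((2:ℝ) ^ ν)⁻¹) ^ a = 2 ^ (-(ν:ℝ) * a) := by
              rw [Real.rpow_mul two.le, Real.rpow_neg two.le, Real.rpow_natCast]
            have w3 : γ ^ ν = 2 ^ (((2 * kap d)⁻¹ - a) * (ν:ℝ)) := by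
              rw [Real.rpow_mul two.le, Real.rpow_natCast]
            rw [w1, w2, w3, ← Real.rpow_add two, ← Real.rpow_add two]
            congr 1; ring
          rw [q1, hK]
          calc _ = C1 ^ a * C2 * (((2:ℝ) ^ (ν + 1)) ^ (2 * kap d)⁻¹ * (((2:ℝ) ^ ν)⁻¹) ^ a) * (R ^ (d - 1)) ^ a * (n ^ a * n ^ (1 / 2 : ℝ)) := by ring
            _ = _ := by rw [q2]; ring
  have step3 : ENNReal.ofReal (lam * n) ≤ G * ENNReal.ofReal (K * (R ^ (d - 1)) ^ a * n ^ (1 - 1 / q) * (1 - γ)⁻¹) := by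
    refine step1.trans ((Finset.sum_le_sum step2).trans ?_)
    rw [← Finset.mul_sum, ← ENNReal.ofReal_sum_of_nonneg (fun _ _ => by positivity), ← Finset.mul_sum]
    gcongr
    rw [← tsum_geometric_of_lt_one hγ0.le hγ1]
    exact (summable_geometric_of_lt_one hγ0.le hγ1).sum_le_tsum _ (fun _ _ => by positivity)
  have hnq : 0 < n ^ (1 - 1 / q) := by positivity
  have e5 : lam * n = lam * n ^ (1 / q) * n ^ (1 - 1 / q) := by
    rw [mul_assoc, ← Real.rpow_add hn]; simp
  rw [e5, ENNReal.ofReal_mul (by positivity)] at step3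
  have e6 : G * ENNReal.ofReal (K * (R ^ (d - 1)) ^ a * n ^ (1 - 1 / q) * (1 - γ)⁻¹) = (ENNReal.ofReal (K * (1 - γ)⁻¹ * (R ^ (d - 1)) ^ a) * G) * ENNReal.ofReal (n ^ (1 - 1 / q)) := by
    have : K * (R ^ (d - 1)) ^ a * n ^ (1 - 1 / q) * (1 - γ)⁻¹ = (K * (1 - γ)⁻¹ * (R ^ (d - 1)) ^ a) * n ^ (1 - 1 / q) := by ring
    rw [this, ENNReal.ofReal_mul (by positivity)]; ring
  rw [e6] at step3
  exact (ENNReal.mul_le_mul_iff_left (by simpa using hnq) (by simp)).1 step3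
end weak

end Part13

section Part14
set_option linter.all false

section jens
variable {α : Type*} [MeasurableSpace α]

lemma jensen_rpow {μ : Measure α} {q : ℝ} (hq : 1 < q) {F : α → ℝ≥0∞} (hF : AEMeasurable F μ) :
    (∫⁻ a, F a ∂μ) ^ q ≤ μ univ ^ (q - 1) * ∫⁻ a, F a ^ q ∂μ := by
  have hc : q.HolderConjugate (q.conjExponent) := Real.HolderConjugate.conjExponent hq
  have h := ENNReal.lintegral_mul_le_Lp_mul_Lq μ hc hF (aemeasurable_const (b := (1:ℝ≥0∞)))
  simp only [Pi.mul_apply, mul_one, ENNReal.one_rpow, lintegral_const, one_mul] at h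
  calc _ ≤ ((∫⁻ a, F a ^ q ∂μ) ^ (1 / q) * μ univ ^ (1 / q.conjExponent)) ^ q := by gcongr
    _ = _ := by
      rw [ENNReal.mul_rpow_of_nonneg _ _ (by linarith), ← ENNReal.rpow_mul, ← ENNReal.rpow_mul, one_div_mul_cancel (by linarith), ENNReal.rpow_one, mul_comm]
      congr 2
      have := hc.inv_add_inv_eq_one
      have h1 : 1 / q.conjExponent = 1 - q⁻¹ := by rw [one_div]; linarith
      rw [h1, sub_mul, inv_mul_cancel₀ (by linarith), one_mul]

lemma jensen_weight {μ : Measure α} {q : ℝ} (hq : 1 < q) {w F : α → ℝ≥0∞} (hw : Measurable w) (hF : Measurable F) :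
    (∫⁻ a, w a * F a ∂μ) ^ q ≤ (∫⁻ a, w a ∂μ) ^ (q - 1) * ∫⁻ a, w a * F a ^ q ∂μ := by
  have := jensen_rpow (μ := μ.withDensity w) hq hF.aemeasurable
  rw [lintegral_withDensity_eq_lintegral_mul _ hw hF, lintegral_withDensity_eq_lintegral_mul _ hw (hF.pow_const q), withDensity_apply _ MeasurableSet.univ, Measure.restrict_univ] at this
  exact this
end jens

section cells
variable {d : ℕ}

def bl (Λ : ℝ) (x : Ed d) : Fin d → ℤ := fun i => ⌊x i / Λ⌋

lemma bl_meas (Λ : ℝ) : Measurable (bl Λ : Ed d → Fin d → ℤ) := by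
  refine measurable_pi_lambda _ fun i => ?_
  unfold bl
  exact Int.measurable_floor.comp ((by fun_prop : Measurable fun x : Ed d => x i / Λ))

lemma bl_one (x : Ed d) : bl 1 x = cell x := by ext i; simp [bl, cell]

lemma bl_vol {Λ : ℝ} (hΛ : 0 < Λ) (n : Fin d → ℤ) : volume ((bl Λ : Ed d → _) ⁻¹' {n}) = ENNReal.ofReal (Λ ^ d) := by
  have : ((bl Λ : Ed d → _) ⁻¹' {n}) = (fun x : Ed d => WithLp.ofLp x) ⁻¹' (univ.pi fun i => Ico (Λ * n i) (Λ * (n i + 1))) := by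
    ext x
    simp only [mem_preimage, mem_singleton_iff, mem_univ_pi, mem_Ico, bl, funext_iff, Int.floor_eq_iff]
    refine forall_congr' fun i => ?_
    rw [le_div_iff₀ hΛ, div_lt_iff₀ hΛ, mul_comm Λ, mul_comm Λ]
  rw [this, (PiLp.volume_preserving_ofLp (Fin d)).measure_preimage (MeasurableSet.univ_pi fun i => measurableSet_Ico).nullMeasurableSet, Real.volume_pi_Ico]
  simp only [mul_add, mul_one, add_sub_cancel_left]
  rw [Finset.prod_const, Finset.card_univ, Fintype.card_fin, ENNReal.ofReal_pow hΛ.le]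

open Classical in
/-- averaging over blocks of side Λ -/
def EL (Λ : ℝ) (u : Ed d → ℝ≥0∞) (x : Ed d) : ℝ≥0∞ :=
  (ENNReal.ofReal (Λ ^ d))⁻¹ * ∫⁻ y, if bl Λ x = bl Λ y then u y else 0

lemma bl_set_meas (Λ : ℝ) : MeasurableSet {p : Ed d × Ed d | bl Λ p.1 = bl Λ p.2} :=
  measurableSet_eq_fun ((bl_meas Λ).comp measurable_fst) ((bl_meas Λ).comp measurable_snd)

lemma EL_meas_param {Ω : Type*} [MeasurableSpace Ω] (Λ : ℝ) {u : Ω × Ed d → ℝ≥0∞} (hu : Measurable u) :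
    Measurable (fun p : Ω × Ed d => EL Λ (fun x => u (p.1, x)) p.2) := by
  classical
  unfold EL
  refine Measurable.const_mul ?_ _
  refine Measurable.lintegral_prod_right' (f := fun z : (Ω × Ed d) × Ed d => if bl Λ z.1.2 = bl Λ z.2 then u (z.1.1, z.2) else 0) ?_
  refine Measurable.ite ?_ (hu.comp (by fun_prop)) measurable_const
  exact measurableSet_eq_fun ((bl_meas Λ).comp (by fun_prop)) ((bl_meas Λ).comp measurable_snd)

lemma EL_meas (Λ : ℝ) {u : Ed d → ℝ≥0∞} (hu : Measurable u) : Measurable (EL Λ u) := by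
  have := EL_meas_param (Ω := Unit) Λ (u := fun p : Unit × Ed d => u p.2) (hu.comp measurable_snd)
  exact this.comp (measurable_prodMk_left (x := ()))

lemma EL_mono (Λ : ℝ) {u v : Ed d → ℝ≥0∞} (h : ∀ x, u x ≤ v x) (x : Ed d) : EL Λ u x ≤ EL Λ v x := by
  unfold EL
  gcongr with y
  split_ifs
  · exact h y
  · exact le_rfl

lemma EL_self {Λ : ℝ} (hΛ : 0 < Λ) {b u : Ed d → ℝ≥0∞} (hb : Measurable b) (hu : Measurable u) 
    (hc : ∀ x y, bl Λ x = bl Λ y → b x = b y) : ∫⁻ x, b x * EL Λ u x = ∫⁻ x, b x * u x := by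
  classical
  have e : ∀ x, b x * EL Λ u x = ∫⁻ y, (ENNReal.ofReal (Λ ^ d))⁻¹ * (if bl Λ x = bl Λ y then b y * u y else 0) := by
    intro x
    have hm : Measurable (fun y => if bl Λ x = bl Λ y then u y else 0) :=
      Measurable.ite (measurableSet_eq_fun measurable_const (bl_meas Λ)) hu measurable_const
    unfold EL
    rw [mul_left_comm, ← lintegral_const_mul _ hm, ← lintegral_const_mul _ (hm.const_mul _)]
    congr 1; ext y
    split_ifs with h
    · rw [hc x y h]
    · simp
  simp_rw [e]
  have hm2 : Measurable (fun p : Ed d × Ed d => (ENNReal.ofReal (Λ ^ d))⁻¹ * (if bl Λ p.1 = bl Λ p.2 then b p.2 * u p.2 else 0)) :=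
    (Measurable.ite (bl_set_meas Λ) (by fun_prop) measurable_const).const_mul _
  rw [lintegral_lintegral_swap hm2.aemeasurable]
  congr 1; ext y
  have : ∀ x : Ed d, (ENNReal.ofReal (Λ ^ d))⁻¹ * (if bl Λ x = bl Λ y then b y * u y else 0) = ((bl Λ : Ed d → _) ⁻¹' {bl Λ y}).indicator (fun _ => (ENNReal.ofReal (Λ ^ d))⁻¹ * (b y * u y)) x := by
    intro x
    rw [indicator_apply]
    simp only [mem_preimage, mem_singleton_iff]
    split_ifs <;> simp
  simp_rw [this]
  have hp : 0 < Λ ^ d := by positivity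
  rw [lintegral_indicator_const (bl_meas Λ (measurableSet_singleton _)), bl_vol hΛ, mul_right_comm, ENNReal.inv_mul_cancel (by simpa using hp) (by simp), one_mul]

lemma EL_const_bl {Λ : ℝ} (hΛ : 0 < Λ) {u : Ed d → ℝ≥0∞} (hc : ∀ x y, bl Λ x = bl Λ y → u x = u y) (x : Ed d) :
    EL Λ u x = u x := by
  classical
  have : ∀ y : Ed d, (if bl Λ x = bl Λ y then u y else 0) = ((bl Λ : Ed d → _) ⁻¹' {bl Λ x}).indicator (fun _ => u x) y := by
    intro y
    rw [indicator_apply]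
    simp only [mem_preimage, mem_singleton_iff, eq_comm (a := bl Λ y)]
    split_ifs with h
    · rw [hc _ _ h]
    · rfl
  have hp : 0 < Λ ^ d := by positivity
  unfold EL
  simp_rw [this]
  rw [lintegral_indicator_const (bl_meas Λ (measurableSet_singleton _)), bl_vol hΛ, mul_left_comm, ENNReal.inv_mul_cancel (by simpa using hp) (by simp), mul_one]

lemma EL_one {Λ : ℝ} (hΛ : 0 < Λ) (x : Ed d) : EL Λ (fun _ => 1) x = 1 := EL_const_bl hΛ (fun _ _ _ => rfl) x

lemma EL_jensen {Λ : ℝ} (hΛ : 0 < Λ) {q : ℝ} (hq : 1 < q) {u : Ed d → ℝ≥0∞} (hu : Measurable u) (x : Ed d) :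
    EL Λ u x ^ q ≤ EL Λ (fun y => u y ^ q) x := by
  classical
  have hset : MeasurableSet {y : Ed d | bl Λ x = bl Λ y} := measurableSet_eq_fun measurable_const (bl_meas Λ)
  have key : ∀ v : Ed d → ℝ≥0∞, Measurable v → EL Λ v x = ∫⁻ y, (ENNReal.ofReal (Λ ^ d))⁻¹ * (if bl Λ x = bl Λ y then 1 else 0) * v y := by
    intro v hv
    unfold EL
    rw [← lintegral_const_mul _ (Measurable.ite hset hv measurable_const)]
    congr 1; ext y; split_ifs <;> simp
  have hw : Measurable (fun y : Ed d => (ENNReal.ofReal (Λ ^ d))⁻¹ * (if bl Λ x = bl Λ y then 1 else 0)) :=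
    (Measurable.ite hset measurable_const measurable_const).const_mul _
  have := jensen_weight (μ := volume) hq hw hu
  rw [← key u hu, ← key _ (hu.pow_const q)] at this
  have h1 := key (fun _ => 1) measurable_const
  rw [EL_one hΛ] at h1
  simp only [mul_one] at h1
  rw [← h1, ENNReal.one_rpow, one_mul] at this
  exact this

lemma EL_contr {Λ : ℝ} (hΛ : 0 < Λ) {q : ℝ} (hq : 1 < q) {u : Ed d → ℝ≥0∞} (hu : Measurable u) :
    ∫⁻ x, EL Λ u x ^ q ≤ ∫⁻ x, u x ^ q := by
  have := EL_self hΛ (b := fun _ => 1) measurable_const (hu.pow_const q) (fun _ _ _ => rfl)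
  simp only [one_mul] at this
  rw [← this]
  exact lintegral_mono fun x => EL_jensen hΛ hq hu x

lemma EL_lintegral (Λ : ℝ) {Ω : Type*} [MeasurableSpace Ω] {μ : Measure Ω} [SFinite μ] {w : Ω → ℝ≥0∞} (hw : Measurable w) {u : Ω × Ed d → ℝ≥0∞} (hu : Measurable u) (x : Ed d) :
    EL Λ (fun y => ∫⁻ r, w r * u (r, y) ∂μ) x = ∫⁻ r, w r * EL Λ (fun y => u (r, y)) x ∂μ := by
  classical
  have hset : MeasurableSet {y : Ed d | bl Λ x = bl Λ y} := measurableSet_eq_fun measurable_const (bl_meas Λ)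
  have hm : Measurable (fun p : Ω × Ed d => if bl Λ x = bl Λ p.2 then u p else 0) :=
    Measurable.ite (measurable_snd hset) hu measurable_const
  have hm1 : Measurable (fun p : Ω × Ed d => w p.1 * (if bl Λ x = bl Λ p.2 then u p else 0)) := (hw.comp measurable_fst).mul hm
  unfold EL
  have e1 : ∀ y, (if bl Λ x = bl Λ y then ∫⁻ r, w r * u (r, y) ∂μ else 0) = ∫⁻ r, w r * (if bl Λ x = bl Λ y then u (r, y) else 0) ∂μ := by
    intro y; split_ifs <;> simp
  simp_rw [e1]
  rw [lintegral_lintegral_swap (f := fun y r => w r * (if bl Λ x = bl Λ y then u (r, y) else 0)) (hm1.comp measurable_swap).aemeasurable]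
  have e2 : ∀ r, ∫⁻ y, w r * (if bl Λ x = bl Λ y then u (r, y) else 0) = w r * ∫⁻ y, (if bl Λ x = bl Λ y then u (r, y) else 0) := by
    intro r
    exact lintegral_const_mul _ (hm.comp measurable_prodMk_left)
  simp_rw [e2]
  have hm3 : Measurable (fun r => w r * ∫⁻ y, (if bl Λ x = bl Λ y then u (r, y) else 0)) := hw.mul hm.lintegral_prod_right'
  rw [← lintegral_const_mul _ hm3]
  congr 1; ext r; ring

lemma EL_add (Λ : ℝ) {u v : Ed d → ℝ≥0∞} (hu : Measurable u) (x : Ed d) : EL Λ (fun y => u y + v y) x = EL Λ u x + EL Λ v x := by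
  classical
  have hset : MeasurableSet {y : Ed d | bl Λ x = bl Λ y} := measurableSet_eq_fun measurable_const (bl_meas Λ)
  unfold EL
  rw [← mul_add, ← lintegral_add_left (Measurable.ite hset hu measurable_const)]
  congr 2; ext y; split_ifs <;> simp
end cells

end Part14

section Part15
set_option linter.all false

section marc
variable {X Ω : Type*} [MeasurableSpace X] [MeasurableSpace Ω]

lemma pow_lint {a s : ℝ} (ha : 0 ≤ a) (hs : 0 < s) : ∫⁻ t in Ioi (0:ℝ), (if t < a then ENNReal.ofReal (t ^ (s - 1)) else 0) = ENNReal.ofReal (a ^ s / s) := by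
  have e1 : ∫⁻ t in Ioi (0:ℝ), (if t < a then ENNReal.ofReal (t ^ (s - 1)) else 0) = ∫⁻ t in Ioo 0 a, ENNReal.ofReal (t ^ (s - 1)) := by
    have : ∀ t, (if t < a then ENNReal.ofReal (t ^ (s - 1)) else 0) = (Iio a).indicator (fun t => ENNReal.ofReal (t ^ (s - 1))) t := by
      intro t; rw [indicator_apply]; rfl
    simp_rw [this]
    rw [lintegral_indicator measurableSet_Iio, Measure.restrict_restrict measurableSet_Iio, inter_comm, Ioi_inter_Iio]
  rw [e1, restrict_Ioo_eq_restrict_Ioc]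
  have hi : IntervalIntegrable (fun t : ℝ => t ^ (s - 1)) volume 0 a := intervalIntegral.intervalIntegrable_rpow' (by linarith)
  rw [← ofReal_integral_eq_lintegral_ofReal ((intervalIntegrable_iff_integrableOn_Ioc_of_le ha).1 hi), ← intervalIntegral.integral_of_le ha, integral_rpow (Or.inl (by linarith))]
  · simp [Real.zero_rpow hs.ne']
  · exact (ae_restrict_mem measurableSet_Ioc).mono fun t ht => Real.rpow_nonneg ht.1.le _

lemma marc (ν : Measure X) [SFinite ν] {q0 q : ℝ} (h0 : 1 ≤ q0) (hq : q0 < q) {T : (X → ℂ) → Ω → ℝ≥0∞} {μ : Measure Ω} {M : ℝ≥0∞} (hMt : M ≠ ⊤) {B1 : ℝ} (hB1 : 0 < B1)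
    (hm : ∀ g : X → ℂ, Integrable g ν → Measurable g → Measurable (T g))
    (hfin : ∀ g : X → ℂ, Integrable g ν → Measurable g → ∀ w, T g w ≠ ⊤)
    (hsub : ∀ g1 g2 : X → ℂ, Integrable g1 ν → Measurable g1 → Integrable g2 ν → Measurable g2 → ∀ w, T (fun x => g1 x + g2 x) w ≤ T g1 w + T g2 w)
    (hweak : ∀ g : X → ℂ, Integrable g ν → Measurable g → ∀ l : ℝ, 0 < l → ENNReal.ofReal (l ^ q0) * μ {w | ENNReal.ofReal l < T g w} ≤ M * ∫⁻ x, ‖g x‖ₑ ^ q0 ∂ν)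
    (hinf : ∀ g : X → ℂ, Integrable g ν → Measurable g → ∀ b : ℝ, 0 ≤ b → (∀ x, ‖g x‖ ≤ b) → ∀ᵐ w ∂μ, T g w ≤ ENNReal.ofReal (B1 * b))
    (g : X → ℂ) (hg : Integrable g ν) (hgm : Measurable g) :
    ∫⁻ w, T g w ^ q ∂μ ≤ ENNReal.ofReal (q / (q - q0) * 2 ^ q * B1 ^ (q - q0)) * M * ∫⁻ x, ‖g x‖ₑ ^ q ∂ν := by
  have hq0 : 0 < q := by linarith
  have hqq : 0 < q - q0 := by linarith
  have e0 : ∫⁻ w, T g w ^ q ∂μ = ∫⁻ w, ENNReal.ofReal ((T g w).toReal ^ q) ∂μ := by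
    congr 1; ext w
    rw [← ENNReal.ofReal_rpow_of_nonneg ENNReal.toReal_nonneg hq0.le, ENNReal.ofReal_toReal (hfin g hg hgm w)]
  rw [e0, lintegral_rpow_eq_lintegral_meas_lt_mul μ (Filter.Eventually.of_forall fun _ => ENNReal.toReal_nonneg) (hm g hg hgm).ennreal_toReal.aemeasurable hq0]
  have key : ∀ t ∈ Ioi (0:ℝ), μ {a | t < (T g a).toReal} * ENNReal.ofReal (t ^ (q - 1)) ≤ M * ∫⁻ x, ‖g x‖ₑ ^ q0 * (if t < 2 * B1 * ‖g x‖ then ENNReal.ofReal (2 ^ q0 * t ^ (q - q0 - 1)) else 0) ∂ν := by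
    intro t ht
    have ht' : 0 < t := ht
    set A : Set X := {x | t < 2 * B1 * ‖g x‖} with hA
    have hAm : MeasurableSet A := measurableSet_lt measurable_const (hgm.norm.const_mul _)
    set g1 := A.indicator g
    set g2 := Aᶜ.indicator g
    have i1 : Integrable g1 ν := hg.indicator hAm
    have i2 : Integrable g2 ν := hg.indicator hAm.compl
    have m1 : Measurable g1 := hgm.indicator hAm
    have m2 : Measurable g2 := hgm.indicator hAm.compl
    have eg : (fun x => g1 x + g2 x) = g := by
      ext x; exact congrFun (indicator_self_add_compl A g) x
    have hs := hsub g1 g2 i1 m1 i2 m2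
    rw [eg] at hs
    have hb := hinf g2 i2 m2 (t / (2 * B1)) (by positivity) (by
      intro x
      by_cases hx : x ∈ A
      · rw [show g2 x = 0 from indicator_of_notMem (by simpa using hx) g]; simp; positivity
      · rw [show g2 x = g x from indicator_of_mem (show x ∈ Aᶜ from hx) g, le_div_iff₀ (by positivity)]
        have : ¬ t < 2 * B1 * ‖g x‖ := hx
        linarith)
    have e1 : B1 * (t / (2 * B1)) = t / 2 := by field_simp
    rw [e1] at hb
    have hsubs : μ {a | t < (T g a).toReal} ≤ μ {w | ENNReal.ofReal (t / 2) < T g1 w} := by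
      refine measure_mono_ae ?_
      filter_upwards [hb] with w hw hw2
      have hw1 : t < (T g w).toReal := hw2
      show ENNReal.ofReal (t / 2) < T g1 w
      by_contra hcon
      push Not at hcon
      have : T g w ≤ ENNReal.ofReal t := (hs w).trans ((add_le_add hcon hw).trans (by rw [← ENNReal.ofReal_add (by positivity) (by positivity)]; simp))
      have := ENNReal.toReal_le_of_le_ofReal ht'.le this
      linarith
    have hw := hweak g1 i1 m1 (t / 2) (by positivity)
    have hpos : 0 < (t / 2) ^ q0 := by positivity
    have hmu : μ {a | t < (T g a).toReal} ≤ ENNReal.ofReal (((t / 2) ^ q0)⁻¹) * (M * ∫⁻ x, ‖g1 x‖ₑ ^ q0 ∂ν) := by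
      refine hsubs.trans ?_
      calc _ = ENNReal.ofReal (((t / 2) ^ q0)⁻¹) * (ENNReal.ofReal ((t / 2) ^ q0) * μ {w | ENNReal.ofReal (t / 2) < T g1 w}) := by
            rw [← mul_assoc, ← ENNReal.ofReal_mul (by positivity), inv_mul_cancel₀ hpos.ne', ENNReal.ofReal_one, one_mul]
        _ ≤ _ := by gcongr
    calc _ ≤ ENNReal.ofReal (((t / 2) ^ q0)⁻¹) * (M * ∫⁻ x, ‖g1 x‖ₑ ^ q0 ∂ν) * ENNReal.ofReal (t ^ (q - 1)) := by gcongr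
      _ = M * ((∫⁻ x, ‖g1 x‖ₑ ^ q0 ∂ν) * ENNReal.ofReal (2 ^ q0 * t ^ (q - q0 - 1))) := by
          have : 2 ^ q0 * t ^ (q - q0 - 1) = ((t / 2) ^ q0)⁻¹ * t ^ (q - 1) := by
            rw [Real.div_rpow ht'.le (by norm_num), inv_div, show q - q0 - 1 = (q - 1) - q0 by ring, Real.rpow_sub ht']
            ring
          rw [this, ENNReal.ofReal_mul (by positivity)]; ring
      _ = _ := by
          rw [← lintegral_mul_const _ (m1.enorm.pow_const q0)]
          congr 2; ext x
          by_cases hx : x ∈ A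
          · rw [show g1 x = g x from indicator_of_mem hx g, if_pos (show t < 2 * B1 * ‖g x‖ from hx)]
          · rw [show g1 x = 0 from indicator_of_notMem hx g, if_neg (show ¬ t < 2 * B1 * ‖g x‖ from hx)]; simp; left; linarith
  refine (mul_le_mul_right (setLIntegral_mono' measurableSet_Ioi key) _).trans ?_
  have hm3 : Measurable (fun p : ℝ × X => ‖g p.2‖ₑ ^ q0 * (if p.1 < 2 * B1 * ‖g p.2‖ then ENNReal.ofReal (2 ^ q0 * p.1 ^ (q - q0 - 1)) else 0)) := by
    refine Measurable.mul (by fun_prop) (Measurable.ite ?_ (by fun_prop) measurable_const)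
    exact measurableSet_lt measurable_fst (by fun_prop)
  rw [lintegral_const_mul _ hm3.lintegral_prod_right', lintegral_lintegral_swap hm3.aemeasurable]
  have e4 : ∀ x, ∫⁻ t in Ioi (0:ℝ), ‖g x‖ₑ ^ q0 * (if t < 2 * B1 * ‖g x‖ then ENNReal.ofReal (2 ^ q0 * t ^ (q - q0 - 1)) else 0) = ENNReal.ofReal (2 ^ q * B1 ^ (q - q0) / (q - q0)) * ‖g x‖ₑ ^ q := by
    intro x
    have : ∀ t : ℝ, ‖g x‖ₑ ^ q0 * (if t < 2 * B1 * ‖g x‖ then ENNReal.ofReal (2 ^ q0 * t ^ (q - q0 - 1)) else 0) = (‖g x‖ₑ ^ q0 * ENNReal.ofReal (2 ^ q0)) * (if t < 2 * B1 * ‖g x‖ then ENNReal.ofReal (t ^ (q - q0 - 1)) else 0) := by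
      intro t
      split_ifs
      · rw [ENNReal.ofReal_mul (by positivity), mul_assoc]
      · simp
    simp_rw [this]
    rw [lintegral_const_mul _ (Measurable.ite measurableSet_Iio (by fun_prop) measurable_const), pow_lint (by positivity) (by linarith)]
    rw [← ofReal_norm, ENNReal.ofReal_rpow_of_nonneg (norm_nonneg _) (by linarith), ENNReal.ofReal_rpow_of_nonneg (norm_nonneg _) (by linarith), ← ENNReal.ofReal_mul (by positivity), ← ENNReal.ofReal_mul (by positivity), ← ENNReal.ofReal_mul (by positivity)]
    congr 1
    rw [Real.mul_rpow (by positivity) (norm_nonneg _), Real.mul_rpow (by norm_num) hB1.le]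
    have a1 : (2:ℝ) ^ q = 2 ^ q0 * 2 ^ (q - q0) := by rw [← Real.rpow_add (by norm_num)]; congr 1; ring
    have a2 : ‖g x‖ ^ q = ‖g x‖ ^ q0 * ‖g x‖ ^ (q - q0) := by
      rw [← Real.rpow_add_of_nonneg (norm_nonneg _) (by linarith) (by linarith)]; congr 1; ring
    rw [a1, a2]; ring
  simp_rw [e4]
  rw [lintegral_const_mul _ (hgm.enorm.pow_const q)]
  have a3 : q / (q - q0) * 2 ^ q * B1 ^ (q - q0) = q * (2 ^ q * B1 ^ (q - q0) / (q - q0)) := by ring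
  rw [a3, ENNReal.ofReal_mul hq0.le]
  exact le_of_eq (by ring)
end marc

end Part15

section Part16
set_option linter.all false

section vr
variable {d : ℕ} [NeZero d]

def vn (d : ℕ) (g : Ed d → ℂ) (r : ℝ) (n : Fin d → ℤ) : ℝ≥0∞ := ⨆ y : {y : Ed d // cell y = n}, ‖Vf d g r y‖ₑ
def vr (d : ℕ) (g : Ed d → ℂ) (r : ℝ) (x : Ed d) : ℝ≥0∞ := vn d g r (cell x)

lemma Vf_le_vr (g : Ed d → ℂ) (r : ℝ) (x : Ed d) : ‖Vf d g r x‖ₑ ≤ vr d g r x := 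
  le_iSup (fun y : {y : Ed d // cell y = cell x} => ‖Vf d g r y‖ₑ) ⟨x, rfl⟩

lemma Vf_cont_r {g : Ed d → ℂ} (hg : Integrable g) (x : Ed d) : Continuous (fun r => Vf d g r x) := by
  obtain ⟨C, hC, h⟩ := Phi_bdd d
  rw [continuous_iff_continuousAt]
  intro r0
  unfold Vf
  refine continuousAt_of_dominated (bound := fun y => ‖g y‖ * (C * (|r0 ^ kap d| + 1))) ?_ ?_ ?_ ?_
  · exact Filter.Eventually.of_forall fun r => (Vf_int hg r x).aestronglyMeasurable
  · have hc : ContinuousAt (fun r : ℝ => |r ^ kap d|) r0 := (continuous_abs.comp (Real.continuous_rpow_const kap_nonneg)).continuousAt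
    filter_upwards [hc.eventually_lt continuousAt_const (show |r0 ^ kap d| < |r0 ^ kap d| + 1 by linarith)] with r hr
    refine Filter.Eventually.of_forall fun y => ?_
    rw [norm_mul]
    gcongr
    refine (h r x y).trans ?_
    gcongr
  · exact hg.norm.mul_const _
  · refine Filter.Eventually.of_forall fun y => ?_
    exact (continuous_const.mul (Phi_cont.comp (by fun_prop : Continuous (fun r : ℝ => (r, x, y))))).continuousAt

lemma vn_meas {g : Ed d → ℂ} (hg : Integrable g) (n : Fin d → ℤ) : Measurable (fun r => vn d g r n) := by
  have : LowerSemicontinuous (fun r => vn d g r n) := by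
    unfold vn
    exact lowerSemicontinuous_iSup fun y => (Vf_cont_r hg y).enorm.lowerSemicontinuous
  exact this.measurable

lemma cell_meas : Measurable (cell : Ed d → Fin d → ℤ) := by
  have := bl_meas (d := d) 1
  convert this using 1
  ext x; rw [bl_one]

lemma vr_meas {g : Ed d → ℂ} (hg : Integrable g) : Measurable (fun p : ℝ × Ed d => vr d g p.1 p.2) := by
  have : Measurable (fun p : ℝ × (Fin d → ℤ) => vn d g p.1 p.2) := measurable_from_prod_countable_left fun n => vn_meas hg n
  exact this.comp (measurable_fst.prodMk (cell_meas.comp measurable_snd))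

lemma vr_meas_x {g : Ed d → ℂ} (hg : Integrable g) (r : ℝ) : Measurable (vr d g r) :=
  (vr_meas hg).comp measurable_prodMk_left

lemma vr_bdd (d : ℕ) [NeZero d] : ∃ C : ℝ, 0 < C ∧ ∀ g : Ed d → ℂ, Integrable g → ∀ r x, vr d g r x ≤ ENNReal.ofReal (C * |r ^ kap d| * ∫ y, ‖g y‖) := by
  obtain ⟨C, hC, h⟩ := Phi_bdd d
  refine ⟨C, hC, fun g hg r x => iSup_le fun y => ?_⟩
  rw [← ofReal_norm]
  refine ENNReal.ofReal_le_ofReal ?_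
  unfold Vf
  rw [← integral_const_mul]
  refine norm_integral_le_of_norm_le (hg.norm.const_mul _) (Filter.Eventually.of_forall fun z => ?_)
  rw [norm_mul, mul_comm]
  gcongr
  exact h r y z

lemma vr_fin {g : Ed d → ℂ} (hg : Integrable g) (r : ℝ) (x : Ed d) : vr d g r x ≠ ⊤ := by
  obtain ⟨C, hC, h⟩ := vr_bdd d
  exact ((h g hg r x).trans_lt ENNReal.ofReal_lt_top).ne

lemma vr_sub {g1 g2 : Ed d → ℂ} (h1 : Integrable g1) (h2 : Integrable g2) (r : ℝ) (x : Ed d) :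
    vr d (fun y => g1 y + g2 y) r x ≤ vr d g1 r x + vr d g2 r x := by
  refine iSup_le fun y => ?_
  have : Vf d (fun y => g1 y + g2 y) r y = Vf d g1 r y + Vf d g2 r y := by
    unfold Vf
    rw [← integral_add (Vf_int h1 r y) (Vf_int h2 r y)]
    congr 1; ext z; ring
  rw [this]
  refine (enorm_add_le _ _).trans (add_le_add ?_ ?_)
  · exact le_iSup (fun y : {y : Ed d // cell y = cell x} => ‖Vf d g1 r y‖ₑ) y
  · exact le_iSup (fun y : {y : Ed d // cell y = cell x} => ‖Vf d g2 r y‖ₑ) y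

lemma cell_vol_set (A : Set (Fin d → ℤ)) : volume ((cell : Ed d → _) ⁻¹' A) = ∑' n, A.indicator (fun _ => (1:ℝ≥0∞)) n := by
  classical
  have hA : MeasurableSet A := A.to_countable.measurableSet
  rw [← Measure.map_apply cell_meas hA, ← Measure.tsum_indicator_apply_singleton _ A hA]
  congr 1; ext n
  have : (Measure.map cell volume) {n} = (1:ℝ≥0∞) := by
    rw [Measure.map_apply cell_meas (measurableSet_singleton n)]
    have h := bl_vol (d := d) (Λ := 1) one_pos n
    have e : (bl 1 : Ed d → _) = cell := by ext x; rw [bl_one]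
    rw [e] at h
    simpa using h
  rw [indicator_apply, indicator_apply]
  split_ifs
  · exact this
  · rfl

lemma eLpNorm_pow {α : Type*} [MeasurableSpace α] {μ : Measure α} {q : ℝ} (hq : 0 < q) (g : α → ℂ) : eLpNorm g (ENNReal.ofReal q) μ ^ q = ∫⁻ x, ‖g x‖ₑ ^ q ∂μ := by
  rw [eLpNorm_eq_lintegral_rpow_enorm_toReal (by simpa using hq) (by simp), ENNReal.toReal_ofReal hq.le, ← ENNReal.rpow_mul, one_div_mul_cancel hq.ne', ENNReal.rpow_one]

lemma weak_theta (hd : 4 ≤ d) {q : ℝ} (hq2 : 2 < q) (hq : 1 / q < 1 / 2 - (2 * kap d)⁻¹) : ∃ C : ℝ, 0 < C ∧ ∀ g : Ed d → ℂ, Integrable g → 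
    ∀ N : ℕ, 1 ≤ N → ∀ θ : ℝ, 0 < θ → θ ≤ 1 → ∀ l : ℝ, 0 < l → 
    ENNReal.ofReal (l ^ q) * ∑ m ∈ Finset.range N, volume {x : Ed d | ENNReal.ofReal l < vr d g (m + θ) x} ≤ 
      ENNReal.ofReal (C * ((N:ℝ) ^ (d - 1)) ^ (q / 2 - 1)) * ∫⁻ x, ‖g x‖ₑ ^ q := by
  classical
  obtain ⟨C, hC, hw⟩ := weak_finite hd hq2 hq
  have q0 : 0 < q := by linarith
  refine ⟨C ^ q, by positivity, fun g hg N hN θ h0 h1 l hl => ?_⟩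
  have hN' : (1:ℝ) ≤ N := by exact_mod_cast hN
  set A : ℕ → Set (Fin d → ℤ) := fun m => {n | ENNReal.ofReal l < vn d g (m + θ) n} with hA
  have e1 : ∑ m ∈ Finset.range N, volume {x : Ed d | ENNReal.ofReal l < vr d g (m + θ) x} = ∑' n, ∑ m ∈ Finset.range N, (A m).indicator (fun _ => (1:ℝ≥0∞)) n := by
    rw [Summable.tsum_finsetSum (fun _ _ => ENNReal.summable)]
    refine Finset.sum_congr rfl fun m _ => ?_
    rw [← cell_vol_set]; rfl
  rw [e1, ENNReal.tsum_eq_iSup_sum, ENNReal.mul_iSup]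
  refine iSup_le fun F => ?_
  set G : Finset (ℕ × (Fin d → ℤ)) := (Finset.range N ×ˢ F).filter (fun p => p.2 ∈ A p.1) with hG
  have e2 : ∑ n ∈ F, ∑ m ∈ Finset.range N, (A m).indicator (fun _ => (1:ℝ≥0∞)) n = ENNReal.ofReal (G.card : ℝ) := by
    rw [Finset.sum_comm, ← Finset.sum_product', ENNReal.ofReal_natCast, Finset.card_filter]
    push_cast
    refine Finset.sum_congr rfl fun p _ => ?_
    rw [indicator_apply]
  rw [e2]
  have hG2 : ∀ p : ℕ × (Fin d → ℤ), p ∈ G → ∃ y : Ed d, cell y = p.2 ∧ ENNReal.ofReal l < ‖Vf d g (p.1 + θ) y‖ₑ := by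
    intro p hp
    have : ENNReal.ofReal l < vn d g (p.1 + θ) p.2 := (Finset.mem_filter.1 hp).2
    obtain ⟨y, hy⟩ := lt_iSup_iff.1 this
    exact ⟨y.1, y.2, hy⟩
  choose! Y hY1 hY2 using hG2
  set E : Finset (Ed d × ℝ) := G.image (fun p => (Y p, (p.1:ℝ) + θ)) with hE
  have hinj : ∀ p ∈ G, ∀ p' ∈ G, cell (Y p) = cell (Y p') → (p.1:ℝ) + θ = p'.1 + θ → p = p' := by
    intro p hp p' hp' c1 c2
    rw [hY1 p hp, hY1 p' hp'] at c1
    refine Prod.ext ?_ c1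
    have : (p.1:ℝ) = p'.1 := by linarith
    exact_mod_cast this
  have hcard : E.card = G.card := by
    refine Finset.card_image_of_injOn fun p hp p' hp' h => ?_
    simp only [Prod.mk.injEq] at h
    exact hinj p hp p' hp' (by rw [h.1]) h.2
  have hadm : Adm E N := by
    refine ⟨?_, ?_, ?_, ?_⟩
    · intro z hz
      obtain ⟨p, hp, rfl⟩ := Finset.mem_image.1 hz
      show 0 < (p.1:ℝ) + θ
      positivity
    · intro z hz
      obtain ⟨p, hp, rfl⟩ := Finset.mem_image.1 hz
      have : p.1 < N := Finset.mem_range.1 (Finset.mem_product.1 (Finset.mem_filter.1 hp).1).1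
      have : (p.1:ℝ) + 1 ≤ N := by exact_mod_cast this
      show (p.1:ℝ) + θ ≤ N
      linarith
    · intro z hz z' hz' hne
      obtain ⟨p, hp, rfl⟩ := Finset.mem_image.1 hz
      obtain ⟨p', hp', rfl⟩ := Finset.mem_image.1 hz'
      show 1 ≤ |(p.1:ℝ) + θ - (p'.1 + θ)|
      rw [add_sub_add_right_eq_sub]
      have h : p.1 ≠ p'.1 := fun h => hne (by simp [h])
      have : 1 ≤ |(p.1:ℤ) - p'.1| := Int.one_le_abs (by omega)
      exact_mod_cast this
    · intro z hz z' hz' h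
      obtain ⟨p, hp, rfl⟩ := Finset.mem_image.1 hz
      obtain ⟨p', hp', rfl⟩ := Finset.mem_image.1 hz'
      simp only [Prod.mk.injEq] at h
      rw [hinj p hp p' hp' h.1 h.2]
  have := hw g hg E N hN' hadm l hl.le (by
    intro z hz
    obtain ⟨p, hp, rfl⟩ := Finset.mem_image.1 hz
    have := hY2 p hp
    rw [← ofReal_norm, ENNReal.ofReal_lt_ofReal_iff'] at this
    exact this.1.le)
  have h3 := ENNReal.rpow_le_rpow this q0.le
  rw [ENNReal.mul_rpow_of_nonneg _ _ q0.le, eLpNorm_pow q0, ENNReal.ofReal_rpow_of_nonneg (by positivity) q0.le, ENNReal.ofReal_rpow_of_nonneg (by positivity) q0.le,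
    Real.mul_rpow hl.le (by positivity), ← Real.rpow_mul (by positivity), one_div_mul_cancel q0.ne', Real.rpow_one, Real.mul_rpow hC.le (by positivity), ← Real.rpow_mul (by positivity), hcard] at h3
  rw [← ENNReal.ofReal_mul (by positivity)]
  have e5 : (1 / 2 - 1 / q) * q = q / 2 - 1 := by field_simp
  rw [e5] at h3
  exact h3

lemma lint_split (f : ℝ → ℝ≥0∞) (hf : Measurable f) (N : ℕ) : ∫⁻ r in Ioc (0:ℝ) N, f r = ∫⁻ θ in Ioc (0:ℝ) 1, ∑ m ∈ Finset.range N, f (m + θ) := by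
  have hfm : ∀ m ∈ Finset.range N, Measurable (fun θ : ℝ => f (m + θ)) := fun m _ => hf.comp (by fun_prop : Measurable fun θ : ℝ => (m:ℝ) + θ)
  rw [lintegral_finset_sum _ hfm]
  clear hfm
  induction N with
  | zero => simp
  | succ n ih =>
    rw [Finset.sum_range_succ, ← ih]
    have : Ioc (0:ℝ) ((n + 1 : ℕ):ℝ) = Ioc (0:ℝ) n ∪ Ioc (n:ℝ) (n + 1) := by
      push_cast
      rw [Ioc_union_Ioc_eq_Ioc (by positivity) (by linarith)]
    rw [this, lintegral_union measurableSet_Ioc (by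
      rw [Set.disjoint_left]; intro x hx hx2; exact absurd hx.2 (not_le.2 hx2.1))]
    congr 1
    rw [← lintegral_indicator measurableSet_Ioc, ← lintegral_indicator measurableSet_Ioc, ← lintegral_add_left_eq_self _ (n:ℝ)]
    congr 1; ext r
    simp only [indicator_apply, mem_Ioc]
    congr 1
    simp

lemma vr_weak (hd : 4 ≤ d) {q : ℝ} (hq2 : 2 < q) (hq : 1 / q < 1 / 2 - (2 * kap d)⁻¹) : ∃ C : ℝ, 0 < C ∧ ∀ g : Ed d → ℂ, Integrable g → 
    ∀ N : ℕ, 1 ≤ N → ∀ l : ℝ, 0 < l → 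
    ENNReal.ofReal (l ^ q) * ((volume.restrict (Ioc (0:ℝ) N)).prod (volume : Measure (Ed d))) {p | ENNReal.ofReal l < vr d g p.1 p.2} ≤ 
      ENNReal.ofReal (C * ((N:ℝ) ^ (d - 1)) ^ (q / 2 - 1)) * ∫⁻ x, ‖g x‖ₑ ^ q := by
  obtain ⟨C, hC, hw⟩ := weak_theta hd hq2 hq
  refine ⟨C, hC, fun g hg N hN l hl => ?_⟩
  have hS : MeasurableSet {p : ℝ × Ed d | ENNReal.ofReal l < vr d g p.1 p.2} := measurableSet_lt measurable_const (vr_meas hg)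
  rw [Measure.prod_apply hS]
  have hfm : Measurable (fun r => volume (Prod.mk r ⁻¹' {p : ℝ × Ed d | ENNReal.ofReal l < vr d g p.1 p.2})) := measurable_measure_prodMk_left hS
  have hfm2 : Measurable (fun θ : ℝ => ∑ m ∈ Finset.range N, volume (Prod.mk ((m:ℝ) + θ) ⁻¹' {p : ℝ × Ed d | ENNReal.ofReal l < vr d g p.1 p.2})) :=
    Finset.measurable_sum _ fun m _ => hfm.comp (by fun_prop : Measurable fun θ : ℝ => (m:ℝ) + θ)
  rw [lint_split _ hfm, ← lintegral_const_mul _ hfm2]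
  calc _ ≤ ∫⁻ θ in Ioc (0:ℝ) 1, ENNReal.ofReal (C * ((N:ℝ) ^ (d - 1)) ^ (q / 2 - 1)) * ∫⁻ x, ‖g x‖ₑ ^ q := 
        setLIntegral_mono' measurableSet_Ioc fun θ hθ => hw g hg N hN θ hθ.1 hθ.2 l hl
    _ = _ := by rw [setLIntegral_const]; simp
end vr

end Part16

section Part17
set_option linter.all false

section linf
variable {d : ℕ} [NeZero d]

lemma kap_sqrt {a : ℝ} (ha : 0 ≤ a) : a ^ kap d = Real.sqrt (a ^ (d - 1)) := by
  have : 1 ≤ d := NeZero.one_le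
  rw [Real.sqrt_eq_rpow, ← Real.rpow_natCast, ← Real.rpow_mul ha, kap]
  congr 1
  push_cast [Nat.cast_sub this]; ring

lemma dual_pick {ι : Type} (F : Finset ι) {g : Ed d → ℂ} (hg : Integrable g) (r : ℝ) (Y : ι → Ed d) :
    ∃ c : ι → ℂ, (∀ i, ‖c i‖ ≤ 1) ∧ ∑ i ∈ F, ‖Vf d g r (Y i)‖ₑ ≤ ∫⁻ y, ‖g y‖ₑ * ‖∑ i ∈ F, c i * Phi d r (Y i) y‖ₑ := by
  have hc : ∀ i : ι, ∃ c : ℂ, ‖c‖ ≤ 1 ∧ c * Vf d g r (Y i) = (‖Vf d g r (Y i)‖ : ℂ) := by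
    intro i
    by_cases h : Vf d g r (Y i) = 0
    · exact ⟨0, by simp, by simp [h]⟩
    · refine ⟨(‖Vf d g r (Y i)‖ : ℂ) / Vf d g r (Y i), ?_, ?_⟩
      · rw [norm_div]; simp [h]
      · field_simp
  choose c hc1 hc2 using hc
  refine ⟨c, hc1, ?_⟩
  have e1 : ((∑ i ∈ F, ‖Vf d g r (Y i)‖ : ℝ) : ℂ) = ∫ y, g y * ∑ i ∈ F, c i * Phi d r (Y i) y := by
    have : ∀ y, g y * ∑ i ∈ F, c i * Phi d r (Y i) y = ∑ i ∈ F, c i * (g y * Phi d r (Y i) y) := by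
      intro y
      rw [Finset.mul_sum]
      refine Finset.sum_congr rfl fun z _ => by ring
    simp_rw [this]
    rw [integral_finset_sum _ (fun z _ => (Vf_int hg _ _).const_mul _)]
    push_cast
    refine Finset.sum_congr rfl fun z _ => ?_
    rw [integral_const_mul, ← hc2 z]; rfl
  calc ∑ i ∈ F, ‖Vf d g r (Y i)‖ₑ = ‖((∑ i ∈ F, ‖Vf d g r (Y i)‖ : ℝ) : ℂ)‖ₑ := by
        rw [← ofReal_norm, Complex.norm_real, Real.norm_of_nonneg (Finset.sum_nonneg fun _ _ => norm_nonneg _), ENNReal.ofReal_sum_of_nonneg (fun _ _ => norm_nonneg _)]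
        simp_rw [ofReal_norm]
    _ ≤ ∫⁻ y, ‖g y * ∑ i ∈ F, c i * Phi d r (Y i) y‖ₑ := by rw [e1]; exact enorm_integral_le_lintegral_enorm _
    _ = _ := by simp_rw [enorm_mul]

lemma vn_pick {g : Ed d → ℂ} (hg : Integrable g) (r : ℝ) (n : Fin d → ℤ) : ∃ y : Ed d, cell y = n ∧ vn d g r n ≤ 2 * ‖Vf d g r y‖ₑ := by
  set x : Ed d := WithLp.toLp 2 (fun i => (n i : ℝ)) with hx
  have hxn : cell x = n := by ext i; simp [cell, hx]
  have hfin : vn d g r n ≠ ⊤ := by have := vr_fin hg r x; rwa [vr, hxn] at this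
  by_cases h0 : vn d g r n = 0
  · exact ⟨x, hxn, by rw [h0]; exact zero_le⟩
  · obtain ⟨y, hy⟩ := lt_iSup_iff.1 (ENNReal.half_lt_self h0 hfin)
    refine ⟨y.1, y.2, ?_⟩
    calc vn d g r n = 2 * (vn d g r n / 2) := (ENNReal.mul_div_cancel (by norm_num) (by norm_num)).symm
      _ ≤ _ := by gcongr; exact hy.le

lemma bl_close {Λ : ℝ} (hΛ : 0 < Λ) {x y : Ed d} (h : bl Λ x = bl Λ y) : ‖x - y‖ ≤ d * Λ := by
  have : ∀ i, |(x - y) i| ≤ Λ := by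
    intro i
    have h1 : ⌊x i / Λ⌋ = ⌊y i / Λ⌋ := congrFun h i
    have h2 := Int.abs_sub_lt_one_of_floor_eq_floor h1
    rw [← sub_div, abs_div, abs_of_pos hΛ, div_lt_one hΛ] at h2
    simpa using h2.le
  rw [EuclideanSpace.norm_eq, Real.sqrt_le_left (by positivity)]
  calc _ ≤ ∑ i : Fin d, Λ ^ 2 := Finset.sum_le_sum fun i _ => by
        rw [Real.norm_eq_abs]; gcongr; exact this i
    _ = d * Λ ^ 2 := by simp
    _ ≤ _ := by
      have : (1:ℝ) ≤ d := by exact_mod_cast (NeZero.one_le : 1 ≤ d)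
      rw [mul_pow]; gcongr; nlinarith

lemma bl_cell {M : ℕ} (hM : 1 ≤ M) {y : Ed d} {B : Fin d → ℤ} :
    bl (M:ℝ) y = B ↔ cell y ∈ Fintype.piFinset (fun i => Finset.Ico ((M:ℤ) * B i) (M * (B i + 1))) := by
  have hM' : (0:ℝ) < M := by exact_mod_cast hM
  rw [Fintype.mem_piFinset, funext_iff]
  refine forall_congr' fun i => ?_
  rw [Finset.mem_Ico, cell, bl, Int.floor_eq_iff, Int.le_floor, Int.floor_lt, le_div_iff₀ hM', div_lt_iff₀ hM']
  push_cast
  rw [mul_comm (M:ℝ), mul_comm (M:ℝ)]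

lemma EL_vr_inf (hd : 3 ≤ d) : ∃ C : ℝ, 0 < C ∧ ∀ g : Ed d → ℂ, Integrable g → ∀ b : ℝ, 0 ≤ b → (∀ x, ‖g x‖ ≤ b) → ∀ r : ℝ, 0 < r → ∀ M : ℕ, 1 ≤ M →
    ∀ x, EL (M:ℝ) (vr d g r) x ≤ ENNReal.ofReal (C * ((r + M) / M) ^ kap d * b) := by
  classical
  obtain ⟨C1, hC1, hann⟩ := annulus_vol d
  obtain ⟨C2, hC2, hF2⟩ := Phi_F2 (d := d) hd
  refine ⟨2 * Real.sqrt (C1 * C2 * (d + 1) ^ d), by positivity, fun g hg b hb hgb r hr M hM x => ?_⟩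
  have hM' : (1:ℝ) ≤ M := by exact_mod_cast hM
  set B := bl (M:ℝ) x with hB
  set F := Fintype.piFinset (fun i => Finset.Ico ((M:ℤ) * B i) (M * (B i + 1))) with hF
  have hcard : F.card = M ^ d := by
    rw [hF, Fintype.card_piFinset]
    have : ∀ i, (Finset.Ico ((M:ℤ) * B i) (M * (B i + 1))).card = M := by
      intro i; rw [Int.card_Ico, mul_add, mul_one, add_sub_cancel_left]; simp
    simp [this]
  choose Y hY1 hY2 using vn_pick hg r
  obtain ⟨c, hc1, hc2⟩ := dual_pick F hg r Y
  set S : Ed d → ℂ := fun y => ∑ i ∈ F, c i * Phi d r (Y i) y with hS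
  have hScont : Continuous S := continuous_finset_sum _ fun z _ => continuous_const.mul (Phi_cont_y _ _)
  -- step 1
  have s1 : (∫⁻ y, if bl (M:ℝ) x = bl (M:ℝ) y then vr d g r y else 0) ≤ 2 * ∫⁻ y, ‖g y‖ₑ * ‖S y‖ₑ := by
    calc _ ≤ ∫⁻ y, ∑ n ∈ F, ((cell : Ed d → _) ⁻¹' {n}).indicator (fun _ => vn d g r n) y := by
          refine lintegral_mono fun y => ?_
          show (if bl (M:ℝ) x = bl (M:ℝ) y then vr d g r y else 0) ≤ _
          split_ifs with h
          · have : cell y ∈ F := (bl_cell hM).1 h.symm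
            refine le_trans ?_ (Finset.single_le_sum (fun _ _ => zero_le) this)
            rw [indicator_of_mem (by simp)]; rfl
          · exact zero_le
      _ = ∑ n ∈ F, vn d g r n := by
          rw [lintegral_finset_sum _ (fun n _ => measurable_const.indicator (cell_meas (measurableSet_singleton n)))]
          refine Finset.sum_congr rfl fun n _ => ?_
          rw [lintegral_indicator_const (cell_meas (measurableSet_singleton n))]
          have h := bl_vol (d := d) (Λ := 1) one_pos n
          have e : (bl 1 : Ed d → _) = cell := by ext x; rw [bl_one]
          rw [e] at h
          rw [h]; simp
      _ ≤ ∑ n ∈ F, 2 * ‖Vf d g r (Y n)‖ₑ := Finset.sum_le_sum fun n _ => hY2 n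
      _ ≤ _ := by rw [← Finset.mul_sum]; gcongr
  -- support
  set w : ℝ := (d + 1) * M with hw
  have hd0 : (0:ℝ) ≤ d := Nat.cast_nonneg _
  have hw0 : 0 < w := by positivity
  set A : Set (Ed d) := {y | |‖x - y‖ - r| ≤ w} with hA
  have hAm : MeasurableSet A := (isClosed_le (by fun_prop) (by fun_prop)).measurableSet
  have hSA : ∀ y ∉ A, S y = 0 := by
    intro y hy
    refine Finset.sum_eq_zero fun n hn => ?_
    by_contra hne
    apply hy
    have n1 : ¬ 1 / 100 < |‖Y n - y‖ - r| := fun h => hne (by rw [Phi_supp hr.le h, mul_zero])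
    push Not at n1
    have hb : bl (M:ℝ) (Y n) = B := (bl_cell hM).2 (by rw [hY1]; exact hn)
    have n2 := bl_close (by linarith) (hB.symm.trans hb.symm)
    have n3 := abs_norm_sub_norm_le (x - y) (Y n - y)
    rw [sub_sub_sub_cancel_right] at n3
    have n4 := n3.trans n2
    rw [abs_le] at n1 n4
    have e : w = d * M + M := by rw [hw]; ring
    rw [hA, mem_setOf_eq, abs_le, e]
    constructor <;> linarith
  -- step 2
  have s2 : ∫⁻ y, ‖g y‖ₑ * ‖S y‖ₑ ≤ ENNReal.ofReal b * (volume A ^ (1 / 2 : ℝ) * eLpNorm S 2 volume) := by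
    have hind : AEStronglyMeasurable (A.indicator (fun _ => (1:ℂ))) (volume : Measure (Ed d)) := (aestronglyMeasurable_const).indicator hAm
    have h := holder_set (q := 2) hind hScont.aestronglyMeasurable le_rfl hAm hSA
    rw [ENNReal.ofReal_ofNat, eLpNorm_indicator_const hAm (by norm_num) (by norm_num)] at h
    simp only [enorm_one, one_mul, sub_self, ENNReal.rpow_zero, mul_one, ENNReal.toReal_ofNat] at h
    calc _ ≤ ∫⁻ y, ENNReal.ofReal b * (‖A.indicator (fun _ => (1:ℂ)) y‖ₑ * ‖S y‖ₑ) := by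
          refine lintegral_mono fun y => ?_
          by_cases hy : y ∈ A
          · simp only [indicator_of_mem hy, enorm_one, one_mul]
            gcongr
            rw [← ofReal_norm]; exact ENNReal.ofReal_le_ofReal (hgb y)
          · simp only [hSA y hy]; simp
      _ = ENNReal.ofReal b * ∫⁻ y, (‖A.indicator (fun _ => (1:ℂ)) y‖ₑ * ‖S y‖ₑ) := lintegral_const_mul' _ _ ENNReal.ofReal_ne_top
      _ ≤ _ := by gcongr
  have s3 : eLpNorm S 2 volume ≤ ENNReal.ofReal (Real.sqrt (C2 * M ^ d)) := by
    have h := hF2 r hr F Y (fun i _ j _ hij => by simpa [hY1] using hij) c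
    have h2 : C2 * ∑ i ∈ F, ‖c i‖ ^ 2 ≤ C2 * M ^ d := by
      gcongr
      calc _ ≤ ∑ i ∈ F, (1:ℝ) := Finset.sum_le_sum fun i _ => pow_le_one₀ (norm_nonneg _) (hc1 i)
        _ = _ := by rw [Finset.sum_const, hcard]; simp
    have h3 := h.trans (ENNReal.ofReal_le_ofReal h2)
    rw [← ENNReal.pow_le_pow_left_iff (n := 2) (by norm_num), ← ENNReal.ofReal_pow (Real.sqrt_nonneg _), Real.sq_sqrt (by positivity)]
    exact h3
  have s4 : volume A ^ (1 / 2 : ℝ) ≤ ENNReal.ofReal (Real.sqrt (C1 * (d + 1) ^ d * ((r + M) ^ (d - 1) * M))) := by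
    have h := hann x r w hr hw0
    have h2 : C1 * (r + w) ^ (d - 1) * w ≤ C1 * (d + 1) ^ d * ((r + M) ^ (d - 1) * M) := by
      have e : ((d:ℝ) + 1) ^ d = (d + 1) ^ (d - 1) * (d + 1) := by rw [← pow_succ, Nat.sub_add_cancel NeZero.one_le]
      have e2 : r + w ≤ (d + 1) * (r + M) := by rw [hw]; nlinarith
      calc _ ≤ C1 * ((d + 1) * (r + M)) ^ (d - 1) * w := by gcongr
        _ = _ := by rw [mul_pow, e, hw]; ring
    calc _ ≤ ENNReal.ofReal (C1 * (d + 1) ^ d * ((r + M) ^ (d - 1) * M)) ^ (1 / 2 : ℝ) := by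
          gcongr; exact h.trans (ENNReal.ofReal_le_ofReal h2)
      _ = _ := by rw [ENNReal.ofReal_rpow_of_nonneg (by positivity) (by norm_num), Real.sqrt_eq_rpow]
  have hMd : (0:ℝ) < (M:ℝ) ^ d := by positivity
  calc EL (M:ℝ) (vr d g r) x ≤ (ENNReal.ofReal ((M:ℝ) ^ d))⁻¹ * (2 * (ENNReal.ofReal b * (ENNReal.ofReal (Real.sqrt (C1 * (d + 1) ^ d * ((r + M) ^ (d - 1) * M))) * ENNReal.ofReal (Real.sqrt (C2 * M ^ d))))) := by
        unfold EL
        have := s1.trans (mul_le_mul_right s2 2)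
        have h5 := mul_le_mul' s4 s3
        gcongr
        exact this.trans (by gcongr)
    _ = ENNReal.ofReal (((M:ℝ) ^ d)⁻¹ * (2 * (b * (Real.sqrt (C1 * (d + 1) ^ d * ((r + M) ^ (d - 1) * M)) * Real.sqrt (C2 * M ^ d))))) := by
        rw [ENNReal.ofReal_mul (by positivity), ENNReal.ofReal_mul (by positivity), ENNReal.ofReal_mul (by positivity), ENNReal.ofReal_mul (by positivity), ENNReal.ofReal_inv_of_pos hMd]; simp
    _ = _ := by
        congr 1
        rw [kap_sqrt (by positivity), ← Real.sqrt_mul (by positivity)]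
        have : C1 * (d + 1) ^ d * ((r + M) ^ (d - 1) * M) * (C2 * M ^ d) = (C1 * C2 * (d + 1) ^ d) * ((((r + M) / M) ^ (d - 1)) * ((M:ℝ) ^ d) ^ 2) := by
          have e : (M:ℝ) ^ d = M ^ (d - 1) * M := by rw [← pow_succ, Nat.sub_add_cancel NeZero.one_le]
          rw [e, div_pow]; field_simp
        rw [this, Real.sqrt_mul (by positivity) (((r + M) / M) ^ (d - 1) * ((M:ℝ) ^ d) ^ 2), Real.sqrt_mul (by positivity) (((M:ℝ) ^ d) ^ 2), Real.sqrt_sq hMd.le]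
        field_simp
end linf

end Part17

section Part18
set_option linter.all false

section star
variable {d : ℕ} [NeZero d]

/-- measure on (0,N] × ℝ^d -/
def muN (d : ℕ) (N : ℝ) : Measure (ℝ × Ed d) := (volume.restrict (Ioc (0:ℝ) N)).prod volume

lemma ELvr_meas (Λ : ℝ) {g : Ed d → ℂ} (hg : Integrable g) : Measurable (fun p : ℝ × Ed d => EL Λ (vr d g p.1) p.2) :=
  EL_meas_param Λ (vr_meas hg)

lemma star_step (hd : 4 ≤ d) {q0 q : ℝ} (h0 : 1 ≤ q0) (hq : q0 < q) : ∃ C : ℝ, 0 < C ∧ ∀ N M : ℕ, 1 ≤ M → M ≤ N → ∀ W : ℝ≥0∞, W ≠ ⊤ →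
    (∀ g : Ed d → ℂ, Integrable g → Measurable g → ∀ l : ℝ, 0 < l → ENNReal.ofReal (l ^ q0) * muN d N {p | ENNReal.ofReal l < EL (M:ℝ) (vr d g p.1) p.2} ≤ W * ∫⁻ x, ‖g x‖ₑ ^ q0) →
    ∀ g : Ed d → ℂ, Integrable g → Measurable g → ∫⁻ p, EL (M:ℝ) (vr d g p.1) p.2 ^ q ∂(muN d N) ≤ ENNReal.ofReal (C * ((N:ℝ) / M) ^ (kap d * (q - q0))) * W * ∫⁻ x, ‖g x‖ₑ ^ q := by
  obtain ⟨C, hC, hinf⟩ := EL_vr_inf (d := d) (by omega)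
  have hqq : 0 < q - q0 := by linarith
  have hq0 : 0 < q := by linarith
  refine ⟨q / (q - q0) * 2 ^ q * (C * 2 ^ kap d) ^ (q - q0), by positivity, fun N M hM hMN W hW hweak g hg hgm => ?_⟩
  have hM' : (1:ℝ) ≤ M := by exact_mod_cast hM
  have hMN' : (M:ℝ) ≤ N := by exact_mod_cast hMN
  have hN0 : (0:ℝ) < N := by linarith
  obtain ⟨D, hD, hbd⟩ := vr_bdd d
  have := marc (X := Ed d) (Ω := ℝ × Ed d) volume h0 hq (T := fun g p => EL (M:ℝ) (vr d g p.1) p.2) (μ := muN d N) (M := W) hW (B1 := C * (2 * (N / M)) ^ kap d) (by positivity)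
    (fun g hg _ => ELvr_meas _ hg) 
    (fun g hg _ p => by
      have h1 : EL (M:ℝ) (vr d g p.1) p.2 ≤ EL (M:ℝ) (fun _ => ENNReal.ofReal (D * |p.1 ^ kap d| * ∫ y, ‖g y‖)) p.2 := EL_mono _ (fun x => hbd g hg p.1 x) _
      have h2 := EL_const_bl (d := d) (Λ := (M:ℝ)) (by linarith) (u := fun _ => ENNReal.ofReal (D * |p.1 ^ kap d| * ∫ y, ‖g y‖)) (fun _ _ _ => rfl) p.2
      rw [h2] at h1
      exact (h1.trans_lt ENNReal.ofReal_lt_top).ne)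
    (fun g1 g2 i1 _ i2 _ p => by
      show EL (M:ℝ) (vr d (fun x => g1 x + g2 x) p.1) p.2 ≤ EL (M:ℝ) (vr d g1 p.1) p.2 + EL (M:ℝ) (vr d g2 p.1) p.2
      rw [← EL_add _ (vr_meas_x i1 p.1)]
      exact EL_mono _ (fun x => vr_sub i1 i2 p.1 x) _)
    hweak
    (fun g hg _ b hb hgb => by
      have hae : ∀ᵐ p ∂(muN d N), p.1 ∈ Ioc (0:ℝ) N := by
        unfold muN
        exact Measure.quasiMeasurePreserving_fst.ae (ae_restrict_mem measurableSet_Ioc)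
      filter_upwards [hae] with p hp
      refine (hinf g hg b hb hgb p.1 hp.1 M hM p.2).trans (ENNReal.ofReal_le_ofReal ?_)
      have hr := hp.1
      gcongr
      · exact kap_nonneg
      · rw [← mul_div_assoc]; gcongr; linarith [hp.2])
    g hg hgm
  refine this.trans (le_of_eq ?_)
  have hid : (C * (2 * ((N:ℝ) / M)) ^ kap d) ^ (q - q0) = (C * 2 ^ kap d) ^ (q - q0) * ((N:ℝ) / M) ^ (kap d * (q - q0)) := by
    rw [Real.mul_rpow (x := 2) (by norm_num) (by positivity), ← mul_assoc C, Real.mul_rpow (x := C * 2 ^ kap d) (by positivity) (by positivity), ← Real.rpow_mul (by positivity)]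
  congr 3
  rw [hid]
  ring

lemma vr_strong (hd : 4 ≤ d) {q0 q : ℝ} (h2 : 2 < q0) (hq0 : 1 / q0 < 1 / 2 - (2 * kap d)⁻¹) (hq : q0 < q) : ∃ C : ℝ, 0 < C ∧ ∀ N : ℕ, 1 ≤ N → 
    ∀ g : Ed d → ℂ, Integrable g → Measurable g → ∫⁻ p, vr d g p.1 p.2 ^ q ∂(muN d N) ≤ ENNReal.ofReal (C * ((N:ℝ) ^ (d - 1)) ^ (q / 2 - 1)) * ∫⁻ x, ‖g x‖ₑ ^ q := by
  obtain ⟨C1, hC1, hw⟩ := vr_weak (d := d) hd h2 hq0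
  obtain ⟨C2, hC2, hs⟩ := star_step (d := d) hd (by linarith : 1 ≤ q0) hq
  refine ⟨C1 * C2, by positivity, fun N hN g hg hgm => ?_⟩
  have e : ∀ (g : Ed d → ℂ) (p : ℝ × Ed d), EL ((1:ℕ):ℝ) (vr d g p.1) p.2 = vr d g p.1 p.2 := by
    intro g p
    push_cast
    refine EL_const_bl one_pos (fun x y h => ?_) _
    rw [bl_one, bl_one] at h
    rw [vr, vr, h]
  have hN' : (1:ℝ) ≤ N := by exact_mod_cast hN
  have := hs N 1 le_rfl hN (ENNReal.ofReal (C1 * ((N:ℝ) ^ (d - 1)) ^ (q0 / 2 - 1))) ENNReal.ofReal_ne_top (by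
    intro g hg _ l hl
    simp_rw [e]
    exact hw g hg N hN l hl) g hg hgm
  simp_rw [e] at this
  refine this.trans (le_of_eq ?_)
  rw [← ENNReal.ofReal_mul (by positivity)]
  congr 2
  have hk : kap d * (q - q0) = ((d - 1 : ℕ):ℝ) * ((q - q0) / 2) := by
    rw [kap, Nat.cast_sub NeZero.one_le]; push_cast; ring
  rw [hk, Nat.cast_one, div_one, Real.rpow_mul (by positivity), Real.rpow_natCast]
  have e3 : q / 2 - 1 = (q - q0) / 2 + (q0 / 2 - 1) := by ring
  rw [e3, Real.rpow_add (by positivity)]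
  ring

lemma lint_muN (N : ℝ) {F : ℝ × Ed d → ℝ≥0∞} (hF : Measurable F) : ∫⁻ p, F p ∂(muN d N) = ∫⁻ r in Ioc (0:ℝ) N, ∫⁻ x, F (r, x) := by
  unfold muN
  rw [lintegral_prod _ hF.aemeasurable]

lemma star_aux (hd : 4 ≤ d) {q1 q0 q : ℝ} (h2 : 2 < q1) (hq1 : 1 / q1 < 1 / 2 - (2 * kap d)⁻¹) (hq0 : q1 < q0) (hq : q0 < q) : ∃ C : ℝ, 0 < C ∧ ∀ N M : ℕ, 1 ≤ M → M ≤ N →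
    ∀ g : Ed d → ℂ, Integrable g → Measurable g → ∫⁻ r in Ioc (0:ℝ) N, ∫⁻ x, EL (M:ℝ) (vr d g r) x ^ q ≤ ENNReal.ofReal (C * (M:ℝ) ^ (-(kap d * (q - q0))) * (N:ℝ) ^ ((d - 1) * (q / 2 - 1))) * ∫⁻ x, ‖g x‖ₑ ^ q := by
  obtain ⟨C1, hC1, hw⟩ := vr_strong (d := d) hd h2 hq1 hq0
  obtain ⟨C2, hC2, hs⟩ := star_step (d := d) hd (by linarith : 1 ≤ q0) hq
  refine ⟨C1 * C2, by positivity, fun N M hM hMN g hg hgm => ?_⟩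
  have hM' : (1:ℝ) ≤ M := by exact_mod_cast hM
  have hMN' : (M:ℝ) ≤ N := by exact_mod_cast hMN
  have hN0 : (0:ℝ) < N := by linarith
  have := hs N M hM hMN (ENNReal.ofReal (C1 * ((N:ℝ) ^ (d - 1)) ^ (q0 / 2 - 1))) ENNReal.ofReal_ne_top (by
    intro g hg hgm l hl
    refine le_trans ?_ (hw N (hM.trans hMN) g hg hgm)
    have hmk := mul_meas_ge_le_lintegral ((ELvr_meas (M:ℝ) hg).pow_const q0) (μ := muN d N) (ENNReal.ofReal (l ^ q0))
    have hsub : {p : ℝ × Ed d | ENNReal.ofReal l < EL (M:ℝ) (vr d g p.1) p.2} ⊆ {p | ENNReal.ofReal (l ^ q0) ≤ EL (M:ℝ) (vr d g p.1) p.2 ^ q0} := by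
      intro p hp
      have hp' : ENNReal.ofReal l < EL (M:ℝ) (vr d g p.1) p.2 := hp
      show ENNReal.ofReal (l ^ q0) ≤ EL (M:ℝ) (vr d g p.1) p.2 ^ q0
      rw [← ENNReal.ofReal_rpow_of_pos hl]
      exact ENNReal.rpow_le_rpow hp'.le (by linarith)
    refine (mul_le_mul_right (measure_mono hsub) _).trans (hmk.trans ?_)
    rw [lint_muN _ ((ELvr_meas (M:ℝ) hg).pow_const q0), lint_muN _ ((vr_meas hg).pow_const q0)]
    exact lintegral_mono fun r => EL_contr (by linarith) (by linarith) (vr_meas_x hg r)) g hg hgm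
  rw [lint_muN _ ((ELvr_meas (M:ℝ) hg).pow_const q)] at this
  refine this.trans (le_of_eq ?_)
  rw [← ENNReal.ofReal_mul (by positivity)]
  congr 2
  have hk : kap d * (q - q0) = ((d:ℝ) - 1) * ((q - q0) / 2) := by
    rw [kap]; ring
  have hk2 : ((N:ℝ) ^ (d - 1)) ^ (q0 / 2 - 1) = (N:ℝ) ^ (((d:ℝ) - 1) * (q0 / 2 - 1)) := by
    rw [Real.rpow_mul (by positivity), ← Nat.cast_pred (NeZero.pos d), Real.rpow_natCast]
  rw [Real.div_rpow (by positivity) (by positivity), Real.rpow_neg (by positivity), hk2]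
  have e3 : ((d:ℝ) - 1) * (q / 2 - 1) = kap d * (q - q0) + ((d:ℝ) - 1) * (q0 / 2 - 1) := by rw [hk]; ring
  rw [e3, Real.rpow_add (by positivity)]
  field_simp

lemma star (hd : 4 ≤ d) {q : ℝ} (hq : 1 / q < 1 / 2 - (2 * kap d)⁻¹) (hq0 : 0 < q) : ∃ C e : ℝ, 0 < C ∧ 0 < e ∧ ∀ N M : ℕ, 1 ≤ M → M ≤ N →
    ∀ g : Ed d → ℂ, Integrable g → Measurable g → ∫⁻ r in Ioc (0:ℝ) N, ∫⁻ x, EL (M:ℝ) (vr d g r) x ^ q ≤ ENNReal.ofReal (C * (M:ℝ) ^ (-e) * (N:ℝ) ^ ((d - 1) * (q / 2 - 1))) * ∫⁻ x, ‖g x‖ₑ ^ q := by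
  have hk := kap_ge hd
  set a := 1 / 2 - (2 * kap d)⁻¹ with ha
  have h1 : 0 < (2 * kap d)⁻¹ := by positivity
  have h2 : 0 < a := lt_trans (by positivity) hq
  have h3 : a < 1 / 2 := by linarith
  have hc : 2 < a⁻¹ := by rw [lt_inv_comm₀ (by norm_num) h2]; linarith
  have hcq : a⁻¹ < q := by rw [inv_lt_comm₀ h2 hq0]; simpa using hq
  set c := a⁻¹ with hcd
  obtain ⟨C, hC, h⟩ := star_aux (d := d) hd (q1 := c + (q - c) / 3) (q0 := c + 2 * (q - c) / 3) (q := q) (by linarith) (by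
    rw [← ha, one_div, inv_lt_comm₀ (by linarith) h2]; linarith) (by linarith) (by linarith)
  exact ⟨C, kap d * (q - (c + 2 * (q - c) / 3)), hC, mul_pos (by linarith) (by linarith), h⟩
end star

end Part18

section Part19
set_option linter.all false

section step9
variable {d : ℕ} [NeZero d]

def wt (n : ℕ) (r t : ℝ) : ℝ≥0∞ := ENNReal.ofReal (((1 + |2 * Real.pi * r - t|) ^ n)⁻¹)

lemma wt_meas (n : ℕ) : Measurable (fun p : ℝ × ℝ => wt n p.1 p.2) := by
  unfold wt
  fun_prop

lemma wt_le_one (n : ℕ) (r t : ℝ) : wt n r t ≤ 1 := by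
  unfold wt
  rw [← ENNReal.ofReal_one]
  refine ENNReal.ofReal_le_ofReal (inv_le_one_of_one_le₀ (one_le_pow₀ ?_))
  linarith [abs_nonneg (2 * Real.pi * r - t)]

/-- majorant -/
def aa (d n : ℕ) (g : Ed d → ℂ) (t : ℝ) (x : Ed d) : ℝ≥0∞ := ∫⁻ r in Ioi (0:ℝ), wt n r t * vr d g r x

lemma aa_meas (n : ℕ) {g : Ed d → ℂ} (hg : Integrable g) : Measurable (fun p : ℝ × Ed d => aa d n g p.1 p.2) := by
  unfold aa
  refine Measurable.lintegral_prod_right (f := fun (z : ℝ × Ed d) (r : ℝ) => wt n r z.1 * vr d g r z.2) ?_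
  have h1 : Measurable (fun z : (ℝ × Ed d) × ℝ => wt n z.2 z.1.1) := (wt_meas n).comp (g := fun p : ℝ × ℝ => wt n p.1 p.2) (f := fun z : (ℝ × Ed d) × ℝ => (z.2, z.1.1)) (by fun_prop)
  have h2 : Measurable (fun z : (ℝ × Ed d) × ℝ => vr d g z.2 z.1.2) := (vr_meas hg).comp (f := fun z : (ℝ × Ed d) × ℝ => (z.2, z.1.2)) (by fun_prop)
  exact h1.mul h2

lemma base_int : ∃ C : ℝ, 1 ≤ C ∧ ∀ n : ℕ, 2 ≤ n → ∀ c : ℝ, ∫⁻ u : ℝ, ENNReal.ofReal (((1 + |u - c|) ^ n)⁻¹) ≤ ENNReal.ofReal C := by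
  have hi : Integrable (fun x : ℝ => (1 + ‖x‖) ^ (-(2:ℝ))) := integrable_one_add_norm (by simp)
  refine ⟨max 1 (∫ x : ℝ, (1 + ‖x‖) ^ (-(2:ℝ))), le_max_left _ _, fun n hn c => ?_⟩
  rw [lintegral_sub_right_eq_self (fun u : ℝ => ENNReal.ofReal (((1 + |u|) ^ n)⁻¹)) c]
  refine le_trans ?_ (ENNReal.ofReal_le_ofReal (le_max_right _ _))
  rw [ofReal_integral_eq_lintegral_ofReal hi (Filter.Eventually.of_forall fun x => by positivity)]
  refine lintegral_mono fun u => ENNReal.ofReal_le_ofReal ?_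
  rw [Real.rpow_neg (by positivity), Real.rpow_two, Real.norm_eq_abs]
  have : 1 ≤ 1 + |u| := by linarith [abs_nonneg u]
  gcongr

lemma wt_int_r : ∃ C : ℝ, 1 ≤ C ∧ ∀ n : ℕ, 2 ≤ n → (∀ t, ∫⁻ r, wt n r t ≤ ENNReal.ofReal C) ∧ (∀ r, ∫⁻ t, wt n r t ≤ ENNReal.ofReal C) := by
  obtain ⟨C, hC, h⟩ := base_int
  refine ⟨C, hC, fun n hn => ⟨fun t => ?_, fun r => ?_⟩⟩
  · refine le_trans (lintegral_mono fun r => ?_) (h n hn (t / (2 * Real.pi)))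
    unfold wt
    refine ENNReal.ofReal_le_ofReal ?_
    have hpi := Real.pi_gt_three
    have e : 2 * Real.pi * r - t = 2 * Real.pi * (r - t / (2 * Real.pi)) := by field_simp
    have : |r - t / (2 * Real.pi)| ≤ |2 * Real.pi * r - t| := by
      rw [e, abs_mul, abs_of_pos (by positivity : 0 < 2 * Real.pi)]
      nlinarith [abs_nonneg (r - t / (2 * Real.pi))]
    gcongr
  · refine le_trans (le_of_eq ?_) (h n hn (2 * Real.pi * r))
    unfold wt
    refine lintegral_congr fun t => ?_
    rw [abs_sub_comm]

lemma W_bound : ∃ C : ℝ, 0 < C ∧ ∀ n : ℕ, 2 ≤ n → ∀ R : ℝ, 1 ≤ R → ∀ r : ℝ, 0 < r →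
    ∫⁻ t in Ioc 0 R, wt n r t ≤ ∑' i : ℕ, ENNReal.ofReal (C * 2 ^ n * ((2:ℝ) ^ (i * n))⁻¹) * (Ioc (0:ℝ) (2 ^ i * R)).indicator 1 r := by
  obtain ⟨C, hC, h⟩ := wt_int_r
  refine ⟨C, by linarith, fun n hn R hR r hr => ?_⟩
  by_cases hrR : r ≤ R
  · refine le_trans ?_ (ENNReal.le_tsum 0)
    have hm : r ∈ Ioc (0:ℝ) (2 ^ 0 * R) := ⟨hr, by simpa using hrR⟩
    rw [indicator_of_mem hm, Pi.one_apply, mul_one]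
    refine (setLIntegral_le_lintegral _ _).trans (((h n hn).2 r).trans (ENNReal.ofReal_le_ofReal ?_))
    have : (1:ℝ) ≤ 2 ^ n := one_le_pow₀ (by norm_num)
    simp
    nlinarith
  · push Not at hrR
    obtain ⟨i, hi1, hi2⟩ := exists_nat_pow_near (x := r / R) (y := 2) (by rw [le_div_iff₀ (by linarith)]; linarith) (by norm_num)
    rw [le_div_iff₀ (by linarith)] at hi1
    rw [div_lt_iff₀ (by linarith)] at hi2
    refine le_trans ?_ (ENNReal.le_tsum (i + 1))
    have hm : r ∈ Ioc (0:ℝ) (2 ^ (i + 1) * R) := ⟨hr, hi2.le⟩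
    rw [indicator_of_mem hm, Pi.one_apply, mul_one]
    have hb : ∀ t ∈ Ioc (0:ℝ) R, wt n r t ≤ ENNReal.ofReal (((2 ^ i * R) ^ n)⁻¹) := by
      intro t ht
      unfold wt
      refine ENNReal.ofReal_le_ofReal ?_
      have hpi := Real.pi_gt_three
      have h1 : 2 ^ i * R ≤ 1 + |2 * Real.pi * r - t| := by
        have := le_abs_self (2 * Real.pi * r - t)
        nlinarith [ht.2]
      gcongr
    refine (setLIntegral_mono' measurableSet_Ioc hb).trans ?_
    rw [setLIntegral_const, Real.volume_Ioc, ← ENNReal.ofReal_mul (by positivity)]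
    refine ENNReal.ofReal_le_ofReal ?_
    have e : C * 2 ^ n * ((2:ℝ) ^ ((i + 1) * n))⁻¹ = C * ((2 ^ i) ^ n)⁻¹ := by
      rw [← pow_mul, add_mul, pow_add, one_mul]; field_simp
    rw [e, sub_zero, mul_pow, mul_inv, mul_comm C, mul_assoc]
    gcongr
    obtain ⟨m, rfl⟩ : ∃ m, n = m + 1 := ⟨n - 1, by omega⟩
    rw [pow_succ, mul_inv, mul_assoc, inv_mul_cancel₀ (by positivity), mul_one]
    exact (inv_le_one_of_one_le₀ (one_le_pow₀ hR)).trans hC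

lemma sum_geo (D : ℝ) (n : ℕ) (hn : D + 1 ≤ n) : ∑' i : ℕ, ENNReal.ofReal (((2:ℝ) ^ (i * n))⁻¹ * ((2:ℝ) ^ i) ^ D) ≤ ENNReal.ofReal 2 := by
  have h : ∀ i : ℕ, ((2:ℝ) ^ (i * n))⁻¹ * ((2:ℝ) ^ i) ^ D ≤ (1 / 2) ^ i := by
    intro i
    rw [← Real.rpow_natCast, ← Real.rpow_natCast 2 i, ← Real.rpow_mul (by norm_num), ← Real.rpow_neg (by norm_num), ← Real.rpow_add (by norm_num), one_div, inv_pow, ← Real.rpow_natCast 2 i, ← Real.rpow_neg (by norm_num)]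
    refine Real.rpow_le_rpow_of_exponent_le (by norm_num) ?_
    push_cast
    have : (0:ℝ) ≤ i := by positivity
    nlinarith
  refine (ENNReal.tsum_le_tsum fun i => ENNReal.ofReal_le_ofReal (h i)).trans ?_
  rw [← ENNReal.ofReal_tsum_of_nonneg (fun i => by positivity) (summable_geometric_of_lt_one (by norm_num) (by norm_num)), tsum_geometric_of_lt_one (by norm_num) (by norm_num)]
  norm_num

lemma step9 (hd : 4 ≤ d) {q : ℝ} (hq : 1 / q < 1 / 2 - (2 * kap d)⁻¹) (hq1 : 1 < q) (n : ℕ) (hn2 : 2 ≤ n) (hn : ((d:ℝ) - 1) * (q / 2 - 1) + 1 ≤ n) :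
    ∃ C e : ℝ, 0 < C ∧ 0 < e ∧ ∀ k s : ℕ, s ≤ k → ∀ g : Ed d → ℂ, Integrable g → Measurable g →
    ∫⁻ t in Ioc (0:ℝ) (2 ^ k), ∫⁻ x, EL ((2:ℝ) ^ s) (aa d n g t) x ^ q ≤ ENNReal.ofReal (C * ((2:ℝ) ^ s) ^ (-e) * ((2:ℝ) ^ k) ^ (((d:ℝ) - 1) * (q / 2 - 1))) * ∫⁻ x, ‖g x‖ₑ ^ q := by
  obtain ⟨C1, e, hC1, he, hst⟩ := star (d := d) hd hq (by linarith)
  obtain ⟨C2, hC2, hw⟩ := wt_int_r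
  obtain ⟨C3, hC3, hW⟩ := W_bound
  set D := ((d:ℝ) - 1) * (q / 2 - 1) with hD
  refine ⟨C2 ^ (q - 1) * (C3 * 2 ^ n * C1 * 2), e, by positivity, he, fun k s hsk g hg hgm => ?_⟩
  set R : ℝ := 2 ^ k with hR
  have hR1 : 1 ≤ R := one_le_pow₀ (by norm_num)
  set G : ℝ → Ed d → ℝ≥0∞ := fun r x => EL ((2:ℝ) ^ s) (vr d g r) x with hG
  have hGm : Measurable (fun p : ℝ × Ed d => G p.1 p.2) := ELvr_meas _ hg
  have h1 : ∀ t x, EL ((2:ℝ) ^ s) (aa d n g t) x ^ q ≤ ENNReal.ofReal C2 ^ (q - 1) * ∫⁻ r in Ioi (0:ℝ), wt n r t * G r x ^ q := by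
    intro t x
    have hwm : Measurable (fun r => wt n r t) := (wt_meas n).comp (g := fun p : ℝ × ℝ => wt n p.1 p.2) (f := fun r => (r, t)) (by fun_prop)
    have e1 : EL ((2:ℝ) ^ s) (aa d n g t) x = ∫⁻ r in Ioi (0:ℝ), wt n r t * G r x :=
      EL_lintegral ((2:ℝ) ^ s) (μ := volume.restrict (Ioi (0:ℝ))) (w := fun r => wt n r t) (u := fun p => vr d g p.1 p.2) hwm (vr_meas hg) x
    rw [e1]
    refine (jensen_weight (μ := volume.restrict (Ioi (0:ℝ))) hq1 hwm (hGm.comp (f := fun r : ℝ => (r, x)) (by fun_prop))).trans ?_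
    refine mul_le_mul_left (ENNReal.rpow_le_rpow ?_ (by linarith)) _
    · exact (setLIntegral_le_lintegral _ _).trans ((hw n hn2).1 t)
  have h2 : ∫⁻ t in Ioc (0:ℝ) R, ∫⁻ x, EL ((2:ℝ) ^ s) (aa d n g t) x ^ q ≤ ENNReal.ofReal C2 ^ (q - 1) * ∫⁻ r in Ioi (0:ℝ), (∫⁻ t in Ioc (0:ℝ) R, wt n r t) * ∫⁻ x, G r x ^ q := by
    have hGq : Measurable (fun p : ℝ × Ed d => G p.1 p.2 ^ q) := hGm.pow_const q
    have hm1 : Measurable (fun z : (ℝ × Ed d) × ℝ => wt n z.2 z.1.1 * G z.2 z.1.2 ^ q) := by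
      have a1 : Measurable (fun z : (ℝ × Ed d) × ℝ => wt n z.2 z.1.1) := (wt_meas n).comp (g := fun p : ℝ × ℝ => wt n p.1 p.2) (f := fun z : (ℝ × Ed d) × ℝ => (z.2, z.1.1)) (by fun_prop)
      have a2 : Measurable (fun z : (ℝ × Ed d) × ℝ => G z.2 z.1.2 ^ q) := hGq.comp (g := fun p : ℝ × Ed d => G p.1 p.2 ^ q) (f := fun z : (ℝ × Ed d) × ℝ => (z.2, z.1.2)) (by fun_prop)
      exact a1.mul a2
    have hGr : Measurable (fun r => ∫⁻ x, G r x ^ q) := Measurable.lintegral_prod_right hGq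
    calc _ ≤ ∫⁻ t in Ioc (0:ℝ) R, ∫⁻ x, ENNReal.ofReal C2 ^ (q - 1) * ∫⁻ r in Ioi (0:ℝ), wt n r t * G r x ^ q := lintegral_mono fun t => lintegral_mono fun x => h1 t x
      _ = ENNReal.ofReal C2 ^ (q - 1) * ∫⁻ t in Ioc (0:ℝ) R, ∫⁻ x, ∫⁻ r in Ioi (0:ℝ), wt n r t * G r x ^ q := by
          have hne : ENNReal.ofReal C2 ^ (q - 1) ≠ ⊤ := ENNReal.rpow_ne_top_of_nonneg (by linarith) ENNReal.ofReal_ne_top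
          rw [← lintegral_const_mul' _ _ hne]
          refine lintegral_congr fun t => ?_
          rw [lintegral_const_mul' _ _ hne]
      _ = ENNReal.ofReal C2 ^ (q - 1) * ∫⁻ t in Ioc (0:ℝ) R, ∫⁻ r in Ioi (0:ℝ), wt n r t * ∫⁻ x, G r x ^ q := by
          congr 1
          refine lintegral_congr fun t => ?_
          rw [lintegral_lintegral_swap]
          · refine lintegral_congr fun r => ?_
            rw [lintegral_const_mul]
            exact hGq.comp (g := fun p : ℝ × Ed d => G p.1 p.2 ^ q) (f := fun x => (r, x)) (by fun_prop)
          · exact (hm1.comp (g := fun z : (ℝ × Ed d) × ℝ => wt n z.2 z.1.1 * G z.2 z.1.2 ^ q) (f := fun p : Ed d × ℝ => ((t, p.1), p.2)) (by fun_prop)).aemeasurable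
      _ = _ := by
          congr 1
          rw [lintegral_lintegral_swap]
          · refine lintegral_congr fun r => ?_
            rw [lintegral_mul_const]
            exact (wt_meas n).comp (g := fun p : ℝ × ℝ => wt n p.1 p.2) (f := fun t => (r, t)) (by fun_prop)
          · have a1 : Measurable (fun z : ℝ × ℝ => wt n z.2 z.1) := (wt_meas n).comp (g := fun p : ℝ × ℝ => wt n p.1 p.2) (f := fun z : ℝ × ℝ => (z.2, z.1)) (by fun_prop)
            have a2 : Measurable (fun z : ℝ × ℝ => ∫⁻ x, G z.2 x ^ q) := hGr.comp measurable_snd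
            exact (a1.mul a2).aemeasurable
  refine h2.trans ?_
  have hGr : Measurable (fun r => ∫⁻ x, G r x ^ q) := Measurable.lintegral_prod_right (hGm.pow_const q)
  set I := ∫⁻ x, ‖g x‖ₑ ^ q with hI
  have h3 : ∫⁻ r in Ioi (0:ℝ), (∫⁻ t in Ioc (0:ℝ) R, wt n r t) * ∫⁻ x, G r x ^ q ≤ ∑' i : ℕ, ENNReal.ofReal (C3 * 2 ^ n * ((2:ℝ) ^ (i * n))⁻¹) * ∫⁻ r in Ioc (0:ℝ) (2 ^ i * R), ∫⁻ x, G r x ^ q := by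
    calc _ ≤ ∫⁻ r in Ioi (0:ℝ), ∑' i : ℕ, ENNReal.ofReal (C3 * 2 ^ n * ((2:ℝ) ^ (i * n))⁻¹) * (Ioc (0:ℝ) (2 ^ i * R)).indicator (fun r => ∫⁻ x, G r x ^ q) r := by
          refine setLIntegral_mono' measurableSet_Ioi fun r hr => ?_
          refine (mul_le_mul_left (hW n hn2 R hR1 r hr) _).trans (le_of_eq ?_)
          rw [← ENNReal.tsum_mul_right]
          refine tsum_congr fun i => ?_
          rw [mul_assoc]
          congr 1
          by_cases hr' : r ∈ Ioc (0:ℝ) (2 ^ i * R)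
          · rw [indicator_of_mem hr', indicator_of_mem hr', Pi.one_apply, one_mul]
          · rw [indicator_of_notMem hr', indicator_of_notMem hr', zero_mul]
      _ ≤ _ := by
          rw [lintegral_tsum fun i => ((hGr.indicator measurableSet_Ioc).const_mul _).aemeasurable]
          refine ENNReal.tsum_le_tsum fun i => ?_
          rw [lintegral_const_mul _ (hGr.indicator measurableSet_Ioc)]
          refine mul_le_mul_right ?_ _
          refine (setLIntegral_le_lintegral _ _).trans ?_
          rw [lintegral_indicator measurableSet_Ioc]
  have h4 : ∀ i : ℕ, ∫⁻ r in Ioc (0:ℝ) (2 ^ i * R), ∫⁻ x, G r x ^ q ≤ ENNReal.ofReal (C1 * ((2:ℝ) ^ s) ^ (-e) * (2 ^ i * R) ^ D) * I := by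
    intro i
    have := hst (2 ^ i * 2 ^ k) (2 ^ s) Nat.one_le_two_pow (by
      calc 2 ^ s ≤ 2 ^ k := Nat.pow_le_pow_right (by norm_num) hsk
        _ ≤ 2 ^ i * 2 ^ k := Nat.le_mul_of_pos_left _ (by positivity)) g hg hgm
    push_cast at this
    exact this
  calc _ ≤ ENNReal.ofReal C2 ^ (q - 1) * ∑' i : ℕ, ENNReal.ofReal (C3 * 2 ^ n * ((2:ℝ) ^ (i * n))⁻¹) * (ENNReal.ofReal (C1 * ((2:ℝ) ^ s) ^ (-e) * (2 ^ i * R) ^ D) * I) := by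
        gcongr
        refine h3.trans (ENNReal.tsum_le_tsum fun i => ?_)
        gcongr
        exact h4 i
    _ = ENNReal.ofReal C2 ^ (q - 1) * (ENNReal.ofReal (C3 * 2 ^ n * C1 * ((2:ℝ) ^ s) ^ (-e) * R ^ D) * (∑' i : ℕ, ENNReal.ofReal (((2:ℝ) ^ (i * n))⁻¹ * ((2:ℝ) ^ i) ^ D)) * I) := by
        congr 1
        rw [← ENNReal.tsum_mul_left, ← ENNReal.tsum_mul_right]
        refine tsum_congr fun i => ?_
        rw [← mul_assoc, ← ENNReal.ofReal_mul (by positivity), ← ENNReal.ofReal_mul (by positivity), Real.mul_rpow (by positivity) (by positivity)]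
        congr 2
        ring
    _ ≤ ENNReal.ofReal C2 ^ (q - 1) * (ENNReal.ofReal (C3 * 2 ^ n * C1 * ((2:ℝ) ^ s) ^ (-e) * R ^ D) * ENNReal.ofReal 2 * I) := by
        gcongr
        exact sum_geo D n hn
    _ = _ := by
        rw [ENNReal.ofReal_rpow_of_pos (by linarith), ← ENNReal.ofReal_mul (by positivity), ← mul_assoc, ← ENNReal.ofReal_mul (by positivity)]
        congr 2
        ring
end step9

end Part19

section Part20
set_option linter.all false

section f4
variable {d : ℕ} [NeZero d]

lemma Vf_eq {h : Ed d → ℂ} (hh : Integrable h) (r : ℝ) (x : Ed d) :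
    Vf d h r x = ((r ^ kap d : ℝ) : ℂ) * ∫ ω, (∫ y, h y * psi d (x - r • ω - y)) ∂(sig d) := by
  obtain ⟨C, hC, hb⟩ := psi_bdd d
  rw [integral_integral_swap]
  · rw [← integral_const_mul, Vf]
    congr 1
    ext y
    rw [Phi, integral_const_mul]
    have : ∀ ω : Ed d, x - r • ω - y = x - y - r • ω := fun ω => by abel
    simp_rw [this]
    ring
  · have h1 : Integrable (fun p : Ed d × Ed d => h p.2) ((sig d).prod volume) := hh.comp_snd (sig d)
    refine h1.mul_bdd (c := C) ?_ (Filter.Eventually.of_forall fun p => hb _)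
    exact ((psi d).continuous.comp (by fun_prop)).aestronglyMeasurable

lemma F4 (hd : 3 ≤ d) (n : ℕ) (b : ℝ → ℝ → ℂ) (hb : Good b) : ∃ C : ℝ, 0 < C ∧ ∀ h : Ed d → ℂ, Integrable h → ∀ t : ℝ, 0 ≤ t → ∀ δ ∈ Icc (0:ℝ) 1, ∀ x,
    ‖𝓕⁻ (fun ξ : Ed d => wm b δ t ‖ξ‖ * (𝓕 h ξ * 𝓕 (psi d : Ed d → ℂ) ξ)) x‖ₑ ≤ ENNReal.ofReal C * aa d n h t x := by
  obtain ⟨C, hC, hk⟩ := kr_decay (d := d) hd n b hb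
  refine ⟨C, hC, fun h hh t ht δ hδ x => ?_⟩
  set u : Ed d → ℂ := MeasureTheory.convolution h (psi d) (ContinuousLinearMap.mul ℂ ℂ) volume with hu
  have hui : Integrable u := hh.integrable_convolution _ (psi d).integrable
  have e1 : (fun ξ : Ed d => wm b δ t ‖ξ‖ * (𝓕 h ξ * 𝓕 (psi d : Ed d → ℂ) ξ)) = fun ξ => wm b δ t ‖ξ‖ * 𝓕 u ξ := by
    ext ξ
    rw [hu, Real.fourier_mul_convolution_eq hh (psi d).integrable]
  rw [e1, fourierInv_mul (wm_integrable hb δ t) hui]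
  simp_rw [kernel_eq hb]
  have e2 : ∫ y, kr d b δ t ‖x - y‖ * u y = ∫ z, kr d b δ t ‖z‖ * u (x - z) := by
    rw [← integral_sub_left_eq_self _ volume x]
    simp
  have hintg : Integrable (fun z : Ed d => kr d b δ t ‖z‖ * u (x - z)) := by
    have hc : Continuous (fun z : Ed d => kr d b δ t ‖z‖) := by
      have := fourierInv_continuous (wm_integrable hb δ t (d := d))
      refine this.congr fun z => kernel_eq hb δ t z
    refine (hui.comp_sub_left x).bdd_mul (c := ∫ ξ : Ed d, ‖wm b δ t ‖ξ‖‖) hc.aestronglyMeasurable (Filter.Eventually.of_forall fun z => ?_)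
    rw [← kernel_eq hb, Real.fourierInv_eq']
    refine (norm_integral_le_integral_norm _).trans (le_of_eq ?_)
    congr 1
    ext ξ
    rw [norm_smul, Complex.norm_exp_ofReal_mul_I, one_mul]
  rw [e2, polar_integral NeZero.one_le _ hintg]
  unfold aa
  rw [← lintegral_const_mul' _ _ ENNReal.ofReal_ne_top]
  refine (enorm_integral_le_lintegral_enorm _).trans (setLIntegral_mono' measurableSet_Ioi fun r hr => ?_)
  have hr0 : (0:ℝ) < r := hr
  have e3 : ∫ ω, kr d b δ t ‖r • ω‖ * u (x - r • ω) ∂(sig d) = kr d b δ t r * ∫ ω, u (x - r • ω) ∂(sig d) := by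
    rw [← integral_const_mul]
    refine integral_congr_ae ?_
    filter_upwards [sig_ae_norm d] with ω hω
    rw [norm_smul, hω, mul_one, Real.norm_of_nonneg hr0.le]
  have e4 := Vf_eq hh r x
  have e5 : ∀ ω : Ed d, u (x - r • ω) = ∫ y, h y * psi d (x - r • ω - y) := fun ω => rfl
  rw [e3]
  simp_rw [e5]
  set S := ∫ ω, (∫ y, h y * psi d (x - r • ω - y)) ∂(sig d)
  have e6 : r ^ (d - 1) = r ^ kap d * r ^ kap d := by
    rw [← Real.rpow_add hr0, ← Real.rpow_natCast, Nat.cast_sub NeZero.one_le]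
    congr 1
    rw [kap]; push_cast; ring
  have e7 : r ^ (d - 1) • (kr d b δ t r * S) = (((r ^ kap d : ℝ) : ℂ) * kr d b δ t r) * Vf d h r x := by
    rw [e4, e6, Complex.real_smul]; push_cast; ring
  rw [e7, enorm_mul, ← mul_assoc]
  refine mul_le_mul' ?_ (Vf_le_vr h r x)
  rw [← ofReal_norm, wt, ← ENNReal.ofReal_mul hC.le]
  refine ENNReal.ofReal_le_ofReal ?_
  rw [norm_mul, Complex.norm_real, Real.norm_of_nonneg (by positivity)]
  have h8 := hk r hr0 t δ hδ
  rw [abs_of_nonneg ht] at h8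
  calc _ ≤ r ^ kap d * (C * r ^ (-kap d) * ((1 + |2 * Real.pi * r - t|) ^ n)⁻¹) := by gcongr
    _ = _ := by
      rw [Real.rpow_neg hr0.le]
      have : r ^ kap d ≠ 0 := by positivity
      field_simp
end f4

end Part20

section Part21
set_option linter.all false

section scaling
variable {d : ℕ}

lemma lint_dil {c : ℝ} (hc : 0 < c) (f : Ed d → ℝ≥0∞) : ∫⁻ x, f (c • x) = ENNReal.ofReal ((c ^ d)⁻¹) * ∫⁻ x, f x := by
  have h := (Homeomorph.smulOfNeZero c hc.ne').measurableEmbedding.lintegral_map f (μ := (volume : Measure (Ed d)))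
  have e := Measure.map_addHaar_smul (volume : Measure (Ed d)) hc.ne'
  rw [finrank_euclideanSpace_fin, abs_of_pos (by positivity)] at e
  have e2 : (Homeomorph.smulOfNeZero c hc.ne' : Ed d → Ed d) = fun x => c • x := rfl
  rw [e2, e, lintegral_smul_measure] at h
  exact h.symm

lemma int_dil {c : ℝ} (hc : 0 < c) {f : Ed d → ℂ} (hf : Integrable f) : Integrable (fun x => f (c • x)) :=
  hf.comp_smul hc.ne'

lemma fourier_dil {c : ℝ} (hc : 0 < c) (f : Ed d → ℂ) (ξ : Ed d) : 𝓕 (fun x => f (c • x)) ξ = (((c ^ d)⁻¹ : ℝ) : ℂ) * 𝓕 f (c⁻¹ • ξ) := by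
  rw [Real.fourier_eq', Real.fourier_eq']
  have h := Measure.integral_comp_smul (volume : Measure (Ed d)) (fun v => Complex.exp (↑(-2 * Real.pi * inner ℝ v (c⁻¹ • ξ)) * Complex.I) • f v) c
  rw [finrank_euclideanSpace_fin, abs_of_pos (by positivity), Complex.real_smul] at h
  rw [← h]
  congr 1
  ext v
  rw [inner_smul_left, inner_smul_right]
  congr 3
  have hc' : (c:ℂ) ≠ 0 := by exact_mod_cast hc.ne'
  simp
  field_simp

lemma fourierInv_dil {c : ℝ} (hc : 0 < c) (f : Ed d → ℂ) (ξ : Ed d) : 𝓕⁻ (fun x => f (c • x)) ξ = (((c ^ d)⁻¹ : ℝ) : ℂ) * 𝓕⁻ f (c⁻¹ • ξ) := by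
  rw [Real.fourierInv_eq_fourier_neg, Real.fourierInv_eq_fourier_neg, fourier_dil hc, smul_neg]
end scaling

section lpdef
variable {d : ℕ}
def cb1 (d : ℕ) : ContDiffBump (0 : Ed d) := ⟨2, 4, by norm_num, by norm_num⟩
def cb2 (d : ℕ) : ContDiffBump (0 : Ed d) := ⟨1/4, 1/2, by norm_num, by norm_num⟩

def mfun (d : ℕ) (ξ : Ed d) : ℂ := ((cb1 d ξ * (1 - cb2 d ξ) : ℝ) : ℂ) / 𝓕 (psi d) ξ

lemma mfun_zero {ξ : Ed d} (h : ‖ξ‖ ∉ Ioo (1/4 : ℝ) 4) : mfun d ξ = 0 := by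
  have : cb1 d ξ * (1 - cb2 d ξ) = 0 := by
    by_cases h1 : ‖ξ‖ ≤ 1/4
    · rw [(cb2 d).one_of_mem_closedBall (by simpa [cb2] using h1)]; ring
    · rw [(cb1 d).zero_of_le_dist (by simp only [dist_zero_right]; by_contra h2; exact h ⟨by linarith, by simpa [cb1] using h2⟩)]; ring
  rw [mfun, this]; simp

lemma psi_fourier_ne {ξ : Ed d} (h0 : 0 < ‖ξ‖) (h : ‖ξ‖ ≤ 8) : 𝓕 (psi d) ξ ≠ 0 := by
  rw [psi_fourier]
  refine mul_ne_zero (pow_ne_zero _ ?_) (psi0_fourier_ne h)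
  have := Real.pi_pos
  have : -(2 * Real.pi * ‖ξ‖) ^ 2 ≠ 0 := by
    have : 0 < (2 * Real.pi * ‖ξ‖) ^ 2 := by positivity
    linarith
  exact_mod_cast this

lemma mfun_mul {ξ : Ed d} (h : ‖ξ‖ ∈ Icc (1/2 : ℝ) 2) : mfun d ξ * 𝓕 (psi d) ξ = 1 := by
  rw [mfun, div_mul_cancel₀ _ (psi_fourier_ne (by linarith [h.1]) (by linarith [h.2])),
    (cb1 d).one_of_mem_closedBall (by simpa [cb1] using h.2), (cb2 d).zero_of_le_dist (by simpa [cb2] using h.1)]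
  simp

lemma mfun_compact : HasCompactSupport (mfun d) := by
  refine HasCompactSupport.intro (isCompact_closedBall (0 : Ed d) 4) fun x hx => mfun_zero fun h => hx ?_
  simpa using h.2.le

lemma mfun_smooth : ContDiff ℝ (↑(⊤ : ℕ∞)) (mfun d) := by
  rw [contDiff_iff_contDiffAt]
  intro ξ
  by_cases h : 0 < ‖ξ‖ ∧ ‖ξ‖ ≤ 8
  · have h1 : ContDiffAt ℝ (↑(⊤ : ℕ∞)) (fun ξ : Ed d => ((cb1 d ξ * (1 - cb2 d ξ) : ℝ) : ℂ)) ξ := by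
      have : ContDiff ℝ (↑(⊤ : ℕ∞)) (fun ξ : Ed d => cb1 d ξ * (1 - cb2 d ξ)) := (cb1 d).contDiff.mul (contDiff_const.sub (cb2 d).contDiff)
      exact (Complex.ofRealCLM.contDiff.comp this).contDiffAt
    have h2 : ContDiffAt ℝ (↑(⊤ : ℕ∞)) (fun ξ => 𝓕 (psi d) ξ) ξ := ((𝓕 (psi d)).smooth ⊤).contDiffAt
    have h3 : mfun d = fun ξ : Ed d => ((cb1 d ξ * (1 - cb2 d ξ) : ℝ) : ℂ) * (𝓕 (psi d) ξ)⁻¹ := by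
      ext ξ; rw [mfun, div_eq_mul_inv]
    rw [h3]
    exact h1.mul (h2.inv (psi_fourier_ne h.1 h.2))
  · have hz : mfun d =ᶠ[nhds ξ] fun _ => 0 := by
      have ho : IsOpen {ξ : Ed d | ‖ξ‖ < 1/4 ∨ 4 < ‖ξ‖} := (isOpen_lt continuous_norm continuous_const).union (isOpen_lt continuous_const continuous_norm)
      have hm : ξ ∈ {ξ : Ed d | ‖ξ‖ < 1/4 ∨ 4 < ‖ξ‖} := by
        by_cases h1 : 0 < ‖ξ‖
        · right; by_contra h2; exact h ⟨h1, by linarith⟩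
        · left; linarith
      filter_upwards [ho.mem_nhds hm] with η hη
      refine mfun_zero fun h => ?_
      rcases hη with h1 | h1
      · linarith [h.1]
      · linarith [h.2]
    exact contDiffAt_const.congr_of_eventuallyEq hz

def mS (d : ℕ) : SchwartzMap (Ed d) ℂ := mfun_compact.toSchwartzMap mfun_smooth
lemma mS_apply (ξ : Ed d) : mS d ξ = mfun d ξ := rfl
def kS (d : ℕ) : SchwartzMap (Ed d) ℂ := 𝓕⁻ (mS d)
lemma kS_fourier : 𝓕 (kS d) = mS d := by rw [kS, FourierTransform.fourier_fourierInv_eq]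

/-- k-th Littlewood–Paley piece -/
def lpf (d : ℕ) (g : Ed d → ℂ) (k : ℕ) (x : Ed d) : ℂ := ∫ y, kS d y * g (x - ((2:ℝ) ^ k)⁻¹ • y)
def gk (g : Ed d → ℂ) (k : ℕ) (x : Ed d) : ℂ := g (((2:ℝ) ^ k)⁻¹ • x)
def hk (d : ℕ) (g : Ed d → ℂ) (k : ℕ) : Ed d → ℂ := MeasureTheory.convolution (kS d) (gk g k) (ContinuousLinearMap.mul ℂ ℂ) volume

lemma gk_int {g : Ed d → ℂ} (hg : Integrable g) (k : ℕ) : Integrable (gk g k) := int_dil (by positivity) hg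
lemma hk_int {g : Ed d → ℂ} (hg : Integrable g) (k : ℕ) : Integrable (hk d g k) := (kS d).integrable.integrable_convolution _ (gk_int hg k)

lemma hk_lpf (g : Ed d → ℂ) (k : ℕ) (x : Ed d) : hk d g k ((2:ℝ) ^ k • x) = lpf d g k x := by
  show ∫ y, kS d y * g (((2:ℝ) ^ k)⁻¹ • ((2:ℝ) ^ k • x - y)) = _
  rw [lpf]
  congr 1; ext y
  rw [smul_sub, smul_smul, inv_mul_cancel₀ (by positivity), one_smul]

lemma hk_fourier {g : Ed d → ℂ} (hg : Integrable g) (k : ℕ) (ξ : Ed d) : 𝓕 (hk d g k) ξ = mfun d ξ * 𝓕 (gk g k) ξ := by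
  rw [hk, Real.fourier_mul_convolution_eq (kS d).integrable (gk_int hg k), ← SchwartzMap.fourier_coe, kS_fourier, mS_apply]

lemma hk_cont {g : Ed d → ℂ} (hg : Integrable g) (k : ℕ) : Continuous (hk d g k) := by
  obtain ⟨C, hC, h⟩ := (kS d).decay 0 0
  refine BddAbove.continuous_convolution_left_of_integrable _ ⟨C, ?_⟩ (kS d).continuous (gk_int hg k)
  rintro _ ⟨x, rfl⟩
  simpa using h x

lemma lpf_cont {g : Ed d → ℂ} (hg : Integrable g) (k : ℕ) : Continuous (lpf d g k) := by
  have : lpf d g k = fun x => hk d g k ((2:ℝ) ^ k • x) := by ext x; rw [hk_lpf]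
  rw [this]
  exact (hk_cont hg k).comp (by fun_prop)

lemma kS_bdd (d : ℕ) : ∃ C : ℝ, 0 < C ∧ ∀ x, ‖kS d x‖ ≤ C := by
  obtain ⟨C, hC, h⟩ := (kS d).decay 0 0
  exact ⟨C, hC, fun x => by simpa using h x⟩

lemma lpf_int {g : Ed d → ℂ} (hg : Integrable g) (k : ℕ) (x : Ed d) : Integrable (fun y => kS d y * g (x - ((2:ℝ) ^ k)⁻¹ • y)) := by
  obtain ⟨C, hC, h⟩ := kS_bdd d
  have : Integrable (fun y => g (x - ((2:ℝ) ^ k)⁻¹ • y)) := int_dil (f := fun z => g (x - z)) (by positivity) (hg.comp_sub_left x)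
  exact this.bdd_mul (c := C) (kS d).continuous.aestronglyMeasurable (Filter.Eventually.of_forall h)

lemma hk_bdd {g : Ed d → ℂ} (hg : Integrable g) (k : ℕ) : ∃ C : ℝ, 0 ≤ C ∧ ∀ x, ‖hk d g k x‖ ≤ C := by
  obtain ⟨C, hC, h⟩ := kS_bdd d
  refine ⟨C * ∫ y, ‖gk g k y‖, by positivity, fun x => ?_⟩
  show ‖∫ y, kS d y * gk g k (x - y)‖ ≤ _
  rw [← integral_sub_left_eq_self (fun y => ‖gk g k y‖) volume x, ← integral_const_mul]
  refine norm_integral_le_of_norm_le ((((gk_int hg k).comp_sub_left x).norm).const_mul C) (Filter.Eventually.of_forall fun y => ?_)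
  rw [norm_mul]
  exact mul_le_mul_of_nonneg_right (h y) (norm_nonneg _)

lemma hk_mem2 {g : Ed d → ℂ} (hg : Integrable g) (k : ℕ) : MemLp (hk d g k) 2 := by
  obtain ⟨C, hC, h⟩ := hk_bdd hg k
  refine (memLp_two_iff_integrable_sq_norm (hk_cont hg k).aestronglyMeasurable).2 ?_
  have : (fun x => ‖hk d g k x‖ ^ 2) = fun x => ‖hk d g k x‖ * ‖hk d g k x‖ := by ext x; ring
  rw [this]
  exact (hk_int hg k).norm.bdd_mul (c := C) (hk_cont hg k).norm.aestronglyMeasurable (Filter.Eventually.of_forall fun x => by simpa using h x)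

lemma lpf_L2 {g : Ed d → ℂ} (hg : Integrable g) (k : ℕ) : ∫⁻ x, ‖lpf d g k x‖ₑ ^ 2 = ∫⁻ ξ, ‖mfun d (((2:ℝ) ^ k)⁻¹ • ξ)‖ₑ ^ 2 * ‖𝓕 g ξ‖ₑ ^ 2 := by
  have h2 : (0:ℝ) < 2 ^ k := by positivity
  have e1 : ∫⁻ x, ‖lpf d g k x‖ₑ ^ 2 = ENNReal.ofReal ((((2:ℝ) ^ k) ^ d)⁻¹) * ∫⁻ x, ‖hk d g k x‖ₑ ^ 2 := by
    rw [← lint_dil h2 (fun x => ‖hk d g k x‖ₑ ^ 2)]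
    simp_rw [hk_lpf]
  have e2 : ∫⁻ x, ‖hk d g k x‖ₑ ^ 2 = ∫⁻ ξ, ‖mfun d ξ * 𝓕 (gk g k) ξ‖ₑ ^ 2 := by
    rw [← eLpNorm_two_sq, ← planch_norm (hk_int hg k) (hk_mem2 hg k), eLpNorm_two_sq]
    simp_rw [hk_fourier hg]
  have e3 : ∀ ξ, 𝓕 (gk g k) ξ = ((((2:ℝ) ^ k) ^ d : ℝ) : ℂ) * 𝓕 g ((2:ℝ) ^ k • ξ) := by
    intro ξ
    show 𝓕 (fun x => g (((2:ℝ) ^ k)⁻¹ • x)) ξ = _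
    rw [fourier_dil (by positivity), inv_inv, inv_pow, inv_inv]
  have e4 := lint_dil h2 (fun ξ => ‖mfun d (((2:ℝ) ^ k)⁻¹ • ξ)‖ₑ ^ 2 * ‖𝓕 g ξ‖ₑ ^ 2)
  have e5 : ∫⁻ ξ, ‖mfun d ξ * 𝓕 (gk g k) ξ‖ₑ ^ 2 = ENNReal.ofReal ((((2:ℝ) ^ k) ^ d) ^ 2) * ∫⁻ ξ, ‖mfun d (((2:ℝ) ^ k)⁻¹ • (2:ℝ) ^ k • ξ)‖ₑ ^ 2 * ‖𝓕 g ((2:ℝ) ^ k • ξ)‖ₑ ^ 2 := by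
    rw [← lintegral_const_mul' _ _ ENNReal.ofReal_ne_top]
    refine lintegral_congr fun ξ => ?_
    rw [e3, enorm_mul, enorm_mul, smul_smul, inv_mul_cancel₀ h2.ne', one_smul, ← ofReal_norm (((((2:ℝ) ^ k) ^ d : ℝ)) : ℂ), Complex.norm_real, Real.norm_of_nonneg (by positivity), ENNReal.ofReal_pow (p := ((2:ℝ) ^ k) ^ d) (by positivity)]
    ring
  rw [e1, e2, e5, e4, ← mul_assoc, ← mul_assoc, ← ENNReal.ofReal_mul (by positivity), ← ENNReal.ofReal_mul (by positivity)]
  rw [show ((((2:ℝ) ^ k) ^ d)⁻¹ * (((2:ℝ) ^ k) ^ d) ^ 2 * (((2:ℝ) ^ k) ^ d)⁻¹) = 1 by field_simp, ENNReal.ofReal_one, one_mul]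
end lpdef

section lpineq
variable {d : ℕ}

lemma mfun_overlap (d : ℕ) : ∃ A : ℝ, 0 < A ∧ ∀ ξ : Ed d, ∑' k : ℕ, ‖mfun d (((2:ℝ) ^ k)⁻¹ • ξ)‖ₑ ^ 2 ≤ ENNReal.ofReal A := by
  classical
  obtain ⟨B, hB, hb⟩ := (mS d).decay 0 0
  have hb' : ∀ ξ, ‖mfun d ξ‖ₑ ^ 2 ≤ ENNReal.ofReal (B ^ 2) := by
    intro ξ
    rw [ENNReal.ofReal_pow hB.le, ← ofReal_norm]
    gcongr
    simpa [mS_apply] using hb ξ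
  refine ⟨4 * B ^ 2, by positivity, fun ξ => ?_⟩
  by_cases hz : ∃ k : ℕ, mfun d (((2:ℝ) ^ k)⁻¹ • ξ) ≠ 0
  · set k0 := Nat.find hz with hk0
    have h0 : mfun d (((2:ℝ) ^ k0)⁻¹ • ξ) ≠ 0 := Nat.find_spec hz
    have hmem : ∀ k : ℕ, mfun d (((2:ℝ) ^ k)⁻¹ • ξ) ≠ 0 → 2 ^ k / 4 < ‖ξ‖ ∧ ‖ξ‖ < 4 * 2 ^ k := by
      intro k hk
      have : ‖((2:ℝ) ^ k)⁻¹ • ξ‖ ∈ Ioo (1/4:ℝ) 4 := by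
        by_contra h; exact hk (mfun_zero h)
      rw [norm_smul, norm_inv, norm_pow, Real.norm_ofNat, inv_mul_eq_div] at this
      have hp : (0:ℝ) < 2 ^ k := by positivity
      have h1 := this.1
      have h2 := this.2
      rw [lt_div_iff₀ hp] at h1
      rw [div_lt_iff₀ hp] at h2
      exact ⟨by linarith, h2⟩
    have hsupp : ∀ k ∉ Finset.Ico k0 (k0 + 4), ‖mfun d (((2:ℝ) ^ k)⁻¹ • ξ)‖ₑ ^ 2 = 0 := by
      intro k hk
      by_contra hne
      have hne' : mfun d (((2:ℝ) ^ k)⁻¹ • ξ) ≠ 0 := by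
        intro h; apply hne; rw [h]; simp
      apply hk
      rw [Finset.mem_Ico]
      refine ⟨Nat.find_min' hz hne', ?_⟩
      by_contra hge
      push Not at hge
      have h1 := (hmem k hne').1
      have h2 := (hmem k0 h0).2
      have h3 : (2:ℝ) ^ (k0 + 4) ≤ 2 ^ k := pow_le_pow_right₀ (by norm_num) hge
      rw [pow_add] at h3
      linarith
    rw [tsum_eq_sum hsupp]
    refine (Finset.sum_le_card_nsmul _ _ _ (fun k _ => hb' _)).trans (le_of_eq ?_)
    rw [Nat.card_Ico, Nat.add_sub_cancel_left, ENNReal.ofReal_mul (by norm_num), nsmul_eq_mul]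
    simp
  · push Not at hz
    simp [hz]

lemma lp_L2 (d : ℕ) : ∃ A : ℝ, 0 < A ∧ ∀ g : Ed d → ℂ, Integrable g → MemLp g 2 → ∑' k : ℕ, ∫⁻ x, ‖lpf d g k x‖ₑ ^ 2 ≤ ENNReal.ofReal A * ∫⁻ x, ‖g x‖ₑ ^ 2 := by
  obtain ⟨A, hA, h⟩ := mfun_overlap d
  refine ⟨A, hA, fun g hg hg2 => ?_⟩
  simp_rw [lpf_L2 hg]
  have hmm : Continuous (mfun d) := (mS d).continuous
  rw [← lintegral_tsum]
  · simp_rw [ENNReal.tsum_mul_right]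
    rw [← eLpNorm_two_sq, ← planch_norm hg hg2, eLpNorm_two_sq, ← lintegral_const_mul' _ _ ENNReal.ofReal_ne_top]
    exact lintegral_mono fun ξ => mul_le_mul_left (h ξ) _
  · intro k
    have h1 : Measurable (fun ξ : Ed d => ‖mfun d (((2:ℝ) ^ k)⁻¹ • ξ)‖ₑ ^ 2) := ((hmm.comp (by fun_prop : Continuous fun ξ : Ed d => ((2:ℝ) ^ k)⁻¹ • ξ)).measurable.enorm).pow_const 2
    have h2 : Measurable (fun ξ : Ed d => ‖𝓕 g ξ‖ₑ ^ 2) := (fourier_continuous hg).measurable.enorm.pow_const 2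
    exact (h1.mul h2).aemeasurable

lemma lp_ineq (d : ℕ) {q : ℝ} (hq : 2 < q) : ∃ C : ℝ, 0 < C ∧ ∀ g : Ed d → ℂ, Integrable g → Measurable g →
    ∑' k : ℕ, ∫⁻ x, ‖lpf d g k x‖ₑ ^ q ≤ ENNReal.ofReal C * ∫⁻ x, ‖g x‖ₑ ^ q := by
  obtain ⟨A, hA, hL2⟩ := lp_L2 d
  set B1 : ℝ := (∫ y, ‖kS d y‖) + 1 with hB1
  have hB : 0 < B1 := by positivity
  have hqq : 0 < q - 2 := by linarith
  refine ⟨q / (q - 2) * 2 ^ q * B1 ^ (q - 2) * A, by positivity, fun g hg hgm => ?_⟩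
  have hprod : ∀ F : ℕ × Ed d → ℝ≥0∞, Measurable F → ∫⁻ p, F p ∂((Measure.count : Measure ℕ).prod volume) = ∑' k, ∫⁻ x, F (k, x) := by
    intro F hF
    rw [lintegral_prod _ hF.aemeasurable, lintegral_count]
  have hmeas : ∀ g : Ed d → ℂ, Integrable g → Measurable (fun p : ℕ × Ed d => ‖lpf d g p.1 p.2‖ₑ) := by
    intro g hg
    exact measurable_from_prod_countable_right fun k => (lpf_cont hg k).measurable.enorm
  have := marc (X := Ed d) (Ω := ℕ × Ed d) volume (q0 := 2) (q := q) (by norm_num) hq (T := fun g p => ‖lpf d g p.1 p.2‖ₑ) (μ := (Measure.count : Measure ℕ).prod volume)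
    (M := ENNReal.ofReal A) ENNReal.ofReal_ne_top hB (fun g hg _ => hmeas g hg) (fun g hg _ p => enorm_ne_top)
    (fun g1 g2 i1 _ i2 _ p => by
      have : lpf d (fun x => g1 x + g2 x) p.1 p.2 = lpf d g1 p.1 p.2 + lpf d g2 p.1 p.2 := by
        rw [lpf, lpf, lpf, ← integral_add (lpf_int i1 _ _) (lpf_int i2 _ _)]
        congr 1; ext y; ring
      show ‖lpf d (fun x => g1 x + g2 x) p.1 p.2‖ₑ ≤ _
      rw [this]
      exact enorm_add_le _ _)
    (fun g hg hgm l hl => by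
      have h2 : ∀ z : ℝ≥0∞, z ^ (2:ℝ) = z ^ 2 := fun z => ENNReal.rpow_two z
      simp_rw [h2]
      by_cases hf : ∫⁻ x, ‖g x‖ₑ ^ 2 = ⊤
      · rw [hf, ENNReal.mul_top (by simpa using hA)]
        exact le_top
      have hg2 : MemLp g 2 := by
        refine ⟨hg.1, ?_⟩
        have h3 := eLpNorm_two_sq g
        by_contra hcon
        rw [not_lt, top_le_iff] at hcon
        rw [hcon] at h3
        exact hf (by rw [← h3]; simp)
      refine le_trans ?_ (hL2 g hg hg2)
      rw [← hprod _ ((hmeas g hg).pow_const 2)]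
      refine le_trans ?_ (mul_meas_ge_le_lintegral ((hmeas g hg).pow_const 2) (ENNReal.ofReal (l ^ (2:ℝ))))
      refine mul_le_mul_right (measure_mono ?_) _
      intro p hp
      have hp' : ENNReal.ofReal l < ‖lpf d g p.1 p.2‖ₑ := hp
      show ENNReal.ofReal (l ^ (2:ℝ)) ≤ ‖lpf d g p.1 p.2‖ₑ ^ 2
      rw [Real.rpow_two, ENNReal.ofReal_pow hl.le]
      gcongr)
    (fun g hg _ b hb hgb => Filter.Eventually.of_forall fun p => by
      show ‖lpf d g p.1 p.2‖ₑ ≤ _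
      rw [← ofReal_norm]
      refine ENNReal.ofReal_le_ofReal ?_
      have h1 : ‖lpf d g p.1 p.2‖ ≤ ∫ y, ‖kS d y‖ * b := by
        refine norm_integral_le_of_norm_le ((kS d).integrable.norm.mul_const b) (Filter.Eventually.of_forall fun y => ?_)
        rw [norm_mul]
        exact mul_le_mul_of_nonneg_left (hgb _) (norm_nonneg _)
      rw [integral_mul_const] at h1
      refine h1.trans ?_
      gcongr
      linarith)
    g hg hgm
  rw [hprod _ ((hmeas g hg).pow_const q)] at this
  refine this.trans (le_of_eq ?_)
  rw [← ENNReal.ofReal_mul (by positivity)]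
end lpineq

end Part21

section Part22
set_option linter.all false

section absum

lemma mvi {A x p : ℝ} (hA : 0 ≤ A) (hx : 0 ≤ x) (hp : 1 ≤ p) : (A + x) ^ p ≤ A ^ p + p * x * (A + x) ^ (p - 1) := by
  rcases hA.eq_or_lt with h0 | h0
  · rcases hx.eq_or_lt with h1 | h1
    · rw [← h0, ← h1]; simp
    · rw [← h0, zero_add]
      have : x ^ p = x * x ^ (p - 1) := by
        rw [Real.rpow_sub_one h1.ne']; field_simp
      rw [this]
      have : 0 ≤ x * x ^ (p - 1) := by positivity
      have h3 : (0:ℝ) ≤ 0 ^ p := Real.rpow_nonneg le_rfl _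
      nlinarith
  · have hs : 0 < A + x := by linarith
    have hb := one_add_mul_self_le_rpow_one_add (s := -(x / (A + x))) (p := p) (by
      rw [neg_le_neg_iff, div_le_one hs]; linarith) hp
    have e1 : 1 + -(x / (A + x)) = A / (A + x) := by field_simp; ring
    rw [e1, Real.div_rpow hA hs.le, le_div_iff₀ (by positivity)] at hb
    have e2 : (A + x) ^ p = (A + x) * (A + x) ^ (p - 1) := by
      rw [Real.rpow_sub_one hs.ne']; field_simp
    have e3 : (1 + p * -(x / (A + x))) * (A + x) ^ p = (A + x) ^ p - p * x * (A + x) ^ (p - 1) := by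
      rw [e2]; field_simp; ring
    linarith

lemma sum1 {q : ℝ} (hq : 2 ≤ q) (a : ℕ → ℝ) (ha : ∀ i, 0 ≤ a i) (n : ℕ) :
    (∑ i ∈ Finset.range n, a i) ^ (q - 1) ≤ (q - 1) * ∑ j ∈ Finset.range n, a j * (∑ i ∈ Finset.range (j + 1), a i) ^ (q - 2) := by
  induction n with
  | zero => simp; rw [Real.zero_rpow (by linarith)]
  | succ n ih =>
    rw [Finset.sum_range_succ (fun j => a j * _), Finset.sum_range_succ a]
    have := mvi (A := ∑ i ∈ Finset.range n, a i) (x := a n) (p := q - 1) (Finset.sum_nonneg fun i _ => ha i) (ha n) (by linarith)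
    rw [show q - 1 - 1 = q - 2 by ring] at this
    nlinarith

lemma sum2 {q : ℝ} (hq : 2 ≤ q) (a : ℕ → ℝ) (ha : ∀ i, 0 ≤ a i) (n : ℕ) :
    (∑ i ∈ Finset.range n, a i) ^ q ≤ (q * q * 2 ^ q) * ∑ j ∈ Finset.range n, a j * (∑ i ∈ Finset.range (j + 1), a i) ^ (q - 2) * ∑ k ∈ Finset.Ico j n, a k := by
  induction n with
  | zero => simp; rw [Real.zero_rpow (by linarith)]
  | succ n ih =>
    set A := ∑ i ∈ Finset.range n, a i with hA
    have hA0 : 0 ≤ A := Finset.sum_nonneg fun i _ => ha i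
    have hx := ha n
    set x := a n with hxx
    set S := ∑ j ∈ Finset.range n, a j * (∑ i ∈ Finset.range (j + 1), a i) ^ (q - 2) with hS
    have e : ∑ j ∈ Finset.range (n + 1), a j * (∑ i ∈ Finset.range (j + 1), a i) ^ (q - 2) * ∑ k ∈ Finset.Ico j (n + 1), a k
        = (∑ j ∈ Finset.range n, a j * (∑ i ∈ Finset.range (j + 1), a i) ^ (q - 2) * ∑ k ∈ Finset.Ico j n, a k) + S * x + x * (A + x) ^ (q - 2) * x := by
      rw [Finset.sum_range_succ, hS, Finset.sum_mul, ← Finset.sum_add_distrib]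
      congr 1
      · refine Finset.sum_congr rfl fun j hj => ?_
        rw [Finset.sum_Ico_succ_top (Finset.mem_range.1 hj).le]
        ring
      · rw [Finset.sum_range_succ a]; simp; rfl
    rw [e, Finset.sum_range_succ a]
    have h1 := mvi hA0 hx (by linarith : 1 ≤ q)
    have h2 : A ^ (q - 1) ≤ (q - 1) * S := sum1 hq a ha n
    have h3 : 0 ≤ A ^ (q - 1) := by positivity
    have hS0 : 0 ≤ S := Finset.sum_nonneg fun j _ => mul_nonneg (ha j) (Real.rpow_nonneg (Finset.sum_nonneg fun i _ => ha i) _)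
    have h4 : 0 ≤ (A + x) ^ (q - 2) := by positivity
    have h2q : (2:ℝ) ≤ 2 ^ q := by
      calc (2:ℝ) = 2 ^ (1:ℝ) := by simp
        _ ≤ 2 ^ q := Real.rpow_le_rpow_of_exponent_le (by norm_num) (by linarith)
    have key : q * x * (A + x) ^ (q - 1) ≤ (q * q * 2 ^ q) * (S * x + x * (A + x) ^ (q - 2) * x) := by
      rcases le_total x A with hxA | hxA
      · have h5 : (A + x) ^ (q - 1) ≤ 2 ^ q * ((q - 1) * S) := by
          calc (A + x) ^ (q - 1) ≤ (2 * A) ^ (q - 1) := Real.rpow_le_rpow (by positivity) (by linarith) (by linarith)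
            _ = 2 ^ (q - 1) * A ^ (q - 1) := Real.mul_rpow (by norm_num) hA0
            _ ≤ 2 ^ q * ((q - 1) * S) := by
              refine mul_le_mul (Real.rpow_le_rpow_of_exponent_le (by norm_num) (by linarith)) h2 h3 (by positivity)
        calc q * x * (A + x) ^ (q - 1) ≤ q * x * (2 ^ q * ((q - 1) * S)) := by gcongr
          _ ≤ q * x * (2 ^ q * (q * S)) := by gcongr; linarith
          _ = (q * q * 2 ^ q) * (S * x) := by ring
          _ ≤ _ := by
            refine mul_le_mul_of_nonneg_left ?_ (by positivity)
            have : 0 ≤ x * (A + x) ^ (q - 2) * x := by positivity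
            linarith
      · have h5 : (A + x) ^ (q - 1) ≤ 2 * x * (A + x) ^ (q - 2) := by
          rcases (add_nonneg hA0 hx).eq_or_lt with h0 | h0
          · rw [← h0, Real.zero_rpow (by linarith)]
            have : (0:ℝ) ≤ 0 ^ (q - 2) := Real.rpow_nonneg le_rfl _
            positivity
          · rw [show q - 1 = 1 + (q - 2) by ring, Real.rpow_add h0, Real.rpow_one]
            gcongr
            linarith
        calc q * x * (A + x) ^ (q - 1) ≤ q * x * (2 * x * (A + x) ^ (q - 2)) := by gcongr
          _ = (q * 2) * (x * (A + x) ^ (q - 2) * x) := by ring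
          _ ≤ (q * q * 2 ^ q) * (x * (A + x) ^ (q - 2) * x) := by
            have : q * 2 ≤ q * q * 2 ^ q := by nlinarith
            gcongr
          _ ≤ _ := by
            refine mul_le_mul_of_nonneg_left ?_ (by positivity)
            have : 0 ≤ S * x := by positivity
            linarith
    nlinarith

lemma sum3 {q : ℝ} (hq : 2 < q) (a : ℕ → ℝ≥0∞) (n : ℕ) :
    (∑ i ∈ Finset.range n, a i) ^ q ≤ ENNReal.ofReal (q * q * 2 ^ q) * ∑ j ∈ Finset.range n, ∑ k ∈ Finset.Ico j n, a j * (∑ i ∈ Finset.range (j + 1), a i) ^ (q - 2) * a k := by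
  have hq0 : 0 < q * q * 2 ^ q := by positivity
  by_cases hf : ∀ i ∈ Finset.range n, a i ≠ ⊤
  · set c : ℕ → ℝ := fun i => if i < n then (a i).toReal else 0 with hc
    have hc0 : ∀ i, 0 ≤ c i := fun i => by simp only [hc]; split_ifs <;> simp
    have hce : ∀ i < n, a i = ENNReal.ofReal (c i) := by
      intro i hi
      simp only [hc, if_pos hi]
      rw [ENNReal.ofReal_toReal (hf i (Finset.mem_range.2 hi))]
    have hs : ∀ m ≤ n, ∑ i ∈ Finset.range m, a i = ENNReal.ofReal (∑ i ∈ Finset.range m, c i) := by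
      intro m hm
      rw [ENNReal.ofReal_sum_of_nonneg fun i _ => hc0 i]
      exact Finset.sum_congr rfl fun i hi => hce i (lt_of_lt_of_le (Finset.mem_range.1 hi) hm)
    have h := sum2 hq.le c hc0 n
    have hsn : ∀ m, 0 ≤ ∑ i ∈ Finset.range m, c i := fun m => Finset.sum_nonneg fun i _ => hc0 i
    rw [hs n le_rfl, ENNReal.ofReal_rpow_of_nonneg (hsn n) (by linarith)]
    refine (ENNReal.ofReal_le_ofReal h).trans (le_of_eq ?_)
    rw [ENNReal.ofReal_mul hq0.le]
    congr 1
    rw [ENNReal.ofReal_sum_of_nonneg fun j _ => mul_nonneg (mul_nonneg (hc0 j) (Real.rpow_nonneg (hsn _) _)) (Finset.sum_nonneg fun i _ => hc0 i)]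
    refine Finset.sum_congr rfl fun j hj => ?_
    have hj' := Finset.mem_range.1 hj
    rw [ENNReal.ofReal_mul (mul_nonneg (hc0 j) (Real.rpow_nonneg (hsn _) _)), ENNReal.ofReal_mul (hc0 j), ← hce j hj', ← ENNReal.ofReal_rpow_of_nonneg (hsn _) (by linarith), ← hs (j + 1) hj', ENNReal.ofReal_sum_of_nonneg fun i _ => hc0 i, Finset.mul_sum]
    refine Finset.sum_congr rfl fun k hk => ?_
    rw [hce k (Finset.mem_Ico.1 hk).2]
  · push Not at hf
    obtain ⟨j, hj, hjt⟩ := hf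
    have h1 : a j * (∑ i ∈ Finset.range (j + 1), a i) ^ (q - 2) * a j = ⊤ := by
      have : ∑ i ∈ Finset.range (j + 1), a i = ⊤ := by
        rw [Finset.sum_range_succ, hjt]; simp
      rw [this, hjt, ENNReal.top_rpow_of_pos (by linarith)]
      simp
    have h2 : ∑ j ∈ Finset.range n, ∑ k ∈ Finset.Ico j n, a j * (∑ i ∈ Finset.range (j + 1), a i) ^ (q - 2) * a k = ⊤ := by
      rw [ENNReal.sum_eq_top]
      refine ⟨j, hj, ?_⟩
      rw [ENNReal.sum_eq_top]
      exact ⟨j, by simpa using hj, h1⟩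
    rw [h2, ENNReal.mul_top (by simpa using hq0)]
    exact le_top

lemma absum {q : ℝ} (hq : 2 < q) {ρ : ℝ} (h0 : 0 < ρ) (h1 : ρ < 1) {C0 : ℝ} (hC0 : 0 < C0) : ∃ C : ℝ, 0 < C ∧ 
    ∀ {Ω : Type} [MeasurableSpace Ω] (μ : Measure Ω) (K : ℕ) (a : ℕ → Ω → ℝ≥0∞) (b : ℕ → ℕ → Ω → ℝ≥0∞) (Z : ℝ≥0∞),
    (∀ k, Measurable (a k)) → (∀ j k, Measurable (b j k)) → (∀ k < K, ∫⁻ w, a k w ^ q ∂μ ≠ ⊤) →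
    (∀ j k, j ≤ k → k < K → ∫⁻ w, a j w * (∑ i ∈ Finset.range (j + 1), a i w) ^ (q - 2) * a k w ∂μ ≤ ∫⁻ w, a j w * (∑ i ∈ Finset.range (j + 1), a i w) ^ (q - 2) * b j k w ∂μ) →
    (∀ s < K, ∑ j ∈ Finset.range (K - s), ∫⁻ w, b j (j + s) w ^ q ∂μ ≤ ENNReal.ofReal (C0 * ρ ^ s) * Z) →
    ∫⁻ w, (∑ k ∈ Finset.range K, a k w) ^ q ∂μ ≤ ENNReal.ofReal C * Z := by
  set c1 := q * q * 2 ^ q with hc1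
  have hq0 : 0 < q := by linarith
  have hρ : 0 < ρ ^ (1 / q) := by positivity
  have hρ1 : ρ ^ (1 / q) < 1 := Real.rpow_lt_one h0.le h1 (by positivity)
  have hg : 0 < (1 - ρ ^ (1 / q))⁻¹ := inv_pos.2 (by linarith)
  set c2 := c1 * (C0 ^ (1 / q) * (1 - ρ ^ (1 / q))⁻¹) with hc2
  have hc20 : 0 < c2 := by positivity
  refine ⟨c2 ^ q, by positivity, fun {Ω} _ μ K a b Z ham hbm hfin hE hb => ?_⟩
  set A : Ω → ℝ≥0∞ := fun w => ∑ k ∈ Finset.range K, a k w with hA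
  have hAm : Measurable A := Finset.measurable_sum _ fun k _ => ham k
  set X := ∫⁻ w, A w ^ q ∂μ with hX
  have hXt : X ≠ ⊤ := by
    have h2 : ∀ w, A w ^ q ≤ (K:ℝ≥0∞) ^ (q - 1) * ∑ k ∈ Finset.range K, a k w ^ q := by
      intro w
      have := ENNReal.rpow_sum_le_const_mul_sum_rpow (Finset.range K) (fun k => a k w) (p := q) (by linarith)
      simpa using this
    refine ne_top_of_le_ne_top ?_ (lintegral_mono h2)
    have hne : (K:ℝ≥0∞) ^ (q - 1) ≠ ⊤ := ENNReal.rpow_ne_top_of_nonneg (by linarith) (by simp)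
    rw [lintegral_const_mul' _ _ hne, lintegral_finsetSum _ fun k _ => (ham k).pow_const q]
    refine ENNReal.mul_ne_top hne ?_
    rw [ENNReal.sum_ne_top]
    exact fun k hk => hfin k (Finset.mem_range.1 hk)
  set D : ℕ → Ω → ℝ≥0∞ := fun j w => a j w * (∑ i ∈ Finset.range (j + 1), a i w) ^ (q - 2) with hD
  have hDm : ∀ j, Measurable (D j) := fun j => (ham j).mul ((Finset.measurable_sum _ fun k _ => ham k).pow_const _)
  have hDa : ∀ j k, Measurable (fun w => D j w * a k w) := fun j k => (hDm j).mul (ham k)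
  have hDb : ∀ j k, Measurable (fun w => D j w * b j k w) := fun j k => (hDm j).mul (hbm j k)
  have hDs : ∀ j, Measurable (fun w => ∑ k ∈ Finset.Ico j K, D j w * a k w) := fun j => Finset.measurable_sum _ fun k _ => hDa j k
  have step1 : X ≤ ENNReal.ofReal c1 * ∑ s ∈ Finset.range K, ∑ j ∈ Finset.range (K - s), ∫⁻ w, D j w * b j (j + s) w ∂μ := by
    calc X ≤ ∫⁻ w, ENNReal.ofReal c1 * ∑ j ∈ Finset.range K, ∑ k ∈ Finset.Ico j K, D j w * a k w ∂μ := lintegral_mono fun w => sum3 hq (fun k => a k w) K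
      _ = ENNReal.ofReal c1 * ∑ j ∈ Finset.range K, ∑ k ∈ Finset.Ico j K, ∫⁻ w, D j w * a k w ∂μ := by
        rw [lintegral_const_mul' _ _ ENNReal.ofReal_ne_top, lintegral_finsetSum _ fun j _ => hDs j]
        congr 1
        refine Finset.sum_congr rfl fun j _ => ?_
        rw [lintegral_finsetSum _ fun k _ => hDa j k]
      _ ≤ ENNReal.ofReal c1 * ∑ j ∈ Finset.range K, ∑ k ∈ Finset.Ico j K, ∫⁻ w, D j w * b j k w ∂μ := by
        refine mul_le_mul_right (Finset.sum_le_sum fun j _ => Finset.sum_le_sum fun k hk => ?_) _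
        exact hE j k (Finset.mem_Ico.1 hk).1 (Finset.mem_Ico.1 hk).2
      _ = _ := by
        congr 1
        have : ∀ j, ∑ k ∈ Finset.Ico j K, ∫⁻ w, D j w * b j k w ∂μ = ∑ s ∈ Finset.range (K - j), ∫⁻ w, D j w * b j (j + s) w ∂μ := fun j => Finset.sum_Ico_eq_sum_range _ _ _
        simp_rw [this]
        refine Finset.sum_comm' fun j s => ?_
        simp only [Finset.mem_range]
        omega
  set B : ℕ → Ω → ℝ≥0∞ := fun s w => (∑ j ∈ Finset.range (K - s), b j (j + s) w ^ q) ^ (1 / q) with hB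
  have hBm : ∀ s, Measurable (B s) := fun s => (Finset.measurable_sum _ fun j _ => (hbm j (j + s)).pow_const q).pow_const _
  have step2 : ∀ s < K, ∑ j ∈ Finset.range (K - s), ∫⁻ w, D j w * b j (j + s) w ∂μ ≤ X ^ (1 - 1 / q) * (ENNReal.ofReal (C0 * ρ ^ s) * Z) ^ (1 / q) := by
    intro s hs
    have p1 : ∀ w, ∑ j ∈ Finset.range (K - s), D j w * b j (j + s) w ≤ A w ^ (q - 1) * B s w := by
      intro w
      calc _ ≤ ∑ j ∈ Finset.range (K - s), a j w * A w ^ (q - 2) * B s w := by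
            refine Finset.sum_le_sum fun j hj => ?_
            have hj' := Finset.mem_range.1 hj
            refine mul_le_mul' (mul_le_mul_right (ENNReal.rpow_le_rpow ?_ (by linarith)) _) ?_
            · refine Finset.sum_le_sum_of_subset ?_
              intro i hi
              rw [Finset.mem_range] at *
              omega
            · calc b j (j + s) w = (b j (j + s) w ^ q) ^ (1 / q) := by rw [← ENNReal.rpow_mul, mul_one_div_cancel hq0.ne', ENNReal.rpow_one]
                _ ≤ B s w := ENNReal.rpow_le_rpow (Finset.single_le_sum (f := fun j => b j (j + s) w ^ q) (fun _ _ => zero_le) hj) (by positivity)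
        _ = (∑ j ∈ Finset.range (K - s), a j w) * A w ^ (q - 2) * B s w := by rw [Finset.sum_mul, Finset.sum_mul]
        _ ≤ A w * A w ^ (q - 2) * B s w := by
            gcongr
            refine Finset.sum_le_sum_of_subset ?_
            intro i hi
            rw [Finset.mem_range] at *
            omega
        _ = A w ^ (q - 1) * B s w := by
            congr 1
            rw [show q - 1 = 1 + (q - 2) by ring, ENNReal.rpow_add_of_nonneg _ _ (by norm_num) (by linarith), ENNReal.rpow_one]
    have hol := ENNReal.lintegral_mul_le_Lp_mul_Lq μ (p := q / (q - 1)) (q := q) (by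
      rw [Real.holderConjugate_iff]
      constructor
      · rw [lt_div_iff₀ (by linarith)]; linarith
      · rw [inv_div]; field_simp; ring) (hAm.pow_const (q - 1)).aemeasurable (hBm s).aemeasurable
    rw [← lintegral_finsetSum _ fun j _ => hDb j (j + s)]
    refine (lintegral_mono p1).trans (hol.trans (mul_le_mul' (le_of_eq ?_) ?_))
    · rw [hX]
      have e1 : ∀ w, (A w ^ (q - 1)) ^ (q / (q - 1)) = A w ^ q := fun w => by
        rw [← ENNReal.rpow_mul]; congr 1
        have : q - 1 ≠ 0 := by linarith
        field_simp
      simp_rw [e1]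
      congr 1
      field_simp
    · refine ENNReal.rpow_le_rpow ?_ (by positivity)
      have e1 : ∀ w, B s w ^ q = ∑ j ∈ Finset.range (K - s), b j (j + s) w ^ q := fun w => by
        simp only [hB]
        rw [← ENNReal.rpow_mul, one_div_mul_cancel hq0.ne', ENNReal.rpow_one]
      simp_rw [e1]
      rw [lintegral_finsetSum _ fun j _ => (hbm j (j + s)).pow_const q]
      exact hb s hs
  have step3 : X ≤ X ^ (1 - 1 / q) * (ENNReal.ofReal c2 * Z ^ (1 / q)) := by
    refine step1.trans ?_
    calc _ ≤ ENNReal.ofReal c1 * ∑ s ∈ Finset.range K, X ^ (1 - 1 / q) * (ENNReal.ofReal (C0 * ρ ^ s) * Z) ^ (1 / q) := 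
          mul_le_mul_right (Finset.sum_le_sum fun s hs => step2 s (Finset.mem_range.1 hs)) _
      _ = ENNReal.ofReal c1 * (X ^ (1 - 1 / q) * ((∑ s ∈ Finset.range K, ENNReal.ofReal (C0 ^ (1 / q) * (ρ ^ (1 / q)) ^ s)) * Z ^ (1 / q))) := by
          rw [← Finset.mul_sum, Finset.sum_mul]
          congr 2
          refine Finset.sum_congr rfl fun s _ => ?_
          rw [ENNReal.mul_rpow_of_nonneg _ _ (by positivity), ENNReal.ofReal_rpow_of_pos (by positivity), Real.mul_rpow hC0.le (by positivity), ← Real.rpow_natCast, ← Real.rpow_natCast, ← Real.rpow_mul h0.le, ← Real.rpow_mul h0.le, mul_comm (1 / q)]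
      _ ≤ ENNReal.ofReal c1 * (X ^ (1 - 1 / q) * (ENNReal.ofReal (C0 ^ (1 / q) * (1 - ρ ^ (1 / q))⁻¹) * Z ^ (1 / q))) := by
          gcongr
          rw [← ENNReal.ofReal_sum_of_nonneg fun s _ => by positivity, ← Finset.mul_sum]
          refine ENNReal.ofReal_le_ofReal ?_
          gcongr
          rw [← tsum_geometric_of_lt_one hρ.le hρ1]
          exact (summable_geometric_of_lt_one hρ.le hρ1).sum_le_tsum _ fun _ _ => by positivity
      _ = _ := by
          rw [hc2, ENNReal.ofReal_mul (p := c1) (by positivity)]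
          ring
  by_cases hX0 : X = 0
  · rw [hX0]; exact zero_le
  have hXp : X ^ (1 - 1 / q) ≠ 0 := by
    rw [Ne, ENNReal.rpow_eq_zero_iff]; push Not
    exact ⟨fun h => absurd h hX0, fun h => absurd h hXt⟩
  have h1q : 0 < 1 - 1 / q := by
    have : 1 / q < 1 := by rw [div_lt_one hq0]; linarith
    linarith
  have hXpt : X ^ (1 - 1 / q) ≠ ⊤ := ENNReal.rpow_ne_top_of_nonneg h1q.le hXt
  have step4 : X ^ (1 / q) ≤ ENNReal.ofReal c2 * Z ^ (1 / q) := by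
    have e : X = X ^ (1 - 1 / q) * X ^ (1 / q) := by
      rw [← ENNReal.rpow_add _ _ hX0 hXt]; simp
    have s3 : X ^ (1 - 1 / q) * X ^ (1 / q) ≤ X ^ (1 - 1 / q) * (ENNReal.ofReal c2 * Z ^ (1 / q)) := by rw [← e]; exact step3
    exact (ENNReal.mul_le_mul_iff_right hXp hXpt).1 s3
  calc X = (X ^ (1 / q)) ^ q := by rw [← ENNReal.rpow_mul, one_div_mul_cancel hq0.ne', ENNReal.rpow_one]
    _ ≤ (ENNReal.ofReal c2 * Z ^ (1 / q)) ^ q := ENNReal.rpow_le_rpow step4 hq0.le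
    _ = _ := by
      rw [ENNReal.mul_rpow_of_nonneg _ _ hq0.le, ← ENNReal.rpow_mul, one_div_mul_cancel hq0.ne', ENNReal.rpow_one, ENNReal.ofReal_rpow_of_pos hc20]
end absum

end Part22

section Part23
set_option linter.all false

variable {d : ℕ} [NeZero d]

lemma bl_dil {c : ℝ} (hc : 0 < c) (Λ : ℝ) (x : Ed d) : bl (c * Λ) (c • x) = bl Λ x := by
  ext i
  simp only [bl, PiLp.smul_apply, smul_eq_mul]
  rw [mul_div_mul_left _ _ hc.ne']

lemma EL_dil {c Λ : ℝ} (hc : 0 < c) (hΛ : 0 < Λ) (u : Ed d → ℝ≥0∞) (x : Ed d) :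
    EL Λ (fun y => u (c • y)) x = EL (c * Λ) u (c • x) := by
  unfold EL
  have h := lint_dil (d := d) hc (fun y => if bl (c * Λ) (c • x) = bl (c * Λ) y then u y else 0)
  simp only [bl_dil hc] at h ⊢
  rw [h, ← mul_assoc]
  congr 1
  rw [← ENNReal.ofReal_inv_of_pos (by positivity), ← ENNReal.ofReal_inv_of_pos (by positivity), ← ENNReal.ofReal_mul (by positivity)]
  congr 1
  rw [mul_pow, mul_inv, mul_comm]

lemma EL_cmul {Λ : ℝ} {c : ℝ≥0∞} (hc : c ≠ ⊤) (u : Ed d → ℝ≥0∞) (x : Ed d) :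
    EL Λ (fun y => c * u y) x = c * EL Λ u x := by
  unfold EL
  rw [mul_left_comm, ← lintegral_const_mul' _ _ hc]
  congr 1
  refine lintegral_congr fun y => ?_
  split_ifs <;> simp

lemma lint_dil1 {c : ℝ} (hc : 0 < c) (F : ℝ → ℝ≥0∞) : ∫⁻ t in Ioc (0:ℝ) 1, F (c * t) = ENNReal.ofReal (c⁻¹) * ∫⁻ t in Ioc 0 c, F t := by
  have h := (Homeomorph.mulLeft₀ c hc.ne').measurableEmbedding.lintegral_map (fun t => (Ioc 0 c).indicator F t) (μ := (volume : Measure ℝ))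
  have e2 : (Homeomorph.mulLeft₀ c hc.ne' : ℝ → ℝ) = fun x => c * x := rfl
  rw [e2, Real.map_volume_mul_left hc.ne', lintegral_smul_measure, abs_of_pos (by positivity), lintegral_indicator measurableSet_Ioc] at h
  rw [smul_eq_mul] at h
  rw [h, ← lintegral_indicator measurableSet_Ioc]
  refine lintegral_congr fun t => ?_
  simp only [indicator_apply, mem_Ioc]
  have : (0 < c * t ∧ c * t ≤ c) ↔ (0 < t ∧ t ≤ 1) := by
    rw [mul_pos_iff_of_pos_left hc, mul_le_iff_le_one_right hc]
  simp only [this]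

def ak (d n : ℕ) (α : ℝ) (g : Ed d → ℂ) (k : ℕ) (p : ℝ × Ed d) : ℝ≥0∞ :=
  ENNReal.ofReal (((2:ℝ) ^ k) ^ (-α)) * aa d n (hk d g k) (2 ^ k * p.1) ((2:ℝ) ^ k • p.2)

lemma ak_meas (n : ℕ) (α : ℝ) {g : Ed d → ℂ} (hg : Integrable g) (k : ℕ) : Measurable (ak d n α g k) := by
  unfold ak
  refine Measurable.const_mul ?_ _
  exact (aa_meas n (hk_int hg k)).comp (f := fun p : ℝ × Ed d => ((2:ℝ) ^ k * p.1, (2:ℝ) ^ k • p.2)) (by fun_prop)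

lemma aa_cell (n : ℕ) (g : Ed d → ℂ) (t : ℝ) {x y : Ed d} (h : cell x = cell y) : aa d n g t x = aa d n g t y := by
  unfold aa vr
  rw [h]

lemma cell_nest {i j : ℕ} (hij : i ≤ j) {x y : Ed d} (h : bl ((2:ℝ) ^ j)⁻¹ x = bl ((2:ℝ) ^ j)⁻¹ y) :
    cell ((2:ℝ) ^ i • x) = cell ((2:ℝ) ^ i • y) := by
  have key : ∀ z : Ed d, ∀ l, cell ((2:ℝ) ^ i • z) l = bl ((2:ℝ) ^ j)⁻¹ z l / ((2 ^ (j - i) : ℕ) : ℤ) := by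
    intro z l
    simp only [cell, bl, PiLp.smul_apply, smul_eq_mul, div_inv_eq_mul]
    rw [← Int.floor_div_natCast]
    congr 1
    push_cast
    obtain ⟨m, rfl⟩ := Nat.exists_eq_add_of_le hij
    rw [Nat.add_sub_cancel_left, pow_add]
    field_simp
  ext l
  rw [key, key, h]

lemma ak_const (n : ℕ) (α : ℝ) (g : Ed d → ℂ) {i j : ℕ} (hij : i ≤ j) (t : ℝ) {x y : Ed d} (h : bl ((2:ℝ) ^ j)⁻¹ x = bl ((2:ℝ) ^ j)⁻¹ y) :
    ak d n α g i (t, x) = ak d n α g i (t, y) := by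
  unfold ak
  simp only
  rw [aa_cell n _ _ (cell_nest hij h)]

lemma lpf_hk {q : ℝ} (g : Ed d → ℂ) (k : ℕ) : ENNReal.ofReal ((((2:ℝ) ^ k) ^ d)⁻¹) * ∫⁻ x, ‖hk d g k x‖ₑ ^ q = ∫⁻ x, ‖lpf d g k x‖ₑ ^ q := by
  rw [← lint_dil (by positivity) (fun x => ‖hk d g k x‖ₑ ^ q)]
  simp_rw [hk_lpf]

lemma b_bound (hd : 4 ≤ d) {q : ℝ} (hq : 1/q < 1/2 - (2 * kap d)⁻¹) (hq1 : 1 < q) (n : ℕ) (hn2 : 2 ≤ n) (hn : ((d:ℝ)-1)*(q/2-1)+1 ≤ n) :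
    ∃ C e : ℝ, 0 < C ∧ 0 < e ∧ ∀ g : Ed d → ℂ, Integrable g → ∀ j s : ℕ,
      ∫⁻ p : ℝ × Ed d, (EL ((2:ℝ) ^ j)⁻¹ (fun x => ak d n (d*(1/2-1/q)-1/2) g (j + s) (p.1, x)) p.2) ^ q ∂((volume.restrict (Ioc (0:ℝ) 1)).prod volume)
      ≤ ENNReal.ofReal (C * ((2:ℝ)^(-e)) ^ s) * ∫⁻ x, ‖lpf d g (j + s) x‖ₑ ^ q := by
  obtain ⟨C, e, hC, he, h⟩ := step9 hd hq hq1 n hn2 hn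
  refine ⟨C, e, hC, he, fun g hg j s => ?_⟩
  set α : ℝ := d*(1/2-1/q)-1/2 with hα
  set k := j + s with hk'
  have h2k : (0:ℝ) < 2 ^ k := by positivity
  have h2j : (0:ℝ) < 2 ^ j := by positivity
  have e1 : ∀ (t : ℝ) (z : Ed d), EL ((2:ℝ) ^ j)⁻¹ (fun x => ak d n α g k (t, x)) z
      = ENNReal.ofReal (((2:ℝ) ^ k) ^ (-α)) * EL ((2:ℝ) ^ s) (aa d n (hk d g k) (2 ^ k * t)) ((2:ℝ) ^ k • z) := by
    intro t z
    unfold ak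
    simp only
    rw [EL_cmul ENNReal.ofReal_ne_top, EL_dil h2k (by positivity)]
    congr 2
    rw [hk', pow_add]
    field_simp
  have hm : Measurable (fun p : ℝ × Ed d => (EL ((2:ℝ) ^ j)⁻¹ (fun x => ak d n α g k (p.1, x)) p.2) ^ q) :=
    (EL_meas_param _ (ak_meas n α hg k)).pow_const q
  rw [lintegral_prod _ hm.aemeasurable]
  simp only [e1]
  have e2 : ∀ t : ℝ, ∫⁻ x : Ed d, (ENNReal.ofReal (((2:ℝ) ^ k) ^ (-α)) * EL ((2:ℝ) ^ s) (aa d n (hk d g k) (2 ^ k * t)) ((2:ℝ) ^ k • x)) ^ q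
      = ENNReal.ofReal ((((2:ℝ) ^ k) ^ (-α)) ^ q * (((2:ℝ) ^ k) ^ d)⁻¹) * ∫⁻ x : Ed d, EL ((2:ℝ) ^ s) (aa d n (hk d g k) (2 ^ k * t)) x ^ q := by
    intro t
    simp_rw [ENNReal.mul_rpow_of_nonneg _ _ (by linarith : 0 ≤ q)]
    rw [lintegral_const_mul' _ _ (ENNReal.rpow_ne_top_of_nonneg (by linarith) ENNReal.ofReal_ne_top), lint_dil h2k (fun x => EL ((2:ℝ) ^ s) (aa d n (hk d g k) (2 ^ k * t)) x ^ q),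
      ENNReal.ofReal_rpow_of_nonneg (by positivity) (by linarith), ← mul_assoc, ← ENNReal.ofReal_mul (by positivity)]
  simp_rw [e2]
  rw [lintegral_const_mul' _ _ ENNReal.ofReal_ne_top, lint_dil1 h2k (fun t => ∫⁻ x : Ed d, EL ((2:ℝ) ^ s) (aa d n (hk d g k) t) x ^ q)]
  refine (mul_le_mul_right (mul_le_mul_right (h k s (by omega) (hk d g k) (hk_int hg k) (hk_cont hg k).measurable) _) _).trans (le_of_eq ?_)
  rw [← lpf_hk, ← mul_assoc, ← mul_assoc, ← mul_assoc, ← ENNReal.ofReal_mul (by positivity), ← ENNReal.ofReal_mul (by positivity), ← ENNReal.ofReal_mul (by positivity)]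
  congr 2
  have e3 : (((2:ℝ) ^ k) ^ (-α)) ^ q * ((2:ℝ) ^ k)⁻¹ * ((2:ℝ) ^ k) ^ (((d:ℝ)-1)*(q/2-1)) = 1 := by
    rw [← Real.rpow_mul h2k.le, ← Real.rpow_neg_one, ← Real.rpow_add h2k, ← Real.rpow_add h2k]
    have : -α * q + -1 + ((d:ℝ)-1)*(q/2-1) = 0 := by
      rw [hα]; field_simp; ring
    rw [this, Real.rpow_zero]
  have e4 : ((2:ℝ) ^ s) ^ (-e) = ((2:ℝ) ^ (-e)) ^ s := by
    rw [← Real.rpow_natCast, ← Real.rpow_natCast, ← Real.rpow_mul (by norm_num), ← Real.rpow_mul (by norm_num), mul_comm]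
  rw [← e4]
  calc _ = ((((2:ℝ) ^ k) ^ (-α)) ^ q * ((2:ℝ) ^ k)⁻¹ * ((2:ℝ) ^ k) ^ (((d:ℝ)-1)*(q/2-1))) * (C * ((2:ℝ) ^ s) ^ (-e) * (((2:ℝ) ^ k) ^ d)⁻¹) := by ring
    _ = _ := by rw [e3, one_mul]

lemma high_sum (hd : 4 ≤ d) {q : ℝ} (hq : 1/q < 1/2 - (2 * kap d)⁻¹) (hq1 : 2 < q) (n : ℕ) (hn2 : 2 ≤ n) (hn : ((d:ℝ)-1)*(q/2-1)+1 ≤ n) :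
    ∃ C : ℝ, 0 < C ∧ ∀ g : Ed d → ℂ, Integrable g → Measurable g → ∫⁻ x, ‖g x‖ₑ ^ q ≠ ⊤ →
      ∫⁻ t in Ioc (0:ℝ) 1, ∫⁻ x, (∑' k, ak d n (d*(1/2-1/q)-1/2) g k (t, x)) ^ q ≤ ENNReal.ofReal C * ∫⁻ x, ‖g x‖ₑ ^ q := by
  obtain ⟨C1, e, hC1, he, hb⟩ := b_bound hd hq (by linarith) n hn2 hn
  obtain ⟨C2, hC2, hlp⟩ := lp_ineq d hq1
  obtain ⟨C, hC, h⟩ := absum hq1 (ρ := (2:ℝ)^(-e)) (by positivity) (Real.rpow_lt_one_of_one_lt_of_neg (by norm_num) (by linarith)) hC1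
  refine ⟨C * C2, by positivity, fun g hg hgm hfin => ?_⟩
  set α : ℝ := d*(1/2-1/q)-1/2 with hα
  set a : ℕ → ℝ × Ed d → ℝ≥0∞ := fun k => ak d n α g k with ha
  have ham : ∀ k, Measurable (a k) := fun k => ak_meas n α hg k
  set μ : Measure (ℝ × Ed d) := (volume.restrict (Ioc (0:ℝ) 1)).prod volume with hμ
  set Z := ∑' k : ℕ, ∫⁻ x, ‖lpf d g k x‖ₑ ^ q with hZ
  have hZt : Z ≠ ⊤ := ne_top_of_le_ne_top (ENNReal.mul_ne_top ENNReal.ofReal_ne_top hfin) (hlp g hg hgm)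
  have hbm : ∀ j k, Measurable (fun p : ℝ × Ed d => EL ((2:ℝ) ^ j)⁻¹ (fun x => a k (p.1, x)) p.2) := fun j k => EL_meas_param _ (ham k)
  have main : ∀ K, ∫⁻ p, (∑ k ∈ Finset.range K, a k p) ^ q ∂μ ≤ ENNReal.ofReal C * Z := by
    intro K
    refine h μ K a (fun j k p => EL ((2:ℝ) ^ j)⁻¹ (fun x => a k (p.1, x)) p.2) Z ham hbm ?_ ?_ ?_
    · intro k _
      have := hb g hg k 0
      have e1 : ∀ p : ℝ × Ed d, EL ((2:ℝ) ^ k)⁻¹ (fun x => ak d n α g (k + 0) (p.1, x)) p.2 = a k p := by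
        intro p
        rw [EL_const_bl (by positivity) (fun x y hxy => ak_const n α g (le_of_eq (add_zero k)) p.1 hxy)]
        simp [ha]
      simp_rw [e1] at this
      refine ne_top_of_le_ne_top (ENNReal.mul_ne_top ENNReal.ofReal_ne_top ?_) this
      exact ne_top_of_le_ne_top hZt (ENNReal.le_tsum (k + 0))
    · intro j k hjk _
      have hDm : Measurable (fun p => a j p * (∑ i ∈ Finset.range (j + 1), a i p) ^ (q - 2)) := (ham j).mul ((Finset.measurable_sum _ fun k _ => ham k).pow_const _)
      have m1 : Measurable (fun p => a j p * (∑ i ∈ Finset.range (j + 1), a i p) ^ (q - 2) * a k p) := hDm.mul (ham k)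
      have m2 : Measurable (fun p : ℝ × Ed d => a j p * (∑ i ∈ Finset.range (j + 1), a i p) ^ (q - 2) * EL ((2:ℝ) ^ j)⁻¹ (fun x => a k (p.1, x)) p.2) := hDm.mul (hbm j k)
      rw [lintegral_prod _ m1.aemeasurable, lintegral_prod _ m2.aemeasurable]
      refine lintegral_mono fun t => le_of_eq ?_
      refine (EL_self (by positivity : (0:ℝ) < ((2:ℝ) ^ j)⁻¹) (b := fun x => a j (t, x) * (∑ i ∈ Finset.range (j + 1), a i (t, x)) ^ (q - 2)) (u := fun x => a k (t, x)) (hDm.comp measurable_prodMk_left) ((ham k).comp measurable_prodMk_left) ?_).symm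
      intro x y hxy
      simp only [ha]
      rw [ak_const n α g le_rfl t hxy]
      congr 2
      refine Finset.sum_congr rfl fun i hi => ak_const n α g (by rw [Finset.mem_range] at hi; omega) t hxy
    · intro s hs
      refine (Finset.sum_le_sum fun j _ => hb g hg j s).trans ?_
      rw [← Finset.mul_sum]
      refine mul_le_mul_right ?_ _
      refine (ENNReal.sum_le_tsum _).trans ?_
      exact ENNReal.tsum_comp_le_tsum_of_injective (f := fun j => j + s) (add_left_injective s) (fun k => ∫⁻ x, ‖lpf d g k x‖ₑ ^ q)
  have hts : Measurable (fun p => ∑' k, a k p) := Measurable.ennreal_tsum ham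
  have mc : ∫⁻ p, (∑' k, a k p) ^ q ∂μ ≤ ENNReal.ofReal C * Z := by
    have e2 : ∀ p, (∑' k, a k p) ^ q = ⨆ K, (∑ k ∈ Finset.range K, a k p) ^ q := by
      intro p
      rw [ENNReal.tsum_eq_iSup_nat]
      exact (ENNReal.orderIsoRpow q (by linarith)).map_iSup _
    simp_rw [e2]
    rw [lintegral_iSup]
    · exact iSup_le main
    · exact fun K => (Finset.measurable_sum _ fun k _ => ham k).pow_const q
    · intro K K' hK p
      exact ENNReal.rpow_le_rpow (Finset.sum_le_sum_of_subset (Finset.range_mono hK)) (by linarith)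
  rw [lintegral_prod _ (hts.pow_const q).aemeasurable] at mc
  refine mc.trans ?_
  rw [ENNReal.ofReal_mul hC.le, mul_assoc]
  exact mul_le_mul_right (hlp g hg hgm) _

end Part23

section Part24
set_option linter.all false

section P24sec
open scoped ContDiff

variable {d : ℕ} [NeZero d]

lemma young {q : ℝ} (hq : 1 < q) {k u : Ed d → ℝ≥0∞} (hk : Measurable k) (hu : Measurable u) :
    ∫⁻ x, (∫⁻ y, k y * u (x - y)) ^ q ≤ (∫⁻ y, k y) ^ q * ∫⁻ x, u x ^ q := by
  calc _ ≤ ∫⁻ x, (∫⁻ y, k y) ^ (q - 1) * ∫⁻ y, k y * u (x - y) ^ q := lintegral_mono fun x => jensen_weight hq hk (hu.comp (by fun_prop))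
    _ ≤ (∫⁻ y, k y) ^ (q - 1) * ∫⁻ x, ∫⁻ y, k y * u (x - y) ^ q := by
      have hm : Measurable (fun x => ∫⁻ y, k y * u (x - y) ^ q) := by
        refine Measurable.lintegral_prod_right (f := fun (x y : Ed d) => k y * u (x - y) ^ q) ?_
        exact (hk.comp measurable_snd).mul ((hu.comp (f := fun p : Ed d × Ed d => p.1 - p.2) (by fun_prop)).pow_const q)
      rw [lintegral_const_mul _ hm]
    _ = (∫⁻ y, k y) ^ (q - 1) * ∫⁻ y, k y * ∫⁻ x, u x ^ q := by
      congr 1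
      rw [lintegral_lintegral_swap]
      · refine lintegral_congr fun y => ?_
        have hm : Measurable (fun x => u (x - y) ^ q) := (hu.comp (by fun_prop)).pow_const q
        rw [lintegral_const_mul _ hm, lintegral_sub_right_eq_self (fun x => u x ^ q) y]
      · exact ((hk.comp measurable_snd).mul ((hu.comp (f := fun p : Ed d × Ed d => p.1 - p.2) (by fun_prop)).pow_const q)).aemeasurable
    _ = _ := by
      rw [lintegral_mul_const _ hk, ← mul_assoc]
      congr 1
      conv_lhs => rw [← ENNReal.rpow_one (∫⁻ y, k y)]
      rw [← ENNReal.rpow_mul, one_mul]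
      rw [← ENNReal.rpow_add_of_nonneg _ _ (by linarith) (by linarith)]
      congr 1; ring

lemma young_meas {k u : Ed d → ℝ≥0∞} (hk : Measurable k) (hu : Measurable u) : Measurable (fun x => ∫⁻ y, k y * u (x - y)) := by
  refine Measurable.lintegral_prod_right (f := fun (x y : Ed d) => k y * u (x - y)) ?_
  exact (hk.comp measurable_snd).mul (hu.comp (f := fun p : Ed d × Ed d => p.1 - p.2) (by fun_prop))

lemma conv_bd {m g : Ed d → ℂ} (hm : Integrable m) (hg : Integrable g) (x : Ed d) :
    ‖𝓕⁻ (fun ξ => m ξ * 𝓕 g ξ) x‖ₑ ≤ ∫⁻ y, ‖𝓕⁻ m y‖ₑ * ‖g (x - y)‖ₑ := by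
  rw [fourierInv_mul hm hg, ← integral_sub_left_eq_self _ volume x]
  refine (enorm_integral_le_lintegral_enorm _).trans (le_of_eq (lintegral_congr fun y => ?_))
  rw [enorm_mul, sub_sub_cancel]

lemma sum_bound {H : ℕ → Ed d → ℂ} {Hi : Ed d → ℂ} {B : Ed d → ℝ} (hB : Integrable B) (hH : ∀ k, Integrable (H k))
    (hb : ∀ K ξ, ‖∑ k ∈ Finset.range K, H k ξ‖ ≤ B ξ)
    (hl : ∀ ξ, Filter.Tendsto (fun K => ∑ k ∈ Finset.range K, H k ξ) Filter.atTop (nhds (Hi ξ))) (x : Ed d) :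
    ‖𝓕⁻ Hi x‖ₑ ≤ ∑' k, ‖𝓕⁻ (H k) x‖ₑ := by
  have h1 : Filter.Tendsto (fun K => 𝓕⁻ (fun ξ => ∑ k ∈ Finset.range K, H k ξ) x) Filter.atTop (nhds (𝓕⁻ Hi x)) := by
    simp only [Real.fourierInv_eq']
    refine tendsto_integral_of_dominated_convergence B ?_ hB ?_ ?_
    · intro K
      have hc : Continuous (fun v : Ed d => Complex.exp (((2 * Real.pi * inner ℝ v x : ℝ) : ℂ) * Complex.I)) := by fun_prop
      refine AEStronglyMeasurable.smul hc.aestronglyMeasurable ?_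
      exact (integrable_finsetSum _ fun k _ => hH k).aestronglyMeasurable
    · intro K
      refine Filter.Eventually.of_forall fun ξ => ?_
      rw [norm_smul, Complex.norm_exp_ofReal_mul_I, one_mul]
      exact hb K ξ
    · exact Filter.Eventually.of_forall fun ξ => (hl ξ).const_smul _
  refine le_of_tendsto (h1.enorm) (Filter.Eventually.of_forall fun K => ?_)
  have e : 𝓕⁻ (fun ξ => ∑ k ∈ Finset.range K, H k ξ) x = ∑ k ∈ Finset.range K, 𝓕⁻ (H k) x := by
    simp only [Real.fourierInv_eq']
    simp_rw [Finset.smul_sum]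
    rw [integral_finsetSum]
    intro k _
    have : Integrable (fun v => H k v * Complex.exp (((2 * Real.pi * inner ℝ v x : ℝ) : ℂ) * Complex.I)) := by
      refine (hH k).mul_bdd (c := 1) (Continuous.aestronglyMeasurable (by fun_prop)) (Filter.Eventually.of_forall fun ξ => ?_)
      rw [Complex.norm_exp_ofReal_mul_I]
    refine this.congr (Filter.Eventually.of_forall fun v => ?_)
    simp only [smul_eq_mul]; ring
  rw [e]
  refine (enorm_sum_le _ _).trans (ENNReal.sum_le_tsum _)

/-- cutoffs -/
def et (l : ℝ) : ℝ := Real.smoothTransition (2 - l ^ 2)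
def be (l : ℝ) : ℝ := et l - et (2 * l)
def bg (δ l : ℝ) : ℂ := ((Real.smoothTransition (16 * l - 2) * be l : ℝ) : ℂ)

lemma et_one {l : ℝ} (h0 : 0 ≤ l) (h : l ≤ 1) : et l = 1 := Real.smoothTransition.one_of_one_le (by nlinarith)
lemma et_zero {l : ℝ} (h : 2 ≤ l) : et l = 0 := Real.smoothTransition.zero_of_nonpos (by nlinarith)
lemma et_nonneg (l : ℝ) : 0 ≤ et l := Real.smoothTransition.nonneg _
lemma et_le (l : ℝ) : et l ≤ 1 := Real.smoothTransition.le_one _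
lemma et_smooth : ContDiff ℝ ∞ et := Real.smoothTransition.contDiff.comp (by fun_prop)
lemma be_smooth : ContDiff ℝ ∞ be := et_smooth.sub (et_smooth.comp (by fun_prop))
lemma be_zero {l : ℝ} (h0 : 0 ≤ l) (h : l ∉ Icc (1/2:ℝ) 2) : be l = 0 := by
  unfold be
  rcases lt_or_ge l (1/2) with h1 | h1
  · rw [et_one h0 (by linarith), et_one (by linarith) (by linarith), sub_self]
  · have : 2 < l := by
      by_contra hh
      exact h ⟨h1, by linarith⟩
    rw [et_zero this.le, et_zero (by linarith), sub_self]
lemma be_abs (l : ℝ) : |be l| ≤ 1 := by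
  unfold be
  rw [abs_le]
  constructor <;> linarith [et_nonneg l, et_nonneg (2 * l), et_le l, et_le (2 * l)]

lemma bg_eq {l : ℝ} (h : 0 ≤ l) (δ : ℝ) : bg δ l = ((be l : ℝ) : ℂ) := by
  unfold bg
  rcases lt_or_ge l (1/2) with h1 | h1
  · rw [be_zero h (by intro hh; linarith [hh.1])]; simp
  · rw [Real.smoothTransition.one_of_one_le (by linarith), one_mul]

lemma bg_good : Good bg := by
  constructor
  · have : ContDiff ℝ ∞ (fun p : ℝ × ℝ => Real.smoothTransition (16 * p.2 - 2) * be p.2) :=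
      (Real.smoothTransition.contDiff.comp (by fun_prop)).mul (be_smooth.comp contDiff_snd)
    exact Complex.ofRealCLM.contDiff.comp this
  · intro δ l h
    unfold bg
    rcases lt_or_ge l (1/8) with h1 | h1
    · rw [Real.smoothTransition.zero_of_nonpos (by linarith)]; simp
    · rw [be_zero (by linarith)]; · simp
      intro hh
      exact h ⟨h1, by linarith [hh.2]⟩

/-- high frequency symbol -/
def bh (α δ l : ℝ) : ℂ := (((δ ^ 2 + l ^ 2) ^ (-(α / 2)) : ℝ) : ℂ) * bg δ l

lemma bh_good (α : ℝ) : Good (bh α) := by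
  refine bg_good.mul (g := fun δ l => (((δ ^ 2 + l ^ 2) ^ (-(α / 2)) : ℝ) : ℂ)) fun p hp => ?_
  have : ContDiffAt ℝ ∞ (fun p : ℝ × ℝ => (p.1 ^ 2 + p.2 ^ 2) ^ (-(α / 2))) p := by
    refine ContDiffAt.rpow_const_of_ne (by fun_prop) ?_
    have := pow_pos hp 2
    positivity
  exact Complex.ofRealCLM.contDiff.contDiffAt.comp p this

/-- low frequency symbol -/
def bw (δ l : ℝ) : ℂ := (Complex.I * l * dslope Complex.exp 0 (Complex.I * δ * l)) * bg δ l

lemma bw_good : Good bw := by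
  refine bg_good.mul (g := fun δ l => (Complex.I * l * dslope Complex.exp 0 (Complex.I * δ * l))) fun p hp => ?_
  have h1 : Differentiable ℂ (dslope Complex.exp 0) := by
    rw [← differentiableOn_univ, Complex.differentiableOn_dslope Filter.univ_mem]
    exact Complex.differentiable_exp.differentiableOn
  have h2 : ContDiff ℝ ∞ (dslope Complex.exp 0) := (h1.contDiff (n := ∞)).restrict_scalars ℝ
  have h3 : ContDiff ℝ ∞ (fun p : ℝ × ℝ => Complex.I * (p.1:ℂ) * (p.2:ℂ)) :=
    (contDiff_const.mul (Complex.ofRealCLM.contDiff.comp contDiff_fst)).mul (Complex.ofRealCLM.contDiff.comp contDiff_snd)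
  have h4 : ContDiff ℝ ∞ (fun p : ℝ × ℝ => Complex.I * (p.2:ℂ)) :=
    (contDiff_const.mul (Complex.ofRealCLM.contDiff.comp contDiff_snd))
  exact (h4.mul (h2.comp h3)).contDiffAt

lemma bw_eq (δ : ℝ) {l : ℝ} (h : 0 ≤ l) : (δ:ℂ) * bw δ l = (Complex.exp (Complex.I * δ * l) - 1) * ((be l : ℝ) : ℂ) := by
  unfold bw
  rw [bg_eq h]
  have := sub_smul_dslope Complex.exp 0 (Complex.I * δ * l)
  simp only [sub_zero, smul_eq_mul, Complex.exp_zero] at this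
  rw [← this]; ring
end P24sec

end Part24

section Part25
set_option linter.all false

variable {d : ℕ} [NeZero d]

lemma fourierInv_cmul (a : ℂ) (φ : Ed d → ℂ) (x : Ed d) : 𝓕⁻ (fun ξ => a * φ ξ) x = a * 𝓕⁻ φ x := by
  simp only [Real.fourierInv_eq', smul_eq_mul]
  rw [← integral_const_mul]
  congr 1; ext v; ring

lemma high_piece (hd : 3 ≤ d) (n : ℕ) (α : ℝ) : ∃ C : ℝ, 0 < C ∧ ∀ g : Ed d → ℂ, Integrable g → ∀ t : ℝ, 0 ≤ t → ∀ (k : ℕ) (x : Ed d),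
    ‖𝓕⁻ (fun ξ : Ed d => Complex.exp (Complex.I * t * ‖ξ‖) * (((1 + ‖ξ‖ ^ 2) ^ (-(α / 2)) : ℝ) : ℂ) * ((be (((2:ℝ) ^ k)⁻¹ * ‖ξ‖) : ℝ) : ℂ) * 𝓕 g ξ) x‖ₑ
      ≤ ENNReal.ofReal C * ak d n α g k (t, x) := by
  obtain ⟨C, hC, h⟩ := F4 hd n (bh α) (bh_good α)
  refine ⟨C, hC, fun g hg t ht k x => ?_⟩
  set c : ℝ := 2 ^ k with hc
  have hc0 : 0 < c := by positivity
  have hc1 : 1 ≤ c := one_le_pow₀ (by norm_num)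
  set φ : Ed d → ℂ := fun ζ => wm (bh α) c⁻¹ (c * t) ‖ζ‖ * (𝓕 (hk d g k) ζ * 𝓕 (psi d : Ed d → ℂ) ζ) with hφ
  have e3 : ∀ ξ, 𝓕 (gk g k) ξ = ((c ^ d : ℝ) : ℂ) * 𝓕 g (c • ξ) := by
    intro ξ
    show 𝓕 (fun x => g (((2:ℝ) ^ k)⁻¹ • x)) ξ = _
    rw [fourier_dil (by positivity), inv_inv, inv_pow, inv_inv]
  have key : (fun ξ : Ed d => Complex.exp (Complex.I * t * ‖ξ‖) * (((1 + ‖ξ‖ ^ 2) ^ (-(α / 2)) : ℝ) : ℂ) * ((be (c⁻¹ * ‖ξ‖) : ℝ) : ℂ) * 𝓕 g ξ)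
      = fun ξ => ((c ^ (-α) * (c ^ d)⁻¹ : ℝ) : ℂ) * φ (c⁻¹ • ξ) := by
    ext ξ
    have hn : ‖c⁻¹ • ξ‖ = c⁻¹ * ‖ξ‖ := by rw [norm_smul, Real.norm_of_nonneg (by positivity)]
    have hn0 : 0 ≤ c⁻¹ * ‖ξ‖ := by positivity
    simp only [hφ, wm, hn, bh, bg_eq hn0]
    by_cases hb : c⁻¹ * ‖ξ‖ ∈ Icc (1/2:ℝ) 2
    · have m1 : mfun d (c⁻¹ • ξ) * 𝓕 (psi d : Ed d → ℂ) (c⁻¹ • ξ) = 1 := by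
        have := mfun_mul (d := d) (ξ := c⁻¹ • ξ) (by rw [hn]; exact hb)
        rwa [SchwartzMap.fourier_coe] at this
      have m2 : 𝓕 (hk d g k) (c⁻¹ • ξ) * 𝓕 (psi d : Ed d → ℂ) (c⁻¹ • ξ) = ((c ^ d : ℝ) : ℂ) * 𝓕 g ξ := by
        rw [hk_fourier hg, mul_right_comm, m1, one_mul, e3, smul_smul, mul_inv_cancel₀ hc0.ne', one_smul]
      rw [m2]
      have m3 : (c⁻¹ ^ 2 + (c⁻¹ * ‖ξ‖) ^ 2) ^ (-(α / 2)) = c ^ α * (1 + ‖ξ‖ ^ 2) ^ (-(α / 2)) := by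
        rw [show c⁻¹ ^ 2 + (c⁻¹ * ‖ξ‖) ^ 2 = c ^ (-2:ℝ) * (1 + ‖ξ‖ ^ 2) by
          rw [Real.rpow_neg hc0.le, Real.rpow_two]; field_simp]
        rw [Real.mul_rpow (by positivity) (by positivity), ← Real.rpow_mul hc0.le]
        congr 2; ring
      rw [m3]
      have m4 : (Complex.I * ((c * t : ℝ) : ℂ) * ((c⁻¹ * ‖ξ‖ : ℝ) : ℂ)) = Complex.I * t * ‖ξ‖ := by
        push_cast
        have : (c:ℂ) ≠ 0 := by exact_mod_cast hc0.ne'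
        field_simp
      rw [m4]
      have m5 : ((c ^ (-α) * (c ^ d)⁻¹ : ℝ) : ℂ) * ((c ^ α : ℝ) : ℂ) * ((c ^ d : ℝ) : ℂ) = 1 := by
        rw [← Complex.ofReal_mul, ← Complex.ofReal_mul]
        rw [show c ^ (-α) * (c ^ d)⁻¹ * c ^ α * c ^ d = 1 by
          rw [Real.rpow_neg hc0.le]; field_simp]
        simp
      rw [Complex.ofReal_mul (c ^ α)]
      linear_combination (-(Complex.exp (Complex.I * t * ‖ξ‖) * (((1 + ‖ξ‖ ^ 2) ^ (-(α / 2)) : ℝ) : ℂ) * ((be (c⁻¹ * ‖ξ‖) : ℝ) : ℂ) * 𝓕 g ξ)) * m5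
    · rw [be_zero hn0 hb]; simp
  rw [key, fourierInv_cmul, fourierInv_dil (by positivity), inv_inv]
  have hδ : c⁻¹ ∈ Icc (0:ℝ) 1 := ⟨by positivity, inv_le_one_of_one_le₀ hc1⟩
  have hF := h (hk d g k) (hk_int hg k) (c * t) (by positivity) c⁻¹ hδ (c • x)
  rw [← mul_assoc, ← Complex.ofReal_mul]
  rw [show c ^ (-α) * (c ^ d)⁻¹ * (c⁻¹ ^ d)⁻¹ = c ^ (-α) by rw [inv_pow, inv_inv]; field_simp]
  rw [enorm_mul, ← ofReal_norm (((c ^ (-α) : ℝ)) : ℂ), Complex.norm_real, Real.norm_of_nonneg (by positivity), ak]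
  calc _ ≤ ENNReal.ofReal (c ^ (-α)) * (ENNReal.ofReal C * aa d n (hk d g k) (c * t) (c • x)) := mul_le_mul_right hF _
    _ = _ := by rw [mul_left_comm]

lemma et_tel (J : ℕ) (l : ℝ) : ∑ j ∈ Finset.range J, be ((2:ℝ) ^ j * l) = et l - et ((2:ℝ) ^ J * l) := by
  induction J with
  | zero => simp
  | succ J ih => rw [Finset.sum_range_succ, ih, be, pow_succ, show 2 * ((2:ℝ) ^ J * l) = 2 ^ J * 2 * l by ring]; ring

lemma et_tel2 (J : ℕ) (l : ℝ) : ∑ j ∈ Finset.range J, be (((2:ℝ) ^ (j + 1))⁻¹ * l) = et (((2:ℝ) ^ J)⁻¹ * l) - et l := by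
  induction J with
  | zero => simp
  | succ J ih =>
    rw [Finset.sum_range_succ, ih, be, show 2 * (((2:ℝ) ^ (J + 1))⁻¹ * l) = ((2:ℝ) ^ J)⁻¹ * l by rw [pow_succ]; field_simp]; ring

lemma et_lim0 {l : ℝ} (h : 0 < l) : ∀ᶠ J : ℕ in Filter.atTop, et ((2:ℝ) ^ J * l) = 0 := by
  have : Filter.Tendsto (fun J : ℕ => (2:ℝ) ^ J * l) Filter.atTop Filter.atTop := (tendsto_pow_atTop_atTop_of_one_lt (by norm_num)).atTop_mul_const h
  filter_upwards [this.eventually_ge_atTop 2] with J hJ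
  exact et_zero hJ

lemma et_lim1 {l : ℝ} (h : 0 ≤ l) : ∀ᶠ J : ℕ in Filter.atTop, et (((2:ℝ) ^ J)⁻¹ * l) = 1 := by
  have : Filter.Tendsto (fun J : ℕ => (2:ℝ) ^ J) Filter.atTop Filter.atTop := (tendsto_pow_atTop_atTop_of_one_lt (by norm_num))
  filter_upwards [this.eventually_ge_atTop l] with J hJ
  refine et_one (by positivity) ?_
  rw [inv_mul_le_iff₀ (by positivity)]; linarith

def psz (d : ℕ) (s : ℝ) : ℝ := s ^ (-kap d) * ((1 + 2 * Real.pi * s) ^ (d + 2))⁻¹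

lemma psz_int (hd : 4 ≤ d) : ∫⁻ x : Ed d, ENNReal.ofReal (psz d ‖x‖) ≠ ⊤ := by
  have h1 : Integrable (fun x : Ed d => psz d ‖x‖) := by
    rw [integrable_fun_norm_addHaar volume, finrank_euclideanSpace_fin]
    have h2 : Integrable (fun r : ℝ => (1 + ‖r‖) ^ (-2:ℝ)) := integrable_one_add_norm (by simp)
    refine (h2.restrict (s := Ioi 0)).mono' ?_ ?_
    · unfold psz
      exact Measurable.aestronglyMeasurable (by fun_prop)
    · refine (ae_restrict_iff' measurableSet_Ioi).2 (Filter.Eventually.of_forall fun r hr => ?_)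
      have hr0 : (0:ℝ) < r := hr
      have hp := Real.pi_gt_three
      have hnn : 0 ≤ psz d r := by unfold psz; positivity
      rw [smul_eq_mul, Real.norm_of_nonneg (by positivity), Real.norm_of_nonneg hr0.le, psz]
      have hk := kap_ge hd
      have a1 : r ^ (d - 1) * r ^ (-kap d) = r ^ (kap d) := by
        rw [← Real.rpow_natCast, ← Real.rpow_add hr0, Nat.cast_sub (by omega)]
        congr 1
        simp only [kap]; push_cast; ring
      have a2 : r ^ (kap d) ≤ (1 + r) ^ d := by
        calc r ^ (kap d) ≤ (1 + r) ^ (kap d) := Real.rpow_le_rpow hr0.le (by linarith) (by linarith)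
          _ ≤ (1 + r) ^ (d:ℝ) := Real.rpow_le_rpow_of_exponent_le (by linarith) (by
            simp only [kap]; have : (0:ℝ) ≤ d := by positivity
            linarith)
          _ = _ := Real.rpow_natCast _ _
      have a3 : ((1 + 2 * Real.pi * r) ^ (d + 2))⁻¹ ≤ ((1 + r) ^ (d + 2))⁻¹ := by
        gcongr
        nlinarith
      rw [← mul_assoc, a1]
      calc _ ≤ (1 + r) ^ d * ((1 + r) ^ (d + 2))⁻¹ := mul_le_mul a2 a3 (by positivity) (by positivity)
        _ = _ := by
          rw [Real.rpow_neg (by positivity), Real.rpow_two, pow_add]; field_simp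
  exact h1.lintegral_lt_top.ne

lemma low_diff (hd : 4 ≤ d) : ∃ W : Ed d → ℝ≥0∞, Measurable W ∧ ∫⁻ x, W x ≠ ⊤ ∧ ∀ g : Ed d → ℂ, Integrable g → Measurable g → Integrable (𝓕 g) → ∀ t ∈ Icc (0:ℝ) 1, ∀ x,
    ‖𝓕⁻ (fun ξ : Ed d => (Complex.exp (Complex.I * t * ‖ξ‖) - 1) * ((et ‖ξ‖ : ℝ) : ℂ) * 𝓕 g ξ) x‖ₑ ≤ ∫⁻ y, W y * ‖g (x - y)‖ₑ := by
  obtain ⟨C, hC, h⟩ := kr_decay (d := d) (by omega) (d + 2) bw bw_good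
  set Wj : ℕ → Ed d → ℝ≥0∞ := fun j y => ENNReal.ofReal (((2:ℝ) ^ j)⁻¹ * (((2:ℝ) ^ j) ^ d)⁻¹ * C) * ENNReal.ofReal (psz d ‖((2:ℝ) ^ j)⁻¹ • y‖) with hWj
  have hpm : Measurable (fun y : Ed d => ENNReal.ofReal (psz d ‖y‖)) := by
    unfold psz; fun_prop
  have hWm : ∀ j, Measurable (Wj j) := fun j => (hpm.comp (f := fun y : Ed d => ((2:ℝ) ^ j)⁻¹ • y) (by fun_prop)).const_mul _
  have hWi : ∀ j, ∫⁻ y, Wj j y = (2⁻¹:ℝ≥0∞) ^ j * (ENNReal.ofReal C * ∫⁻ x : Ed d, ENNReal.ofReal (psz d ‖x‖)) := by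
    intro j
    simp only [hWj]
    rw [lintegral_const_mul' _ _ ENNReal.ofReal_ne_top, lint_dil (by positivity) (fun y : Ed d => ENNReal.ofReal (psz d ‖y‖)), ← mul_assoc, ← mul_assoc, ← ENNReal.ofReal_mul (by positivity)]
    congr 1
    have : (2⁻¹:ℝ≥0∞) ^ j = ENNReal.ofReal (((2:ℝ) ^ j)⁻¹) := by
      rw [← inv_pow, ENNReal.ofReal_pow (by norm_num), ENNReal.ofReal_inv_of_pos (by norm_num)]
      simp
    rw [this, ← ENNReal.ofReal_mul (by positivity)]
    congr 1
    rw [inv_pow, inv_inv]; field_simp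
  refine ⟨fun y => ∑' j, Wj j y, Measurable.ennreal_tsum hWm, ?_, fun g hg hgm hF t ht x => ?_⟩
  · rw [lintegral_tsum fun j => (hWm j).aemeasurable]
    simp_rw [hWi]
    rw [ENNReal.tsum_mul_right, ENNReal.tsum_geometric_two]
    exact ENNReal.mul_ne_top (by simp) (ENNReal.mul_ne_top ENNReal.ofReal_ne_top (psz_int hd))
  set m : ℕ → Ed d → ℂ := fun j ξ => (Complex.exp (Complex.I * t * ‖ξ‖) - 1) * ((be ((2:ℝ) ^ j * ‖ξ‖) : ℝ) : ℂ) with hm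
  have hme : ∀ j, m j = fun ξ => ((t * ((2:ℝ) ^ j)⁻¹ : ℝ) : ℂ) * (fun ζ : Ed d => wm bw (t * ((2:ℝ) ^ j)⁻¹) 0 ‖ζ‖) ((2:ℝ) ^ j • ξ) := by
    intro j
    ext ξ
    have hn : ‖(2:ℝ) ^ j • ξ‖ = (2:ℝ) ^ j * ‖ξ‖ := by rw [norm_smul, Real.norm_of_nonneg (by positivity)]
    simp only [hm, wm, hn]
    rw [mul_left_comm, bw_eq _ (by positivity)]
    have : (Complex.I * ((t * ((2:ℝ) ^ j)⁻¹ : ℝ) : ℂ) * (((2:ℝ) ^ j * ‖ξ‖ : ℝ) : ℂ)) = Complex.I * t * ‖ξ‖ := by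
      push_cast
      field_simp
    rw [this]; simp
  have hmi : ∀ j, Integrable (m j) := by
    intro j
    rw [hme]
    exact (int_dil (f := fun ζ : Ed d => wm bw (t * ((2:ℝ) ^ j)⁻¹) 0 ‖ζ‖) (by positivity) (wm_integrable bw_good _ 0)).const_mul _
  have hk1 : ∀ j (y : Ed d), y ≠ 0 → ‖𝓕⁻ (m j) y‖ₑ ≤ Wj j y := by
    intro j y hy
    have hδ : t * ((2:ℝ) ^ j)⁻¹ ∈ Icc (0:ℝ) 1 := ⟨mul_nonneg ht.1 (by positivity), mul_le_one₀ ht.2 (by positivity) (inv_le_one_of_one_le₀ (one_le_pow₀ (by norm_num)))⟩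
    have e0 : 𝓕⁻ (m j) y = ((t * ((2:ℝ) ^ j)⁻¹ : ℝ) : ℂ) * (((((2:ℝ) ^ j) ^ d)⁻¹ : ℝ) * kr d bw (t * ((2:ℝ) ^ j)⁻¹) 0 ‖((2:ℝ) ^ j)⁻¹ • y‖) := by
      rw [hme, ← kernel_eq bw_good]
      refine (fourierInv_cmul _ _ _).trans ?_
      congr 1
      exact fourierInv_dil (by positivity) (fun ζ : Ed d => wm bw (t * ((2:ℝ) ^ j)⁻¹) 0 ‖ζ‖) y
    rw [e0]
    have hs : 0 < ‖((2:ℝ) ^ j)⁻¹ • y‖ := norm_pos_iff.2 (smul_ne_zero (by positivity) hy)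
    have h1 := h _ hs 0 _ hδ
    rw [abs_zero, sub_zero, abs_of_nonneg (by positivity)] at h1
    simp only [hWj]
    rw [← ofReal_norm, ← ENNReal.ofReal_mul (by positivity)]
    refine ENNReal.ofReal_le_ofReal ?_
    rw [norm_mul, norm_mul, Complex.norm_real, Complex.norm_real, Real.norm_of_nonneg hδ.1, Real.norm_of_nonneg (by positivity)]
    have h2 : t * ((2:ℝ) ^ j)⁻¹ ≤ ((2:ℝ) ^ j)⁻¹ := mul_le_of_le_one_left (by positivity) ht.2
    calc _ ≤ ((2:ℝ) ^ j)⁻¹ * ((((2:ℝ) ^ j) ^ d)⁻¹ * (C * ‖((2:ℝ) ^ j)⁻¹ • y‖ ^ (-kap d) * ((1 + 2 * Real.pi * ‖((2:ℝ) ^ j)⁻¹ • y‖) ^ (d + 2))⁻¹)) :=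
          mul_le_mul h2 (mul_le_mul_of_nonneg_left h1 (by positivity)) (by positivity) (by positivity)
      _ = _ := by unfold psz; ring
  have hsum := sum_bound (H := fun j ξ => m j ξ * 𝓕 g ξ) (Hi := fun ξ : Ed d => (Complex.exp (Complex.I * t * ‖ξ‖) - 1) * ((et ‖ξ‖ : ℝ) : ℂ) * 𝓕 g ξ) (B := fun ξ => 2 * ‖𝓕 g ξ‖) (hF.norm.const_mul 2) ?_ ?_ ?_ x
  · refine hsum.trans ?_
    have e : ∫⁻ y, (∑' j, Wj j y) * ‖g (x - y)‖ₑ = ∑' j, ∫⁻ y, Wj j y * ‖g (x - y)‖ₑ := by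
      simp_rw [← ENNReal.tsum_mul_right]
      rw [lintegral_tsum]
      intro j
      exact ((hWm j).mul (hgm.comp (by fun_prop : Measurable fun y : Ed d => x - y)).enorm).aemeasurable
    rw [e]
    refine ENNReal.tsum_le_tsum fun j => (conv_bd (hmi j) hg x).trans ?_
    haveI : Nontrivial (Ed d) := inferInstance
    refine lintegral_mono_ae ?_
    have : ∀ᵐ y : Ed d, y ≠ 0 := by
      rw [ae_iff]; simp
    filter_upwards [this] with y hy
    exact mul_le_mul_left (hk1 j y hy) _
  · intro j
    have hb : ∀ ξ, ‖m j ξ‖ ≤ 2 := by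
      intro ξ
      simp only [hm]
      rw [norm_mul, Complex.norm_real]
      have h1 : ‖Complex.exp (Complex.I * t * ‖ξ‖) - 1‖ ≤ 2 := by
        refine (norm_sub_le _ _).trans ?_
        rw [show Complex.I * t * ‖ξ‖ = ((t * ‖ξ‖ : ℝ) : ℂ) * Complex.I by push_cast; ring, Complex.norm_exp_ofReal_mul_I]
        norm_num
      have h2 := be_abs ((2:ℝ) ^ j * ‖ξ‖)
      rw [Real.norm_eq_abs]
      nlinarith [norm_nonneg (Complex.exp (Complex.I * t * ‖ξ‖) - 1), abs_nonneg (be ((2:ℝ) ^ j * ‖ξ‖))]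
    exact hF.bdd_mul (c := 2) (hmi j).aestronglyMeasurable (Filter.Eventually.of_forall hb)
  · intro K ξ
    have e1 : ∑ k ∈ Finset.range K, m k ξ * 𝓕 g ξ = (Complex.exp (Complex.I * t * ‖ξ‖) - 1) * ((et ‖ξ‖ - et ((2:ℝ) ^ K * ‖ξ‖) : ℝ) : ℂ) * 𝓕 g ξ := by
      rw [← et_tel, ← Finset.sum_mul]
      simp only [hm]
      rw [← Finset.mul_sum]; push_cast; rfl
    rw [e1, norm_mul]
    refine mul_le_mul_of_nonneg_right ?_ (norm_nonneg _)
    rw [norm_mul, Complex.norm_real]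
    have h1 : ‖Complex.exp (Complex.I * t * ‖ξ‖) - 1‖ ≤ 2 := by
      refine (norm_sub_le _ _).trans ?_
      rw [show Complex.I * t * ‖ξ‖ = ((t * ‖ξ‖ : ℝ) : ℂ) * Complex.I by push_cast; ring, Complex.norm_exp_ofReal_mul_I]
      norm_num
    have h2 : |et ‖ξ‖ - et ((2:ℝ) ^ K * ‖ξ‖)| ≤ 1 := by
      rw [abs_le]
      constructor <;> linarith [et_nonneg ‖ξ‖, et_nonneg ((2:ℝ) ^ K * ‖ξ‖), et_le ‖ξ‖, et_le ((2:ℝ) ^ K * ‖ξ‖)]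
    rw [Real.norm_eq_abs]
    nlinarith [norm_nonneg (Complex.exp (Complex.I * t * ‖ξ‖) - 1), abs_nonneg (et ‖ξ‖ - et ((2:ℝ) ^ K * ‖ξ‖))]
  · intro ξ
    refine tendsto_const_nhds.congr' ?_
    have e1 : ∀ K, ∑ k ∈ Finset.range K, m k ξ * 𝓕 g ξ = (Complex.exp (Complex.I * t * ‖ξ‖) - 1) * ((et ‖ξ‖ - et ((2:ℝ) ^ K * ‖ξ‖) : ℝ) : ℂ) * 𝓕 g ξ := by
      intro K
      rw [← et_tel, ← Finset.sum_mul]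
      simp only [hm]
      rw [← Finset.mul_sum]; push_cast; rfl
    rcases (norm_nonneg ξ).eq_or_lt with h0 | h0
    · refine Filter.Eventually.of_forall fun K => ?_
      simp only
      rw [e1, ← h0]; simp
    · filter_upwards [et_lim0 h0] with K hK
      rw [e1, hK, sub_zero]

end Part25

section Part26
set_option linter.all false

section P26sec
open scoped ContDiff

variable {d : ℕ} [NeZero d]

def ww (α : ℝ) (ξ : Ed d) : ℝ := (1 + ‖ξ‖ ^ 2) ^ (-(α / 2))

lemma ww_smooth (α : ℝ) : ContDiff ℝ ∞ (ww (d := d) α) := by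
  unfold ww
  rw [contDiff_iff_contDiffAt]
  intro ξ
  refine ContDiffAt.rpow_const_of_ne (contDiffAt_const.add (contDiff_norm_sq ℝ).contDiffAt) (by positivity)

lemma ww_nonneg (α : ℝ) (ξ : Ed d) : 0 ≤ ww α ξ := by unfold ww; positivity

lemma ww_le {α : ℝ} (hα : 0 ≤ α) (ξ : Ed d) : ww α ξ ≤ 1 := by
  unfold ww
  exact Real.rpow_le_one_of_one_le_of_nonpos (by nlinarith [norm_nonneg ξ]) (by linarith)

lemma etn_smooth : ContDiff ℝ ∞ (fun ξ : Ed d => et ‖ξ‖) := by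
  unfold et
  exact Real.smoothTransition.contDiff.comp (contDiff_const.sub (contDiff_norm_sq ℝ))

lemma etn_compact : HasCompactSupport (fun ξ : Ed d => et ‖ξ‖) := by
  refine HasCompactSupport.of_support_subset_isCompact (isCompact_closedBall (0 : Ed d) 2) ?_
  intro ξ hξ
  rw [mem_closedBall, dist_zero_right]
  by_contra hh
  exact hξ (et_zero (by linarith))

/-- Schwartz multiplier attached to a compactly supported smooth real function -/
def mkS (χ : Ed d → ℝ) (hχ : ContDiff ℝ ∞ χ) (hc : HasCompactSupport χ) (α : ℝ) : SchwartzMap (Ed d) ℂ :=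
  HasCompactSupport.toSchwartzMap (f := fun ξ => ((χ ξ * ww α ξ : ℝ) : ℂ)) ((hc.mul_right (f' := ww α)).comp_left (g := fun r : ℝ => (r : ℂ)) (by simp))
    (Complex.ofRealCLM.contDiff.comp (hχ.mul (ww_smooth α)))

lemma mkS_apply (χ : Ed d → ℝ) (hχ : ContDiff ℝ ∞ χ) (hc : HasCompactSupport χ) (α : ℝ) (ξ : Ed d) : mkS χ hχ hc α ξ = ((χ ξ * ww α ξ : ℝ) : ℂ) := rfl

def cvS (m : SchwartzMap (Ed d) ℂ) (g : Ed d → ℂ) : Ed d → ℂ := MeasureTheory.convolution (𝓕⁻ m : SchwartzMap (Ed d) ℂ) g (ContinuousLinearMap.mul ℂ ℂ) volume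

lemma cvS_int (m : SchwartzMap (Ed d) ℂ) {g : Ed d → ℂ} (hg : Integrable g) : Integrable (cvS m g) :=
  (𝓕⁻ m : SchwartzMap (Ed d) ℂ).integrable.integrable_convolution _ hg

lemma cvS_cont (m : SchwartzMap (Ed d) ℂ) {g : Ed d → ℂ} (hg : Integrable g) : Continuous (cvS m g) := by
  obtain ⟨C, hC, h⟩ := (𝓕⁻ m : SchwartzMap (Ed d) ℂ).decay 0 0
  refine BddAbove.continuous_convolution_left_of_integrable _ ⟨C, ?_⟩ (𝓕⁻ m : SchwartzMap (Ed d) ℂ).continuous hg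
  rintro _ ⟨x, rfl⟩
  simpa using h x

lemma cvS_fourier (m : SchwartzMap (Ed d) ℂ) {g : Ed d → ℂ} (hg : Integrable g) (ξ : Ed d) : 𝓕 (cvS m g) ξ = m ξ * 𝓕 g ξ := by
  rw [cvS, Real.fourier_mul_convolution_eq (𝓕⁻ m : SchwartzMap (Ed d) ℂ).integrable hg, ← SchwartzMap.fourier_coe]
  congr 2
  simp

lemma cvS_bd (m : SchwartzMap (Ed d) ℂ) (g : Ed d → ℂ) (x : Ed d) : ‖cvS m g x‖ₑ ≤ ∫⁻ y, ‖(𝓕⁻ m : SchwartzMap (Ed d) ℂ) y‖ₑ * ‖g (x - y)‖ₑ := by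
  show ‖∫ y, (𝓕⁻ m : SchwartzMap (Ed d) ℂ) y * g (x - y)‖ₑ ≤ _
  refine (enorm_integral_le_lintegral_enorm _).trans (le_of_eq (lintegral_congr fun y => ?_))
  rw [enorm_mul]

lemma schw_l1 (m : SchwartzMap (Ed d) ℂ) : ∫⁻ y, ‖m y‖ₑ ≠ ⊤ := m.integrable.2.ne

def Tw (α t : ℝ) (g : Ed d → ℂ) (x : Ed d) : ℂ := 𝓕⁻ (fun ξ : Ed d => Complex.exp (Complex.I * t * ‖ξ‖) * ((ww α ξ : ℝ) : ℂ) * 𝓕 g ξ) x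

lemma exp_n (t r : ℝ) : ‖Complex.exp (Complex.I * t * r)‖ = 1 := by
  rw [show Complex.I * t * r = ((t * r : ℝ) : ℂ) * Complex.I by push_cast; ring, Complex.norm_exp_ofReal_mul_I]

lemma fourierInv_add {u v : Ed d → ℂ} (hu : Integrable u) (hv : Integrable v) (x : Ed d) : 𝓕⁻ (fun ξ => u ξ + v ξ) x = 𝓕⁻ u x + 𝓕⁻ v x := by
  have key : ∀ {u : Ed d → ℂ}, Integrable u → Integrable (fun v => Complex.exp (((2 * Real.pi * inner ℝ v x : ℝ) : ℂ) * Complex.I) • u v) := by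
    intro u hu
    have hc : Continuous (fun v : Ed d => Complex.exp (((2 * Real.pi * inner ℝ v x : ℝ) : ℂ) * Complex.I)) := by fun_prop
    exact hu.bdd_mul (c := 1) hc.aestronglyMeasurable (Filter.Eventually.of_forall fun ξ => by rw [Complex.norm_exp_ofReal_mul_I])
  simp only [Real.fourierInv_eq']
  rw [← integral_add (key hu) (key hv)]
  simp_rw [smul_add]

lemma Tw_bound (hd : 4 ≤ d) (n : ℕ) {α : ℝ} (hα : 0 ≤ α) : ∃ (C : ℝ) (W : Ed d → ℝ≥0∞) (m0 m1 : SchwartzMap (Ed d) ℂ), Measurable W ∧ ∫⁻ x, W x ≠ ⊤ ∧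
    ∀ g : Ed d → ℂ, Integrable g → Measurable g → Integrable (𝓕 g) → ∀ t ∈ Icc (0:ℝ) 1, ∀ x,
    ‖Tw α t g x‖ₑ ≤ ENNReal.ofReal C * (∑' k, ak d n α g k (t, x)) + ((∫⁻ y, W y * ‖cvS m0 g (x - y)‖ₑ) + ‖cvS m1 g x‖ₑ) := by
  obtain ⟨C, hC, hhigh⟩ := high_piece (d := d) (by omega) n α
  obtain ⟨W, hWm, hWi, hlow⟩ := low_diff hd
  set m0 : SchwartzMap (Ed d) ℂ := mkS (fun ξ => cb1 d ξ) (cb1 d).contDiff (cb1 d).hasCompactSupport α with hm0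
  set m1 : SchwartzMap (Ed d) ℂ := mkS (fun ξ => et ‖ξ‖) etn_smooth etn_compact α with hm1
  refine ⟨C, W, m0, m1, hWm, hWi, fun g hg hgm hF t ht x => ?_⟩
  have hwc : Continuous (ww (d := d) α) := (ww_smooth α).continuous
  have hec : Continuous et := et_smooth.continuous
  have hbc : Continuous be := be_smooth.continuous
  have bdd : ∀ (u : Ed d → ℂ) (c : ℝ), Continuous u → (∀ ξ, ‖u ξ‖ ≤ c) → Integrable (fun ξ => u ξ * 𝓕 g ξ) := fun u c hu hb =>
    hF.bdd_mul (c := c) hu.aestronglyMeasurable (Filter.Eventually.of_forall hb)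
  have hEw : ∀ (ξ : Ed d) (r : ℝ), |r| ≤ 1 → ‖Complex.exp (Complex.I * t * ‖ξ‖) * ((ww α ξ : ℝ) : ℂ) * (r : ℂ)‖ ≤ 1 := by
    intro ξ r hr
    rw [norm_mul, norm_mul, exp_n, one_mul, Complex.norm_real, Complex.norm_real, Real.norm_of_nonneg (ww_nonneg α ξ), Real.norm_eq_abs]
    exact mul_le_one₀ (ww_le hα ξ) (abs_nonneg _) hr
  have het : ∀ l, |1 - et l| ≤ 1 := fun l => by rw [abs_le]; constructor <;> linarith [et_nonneg l, et_le l]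
  -- the three pieces
  set A : Ed d → ℂ := fun ξ => Complex.exp (Complex.I * t * ‖ξ‖) * ((ww α ξ : ℝ) : ℂ) * ((1 - et ‖ξ‖ : ℝ) : ℂ) * 𝓕 g ξ with hA
  set B : Ed d → ℂ := fun ξ => (Complex.exp (Complex.I * t * ‖ξ‖) - 1) * ((et ‖ξ‖ : ℝ) : ℂ) * 𝓕 (cvS m0 g) ξ with hB
  set D : Ed d → ℂ := fun ξ => 𝓕 (cvS m1 g) ξ with hD
  have hcf0 : Integrable (𝓕 (cvS m0 g)) := by
    have e : 𝓕 (cvS m0 g) = fun ξ => m0 ξ * 𝓕 g ξ := funext fun ξ => cvS_fourier m0 hg ξ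
    rw [e]
    obtain ⟨c, hc, h⟩ := m0.decay 0 0
    exact bdd _ c m0.continuous fun ξ => by simpa using h ξ
  have hcf1 : Integrable D := by
    have e : D = fun ξ => m1 ξ * 𝓕 g ξ := funext fun ξ => cvS_fourier m1 hg ξ
    rw [e]
    obtain ⟨c, hc, h⟩ := m1.decay 0 0
    exact bdd _ c m1.continuous fun ξ => by simpa using h ξ
  have hAi : Integrable A := bdd (fun ξ => Complex.exp (Complex.I * t * ‖ξ‖) * ((ww α ξ : ℝ) : ℂ) * ((1 - et ‖ξ‖ : ℝ) : ℂ)) 1 (by fun_prop) fun ξ => hEw ξ _ (het _)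
  have hBi : Integrable B := by
    refine hcf0.bdd_mul (c := 2) (f := fun ξ : Ed d => (Complex.exp (Complex.I * t * ‖ξ‖) - 1) * ((et ‖ξ‖ : ℝ) : ℂ)) (Continuous.aestronglyMeasurable (by fun_prop)) (Filter.Eventually.of_forall fun ξ => ?_)
    rw [norm_mul, Complex.norm_real, Real.norm_of_nonneg (et_nonneg _)]
    have h1 : ‖Complex.exp (Complex.I * t * ‖ξ‖) - 1‖ ≤ 2 := by
      refine (norm_sub_le _ _).trans ?_
      rw [exp_n]; norm_num
    nlinarith [et_le ‖ξ‖, et_nonneg ‖ξ‖, norm_nonneg (Complex.exp (Complex.I * t * ‖ξ‖) - 1)]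
  have split : Tw α t g x = 𝓕⁻ A x + (𝓕⁻ B x + 𝓕⁻ D x) := by
    have hBD : Integrable (fun ξ => B ξ + D ξ) := hBi.add hcf1
    rw [← fourierInv_add hBi hcf1, ← fourierInv_add hAi hBD, Tw]
    refine congrArg (fun u : Ed d → ℂ => 𝓕⁻ u x) (funext fun ξ => ?_)
    simp only [hA, hB, hD, cvS_fourier _ hg, hm0, hm1, mkS_apply]
    have e : ((et ‖ξ‖ : ℝ) : ℂ) * ((cb1 d ξ * ww α ξ : ℝ) : ℂ) = ((et ‖ξ‖ * ww α ξ : ℝ) : ℂ) := by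
      rw [← Complex.ofReal_mul]
      congr 1
      rcases le_total ‖ξ‖ 2 with h | h
      · rw [(cb1 d).one_of_mem_closedBall (by rw [mem_closedBall, dist_zero_right]; exact h), one_mul]
      · rw [et_zero h]; simp
    push_cast at e ⊢
    linear_combination (-(Complex.exp (Complex.I * t * ‖ξ‖) - 1) * 𝓕 g ξ) * e
  rw [split]
  refine (enorm_add_le _ _).trans (add_le_add ?_ ((enorm_add_le _ _).trans (add_le_add ?_ ?_)))
  · have hs := sum_bound (H := fun k ξ => Complex.exp (Complex.I * t * ‖ξ‖) * ((ww α ξ : ℝ) : ℂ) * ((be (((2:ℝ) ^ (k + 1))⁻¹ * ‖ξ‖) : ℝ) : ℂ) * 𝓕 g ξ) (Hi := A) (B := fun ξ => ‖𝓕 g ξ‖) hF.norm ?_ ?_ ?_ x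
    · refine hs.trans ?_
      rw [← ENNReal.tsum_mul_left]
      refine (ENNReal.tsum_le_tsum fun k => hhigh g hg t ht.1 (k + 1) x).trans ?_
      exact ENNReal.tsum_comp_le_tsum_of_injective (f := fun k => k + 1) (add_left_injective 1) (fun k => ENNReal.ofReal C * ak d n α g k (t, x))
    · intro k
      exact bdd (fun ξ => Complex.exp (Complex.I * t * ‖ξ‖) * ((ww α ξ : ℝ) : ℂ) * ((be (((2:ℝ) ^ (k + 1))⁻¹ * ‖ξ‖) : ℝ) : ℂ)) 1 (by fun_prop) fun ξ => hEw ξ _ (be_abs _)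
    · intro K ξ
      have e1 : ∑ k ∈ Finset.range K, Complex.exp (Complex.I * t * ‖ξ‖) * ((ww α ξ : ℝ) : ℂ) * ((be (((2:ℝ) ^ (k + 1))⁻¹ * ‖ξ‖) : ℝ) : ℂ) * 𝓕 g ξ = Complex.exp (Complex.I * t * ‖ξ‖) * ((ww α ξ : ℝ) : ℂ) * ((et (((2:ℝ) ^ K)⁻¹ * ‖ξ‖) - et ‖ξ‖ : ℝ) : ℂ) * 𝓕 g ξ := by
        rw [← et_tel2, ← Finset.sum_mul, ← Finset.mul_sum, Complex.ofReal_sum]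
      rw [e1, norm_mul]
      refine mul_le_of_le_one_left (norm_nonneg _) (hEw ξ _ ?_)
      rw [abs_le]
      constructor <;> linarith [et_nonneg ‖ξ‖, et_le ‖ξ‖, et_nonneg (((2:ℝ) ^ K)⁻¹ * ‖ξ‖), et_le (((2:ℝ) ^ K)⁻¹ * ‖ξ‖)]
    · intro ξ
      refine tendsto_const_nhds.congr' ?_
      filter_upwards [et_lim1 (norm_nonneg ξ)] with K hK
      rw [← Finset.sum_mul, ← Finset.mul_sum, ← Complex.ofReal_sum, et_tel2, hK]
  · exact hlow (cvS m0 g) (cvS_int m0 hg) (cvS_cont m0 hg).measurable hcf0 t ht x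
  · refine le_of_eq ?_
    congr 1
    have := (cvS_cont m1 hg).fourierInv_fourier_eq (cvS_int m1 hg) hcf1
    exact congrFun this x

lemma cvS_Lq {q : ℝ} (hq : 1 < q) (m : SchwartzMap (Ed d) ℂ) : ∃ A : ℝ≥0∞, A ≠ ⊤ ∧ ∀ g : Ed d → ℂ, Measurable g → ∫⁻ x, ‖cvS m g x‖ₑ ^ q ≤ A * ∫⁻ x, ‖g x‖ₑ ^ q := by
  refine ⟨(∫⁻ y, ‖(𝓕⁻ m : SchwartzMap (Ed d) ℂ) y‖ₑ) ^ q, ENNReal.rpow_ne_top_of_nonneg (by linarith) (schw_l1 _), fun g hg => ?_⟩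
  refine (lintegral_mono fun x => ENNReal.rpow_le_rpow (cvS_bd m g x) (by linarith)).trans ?_
  exact young hq (k := fun y => ‖(𝓕⁻ m : SchwartzMap (Ed d) ℂ) y‖ₑ) (u := fun y => ‖g y‖ₑ) (𝓕⁻ m : SchwartzMap (Ed d) ℂ).continuous.measurable.enorm hg.enorm

lemma comb (q : ℝ) (hq1 : 2 < q) (C C1 A0 A1 I Z P : ℝ≥0∞) (hP : P = (2:ℝ≥0∞) ^ (q - 1))
    (T : ℝ → Ed d → ℝ≥0∞) (S : ℝ → Ed d → ℝ≥0∞) (V1 V2 : Ed d → ℝ≥0∞)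
    (hSm2 : Measurable (fun p : ℝ × Ed d => S p.1 p.2)) (hV1m : Measurable V1) (i1 : ∫⁻ x, V1 x ^ q ≤ I * (A0 * Z))
    (i2 : ∫⁻ x, V2 x ^ q ≤ A1 * Z) (hS : ∫⁻ t in Ioc (0:ℝ) 1, ∫⁻ x, S t x ^ q ≤ C1 * Z)
    (hT : ∀ t ∈ Ioc (0:ℝ) 1, ∀ x, T t x ≤ C * S t x + (V1 x + V2 x)) :
    ∫⁻ t in Ioc (0:ℝ) 1, ∫⁻ x, T t x ^ q ≤ (P * (C ^ q * C1 + P * (I * A0 + A1))) * Z := by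
  have hPt : P ≠ ⊤ := by rw [hP]; exact ENNReal.rpow_ne_top_of_nonneg (by linarith) (by simp)
  have hq0 : 0 ≤ q := by linarith
  have hSm : ∀ t, Measurable (fun x => S t x ^ q) := fun t => (hSm2.comp measurable_prodMk_left).pow_const q
  have hpw : ∀ a b : ℝ≥0∞, (a + b) ^ q ≤ P * (a ^ q + b ^ q) := fun a b => by
    rw [hP]; exact ENNReal.rpow_add_le_mul_rpow_add_rpow _ _ (by linarith)
  have i3 : ∫⁻ x, (V1 x + V2 x) ^ q ≤ P * (I * A0 + A1) * Z := by
    calc _ ≤ ∫⁻ x, P * (V1 x ^ q + V2 x ^ q) := lintegral_mono fun x => hpw _ _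
      _ = P * ((∫⁻ x, V1 x ^ q) + ∫⁻ x, V2 x ^ q) := by
        rw [lintegral_const_mul' _ _ hPt, lintegral_add_left (hV1m.pow_const q)]
      _ ≤ P * (I * (A0 * Z) + A1 * Z) := mul_le_mul_right (add_le_add i1 i2) _
      _ = _ := by ring
  have i4 : ∀ t ∈ Ioc (0:ℝ) 1, ∫⁻ x, T t x ^ q ≤ P * (C ^ q * (∫⁻ x, S t x ^ q)) + P * (P * (I * A0 + A1) * Z) := by
    intro t ht
    calc _ ≤ ∫⁻ x, P * (C ^ q * S t x ^ q + (V1 x + V2 x) ^ q) := by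
          refine lintegral_mono fun x => ?_
          refine (ENNReal.rpow_le_rpow (hT t ht x) hq0).trans ?_
          refine (hpw _ _).trans (le_of_eq ?_)
          rw [ENNReal.mul_rpow_of_nonneg _ _ hq0]
      _ = P * (C ^ q * (∫⁻ x, S t x ^ q)) + P * ∫⁻ x, (V1 x + V2 x) ^ q := by
        rw [lintegral_const_mul' _ _ hPt, lintegral_add_left ((hSm t).const_mul _), lintegral_const_mul _ (hSm t), mul_add]
      _ ≤ _ := add_le_add le_rfl (mul_le_mul_right i3 _)
  calc _ ≤ ∫⁻ t in Ioc (0:ℝ) 1, (P * (C ^ q * (∫⁻ x, S t x ^ q)) + P * (P * (I * A0 + A1) * Z)) := setLIntegral_mono' measurableSet_Ioc i4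
    _ = P * (C ^ q * (∫⁻ t in Ioc (0:ℝ) 1, ∫⁻ x, S t x ^ q)) + P * (P * (I * A0 + A1) * Z) := by
      have hm : Measurable (fun t => ∫⁻ x, S t x ^ q) := Measurable.lintegral_prod_right (hSm2.pow_const q)
      rw [lintegral_add_right _ measurable_const, lintegral_const_mul' _ _ hPt, lintegral_const_mul _ hm]
      simp
    _ ≤ P * (C ^ q * (C1 * Z)) + P * (P * (I * A0 + A1) * Z) :=
      add_le_add (mul_le_mul_right (mul_le_mul_right hS _) _) le_rfl
    _ = _ := by ring

lemma main1 (hd : 4 ≤ d) {q : ℝ} (hq : 1/q < 1/2 - (2 * kap d)⁻¹) (hq1 : 2 < q) (hα : 0 ≤ d*(1/2-1/q)-1/2) :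
    ∃ A : ℝ≥0∞, A ≠ ⊤ ∧ ∀ g : Ed d → ℂ, Integrable g → Measurable g → Integrable (𝓕 g) → ∫⁻ x, ‖g x‖ₑ ^ q ≠ ⊤ →
      ∫⁻ t in Ioc (0:ℝ) 1, ∫⁻ x, ‖Tw (d*(1/2-1/q)-1/2) t g x‖ₑ ^ q ≤ A * ∫⁻ x, ‖g x‖ₑ ^ q := by
  obtain ⟨n, hn2, hn1⟩ : ∃ n : ℕ, 2 ≤ n ∧ ((d:ℝ)-1)*(q/2-1)+1 ≤ n :=
    ⟨max 2 ⌈((d:ℝ)-1)*(q/2-1)+1⌉₊, le_max_left _ _, (Nat.le_ceil _).trans (Nat.cast_le.2 (le_max_right _ _))⟩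
  obtain ⟨C1, hC1, hhs⟩ := high_sum hd hq hq1 n hn2 hn1
  generalize (d:ℝ)*(1/2-1/q)-1/2 = α at hα hhs ⊢
  obtain ⟨C, W, m0, m1, hWm, hWi, hb⟩ := Tw_bound hd n hα
  obtain ⟨A0, hA0, h0⟩ := cvS_Lq (d := d) (q := q) (by linarith) m0
  obtain ⟨A1, hA1, h1⟩ := cvS_Lq (d := d) (q := q) (by linarith) m1
  have hq0 : 0 ≤ q := by linarith
  have hPt : (2:ℝ≥0∞) ^ (q - 1) ≠ ⊤ := ENNReal.rpow_ne_top_of_nonneg (by linarith) (by simp)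
  have hW : (∫⁻ x, W x) ^ q ≠ ⊤ := ENNReal.rpow_ne_top_of_nonneg hq0 hWi
  have h3 : ENNReal.ofReal C ^ q ≠ ⊤ := ENNReal.rpow_ne_top_of_nonneg hq0 ENNReal.ofReal_ne_top
  refine ⟨(2:ℝ≥0∞) ^ (q - 1) * (ENNReal.ofReal C ^ q * ENNReal.ofReal C1 + (2:ℝ≥0∞) ^ (q - 1) * ((∫⁻ x, W x) ^ q * A0 + A1)), ?_, fun g hg hgm hF hfin => ?_⟩
  · exact ENNReal.mul_ne_top hPt (ENNReal.add_ne_top.2 ⟨ENNReal.mul_ne_top h3 ENNReal.ofReal_ne_top, ENNReal.mul_ne_top hPt (ENNReal.add_ne_top.2 ⟨ENNReal.mul_ne_top hW hA0, hA1⟩)⟩)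
  refine comb q hq1 (ENNReal.ofReal C) (ENNReal.ofReal C1) A0 A1 ((∫⁻ x, W x) ^ q) (∫⁻ x, ‖g x‖ₑ ^ q) _ rfl
    (fun t x => ‖Tw α t g x‖ₑ) (fun t x => ∑' k, ak d n α g k (t, x)) (fun x => ∫⁻ y, W y * ‖cvS m0 g (x - y)‖ₑ) (fun x => ‖cvS m1 g x‖ₑ) ?_ ?_ ?_ ?_ ?_ ?_
  · exact Measurable.ennreal_tsum fun k => ak_meas n α hg k
  · exact young_meas hWm (cvS_cont m0 hg).measurable.enorm
  · exact (young (by linarith : 1 < q) hWm (u := fun y => ‖cvS m0 g y‖ₑ) (cvS_cont m0 hg).measurable.enorm).trans (mul_le_mul_right (h0 g hgm) _)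
  · exact h1 g hgm
  · exact hhs g hg hgm hfin
  · exact fun t ht x => hb g hg hgm hF t ⟨ht.1.le, ht.2⟩ x
end P26sec

end Part26

section Part27
set_option linter.all false

section P27sec
variable {d : ℕ} [NeZero d]

lemma fourier_conj (g : Ed d → ℂ) (ξ : Ed d) : 𝓕 (fun x => (starRingEnd ℂ) (g x)) ξ = (starRingEnd ℂ) (𝓕 g (-ξ)) := by
  rw [Real.fourier_eq', Real.fourier_eq', ← integral_conj]
  refine integral_congr_ae (Filter.Eventually.of_forall fun v => ?_)
  simp only [smul_eq_mul, map_mul, ← Complex.exp_conj, Complex.conj_I, Complex.conj_ofReal, inner_neg_right]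
  congr 2
  push_cast; ring

lemma Tw_conj (α t : ℝ) (g : Ed d → ℂ) (x : Ed d) : Tw α t (fun x => (starRingEnd ℂ) (g x)) x = (starRingEnd ℂ) (Tw α (-t) g x) := by
  rw [Tw, Tw, Real.fourierInv_eq_fourier_comp_neg, Real.fourierInv_eq_fourier_neg, ← fourier_conj]
  refine congrArg (fun u : Ed d → ℂ => 𝓕 u x) (funext fun ξ => ?_)
  simp only [fourier_conj, neg_neg, norm_neg, map_mul, ← Complex.exp_conj, Complex.conj_I, Complex.conj_ofReal, ww]
  congr 3
  push_cast; ring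

lemma main2 (hd : 4 ≤ d) {q : ℝ} (hq : 1/q < 1/2 - (2 * kap d)⁻¹) (hq1 : 2 < q) (hα : 0 ≤ d*(1/2-1/q)-1/2) :
    ∃ A : ℝ≥0∞, A ≠ ⊤ ∧ ∀ g : Ed d → ℂ, Integrable g → Measurable g → Integrable (𝓕 g) → ∫⁻ x, ‖g x‖ₑ ^ q ≠ ⊤ →
      ∫⁻ t in Ioc (0:ℝ) 1, ∫⁻ x, ‖Tw (d*(1/2-1/q)-1/2) t g x‖ₑ ^ q ≤ A * ∫⁻ x, ‖g x‖ₑ ^ q ∧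
      ∫⁻ t in Ioc (0:ℝ) 1, ∫⁻ x, ‖Tw (d*(1/2-1/q)-1/2) (-t) g x‖ₑ ^ q ≤ A * ∫⁻ x, ‖g x‖ₑ ^ q := by
  obtain ⟨A, hA, h⟩ := main1 hd hq hq1 hα
  refine ⟨A, hA, fun g hg hgm hF hfin => ⟨h g hg hgm hF hfin, ?_⟩⟩
  have he : ∀ z : ℂ, ‖(starRingEnd ℂ) z‖ₑ = ‖z‖ₑ := fun z => by
    rw [← ofReal_norm, ← ofReal_norm, RCLike.norm_conj]
  have hc : Measurable (fun z : ℂ => (starRingEnd ℂ) z) := RCLike.continuous_conj.measurable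
  have h2 := h (fun x => (starRingEnd ℂ) (g x)) ((RCLike.conjCLE (K := ℂ)).toContinuousLinearMap.integrable_comp hg) (hc.comp hgm) ?_ (by simpa only [he] using hfin)
  · simpa only [he, Tw_conj] using h2
  · have e : 𝓕 (fun x => (starRingEnd ℂ) (g x)) = fun ξ => (starRingEnd ℂ) (𝓕 g (-ξ)) := funext fun ξ => fourier_conj g ξ
    rw [e]
    exact (RCLike.conjCLE (K := ℂ)).toContinuousLinearMap.integrable_comp hF.comp_neg

/-- the Bessel weight -/
def bwt (L α : ℝ) (ξ : Ed d) : ℝ := (1 + ‖L • ξ‖ ^ 2) ^ (α / 2)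

lemma bwt_tg (L α : ℝ) : (bwt (d := d) L α).HasTemperateGrowth := by
  have h1 := Function.hasTemperateGrowth_one_add_norm_sq_rpow (Ed d) (α / 2)
  have h2 : (fun ξ : Ed d => L • ξ).HasTemperateGrowth := (L • ContinuousLinearMap.id ℝ (Ed d)).hasTemperateGrowth
  exact h1.comp h2

def bS (L α : ℝ) (f : SchwartzMap (Ed d) ℂ) : SchwartzMap (Ed d) ℂ := SchwartzMap.smulLeftCLM ℂ (bwt L α) (𝓕 f)

lemma bS_apply (L α : ℝ) (f : SchwartzMap (Ed d) ℂ) (ξ : Ed d) : bS L α f ξ = ((bwt L α ξ : ℝ) : ℂ) * 𝓕 (f : Ed d → ℂ) ξ := by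
  rw [bS, SchwartzMap.smulLeftCLM_apply_apply (bwt_tg L α), SchwartzMap.fourier_coe, Complex.real_smul]

lemma bessel_eq {L : ℝ} (α : ℝ) (f : SchwartzMap (Ed d) ℂ) : besselOp d L α f = ((𝓕⁻ (bS L α f) : SchwartzMap (Ed d) ℂ) : Ed d → ℂ) := by
  rw [SchwartzMap.fourierInv_coe, besselOp]
  refine congrArg (fun u : Ed d → ℂ => 𝓕⁻ u) (funext fun ξ => ?_)
  rw [bS_apply, bwt, norm_smul, mul_pow, Real.norm_eq_abs, sq_abs]

lemma Tw_wave {L : ℝ} (hL : 0 < L) (α t : ℝ) (f : SchwartzMap (Ed d) ℂ) (x : Ed d) :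
    Tw α t (fun x => (𝓕⁻ (bS L α f) : SchwartzMap (Ed d) ℂ) (L • x)) x = waveOp d (L * t) f (L • x) := by
  have h := fourierInv_dil (inv_pos.2 hL) (fun ξ => Complex.exp (Complex.I * ((L * t : ℝ) : ℂ) * (‖ξ‖ : ℂ)) * 𝓕 (f : Ed d → ℂ) ξ) x
  rw [inv_inv] at h
  have h' : waveOp d (L * t) f (L • x) = ((((L ^ d)⁻¹ : ℝ)) : ℂ) * 𝓕⁻ (fun ξ : Ed d => Complex.exp (Complex.I * ((L * t : ℝ) : ℂ) * (‖L⁻¹ • ξ‖ : ℂ)) * 𝓕 (f : Ed d → ℂ) (L⁻¹ • ξ)) x := by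
    rw [h, waveOp, ← mul_assoc, ← Complex.ofReal_mul, inv_pow, inv_inv, inv_mul_cancel₀ (by positivity)]
    simp
  rw [h', ← fourierInv_cmul, Tw]
  refine congrArg (fun u : Ed d → ℂ => 𝓕⁻ u x) (funext fun ξ => ?_)
  rw [fourier_dil hL, ← SchwartzMap.fourier_coe]
  have e1 : (𝓕 (𝓕⁻ (bS L α f) : SchwartzMap (Ed d) ℂ) : SchwartzMap (Ed d) ℂ) = bS L α f := by simp
  rw [e1, bS_apply]
  have e2 : ((ww α ξ : ℝ) : ℂ) * ((bwt L α (L⁻¹ • ξ) : ℝ) : ℂ) = 1 := by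
    rw [← Complex.ofReal_mul, ww, bwt, smul_inv_smul₀ hL.ne', ← Real.rpow_add (by positivity)]
    simp
  have e3 : Complex.I * ((L * t : ℝ) : ℂ) * (‖L⁻¹ • ξ‖ : ℂ) = Complex.I * t * ‖ξ‖ := by
    rw [norm_smul, Real.norm_of_nonneg (by positivity)]
    have : (L : ℂ) ≠ 0 := by exact_mod_cast hL.ne'
    push_cast; field_simp
  rw [e3]
  linear_combination (Complex.exp (Complex.I * t * ‖ξ‖) * (((L ^ d)⁻¹ : ℝ) : ℂ) * 𝓕 (f : Ed d → ℂ) (L⁻¹ • ξ)) * e2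

lemma time_split {L : ℝ} (hL : 0 < L) (F : ℝ → ℝ≥0∞) : ENNReal.ofReal (1/(2*L)) * ∫⁻ t in Icc (-L) L, F t ≤
    ENNReal.ofReal (1/2) * ((∫⁻ t in Ioc (0:ℝ) 1, F (L * t)) + ∫⁻ t in Ioc (0:ℝ) 1, F (L * -t)) := by
  have h1 : ∫⁻ t in Icc (-L) L, F t ≤ (∫⁻ t in Icc 0 L, F t) + ∫⁻ t in Icc (-L) 0, F t := by
    refine le_trans (lintegral_mono_set ?_) (lintegral_union_le _ _ _)
    intro t ht
    rcases le_total 0 t with h | h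
    · exact Or.inl ⟨h, ht.2⟩
    · exact Or.inr ⟨ht.1, h⟩
  have h2 : ∫⁻ t in Icc (-L) 0, F t = ∫⁻ t in Icc 0 L, F (-t) := by
    have := (Measure.measurePreserving_neg (volume : Measure ℝ)).setLIntegral_comp_preimage_emb (MeasurableEquiv.neg ℝ).measurableEmbedding F (Icc (-L) 0)
    rw [← this]
    congr 2
    ext t
    simp [and_comm]
  have h3 : ∀ F : ℝ → ℝ≥0∞, ∫⁻ t in Icc 0 L, F t = ENNReal.ofReal L * ∫⁻ t in Ioc (0:ℝ) 1, F (L * t) := by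
    intro F
    rw [lint_dil1 hL, ← mul_assoc, ← ENNReal.ofReal_mul hL.le, mul_inv_cancel₀ hL.ne', ENNReal.ofReal_one, one_mul]
    exact setLIntegral_congr Ioc_ae_eq_Icc.symm
  rw [h2, h3, h3 (fun t => F (-t)), ← mul_add] at h1
  refine (mul_le_mul_right h1 _).trans (le_of_eq ?_)
  rw [← mul_assoc, ← ENNReal.ofReal_mul (by positivity)]
  simp only [mul_neg]
  congr 2
  field_simp

end P27sec

end Part27

/-- for `d ≥ 4`, `q > 2 + 4/(d-3)` and `α = d(1/2-1/q) - 1/2`, there is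
`C = C(q,d)` so that for all `L > 0` and Schwartz `f`,
`(1/(2L)) ∫_{-L}^L ‖e^{it√(-Δ)}f‖_q^q dt ≤ C^q ‖(I - L²Δ)^{α/2} f‖_q^q`. -/
theorem local_smoothing_endpoint
    (d : ℕ) (hd : 4 ≤ d) (q : ℝ) (hq : 2 + 4 / ((d : ℝ) - 3) < q) :
    ∃ C : ℝ, 0 < C ∧ ∀ L : ℝ, 0 < L → ∀ f : SchwartzMap (Ed d) ℂ,
      ENNReal.ofReal (1 / (2 * L)) *
        ∫⁻ t in Set.Icc (-L) L,
          (eLpNorm (waveOp d t ⇑f) (ENNReal.ofReal q) volume) ^ q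
      ≤ ENNReal.ofReal (C ^ q) *
          (eLpNorm (besselOp d L ((d : ℝ) * (1 / 2 - 1 / q) - 1 / 2) ⇑f)
              (ENNReal.ofReal q) volume) ^ q := by
  haveI : NeZero d := ⟨by omega⟩
  have hd4 : (4:ℝ) ≤ d := by exact_mod_cast hd
  have h3 : 0 < (d:ℝ) - 3 := by linarith
  have hq2 : 2 < q := lt_trans (by have : 0 < 4 / ((d:ℝ) - 3) := by positivity
                                   linarith) hq
  have hq0 : 0 < q := by linarith
  have hqa : 1 / q < 1 / 2 - (2 * kap d)⁻¹ := by
    have e : 2 + 4 / ((d:ℝ) - 3) = 2 * ((d:ℝ) - 1) / ((d:ℝ) - 3) := by field_simp; ring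
    rw [e] at hq
    have e2 : 1 / 2 - (2 * kap d)⁻¹ = 1 / (2 * ((d:ℝ) - 1) / ((d:ℝ) - 3)) := by
      unfold kap
      have : (d:ℝ) - 1 ≠ 0 := by linarith
      field_simp; ring
    rw [e2]
    exact one_div_lt_one_div_of_lt (by have : 0 < (d:ℝ) - 1 := by linarith
                                       positivity) hq
  have hα : 0 ≤ (d:ℝ) * (1 / 2 - 1 / q) - 1 / 2 := by
    have h1 : (2 * kap d)⁻¹ = 1 / ((d:ℝ) - 1) := by
      unfold kap
      rw [one_div]; congr 1; ring
    rw [h1] at hqa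
    have h2 : 1 / (d:ℝ) ≤ 1 / ((d:ℝ) - 1) := one_div_le_one_div_of_le (by linarith) (by linarith)
    have h4 : 1 / (d:ℝ) ≤ 1 / 2 - 1 / q := by linarith
    have h5 : (d:ℝ) * (1 / (d:ℝ)) ≤ d * (1 / 2 - 1 / q) := mul_le_mul_of_nonneg_left h4 (by linarith)
    rw [mul_one_div_cancel (by linarith)] at h5
    linarith
  obtain ⟨A, hA, hmain⟩ := main2 hd hqa hq2 hα
  generalize (d : ℝ) * (1 / 2 - 1 / q) - 1 / 2 = α at hmain ⊢
  refine ⟨(A.toReal + 1) ^ (1 / q), by positivity, fun L hL f => ?_⟩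
  rw [← Real.rpow_mul (by positivity), one_div_mul_cancel hq0.ne', Real.rpow_one]
  simp only [eLpNorm_pow hq0]
  rw [bessel_eq]
  have hintg : Integrable (fun x => (𝓕⁻ (bS L α f) : SchwartzMap (Ed d) ℂ) (L • x)) := int_dil hL (𝓕⁻ (bS L α f) : SchwartzMap (Ed d) ℂ).integrable
  have hfin : ∫⁻ x, ‖(𝓕⁻ (bS L α f) : SchwartzMap (Ed d) ℂ) x‖ₑ ^ q ≠ ⊤ := by
    rw [← eLpNorm_pow hq0]
    exact ENNReal.rpow_ne_top_of_nonneg hq0.le ((𝓕⁻ (bS L α f) : SchwartzMap (Ed d) ℂ).memLp (ENNReal.ofReal q) volume).2.ne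
  have hsc := lint_dil hL (fun x => ‖(𝓕⁻ (bS L α f) : SchwartzMap (Ed d) ℂ) x‖ₑ ^ q)
  have hF : Integrable (𝓕 (fun x => (𝓕⁻ (bS L α f) : SchwartzMap (Ed d) ℂ) (L • x))) := by
    have e : 𝓕 (fun x => (𝓕⁻ (bS L α f) : SchwartzMap (Ed d) ℂ) (L • x)) = fun ξ => (((L ^ d)⁻¹ : ℝ) : ℂ) * (bS L α f) (L⁻¹ • ξ) := by
      funext ξ
      rw [fourier_dil hL, ← SchwartzMap.fourier_coe]
      simp
    rw [e]
    exact (int_dil (inv_pos.2 hL) (bS L α f).integrable).const_mul _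
  obtain ⟨m1, m2⟩ := hmain _ hintg ((𝓕⁻ (bS L α f) : SchwartzMap (Ed d) ℂ).continuous.measurable.comp (measurable_const_smul L)) hF
    (by rw [hsc]; exact ENNReal.mul_ne_top ENNReal.ofReal_ne_top hfin)
  simp only [Tw_wave hL] at m1 m2
  rw [hsc] at m1 m2
  have hw : ∀ s, ∫⁻ x, ‖waveOp d s f (L • x)‖ₑ ^ q = ENNReal.ofReal ((L ^ d)⁻¹) * ∫⁻ x, ‖waveOp d s f x‖ₑ ^ q := fun s => lint_dil hL (fun x => ‖waveOp d s f x‖ₑ ^ q)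
  simp only [hw] at m1 m2
  have hcp : 0 < (L ^ d)⁻¹ := by positivity
  have hc0 : ENNReal.ofReal ((L ^ d)⁻¹) ≠ 0 := (ENNReal.ofReal_pos.2 hcp).ne'
  have hct : ENNReal.ofReal ((L ^ d)⁻¹) ≠ ⊤ := ENNReal.ofReal_ne_top
  rw [lintegral_const_mul' _ _ hct, mul_left_comm, ENNReal.mul_le_mul_iff_right hc0 hct] at m1 m2
  refine (time_split hL _).trans ?_
  refine (mul_le_mul_right (add_le_add m1 m2) _).trans ?_
  rw [← two_mul, ← mul_assoc, ← mul_assoc]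
  refine mul_le_mul_left ?_ _
  have : ENNReal.ofReal (1 / 2) * 2 = 1 := by
    rw [← ENNReal.ofReal_ofNat, ← ENNReal.ofReal_mul (by norm_num)]; norm_num
  rw [this, one_mul]
  calc A = ENNReal.ofReal A.toReal := (ENNReal.ofReal_toReal hA).symm
    _ ≤ _ := ENNReal.ofReal_le_ofReal (by linarith)
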